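/- Let $\varphi,\psi\in\mathcal{S}(\mathbb{R})$ with $\widehat{\varphi}$ supported in $\{|\xi|\le 1\}$ and $\widehat{\psi}$ supported in $\{\frac{1}{2}\le|\xi|\le 2\}$, let $(\lambda_k)_{k\in\mathbb{Z}}$ satisfy $|\lambda_k|\le 1$, and let $1<p,q<\infty$ with $\frac{1}{p}+\frac{1}{q}=\frac{1}{r}>\frac{1}{2}$. Then the twisted paraproduct $\Pi_{\varphi,\psi,\lambda}$ admits $\ell^2$-valued estimates in the second argument: there is a constant $C$ such that for every sequence $(g_\ell)_{\ell\ge 0}$ of Schwartz functions on $\mathbb{R}^2$ and every Schwartz $f$, $\Big\|\Big(\sum_{\ell\ge 0}|\Pi_{\varphi,\psi,\lambda}(f,g_\ell)|^2\Big)^{1/2}\Big\|_{\mathrm{L}^r(\mathbb{R}^2)} \le C\,\|f\|_{\mathrm{L}^p(\mathbb{R}^2)}\,\Big\|\Big(\sum_{\ell\ge 0}|g_\ell|^2\Big)^{1/2}\Big\|_{\mathrm{L}^q(\mathbb{R}^2)}$. -/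

import Mathlib

open MeasureTheory Filter
open scoped ENNReal NNReal Topology

noncomputable section

/-- `e2π t = exp(2πit)`. -/
def e2π (t : ℝ) : ℂ := Complex.exp (2 * (Real.pi : ℂ) * Complex.I * (t : ℂ))

/-- Two-dimensional Fourier transform `f̂(ζ) = ∫ f(u) e^{-2πi u·ζ} du`. -/
def FT2 (f : ℝ × ℝ → ℂ) (ζ : ℝ × ℝ) : ℂ :=
  ∫ u : ℝ × ℝ, f u * e2π (-(u.1 * ζ.1 + u.2 * ζ.2))

/-- One-dimensional Fourier transform. -/
def FT1 (φ : ℝ → ℂ) (ξ : ℝ) : ℂ := ∫ t : ℝ, φ t * e2π (-(t * ξ))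

/-- The bilinear Fourier multiplier with symbol `μ` on `ℝ⁴`. -/
def Tmu (μ : (ℝ × ℝ) × (ℝ × ℝ) → ℂ) (f g : ℝ × ℝ → ℂ) (z : ℝ × ℝ) : ℂ :=
  ∫ w : (ℝ × ℝ) × (ℝ × ℝ),
    μ w * e2π (z.1 * (w.1.1 + w.2.1) + z.2 * (w.1.2 + w.2.2)) * FT2 f w.1 * FT2 g w.2

/-- The bilinear operator with `(x,y)`-dependent symbol `σ(x,y,ξ₁,η₂)`. -/
def Tsigma (σ : (ℝ × ℝ) → (ℝ × ℝ) → ℂ) (f g : ℝ × ℝ → ℂ) (z : ℝ × ℝ) : ℂ :=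
  ∫ w : (ℝ × ℝ) × (ℝ × ℝ),
    σ z (w.1.1, w.2.2) * e2π (z.1 * (w.1.1 + w.2.1) + z.2 * (w.1.2 + w.2.2)) *
      FT2 f w.1 * FT2 g w.2

/-- The `L^p(ℝ²)` norm. -/
def LpNorm (p : ℝ) (f : ℝ × ℝ → ℂ) : ℝ≥0∞ := eLpNorm f (ENNReal.ofReal p) volume

/-- `(I - Δ)^{s/2} f`, the Fourier multiplier with symbol `(1+4π²|ζ|²)^{s/2}`. -/
def JsFull (s : ℝ) (f : ℝ × ℝ → ℂ) (x : ℝ × ℝ) : ℂ :=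
  ∫ ζ : ℝ × ℝ,
    (((1 + 4 * Real.pi ^ 2 * (ζ.1 ^ 2 + ζ.2 ^ 2)) ^ (s / 2) : ℝ) : ℂ) * FT2 f ζ *
      e2π (x.1 * ζ.1 + x.2 * ζ.2)

/-- `(I - Δ_x)^{s/2} f`, the Fourier multiplier with symbol `(1+4π²ζ₁²)^{s/2}`. -/
def JsX (s : ℝ) (f : ℝ × ℝ → ℂ) (x : ℝ × ℝ) : ℂ :=
  ∫ ζ : ℝ × ℝ,
    (((1 + 4 * Real.pi ^ 2 * ζ.1 ^ 2) ^ (s / 2) : ℝ) : ℂ) * FT2 f ζ *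
      e2π (x.1 * ζ.1 + x.2 * ζ.2)

/-- The non-homogeneous Sobolev norm `‖f‖_{W^{s,p}}`. -/
def WNorm (s p : ℝ) (f : ℝ × ℝ → ℂ) : ℝ≥0∞ := eLpNorm (JsFull s f) (ENNReal.ofReal p) volume

/-- The mixed Sobolev norm `‖f‖_{L^p_y(W^{s,p}_x)}`. -/
def WxNorm (s r : ℝ) (f : ℝ × ℝ → ℂ) : ℝ≥0∞ := eLpNorm (JsX s f) (ENNReal.ofReal r) volume

/-- `L¹`-normalized dilate `φ_k(t) = 2^k φ(2^k t)`. -/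
def dil (φ : ℝ → ℂ) (k : ℤ) (t : ℝ) : ℂ := (((2 : ℝ) ^ k : ℝ) : ℂ) * φ ((2 : ℝ) ^ k * t)

/-- Fiber-wise convolution in the first variable. -/
def Px (φ : ℝ → ℂ) (f : ℝ × ℝ → ℂ) (z : ℝ × ℝ) : ℂ := ∫ t : ℝ, f (z.1 - t, z.2) * φ t

/-- Fiber-wise convolution in the second variable. -/
def Py (ψ : ℝ → ℂ) (g : ℝ × ℝ → ℂ) (z : ℝ × ℝ) : ℂ := ∫ t : ℝ, g (z.1, z.2 - t) * ψ t

/-- The twisted paraproduct with coefficients `λ = (λ_k)_{k ∈ ℤ}`. -/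
def TwPara (φ ψ : ℝ → ℂ) (lam : ℤ → ℂ) (f g : ℝ × ℝ → ℂ) (z : ℝ × ℝ) : ℂ :=
  ∑' k : ℤ, lam k * Px (dil φ k) f z * Py (dil ψ k) g z

/-- The Schwartz seminorm `‖φ‖_{α,β} = sup_t |t|^α |∂^β φ(t)|`. -/
def schSemi (φ : ℝ → ℂ) (α β : ℕ) : ℝ := ⨆ t : ℝ, |t| ^ α * ‖iteratedDeriv β φ t‖

/-- `max_{0 ≤ α,β ≤ 3} ‖φ‖_{α,β}`. -/
def maxSchSemi3 (φ : ℝ → ℂ) : ℝ := ⨆ ab : Fin 4 × Fin 4, schSemi φ (ab.1 : ℕ) (ab.2 : ℕ)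

/-- The mixed partial derivative `∂_{τ₁}^{β₁} ∂_{τ₂}^{β₂} F`. -/
def pd (β₁ β₂ : ℕ) (F : ℝ → ℝ → ℂ) (τ₁ τ₂ : ℝ) : ℂ :=
  iteratedDeriv β₁ (fun a => iteratedDeriv β₂ (F a) τ₂) τ₁

/-- The mixed partial derivative `∂_x^{α₁} ∂_y^{α₂} ∂_{τ₁}^{β₁} ∂_{τ₂}^{β₂} F`. -/
def pd4 (α₁ α₂ β₁ β₂ : ℕ) (F : ℝ → ℝ → ℝ → ℝ → ℂ) (x y τ₁ τ₂ : ℝ) : ℂ :=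
  iteratedDeriv α₁ (fun a =>
    iteratedDeriv α₂ (fun b =>
      iteratedDeriv β₁ (fun u => iteratedDeriv β₂ (fun v => F a b u v) τ₂) τ₁) y) x

/-- `∂_x^n F` for `F : ℝ² → ℂ` (derivative in the first variable). -/
def pdx (n : ℕ) (F : ℝ × ℝ → ℂ) (z : ℝ × ℝ) : ℂ := iteratedDeriv n (fun t => F (t, z.2)) z.1

/-- `∂_y^n F` for `F : ℝ² → ℂ` (derivative in the second variable). -/
def pdy (n : ℕ) (F : ℝ × ℝ → ℂ) (z : ℝ × ℝ) : ℂ := iteratedDeriv n (fun t => F (z.1, t)) z.2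

/-- `ϑ(τ) = θ(τ/2) - θ(τ)`. -/
def vartheta (θ : ℝ → ℝ) (τ : ℝ) : ℝ := θ (τ / 2) - θ τ

/-- The modulated dilate `f_ε(x,y) = e^{2πi(ξ⁰₁x + ξ⁰₂y)} Φ(εx, εy)`. -/
def fEps (ξ0 : ℝ × ℝ) (Φ : ℝ × ℝ → ℂ) (ε : ℝ) (z : ℝ × ℝ) : ℂ :=
  e2π (ξ0.1 * z.1 + ξ0.2 * z.2) * Φ (ε * z.1, ε * z.2)

/-- `h_ε(x,y) = ε² e^{2πi(ζ⁰₁x + ζ⁰₂y)} Ψ(εx, εy)`. -/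
def hEps (ζ0 : ℝ × ℝ) (Ψ : ℝ × ℝ → ℂ) (ε : ℝ) (z : ℝ × ℝ) : ℂ :=
  ((ε ^ 2 : ℝ) : ℂ) * e2π (ζ0.1 * z.1 + ζ0.2 * z.2) * Ψ (ε * z.1, ε * z.2)

namespace TwistedParaproduct

/-! ### The one-dimensional maximal function -/

/-- Centred maximal function over intervals of dyadic radius. -/
def HL (u : ℝ → ℝ≥0∞) (x : ℝ) : ℝ≥0∞ :=
  ⨆ k : ℤ, ENNReal.ofReal ((2 : ℝ) ^ (-k)) * ∫⁻ t in Metric.closedBall x ((2 : ℝ) ^ k), u t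

lemma HL_mono {u v : ℝ → ℝ≥0∞} (h : ∀ t, u t ≤ v t) (x : ℝ) : HL u x ≤ HL v x :=
  iSup_mono fun _ => mul_le_mul_right (lintegral_mono h) _

lemma lintegral_closedBall_le_HL (u : ℝ → ℝ≥0∞) (x : ℝ) (k : ℤ) :
    ∫⁻ t in Metric.closedBall x ((2 : ℝ) ^ k), u t ≤ ENNReal.ofReal ((2 : ℝ) ^ k) * HL u x := by
  have h := le_iSup (fun k : ℤ => ENNReal.ofReal ((2 : ℝ) ^ (-k)) *
    ∫⁻ t in Metric.closedBall x ((2 : ℝ) ^ k), u t) k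
  calc _ = ENNReal.ofReal ((2 : ℝ) ^ k) * (ENNReal.ofReal ((2 : ℝ) ^ (-k)) *
        ∫⁻ t in Metric.closedBall x ((2 : ℝ) ^ k), u t) := by
        rw [← mul_assoc, ← ENNReal.ofReal_mul (by positivity), ← zpow_add₀ two_ne_zero]
        simp
    _ ≤ _ := mul_le_mul_right h _

lemma measurable_HL_param {Ω : Type*} [MeasurableSpace Ω] {u : Ω → ℝ → ℝ≥0∞}
    (hu : Measurable (Function.uncurry u)) :
    Measurable (fun z : Ω × ℝ => HL (u z.1) z.2) := by
  unfold HL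
  refine Measurable.iSup fun k => Measurable.const_mul ?_ _
  have : ∀ z : Ω × ℝ, ∫⁻ t in Metric.closedBall z.2 ((2 : ℝ) ^ k), u z.1 t =
      ∫⁻ t, {w : (Ω × ℝ) × ℝ | dist w.2 w.1.2 ≤ (2 : ℝ) ^ k}.indicator
        (fun w => u w.1.1 w.2) (z, t) := by
    intro z
    rw [← lintegral_indicator Metric.isClosed_closedBall.measurableSet]
    rfl
  simp_rw [this]
  apply Measurable.lintegral_prod_right'
  refine Measurable.indicator ?_ ?_
  · exact hu.comp ((measurable_fst.comp measurable_fst).prodMk measurable_snd)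
  · exact measurableSet_le (measurable_snd.dist (measurable_snd.comp measurable_fst))
      measurable_const

lemma measurable_HL {u : ℝ → ℝ≥0∞} (hu : Measurable u) : Measurable (HL u) := by
  have h : Measurable (Function.uncurry fun _ : ℝ => u) := hu.comp measurable_snd
  have h2 : Measurable (fun z : ℝ × ℝ => HL u z.2) := measurable_HL_param h
  have h3 := h2.comp (measurable_prodMk_left (x := (0 : ℝ)))
  exact h3

lemma HL_weak_type_of_le (u : ℝ → ℝ≥0∞) {s : ℝ≥0∞} (hs : s ≠ 0) (hs' : s ≠ ⊤) (K : ℕ) :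
    volume {x | ∃ k : ℤ, k ≤ K ∧ s < ENNReal.ofReal ((2 : ℝ) ^ (-k)) *
      ∫⁻ t in Metric.closedBall x ((2 : ℝ) ^ k), u t} ≤ 10 / s * ∫⁻ t, u t := by
  set E := {x | ∃ k : ℤ, k ≤ K ∧ s < ENNReal.ofReal ((2 : ℝ) ^ (-k)) *
      ∫⁻ t in Metric.closedBall x ((2 : ℝ) ^ k), u t} with hE
  have hE' : ∀ x : ℝ, ∃ k : ℤ, x ∈ E → k ≤ K ∧ s < ENNReal.ofReal ((2 : ℝ) ^ (-k)) *
      ∫⁻ t in Metric.closedBall x ((2 : ℝ) ^ k), u t := by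
    intro x
    by_cases hx : x ∈ E
    · obtain ⟨k, hk⟩ := hx
      exact ⟨k, fun _ => hk⟩
    · exact ⟨0, fun h => absurd h hx⟩
  choose k hk using hE'
  obtain ⟨U, hUE, hdisj, hcov⟩ := Vitali.exists_disjoint_subfamily_covering_enlargement_closedBall
    E id (fun x => (2 : ℝ) ^ (k x)) ((2 : ℝ) ^ (K : ℤ))
    (fun x hx => zpow_le_zpow_right₀ one_le_two (hk x hx).1) 5 (by norm_num)
  simp only [id] at hdisj hcov
  have hcount : U.Countable := hdisj.countable_of_nonempty_interior fun x _ => by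
    refine ⟨x, ?_⟩
    rw [mem_interior_iff_mem_nhds]
    exact Metric.closedBall_mem_nhds _ (by positivity)
  have hsub : E ⊆ ⋃ x ∈ U, Metric.closedBall x (5 * (2 : ℝ) ^ (k x)) := by
    intro x hx
    obtain ⟨b, hb, hxb⟩ := hcov x hx
    exact Set.mem_iUnion₂.2 ⟨b, hb, hxb (Metric.mem_closedBall_self (by positivity))⟩
  have hone : ∀ x ∈ U, volume (Metric.closedBall x (5 * (2 : ℝ) ^ (k x))) ≤
      10 / s * ∫⁻ t in Metric.closedBall x ((2 : ℝ) ^ (k x)), u t := by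
    intro x hx
    have h := (hk x (hUE hx)).2
    have h2 : s * ENNReal.ofReal ((2 : ℝ) ^ (k x)) ≤
        ∫⁻ t in Metric.closedBall x ((2 : ℝ) ^ (k x)), u t := by
      calc _ ≤ (ENNReal.ofReal ((2 : ℝ) ^ (-(k x))) *
            ∫⁻ t in Metric.closedBall x ((2 : ℝ) ^ (k x)), u t) *
              ENNReal.ofReal ((2 : ℝ) ^ (k x)) := mul_le_mul_left h.le _
        _ = (ENNReal.ofReal ((2 : ℝ) ^ (-(k x))) * ENNReal.ofReal ((2 : ℝ) ^ (k x))) *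
            ∫⁻ t in Metric.closedBall x ((2 : ℝ) ^ (k x)), u t := by ring
        _ = _ := by
          rw [← ENNReal.ofReal_mul (by positivity), ← zpow_add₀ two_ne_zero]
          simp
    rw [Real.volume_closedBall]
    calc ENNReal.ofReal (2 * (5 * 2 ^ k x)) = 10 / s * (s * ENNReal.ofReal ((2 : ℝ) ^ (k x))) := by
          rw [← mul_assoc (10 / s), ENNReal.div_mul_cancel hs hs', ← mul_assoc,
            ENNReal.ofReal_mul (by norm_num)]
          norm_num
      _ ≤ _ := mul_le_mul_right h2 _
  calc volume E ≤ volume (⋃ x ∈ U, Metric.closedBall x (5 * (2 : ℝ) ^ (k x))) :=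
        measure_mono hsub
    _ ≤ ∑' x : U, volume (Metric.closedBall (x : ℝ) (5 * (2 : ℝ) ^ (k x))) :=
        measure_biUnion_le _ hcount _
    _ ≤ ∑' x : U, 10 / s * ∫⁻ t in Metric.closedBall (x : ℝ) ((2 : ℝ) ^ (k x)), u t :=
        ENNReal.tsum_le_tsum fun x => hone x x.2
    _ = 10 / s * ∫⁻ t in ⋃ x ∈ U, Metric.closedBall (x : ℝ) ((2 : ℝ) ^ (k x)), u t := by
        rw [ENNReal.tsum_mul_left, lintegral_biUnion hcount
          (fun x _ => Metric.isClosed_closedBall.measurableSet) hdisj]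
    _ ≤ _ := mul_le_mul_right (setLIntegral_le_lintegral _ _) _

lemma HL_weak_type (u : ℝ → ℝ≥0∞) {s : ℝ≥0∞} (hs : s ≠ 0) (hs' : s ≠ ⊤) :
    volume {x | s < HL u x} ≤ 10 / s * ∫⁻ t, u t := by
  have hU : {x | s < HL u x} = ⋃ K : ℕ, {x | ∃ k : ℤ, k ≤ K ∧
      s < ENNReal.ofReal ((2 : ℝ) ^ (-k)) *
        ∫⁻ t in Metric.closedBall x ((2 : ℝ) ^ k), u t} := by
    ext x
    simp only [HL, Set.mem_ofPred_eq, lt_iSup_iff, Set.mem_iUnion]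
    constructor
    · rintro ⟨k, hk⟩
      exact ⟨k.toNat, k, Int.self_le_toNat k, hk⟩
    · rintro ⟨_, k, _, hk⟩
      exact ⟨k, hk⟩
  have hmono : Monotone fun K : ℕ => {x | ∃ k : ℤ, k ≤ K ∧
      s < ENNReal.ofReal ((2 : ℝ) ^ (-k)) *
        ∫⁻ t in Metric.closedBall x ((2 : ℝ) ^ k), u t} := by
    intro K L hKL x hx
    obtain ⟨k, hk, h⟩ := hx
    exact ⟨k, hk.trans (by exact_mod_cast hKL), h⟩
  rw [hU, hmono.measure_iUnion]
  exact iSup_le fun K => HL_weak_type_of_le u hs hs' K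

lemma HL_add_le (u v : ℝ → ℝ≥0∞) (hu : Measurable u) (x : ℝ) :
    HL (fun t => u t + v t) x ≤ HL u x + HL v x := by
  refine iSup_le fun k => ?_
  rw [lintegral_add_left hu, mul_add]
  exact add_le_add (le_iSup (fun k : ℤ => ENNReal.ofReal ((2 : ℝ) ^ (-k)) *
    ∫⁻ t in Metric.closedBall x ((2 : ℝ) ^ k), u t) k)
    (le_iSup (fun k : ℤ => ENNReal.ofReal ((2 : ℝ) ^ (-k)) *
    ∫⁻ t in Metric.closedBall x ((2 : ℝ) ^ k), v t) k)

lemma HL_le_of_le {u : ℝ → ℝ≥0∞} {s : ℝ≥0∞} (h : ∀ t, u t ≤ s) (x : ℝ) :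
    HL u x ≤ 2 * s := by
  refine iSup_le fun k => ?_
  calc ENNReal.ofReal ((2 : ℝ) ^ (-k)) * ∫⁻ t in Metric.closedBall x ((2 : ℝ) ^ k), u t
      ≤ ENNReal.ofReal ((2 : ℝ) ^ (-k)) * ∫⁻ t in Metric.closedBall x ((2 : ℝ) ^ k), s :=
        mul_le_mul_right (lintegral_mono h) _
    _ = ENNReal.ofReal ((2 : ℝ) ^ (-k)) * ENNReal.ofReal (2 * (2 : ℝ) ^ k) * s := by
        rw [setLIntegral_const, Real.volume_closedBall]; ring
    _ = 2 * s := by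
        rw [← ENNReal.ofReal_mul (by positivity), mul_left_comm, ← zpow_add₀ two_ne_zero]
        simp

lemma HL_level (u : ℝ → ℝ≥0∞) (hu : Measurable u) {s : ℝ≥0∞} (hs : s ≠ 0) (hs' : s ≠ ⊤) :
    volume {x | 3 * s < HL u x} ≤ 10 / s * ∫⁻ t, {t | s < u t}.indicator u t := by
  have hm : MeasurableSet {t | s < u t} := measurableSet_lt measurable_const hu
  refine le_trans (measure_mono fun x hx => ?_) (HL_weak_type _ hs hs')
  have h1 : HL u x ≤ HL ({t | s < u t}.indicator u) x + 2 * s := by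
    refine le_trans ?_ (add_le_add_right (HL_le_of_le
      (u := {t | s < u t}ᶜ.indicator u) (s := s) (fun t => ?_) x) _)
    · refine le_trans (HL_mono (fun t => ?_) x) (HL_add_le _ _ (hu.indicator hm) x)
      exact (congrFun (Set.indicator_self_add_compl {t | s < u t} u) t).ge
    · by_cases h : s < u t
      · simp [h]
      · simp [h, not_lt.1 h]
  by_contra hcon
  simp only [Set.mem_ofPred_eq, not_lt] at hcon hx
  refine absurd (hx.trans_le (h1.trans (add_le_add_left hcon _))) ?_
  rw [not_lt]
  exact le_of_eq (by ring)

/-! ### Layer-cake integration in `ℝ≥0∞` -/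

lemma lintegral_rpow_indicator {a : ℝ} (ha : 0 < a) (v : ℝ≥0∞) :
    ∫⁻ s in Set.Ioi (0 : ℝ), ENNReal.ofReal (s ^ (a - 1)) *
      {s : ℝ | ENNReal.ofReal s < v}.indicator 1 s = v ^ a / ENNReal.ofReal a := by
  have hfin : ∀ V : ℝ, 0 ≤ V → ∫⁻ s in Set.Ioi (0 : ℝ), ENNReal.ofReal (s ^ (a - 1)) *
      (Set.Iio V).indicator 1 s = ENNReal.ofReal V ^ a / ENNReal.ofReal a := by
    intro V hV
    have h1 : ∀ s, ENNReal.ofReal (s ^ (a - 1)) * (Set.Iio V).indicator 1 s =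
        (Set.Iio V).indicator (fun s => ENNReal.ofReal (s ^ (a - 1))) s := by
      intro s
      by_cases hs : s ∈ Set.Iio V <;> simp [hs]
    simp_rw [h1]
    rw [setLIntegral_indicator measurableSet_Iio, Set.inter_comm, Set.Ioi_inter_Iio,
      setLIntegral_congr Ioo_ae_eq_Ioc, ← ofReal_integral_eq_lintegral_ofReal,
      ← intervalIntegral.integral_of_le hV, integral_rpow (Or.inl (by linarith)),
      ENNReal.ofReal_rpow_of_nonneg hV ha.le, ← ENNReal.ofReal_div_of_pos ha]
    · simp [Real.zero_rpow ha.ne']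
    · exact (intervalIntegrable_iff_integrableOn_Ioc_of_le hV).1
        (intervalIntegral.intervalIntegrable_rpow' (by linarith))
    · exact (ae_restrict_mem measurableSet_Ioc).mono fun s hs => Real.rpow_nonneg hs.1.le _
  rcases eq_or_ne v ⊤ with rfl | hv
  · rw [ENNReal.top_rpow_of_pos ha, ENNReal.top_div_of_ne_top ENNReal.ofReal_ne_top]
    refine ENNReal.eq_top_of_forall_nnreal_le fun r => ?_
    set V : ℝ := (a * r) ^ (1 / a) with hV
    have hr : (0 : ℝ) ≤ a * r := by positivity
    calc (r : ℝ≥0∞) = ENNReal.ofReal V ^ a / ENNReal.ofReal a := by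
          rw [ENNReal.ofReal_rpow_of_nonneg (by positivity) ha.le, ← ENNReal.ofReal_div_of_pos ha,
            hV, ← Real.rpow_mul hr, one_div_mul_cancel ha.ne', Real.rpow_one,
            mul_div_cancel_left₀ _ ha.ne', ENNReal.ofReal_coe_nnreal]
      _ = _ := (hfin V (by positivity)).symm
      _ ≤ _ := by
        refine lintegral_mono fun s => mul_le_mul_right ?_ _
        refine Set.indicator_le_indicator_of_subset (fun s _ => ?_) (fun _ => zero_le) _
        exact ENNReal.ofReal_lt_top
  · rw [← ENNReal.ofReal_toReal hv, ← hfin _ ENNReal.toReal_nonneg]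
    refine setLIntegral_congr_fun measurableSet_Ioi fun s hs => ?_
    have : (s ∈ {s : ℝ | ENNReal.ofReal s < ENNReal.ofReal v.toReal}) ↔ s ∈ Set.Iio v.toReal :=
      ENNReal.ofReal_lt_ofReal_iff_of_nonneg (le_of_lt hs)
    by_cases h : s ∈ Set.Iio v.toReal
    · simp only [Set.indicator_of_mem h, Set.indicator_of_mem (this.2 h)]
    · simp only [Set.indicator_of_notMem h, Set.indicator_of_notMem (fun h' => h (this.1 h'))]

lemma measurable_levelSet_param {Z : Type*} [MeasurableSpace Z] {v : Z → ℝ≥0∞}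
    (hv : Measurable v) : MeasurableSet {w : Z × ℝ | ENNReal.ofReal w.2 < v w.1} :=
  measurableSet_lt (ENNReal.measurable_ofReal.comp measurable_snd) (hv.comp measurable_fst)

/-- Weighted layer-cake formula. -/
lemma lintegral_layer {Z : Type*} [MeasurableSpace Z] {μ : Measure Z} [SFinite μ]
    {v w : Z → ℝ≥0∞} (hv : Measurable v) (hw : Measurable w) {a : ℝ} (ha : 0 < a) :
    ∫⁻ s in Set.Ioi (0 : ℝ), ENNReal.ofReal (s ^ (a - 1)) *
      ∫⁻ z, {z | ENNReal.ofReal s < v z}.indicator w z ∂μ =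
      (∫⁻ z, w z * v z ^ a ∂μ) / ENNReal.ofReal a := by
  have hms := measurable_levelSet_param hv
  have hm1 : Measurable fun q : Z × ℝ => ENNReal.ofReal (q.2 ^ (a - 1)) *
      {q : Z × ℝ | ENNReal.ofReal q.2 < v q.1}.indicator (fun q => w q.1) q :=
    ((measurable_snd.pow_const _).ennreal_ofReal).mul ((hw.comp measurable_fst).indicator hms)
  calc _ = ∫⁻ s in Set.Ioi (0 : ℝ), ∫⁻ z, ENNReal.ofReal (s ^ (a - 1)) *
      {z | ENNReal.ofReal s < v z}.indicator w z ∂μ := by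
        refine lintegral_congr fun s => ?_
        rw [lintegral_const_mul _ (hw.indicator (measurableSet_lt measurable_const hv))]
    _ = ∫⁻ z, (∫⁻ s in Set.Ioi (0 : ℝ), ENNReal.ofReal (s ^ (a - 1)) *
      {z | ENNReal.ofReal s < v z}.indicator w z) ∂μ :=
        lintegral_lintegral_swap (hm1.comp measurable_swap).aemeasurable
    _ = ∫⁻ z, w z * (v z ^ a / ENNReal.ofReal a) ∂μ := by
        refine lintegral_congr fun z => ?_
        rw [← lintegral_rpow_indicator ha, ← lintegral_const_mul]
        · refine lintegral_congr fun s => ?_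
          by_cases h : ENNReal.ofReal s < v z
          · simp [Set.indicator, h, mul_comm]
          · simp [Set.indicator, h]
        · refine Measurable.mul (by fun_prop) (measurable_one.indicator ?_)
          exact measurableSet_lt ENNReal.measurable_ofReal measurable_const
    _ = _ := by
        simp_rw [div_eq_mul_inv, ← mul_assoc]
        rw [lintegral_mul_const (f := fun z => w z * v z ^ a) _ (hw.mul (hv.pow_const _))]

lemma lintegral_rpow_eq_layer {Z : Type*} [MeasurableSpace Z] {μ : Measure Z} [SFinite μ]
    {v : Z → ℝ≥0∞} (hv : Measurable v) {a : ℝ} (ha : 0 < a) :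
    ∫⁻ z, v z ^ a ∂μ = ENNReal.ofReal a * ∫⁻ s in Set.Ioi (0 : ℝ), ENNReal.ofReal (s ^ (a - 1)) *
      μ {z | ENNReal.ofReal s < v z} := by
  have h := lintegral_layer (μ := μ) hv (measurable_one (α := ℝ≥0∞) (β := Z)) ha
  have h2 : ∀ s : ℝ, ∫⁻ z, {z | ENNReal.ofReal s < v z}.indicator 1 z ∂μ =
      μ {z | ENNReal.ofReal s < v z} := fun s =>
    lintegral_indicator_one (measurableSet_lt measurable_const hv)
  simp_rw [h2, Pi.one_apply, one_mul] at h
  rw [h, ENNReal.mul_div_cancel (by simpa using ha) ENNReal.ofReal_ne_top]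

lemma lintegral_min_rpow_le {P : ℝ} (hP : 1 < P) (v : ℝ≥0∞) :
    ∫⁻ s in Set.Ioi (0 : ℝ), ENNReal.ofReal (s ^ (-P)) * min v (ENNReal.ofReal s) ^ P ≤
      v * ENNReal.ofReal (P / (P - 1)) := by
  have hP1 : 0 < P - 1 := by linarith
  rcases eq_or_ne v ⊤ with rfl | hv
  · rw [ENNReal.top_mul]
    · exact le_top
    · simpa using div_pos (by linarith) hP1
  rcases eq_or_ne v 0 with rfl | hv0
  · simp [ENNReal.zero_rpow_of_pos (by linarith : 0 < P)]
  obtain ⟨V, hV, rfl⟩ : ∃ V : ℝ, 0 < V ∧ v = ENNReal.ofReal V :=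
    ⟨v.toReal, ENNReal.toReal_pos hv0 hv, (ENNReal.ofReal_toReal hv).symm⟩
  rw [← Set.Ioc_union_Ioi_eq_Ioi hV.le]
  refine (lintegral_union_le _ _ _).trans ?_
  have h1 : ∫⁻ s in Set.Ioc 0 V, ENNReal.ofReal (s ^ (-P)) *
      min (ENNReal.ofReal V) (ENNReal.ofReal s) ^ P ≤ ENNReal.ofReal V := by
    calc _ ≤ ∫⁻ s in Set.Ioc 0 V, 1 := by
          refine setLIntegral_mono measurable_one fun s hs => ?_
          calc _ ≤ ENNReal.ofReal (s ^ (-P)) * ENNReal.ofReal s ^ P := by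
                gcongr; exact min_le_right _ _
            _ = 1 := by
              rw [ENNReal.ofReal_rpow_of_pos hs.1, ← ENNReal.ofReal_mul (Real.rpow_nonneg hs.1.le _),
                ← Real.rpow_add hs.1]
              simp
      _ = _ := by simp
  have h2 : ∫⁻ s in Set.Ioi V, ENNReal.ofReal (s ^ (-P)) *
      min (ENNReal.ofReal V) (ENNReal.ofReal s) ^ P ≤ ENNReal.ofReal (V / (P - 1)) := by
    calc _ ≤ ∫⁻ s in Set.Ioi V, ENNReal.ofReal (s ^ (-P)) * ENNReal.ofReal V ^ P := by
          gcongr; exact min_le_left _ _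
      _ = _ := by
        rw [lintegral_mul_const _ (by fun_prop), ← ofReal_integral_eq_lintegral_ofReal
          (integrableOn_Ioi_rpow_of_lt (by linarith) hV)
          ((ae_restrict_mem measurableSet_Ioi).mono fun s hs =>
            Real.rpow_nonneg (hV.trans hs).le _),
          integral_Ioi_rpow_of_lt (by linarith) hV, ENNReal.ofReal_rpow_of_pos hV,
          ← ENNReal.ofReal_mul (div_nonneg_of_nonpos
            (neg_nonpos.2 (Real.rpow_nonneg hV.le _)) (by linarith))]
        congr 1
        have : V ^ (-P + 1) * V ^ P = V := by
          rw [← Real.rpow_add hV]; simp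
        have h3 : -P + 1 ≠ 0 := by linarith
        field_simp
        have h4 : (P - 1) * (-P + 1)⁻¹ = -1 := by
          field_simp; ring
        linear_combination (1 - P) * this
  refine (add_le_add h1 h2).trans (le_of_eq ?_)
  rw [← ENNReal.ofReal_add hV.le (by positivity), ← ENNReal.ofReal_mul hV.le]
  congr 1
  field_simp
  ring

/-- Integration of a level-set inequality with truncated power means on the right. -/
lemma lintegral_le_of_level {Z : Type*} [MeasurableSpace Z] {μ : Measure Z} [SFinite μ]
    {U F G : Z → ℝ≥0∞} (hU : Measurable U) (hF : Measurable F) (hG : Measurable G)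
    {P Q : ℝ} (hP : 1 < P) (hQ : 1 < Q) {A : ℝ≥0∞}
    (h : ∀ s : ℝ, 0 < s → μ {z | ENNReal.ofReal s < U z} ≤
      A * (μ {z | ENNReal.ofReal s < F z} + μ {z | ENNReal.ofReal s < G z} +
        (ENNReal.ofReal (s ^ (-P)) * ∫⁻ z, min (F z) (ENNReal.ofReal s) ^ P ∂μ +
        ENNReal.ofReal (s ^ (-Q)) * ∫⁻ z, min (G z) (ENNReal.ofReal s) ^ Q ∂μ))) :
    ∫⁻ z, U z ∂μ ≤ A * ((∫⁻ z, F z ∂μ) * ENNReal.ofReal (1 + P / (P - 1)) +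
      (∫⁻ z, G z ∂μ) * ENNReal.ofReal (1 + Q / (Q - 1))) := by
  have one : ∀ V : Z → ℝ≥0∞, Measurable V →
      ∫⁻ z, V z ∂μ = ∫⁻ s in Set.Ioi (0 : ℝ), μ {z | ENNReal.ofReal s < V z} := by
    intro V hV
    simpa using lintegral_rpow_eq_layer (μ := μ) hV one_pos
  have mlev : ∀ V : Z → ℝ≥0∞, Measurable V →
      Measurable fun s : ℝ => μ {z | ENNReal.ofReal s < V z} := fun V hV =>
    measurable_measure_prodMk_right (measurable_levelSet_param hV)
  have two : ∀ (V : Z → ℝ≥0∞) (R : ℝ), Measurable V → 1 < R →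
      Measurable (fun s : ℝ => ENNReal.ofReal (s ^ (-R)) *
        ∫⁻ z, min (V z) (ENNReal.ofReal s) ^ R ∂μ) ∧
      ∫⁻ s in Set.Ioi (0 : ℝ), ENNReal.ofReal (s ^ (-R)) *
        ∫⁻ z, min (V z) (ENNReal.ofReal s) ^ R ∂μ ≤
        (∫⁻ z, V z ∂μ) * ENNReal.ofReal (R / (R - 1)) := by
    intro V R hV hR
    have hm : Measurable fun q : ℝ × Z => min (V q.2) (ENNReal.ofReal q.1) ^ R :=
      ((hV.comp measurable_snd).min (ENNReal.measurable_ofReal.comp measurable_fst)).pow_const _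
    have hm2 : Measurable fun q : ℝ × Z => ENNReal.ofReal (q.1 ^ (-R)) *
        min (V q.2) (ENNReal.ofReal q.1) ^ R :=
      ((measurable_fst.pow_const _).ennreal_ofReal).mul hm
    refine ⟨(by fun_prop : Measurable fun s : ℝ => ENNReal.ofReal (s ^ (-R))).mul
      hm.lintegral_prod_right', ?_⟩
    calc _ = ∫⁻ s in Set.Ioi (0 : ℝ), ∫⁻ z, ENNReal.ofReal (s ^ (-R)) *
          min (V z) (ENNReal.ofReal s) ^ R ∂μ := by
          refine lintegral_congr fun s => ?_
          rw [lintegral_const_mul _ ((hV.min measurable_const).pow_const _)]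
      _ = ∫⁻ z, (∫⁻ s in Set.Ioi (0 : ℝ), ENNReal.ofReal (s ^ (-R)) *
          min (V z) (ENNReal.ofReal s) ^ R) ∂μ := lintegral_lintegral_swap hm2.aemeasurable
      _ ≤ ∫⁻ z, V z * ENNReal.ofReal (R / (R - 1)) ∂μ :=
          lintegral_mono fun z => lintegral_min_rpow_le hR (V z)
      _ = _ := lintegral_mul_const _ hV
  obtain ⟨mF, iF⟩ := two F P hF hP
  obtain ⟨mG, iG⟩ := two G Q hG hQ
  rw [one U hU]
  calc _ ≤ ∫⁻ s in Set.Ioi (0 : ℝ), A * (μ {z | ENNReal.ofReal s < F z} +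
        μ {z | ENNReal.ofReal s < G z} +
        (ENNReal.ofReal (s ^ (-P)) * ∫⁻ z, min (F z) (ENNReal.ofReal s) ^ P ∂μ +
        ENNReal.ofReal (s ^ (-Q)) * ∫⁻ z, min (G z) (ENNReal.ofReal s) ^ Q ∂μ)) :=
        setLIntegral_mono' measurableSet_Ioi h
    _ = A * ((∫⁻ z, F z ∂μ) + (∫⁻ z, G z ∂μ) +
        ((∫⁻ s in Set.Ioi (0 : ℝ), ENNReal.ofReal (s ^ (-P)) *
          ∫⁻ z, min (F z) (ENNReal.ofReal s) ^ P ∂μ) +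
        ∫⁻ s in Set.Ioi (0 : ℝ), ENNReal.ofReal (s ^ (-Q)) *
          ∫⁻ z, min (G z) (ENNReal.ofReal s) ^ Q ∂μ)) := by
        have m1 := (mlev F hF).add (mlev G hG)
        have m2 := m1.add (mF.add mG)
        simp only [Pi.add_def] at m1 m2
        rw [lintegral_const_mul _ m2, lintegral_add_left m1, lintegral_add_left (mlev F hF),
          lintegral_add_left mF, one F hF, one G hG]
    _ ≤ A * ((∫⁻ z, F z ∂μ) + (∫⁻ z, G z ∂μ) + ((∫⁻ z, F z ∂μ) * ENNReal.ofReal (P / (P - 1)) +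
        (∫⁻ z, G z ∂μ) * ENNReal.ofReal (Q / (Q - 1)))) := by gcongr
    _ = _ := by
        rw [ENNReal.ofReal_add zero_le_one (div_nonneg (by linarith) (by linarith)),
          ENNReal.ofReal_add zero_le_one (div_nonneg (by linarith) (by linarith)),
          ENNReal.ofReal_one]
        ring

lemma HL_strong_type {p : ℝ} (hp : 1 < p) : ∃ C : ℝ≥0, ∀ u : ℝ → ℝ≥0∞, Measurable u →
    ∫⁻ x, HL u x ^ p ≤ C * ∫⁻ x, u x ^ p := by
  have hp0 : 0 < p := by linarith
  refine ⟨((3 : ℝ).toNNReal) ^ p * (p.toNNReal * (10 / (p - 1).toNNReal)), fun u hu => ?_⟩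
  have hH := measurable_HL hu
  have hH3 : Measurable fun x => HL u x / 3 := hH.div_const 3
  have key : ∫⁻ x, (HL u x / 3) ^ p ≤ ENNReal.ofReal p * (10 * ((∫⁻ x, u x ^ p) /
      ENNReal.ofReal (p - 1))) := by
    rw [lintegral_rpow_eq_layer hH3 hp0]
    refine mul_le_mul_right ?_ _
    have h2 := lintegral_layer (μ := volume) hu hu (a := p - 1) (by linarith)
    have h3 : ∀ x, u x * u x ^ (p - 1) = u x ^ p := by
      intro x
      rcases eq_or_ne (u x) ⊤ with h | h
      · simp [h, ENNReal.top_rpow_of_pos hp0, ENNReal.top_rpow_of_pos (sub_pos.2 hp)]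
      rcases eq_or_ne (u x) 0 with h' | h'
      · simp [h', ENNReal.zero_rpow_of_pos hp0]
      nth_rewrite 1 [← ENNReal.rpow_one (u x)]
      rw [← ENNReal.rpow_add _ _ h' h]
      ring_nf
    simp_rw [h3] at h2
    rw [← h2, ← lintegral_const_mul']
    · refine setLIntegral_mono' measurableSet_Ioi fun s hs => ?_
      have hs0 : ENNReal.ofReal s ≠ 0 := by simpa using hs
      have h4 := HL_level u hu hs0 ENNReal.ofReal_ne_top
      have h5 : {x | ENNReal.ofReal s < HL u x / 3} = {x | 3 * ENNReal.ofReal s < HL u x} := by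
        ext x
        simp only [Set.mem_ofPred_eq]
        rw [ENNReal.lt_div_iff_mul_lt (by simp) (by simp), mul_comm]
      rw [h5]
      calc _ ≤ ENNReal.ofReal (s ^ (p - 1)) * (10 / ENNReal.ofReal s *
            ∫⁻ t, {t | ENNReal.ofReal s < u t}.indicator u t) := mul_le_mul_right h4 _
        _ = _ := by
          have : ENNReal.ofReal (s ^ (p - 1)) =
              ENNReal.ofReal (s ^ (p - 1 - 1)) * ENNReal.ofReal s := by
            rw [← ENNReal.ofReal_mul (Real.rpow_nonneg (le_of_lt hs) _)]
            congr 1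
            nth_rewrite 3 [← Real.rpow_one s]
            rw [← Real.rpow_add hs]
            ring_nf
          rw [this, div_eq_mul_inv, mul_assoc, ← mul_assoc (ENNReal.ofReal s),
            mul_left_comm (ENNReal.ofReal s), ENNReal.mul_inv_cancel hs0 ENNReal.ofReal_ne_top]
          ring
    · simp
  calc ∫⁻ x, HL u x ^ p = ∫⁻ x, (3 : ℝ≥0∞) ^ p * (HL u x / 3) ^ p := by
        refine lintegral_congr fun x => ?_
        rw [← ENNReal.mul_rpow_of_nonneg _ _ hp0.le, ENNReal.mul_div_cancel (by simp) (by simp)]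
    _ = (3 : ℝ≥0∞) ^ p * ∫⁻ x, (HL u x / 3) ^ p := lintegral_const_mul _ (hH3.pow_const _)
    _ ≤ _ := mul_le_mul_right key _
    _ = _ := by
        rw [ENNReal.coe_mul, ENNReal.coe_mul, ENNReal.coe_div (by simpa using hp),
          ENNReal.coe_rpow_of_nonneg _ hp0.le]
        simp only [ENNReal.ofReal, div_eq_mul_inv]
        norm_num
        ring

/-! ### Smooth kernels, fibrewise convolution and the maximal functions on the plane -/

lemma lintegral_profile_le_HL {u : ℝ → ℝ≥0∞} (hu : Measurable u) (k : ℤ) (x : ℝ) :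
    ∫⁻ t, ENNReal.ofReal ((2 : ℝ) ^ k / (1 + (2 : ℝ) ^ k * |x - t|) ^ 2) * u t ≤ 8 * HL u x := by
  have hpt : ∀ t, ENNReal.ofReal ((2 : ℝ) ^ k / (1 + (2 : ℝ) ^ k * |x - t|) ^ 2) * u t ≤
      ∑' j : ℕ, ENNReal.ofReal (4 * (1 / 4) ^ j * (2 : ℝ) ^ k) *
        (Metric.closedBall x ((2 : ℝ) ^ ((j : ℤ) - k))).indicator u t := by
    intro t
    have h2k : (0 : ℝ) < 2 ^ k := by positivity
    set r := (2 : ℝ) ^ k * |x - t| with hr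
    have hr0 : 0 ≤ r := by positivity
    have hex : ∃ j : ℕ, r ≤ 2 ^ j := (pow_unbounded_of_one_lt r one_lt_two).imp fun _ h => h.le
    classical
    set j := Nat.find hex with hj
    have hj1 : r ≤ 2 ^ j := Nat.find_spec hex
    have hmem : t ∈ Metric.closedBall x ((2 : ℝ) ^ ((j : ℤ) - k)) := by
      rw [Metric.mem_closedBall, dist_comm, Real.dist_eq, zpow_sub₀ two_ne_zero,
        le_div_iff₀ h2k, mul_comm]
      simpa using hj1
    have hbd : 1 / (1 + r) ^ 2 ≤ 4 * (1 / 4 : ℝ) ^ j := by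
      have h3 : (2 : ℝ) ^ j ≤ 2 * (1 + r) := by
        rcases Nat.eq_zero_or_pos j with h0 | h0
        · rw [h0]; simp; linarith
        · have := Nat.find_min hex (m := j - 1) (by omega)
          rw [not_le] at this
          calc (2 : ℝ) ^ j = 2 * 2 ^ (j - 1) := by
                rw [← pow_succ']; congr 1; omega
            _ ≤ _ := by linarith
      have h4 : (1 / 4 : ℝ) ^ j = 1 / (2 ^ j) ^ 2 := by
        rw [one_div_pow, ← pow_mul, mul_comm j 2, pow_mul]; norm_num
      rw [h4, ← mul_div_assoc, mul_one, div_le_div_iff₀ (by positivity) (by positivity)]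
      nlinarith [pow_le_pow_left₀ (by positivity) h3 2]
    refine le_trans ?_ (ENNReal.le_tsum j)
    rw [Set.indicator_of_mem hmem]
    gcongr
    calc (2 : ℝ) ^ k / (1 + r) ^ 2 = 1 / (1 + r) ^ 2 * 2 ^ k := by ring
      _ ≤ _ := mul_le_mul_of_nonneg_right hbd h2k.le
  calc _ ≤ ∫⁻ t, ∑' j : ℕ, ENNReal.ofReal (4 * (1 / 4) ^ j * (2 : ℝ) ^ k) *
        (Metric.closedBall x ((2 : ℝ) ^ ((j : ℤ) - k))).indicator u t := lintegral_mono hpt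
    _ = ∑' j : ℕ, ENNReal.ofReal (4 * (1 / 4) ^ j * (2 : ℝ) ^ k) *
        ∫⁻ t in Metric.closedBall x ((2 : ℝ) ^ ((j : ℤ) - k)), u t := by
        have hm := fun j : ℕ => hu.indicator
          (Metric.isClosed_closedBall (x := x) (ε := (2 : ℝ) ^ ((j : ℤ) - k))).measurableSet
        rw [lintegral_tsum fun j => ((hm j).const_mul _).aemeasurable]
        refine tsum_congr fun j => ?_
        rw [lintegral_const_mul _ (hm j), lintegral_indicator Metric.isClosed_closedBall.measurableSet]
    _ ≤ ∑' j : ℕ, ENNReal.ofReal (4 * (1 / 2) ^ j) * HL u x := by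
        refine ENNReal.tsum_le_tsum fun j => ?_
        calc _ ≤ ENNReal.ofReal (4 * (1 / 4) ^ j * (2 : ℝ) ^ k) *
              (ENNReal.ofReal ((2 : ℝ) ^ ((j : ℤ) - k)) * HL u x) :=
              mul_le_mul_right (lintegral_closedBall_le_HL u x _) _
          _ = _ := by
            rw [← mul_assoc, ← ENNReal.ofReal_mul (by positivity)]
            congr 2
            have : (2 : ℝ) ^ k ≠ 0 := by positivity
            rw [zpow_sub₀ two_ne_zero, zpow_natCast, mul_assoc, mul_div_cancel₀ _ this, mul_assoc,
              ← mul_pow]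
            norm_num
    _ = 8 * HL u x := by
        rw [ENNReal.tsum_mul_right, ← ENNReal.ofReal_tsum_of_nonneg (fun _ => by positivity)
          ((summable_geometric_two).mul_left 4), tsum_mul_left, tsum_geometric_two]
        norm_num

/-- Kernels with cubic decay and a matching Lipschitz bound. -/
structure IsKer (K : ℝ → ℝ) (C : ℝ) : Prop where
  bound : ∀ t, |K t| ≤ C / (1 + |t|) ^ 3
  lip : ∀ s t, |K s - K t| ≤ C * |s - t| * (1 / (1 + |s|) ^ 3 + 1 / (1 + |t|) ^ 3)

/-- `L¹`-normalised dyadic dilate of a real kernel. -/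
def rdil (K : ℝ → ℝ) (k : ℤ) (t : ℝ) : ℝ := (2 : ℝ) ^ k * K ((2 : ℝ) ^ k * t)

/-- Convolution of a vector-valued function with a scalar kernel. -/
def fconv {E : Type*} [NormedAddCommGroup E] [NormedSpace ℝ E] (K : ℝ → ℝ) (u : ℝ → E) (x : ℝ) : E :=
  ∫ t, K (x - t) • u t

namespace IsKer

variable {K : ℝ → ℝ} {C : ℝ}

lemma nonneg (h : IsKer K C) : 0 ≤ C := by
  have := (abs_nonneg _).trans (h.bound 0)
  simpa using this

lemma continuous (h : IsKer K C) : Continuous K := by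
  refine LipschitzWith.continuous (K := (2 * C).toNNReal) ?_
  refine LipschitzWith.of_dist_le_mul fun s t => ?_
  have one : ∀ s : ℝ, 1 / (1 + |s|) ^ 3 ≤ 1 := fun s => by
    rw [div_le_one (by positivity)]
    exact one_le_pow₀ (by linarith [abs_nonneg s])
  rw [Real.dist_eq, Real.dist_eq, Real.coe_toNNReal _ (by linarith [h.nonneg])]
  refine (h.lip s t).trans ?_
  have := mul_nonneg h.nonneg (abs_nonneg (s - t))
  nlinarith [one s, one t]

lemma bound_sq (h : IsKer K C) (t : ℝ) : |K t| ≤ C / (1 + |t|) ^ 2 :=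
  (h.bound t).trans (div_le_div_of_nonneg_left h.nonneg (by positivity)
    (pow_le_pow_right₀ (by linarith [abs_nonneg t]) (by norm_num)))

lemma bound_inv (h : IsKer K C) (t : ℝ) : |K t| ≤ C * (1 + t ^ 2)⁻¹ := by
  refine (h.bound_sq t).trans ?_
  rw [div_eq_mul_inv]
  refine mul_le_mul_of_nonneg_left (inv_anti₀ (by positivity) ?_) h.nonneg
  nlinarith [abs_nonneg t, sq_abs t]

lemma mul_bound_inv (h : IsKer K C) (t : ℝ) : |K t| * |t| ≤ C * (1 + t ^ 2)⁻¹ := by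
  have h1 : |K t| * |t| ≤ C / (1 + |t|) ^ 3 * (1 + |t|) :=
    mul_le_mul (h.bound t) (by linarith) (abs_nonneg _)
      (div_nonneg h.nonneg (by positivity))
  have h2 : C / (1 + |t|) ^ 3 * (1 + |t|) = C / (1 + |t|) ^ 2 := by
    field_simp
  refine h1.trans (h2.le.trans ?_)
  rw [div_eq_mul_inv]
  refine mul_le_mul_of_nonneg_left (inv_anti₀ (by positivity) ?_) h.nonneg
  nlinarith [abs_nonneg t, sq_abs t]

lemma integrable (h : IsKer K C) : Integrable K :=
  (integrable_inv_one_add_sq.const_mul C).mono' h.continuous.aestronglyMeasurable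
    (Eventually.of_forall h.bound_inv)

lemma integrable_rdil (h : IsKer K C) (k : ℤ) : Integrable (rdil K k) :=
  (h.integrable.comp_mul_left' (by positivity)).const_mul _

lemma continuous_rdil (h : IsKer K C) (k : ℤ) : Continuous (rdil K k) :=
  continuous_const.mul (h.continuous.comp (continuous_const.mul continuous_id))

lemma rdil_bound (h : IsKer K C) (k : ℤ) (t : ℝ) :
    |rdil K k t| ≤ C * ((2 : ℝ) ^ k / (1 + (2 : ℝ) ^ k * |t|) ^ 2) := by
  have h2k : (0 : ℝ) < 2 ^ k := by positivity
  have := h.bound_sq ((2 : ℝ) ^ k * t)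
  rw [abs_mul, abs_of_pos h2k] at this
  rw [rdil, abs_mul, abs_of_pos h2k]
  calc _ ≤ (2 : ℝ) ^ k * (C / (1 + (2 : ℝ) ^ k * |t|) ^ 2) :=
        mul_le_mul_of_nonneg_left this h2k.le
    _ = _ := by ring

lemma rdil_le (h : IsKer K C) (k : ℤ) (t : ℝ) : |rdil K k t| ≤ C * (2 : ℝ) ^ k := by
  refine (h.rdil_bound k t).trans (mul_le_mul_of_nonneg_left ?_ h.nonneg)
  exact div_le_self (by positivity) (one_le_pow₀ (by
    have : 0 ≤ (2 : ℝ) ^ k * |t| := by positivity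
    linarith))

lemma enorm_fconv_le (h : IsKer K C) (k : ℤ) {E : Type*} [NormedAddCommGroup E] [NormedSpace ℝ E]
    {u : ℝ → E} (hu : Measurable fun t => ‖u t‖ₑ) (x : ℝ) :
    ‖fconv (rdil K k) u x‖ₑ ≤ ENNReal.ofReal (8 * C) * HL (fun t => ‖u t‖ₑ) x := by
  calc _ ≤ ∫⁻ t, ‖rdil K k (x - t) • u t‖ₑ := enorm_integral_le_lintegral_enorm _
    _ ≤ ∫⁻ t, ENNReal.ofReal C * (ENNReal.ofReal ((2 : ℝ) ^ k / (1 + (2 : ℝ) ^ k * |x - t|) ^ 2) *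
        ‖u t‖ₑ) := by
        refine lintegral_mono fun t => ?_
        rw [enorm_smul, ← mul_assoc, ← ENNReal.ofReal_mul h.nonneg]
        gcongr
        rw [Real.enorm_eq_ofReal_abs]
        exact ENNReal.ofReal_le_ofReal (h.rdil_bound k _)
    _ = ENNReal.ofReal C * ∫⁻ t, ENNReal.ofReal ((2 : ℝ) ^ k / (1 + (2 : ℝ) ^ k * |x - t|) ^ 2) *
        ‖u t‖ₑ := by
        rw [lintegral_const_mul]
        exact Measurable.mul (by fun_prop) hu
    _ ≤ ENNReal.ofReal C * (8 * HL (fun t => ‖u t‖ₑ) x) :=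
        mul_le_mul_right (lintegral_profile_le_HL hu k x) _
    _ = _ := by
        rw [mul_comm 8 C, ENNReal.ofReal_mul h.nonneg, ← mul_assoc]
        norm_num

end IsKer

/-- Maximal function in the first variable. -/
def Mx (u : ℝ × ℝ → ℝ≥0∞) (z : ℝ × ℝ) : ℝ≥0∞ := HL (fun t => u (t, z.2)) z.1

/-- Maximal function in the second variable. -/
def My (u : ℝ × ℝ → ℝ≥0∞) (z : ℝ × ℝ) : ℝ≥0∞ := HL (fun t => u (z.1, t)) z.2

lemma measurable_My {u : ℝ × ℝ → ℝ≥0∞} (hu : Measurable u) : Measurable (My u) :=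
  measurable_HL_param (u := fun x t => u (x, t)) hu

lemma measurable_Mx {u : ℝ × ℝ → ℝ≥0∞} (hu : Measurable u) : Measurable (Mx u) := by
  have h1 : Measurable fun z : ℝ × ℝ => HL (fun t => u (t, z.1)) z.2 :=
    measurable_HL_param (u := fun y t => u (t, y)) (hu.comp measurable_swap)
  have h2 := h1.comp measurable_swap
  exact h2

lemma lintegral_My_rpow_le {p : ℝ} (hp : 1 < p) : ∃ C : ℝ≥0, ∀ u : ℝ × ℝ → ℝ≥0∞, Measurable u →
    ∫⁻ z, My u z ^ p ≤ C * ∫⁻ z, u z ^ p := by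
  obtain ⟨C, hC⟩ := HL_strong_type hp
  refine ⟨C, fun u hu => ?_⟩
  rw [Measure.volume_eq_prod, lintegral_prod _ ((measurable_My hu).pow_const _).aemeasurable,
    lintegral_prod _ (hu.pow_const _).aemeasurable, ← lintegral_const_mul]
  · exact lintegral_mono fun x => hC _ (hu.comp measurable_prodMk_left)
  · exact (hu.pow_const _).lintegral_prod_right'

lemma lintegral_swap_plane {u : ℝ × ℝ → ℝ≥0∞} :
    ∫⁻ z : ℝ × ℝ, u z.swap = ∫⁻ z, u z :=
  (Measure.measurePreserving_swap (μ := (volume : Measure ℝ)) (ν := (volume : Measure ℝ))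
    ).lintegral_comp_emb MeasurableEquiv.prodComm.measurableEmbedding u

lemma lintegral_Mx_rpow_le {p : ℝ} (hp : 1 < p) : ∃ C : ℝ≥0, ∀ u : ℝ × ℝ → ℝ≥0∞, Measurable u →
    ∫⁻ z, Mx u z ^ p ≤ C * ∫⁻ z, u z ^ p := by
  obtain ⟨C, hC⟩ := lintegral_My_rpow_le hp
  refine ⟨C, fun u hu => ?_⟩
  have h := hC (fun z => u z.swap) (hu.comp measurable_swap)
  rw [lintegral_swap_plane (u := fun z => u z ^ p)] at h
  rw [← lintegral_swap_plane]
  exact h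

/-! ### Bounded measurable functions and Gram kernels -/

/-- Bounded measurable real functions. -/
def BM {α : Type*} [MeasurableSpace α] (u : α → ℝ) : Prop := Measurable u ∧ ∃ C, ∀ x, |u x| ≤ C

namespace BM

variable {α β : Type*} [MeasurableSpace α] [MeasurableSpace β] {u v : α → ℝ}

lemma const (c : ℝ) : BM fun _ : α => c := ⟨measurable_const, |c|, fun _ => le_rfl⟩

lemma mul (hu : BM u) (hv : BM v) : BM fun x => u x * v x := by
  obtain ⟨hu, C, hC⟩ := hu
  obtain ⟨hv, D, hD⟩ := hv
  refine ⟨hu.mul hv, C * D, fun x => ?_⟩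
  rw [abs_mul]
  exact mul_le_mul (hC x) (hD x) (abs_nonneg _) ((abs_nonneg _).trans (hC x))

lemma add (hu : BM u) (hv : BM v) : BM fun x => u x + v x := by
  obtain ⟨hu, C, hC⟩ := hu
  obtain ⟨hv, D, hD⟩ := hv
  exact ⟨hu.add hv, C + D, fun x => (abs_add_le _ _).trans (add_le_add (hC x) (hD x))⟩

lemma neg (hu : BM u) : BM fun x => -u x := by
  obtain ⟨hu, C, hC⟩ := hu
  exact ⟨hu.neg, C, fun x => by rw [abs_neg]; exact hC x⟩

lemma sub (hu : BM u) (hv : BM v) : BM fun x => u x - v x := by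
  simp_rw [sub_eq_add_neg]
  exact hu.add hv.neg

lemma abs (hu : BM u) : BM fun x => |u x| := by
  obtain ⟨hu, C, hC⟩ := hu
  exact ⟨hu.abs, C, fun x => by rw [abs_abs]; exact hC x⟩

lemma sum {ι : Type*} (s : Finset ι) {u : ι → α → ℝ} (hu : ∀ i, BM (u i)) :
    BM fun x => ∑ i ∈ s, u i x := by
  classical
  induction s using Finset.induction_on with
  | empty => simpa using BM.const 0
  | insert i s hi ih =>
    simp only [Finset.sum_insert hi]
    exact (hu i).add ih

lemma comp (hu : BM u) {m : β → α} (hm : Measurable m) : BM fun x => u (m x) :=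
  ⟨hu.1.comp hm, hu.2.imp fun _ hC _ => hC _⟩

lemma pow (hu : BM u) (n : ℕ) : BM fun x => u x ^ n := by
  induction n with
  | zero => simpa using BM.const 1
  | succ n ih => simp_rw [pow_succ]; exact ih.mul hu

lemma integrable (hu : BM u) (μ : Measure α) [IsFiniteMeasure μ] : Integrable u μ := by
  obtain ⟨hu, C, hC⟩ := hu
  exact (integrable_const C).mono' hu.aestronglyMeasurable (Eventually.of_forall hC)

lemma integral_left {w : α × β → ℝ} (hw : BM w) (μ : Measure α) [IsFiniteMeasure μ] :
    BM fun y => ∫ x, w (x, y) ∂μ := by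
  obtain ⟨hm, C, hC⟩ := hw
  refine ⟨(hm.stronglyMeasurable.integral_prod_left' (μ := μ)).measurable, C * μ.real Set.univ,
    fun y => ?_⟩
  exact norm_integral_le_of_norm_le_const (f := fun x => w (x, y))
    (Eventually.of_forall fun _ => hC _)

lemma integral_right {w : α × β → ℝ} (hw : BM w) (μ : Measure β) [IsFiniteMeasure μ] :
    BM fun x => ∫ y, w (x, y) ∂μ :=
  (hw.comp measurable_swap).integral_left μ

end BM

section Gram

variable {ι κ : Type*} [Fintype ι] [Fintype κ]

/-- The Gram kernel `∑ᵢ ∫ uᵢ(x, y) uᵢ(x, y') dμ(x)`. -/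
def gram (μ : Measure ℝ) (u : ι → ℝ × ℝ → ℝ) (z : ℝ × ℝ) : ℝ :=
  ∑ i, ∫ x, u i (x, z.1) * u i (x, z.2) ∂μ

lemma gram_bm (μ : Measure ℝ) [IsFiniteMeasure μ] {u : ι → ℝ × ℝ → ℝ} (hu : ∀ i, BM (u i)) :
    BM (gram μ u) := by
  refine BM.sum _ fun i => ?_
  have h : BM fun w : ℝ × ℝ × ℝ => u i (w.1, w.2.1) * u i (w.1, w.2.2) :=
    ((hu i).comp (by fun_prop)).mul ((hu i).comp (by fun_prop))
  exact h.integral_left μ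

lemma gram_add (μ₀ μ₁ : Measure ℝ) [IsFiniteMeasure μ₀] [IsFiniteMeasure μ₁]
    {u : ι → ℝ × ℝ → ℝ} (hu : ∀ i, BM (u i)) (z : ℝ × ℝ) :
    gram (μ₀ + μ₁) u z = gram μ₀ u z + gram μ₁ u z := by
  rw [gram, gram, gram, ← Finset.sum_add_distrib]
  refine Finset.sum_congr rfl fun i _ => ?_
  have h : BM fun x => u i (x, z.1) * u i (x, z.2) :=
    ((hu i).comp (by fun_prop)).mul ((hu i).comp (by fun_prop))
  exact integral_add_measure (h.integrable _) (h.integrable _)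

/-- The quadrilinear form `∬ w(y) w(y') A^u(y, y') A^v(y, y') dν(y) dν(y')`. -/
def gramForm (μ ν : Measure ℝ) (w : ℝ → ℝ) (u : ι → ℝ × ℝ → ℝ) (v : κ → ℝ × ℝ → ℝ) : ℝ :=
  ∫ z, w z.1 * w z.2 * (gram μ u z * gram μ v z) ∂(ν.prod ν)

lemma integral_sq_eq (ν : Measure ℝ) [IsFiniteMeasure ν] (a : ℝ → ℝ) :
    (∫ y, a y ∂ν) ^ 2 = ∫ z, a z.1 * a z.2 ∂(ν.prod ν) := by
  rw [sq, ← integral_prod_mul]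

lemma gramForm_eq (μ ν : Measure ℝ) [IsFiniteMeasure μ] [IsFiniteMeasure ν] {w : ℝ → ℝ}
    (hw : BM w) {u : ι → ℝ × ℝ → ℝ} (hu : ∀ i, BM (u i)) {v : κ → ℝ × ℝ → ℝ}
    (hv : ∀ i, BM (v i)) :
    gramForm μ ν w u v = ∑ i, ∑ j, ∫ x, (∫ y, w y * (u i (x.1, y) * v j (x.2, y)) ∂ν) ^ 2
      ∂(μ.prod μ) := by
  have key : ∀ i j, ∫ x, (∫ y, w y * (u i (x.1, y) * v j (x.2, y)) ∂ν) ^ 2 ∂(μ.prod μ) =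
      ∫ z, w z.1 * w z.2 * ((∫ x, u i (x, z.1) * u i (x, z.2) ∂μ) *
        ∫ x, v j (x, z.1) * v j (x, z.2) ∂μ) ∂(ν.prod ν) := by
    intro i j
    simp_rw [integral_sq_eq]
    rw [integral_integral_swap]
    · refine integral_congr_ae (Eventually.of_forall fun z => ?_)
      simp only
      rw [← integral_prod_mul, ← integral_const_mul]
      refine integral_congr_ae (Eventually.of_forall fun x => ?_)
      simp only
      ring
    · refine BM.integrable (u := Function.uncurry fun (x z : ℝ × ℝ) =>
        w z.1 * (u i (x.1, z.1) * v j (x.2, z.1)) * (w z.2 * (u i (x.1, z.2) * v j (x.2, z.2))))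
        ?_ _
      exact ((hw.comp (by fun_prop)).mul (((hu i).comp (by fun_prop)).mul
        ((hv j).comp (by fun_prop)))).mul ((hw.comp (by fun_prop)).mul
        (((hu i).comp (by fun_prop)).mul ((hv j).comp (by fun_prop))))
  simp_rw [key, gramForm, gram, Finset.sum_mul_sum, Finset.mul_sum]
  have hintg : ∀ i j, Integrable (fun z : ℝ × ℝ => w z.1 * w z.2 *
      ((∫ x, u i (x, z.1) * u i (x, z.2) ∂μ) * ∫ x, v j (x, z.1) * v j (x, z.2) ∂μ))
      (ν.prod ν) := by
    intro i j
    have h1 : BM fun q : ℝ × ℝ × ℝ => u i (q.1, q.2.1) * u i (q.1, q.2.2) :=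
      ((hu i).comp (by fun_prop)).mul ((hu i).comp (by fun_prop))
    have h2 : BM fun q : ℝ × ℝ × ℝ => v j (q.1, q.2.1) * v j (q.1, q.2.2) :=
      ((hv j).comp (by fun_prop)).mul ((hv j).comp (by fun_prop))
    exact BM.integrable (((hw.comp measurable_fst).mul (hw.comp measurable_snd)).mul
      ((h1.integral_left μ).mul (h2.integral_left μ))) _
  rw [integral_finsetSum _ fun i _ => integrable_finsetSum _ fun j _ => hintg i j]
  exact Finset.sum_congr rfl fun i _ => integral_finsetSum _ fun j _ => hintg i j

lemma gramForm_nonneg (μ ν : Measure ℝ) [IsFiniteMeasure μ] [IsFiniteMeasure ν] {w : ℝ → ℝ}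
    (hw : BM w) {u : ι → ℝ × ℝ → ℝ} (hu : ∀ i, BM (u i)) {v : κ → ℝ × ℝ → ℝ}
    (hv : ∀ i, BM (v i)) : 0 ≤ gramForm μ ν w u v := by
  rw [gramForm_eq μ ν hw hu hv]
  exact Finset.sum_nonneg fun i _ => Finset.sum_nonneg fun j _ =>
    integral_nonneg fun _ => sq_nonneg _

lemma integral_mul_sq_le (ν : Measure ℝ) [IsFiniteMeasure ν] {a b : ℝ → ℝ} (ha : BM a) (hb : BM b) :
    (∫ y, a y * b y ∂ν) ^ 2 ≤ (∫ y, a y ^ 2 ∂ν) * ∫ y, b y ^ 2 ∂ν := by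
  have key : ∀ t : ℝ, 0 ≤ (∫ y, a y ^ 2 ∂ν) * (t * t) + (2 * ∫ y, a y * b y ∂ν) * t +
      ∫ y, b y ^ 2 ∂ν := by
    intro t
    have h : 0 ≤ ∫ y, (t * a y + b y) ^ 2 ∂ν := integral_nonneg fun _ => sq_nonneg _
    have h2 : ∫ y, (t * a y + b y) ^ 2 ∂ν = ∫ y, ((t * t) * a y ^ 2 + (2 * t) * (a y * b y)) +
        b y ^ 2 ∂ν := integral_congr_ae (Eventually.of_forall fun y => by simp only; ring)
    rw [h2, integral_add, integral_add, integral_const_mul, integral_const_mul] at h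
    · linarith
    · exact ((ha.pow 2).integrable ν).const_mul _
    · exact ((ha.mul hb).integrable ν).const_mul _
    · exact (((ha.pow 2).integrable ν).const_mul _).add (((ha.mul hb).integrable ν).const_mul _)
    · exact (hb.pow 2).integrable ν
  have := discrim_le_zero key
  rw [discrim] at this
  nlinarith

lemma gramForm_one_le (μ ν : Measure ℝ) [IsFiniteMeasure μ] [IsFiniteMeasure ν]
    {u : ι → ℝ × ℝ → ℝ} (hu : ∀ i, BM (u i)) {v : κ → ℝ × ℝ → ℝ}
    (hv : ∀ i, BM (v i)) : gramForm μ ν 1 u v ≤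
      (∫ z, ∑ i, u i z ^ 2 ∂(μ.prod ν)) * ∫ z, ∑ i, v i z ^ 2 ∂(μ.prod ν) := by
  rw [gramForm_eq μ ν (by exact BM.const 1) hu hv,
    integral_finsetSum _ fun i _ => ((hu i).pow 2).integrable _,
    integral_finsetSum _ fun i _ => ((hv i).pow 2).integrable _, Finset.sum_mul_sum]
  refine Finset.sum_le_sum fun i _ => Finset.sum_le_sum fun j _ => ?_
  rw [integral_prod _ (((hu i).pow 2).integrable _), integral_prod _ (((hv j).pow 2).integrable _),
    ← integral_prod_mul]
  refine integral_mono_of_nonneg (Eventually.of_forall fun _ => sq_nonneg _) ?_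
    (Eventually.of_forall fun x => ?_)
  · exact BM.integrable (((((hu i).pow 2).integral_right ν).comp measurable_fst).mul
      ((((hv j).pow 2).integral_right ν).comp measurable_snd)) _
  · simp only [Pi.one_apply, one_mul]
    exact integral_mul_sq_le ν ((hu i).comp (by fun_prop)) ((hv j).comp (by fun_prop))

end Gram

section Increment

variable {ι κ : Type*} [Fintype ι] [Fintype κ]

lemma integral_prod_add_self {ν₀ ν₁ : Measure ℝ} [IsFiniteMeasure ν₀] [IsFiniteMeasure ν₁]
    {F : ℝ × ℝ → ℝ} (hF : BM F) : ∫ z, F z ∂((ν₀ + ν₁).prod (ν₀ + ν₁)) =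
      ∫ z, F z ∂(ν₀.prod ν₀) + ∫ z, F z ∂(ν₀.prod ν₁) + ∫ z, F z ∂(ν₁.prod ν₀) +
        ∫ z, F z ∂(ν₁.prod ν₁) := by
  rw [Measure.prod_add, Measure.add_prod, Measure.add_prod, integral_add_measure
    (hF.integrable _) (hF.integrable _), integral_add_measure
    (hF.integrable _) (hF.integrable _), integral_add_measure
    (hF.integrable _) (hF.integrable _)]
  ring

/-- The increment of `gramForm` when both intervals are halved. -/
def gramInc (μ₀ μ₁ ν₀ ν₁ : Measure ℝ) (u : ι → ℝ × ℝ → ℝ) (v : κ → ℝ × ℝ → ℝ) : ℝ :=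
  4 * (gramForm μ₀ ν₀ 1 u v + gramForm μ₁ ν₀ 1 u v + gramForm μ₀ ν₁ 1 u v +
    gramForm μ₁ ν₁ 1 u v) - gramForm (μ₀ + μ₁) (ν₀ + ν₁) 1 u v

lemma integral_congr_prod {ν₀ ν₁ : Measure ℝ} [IsFiniteMeasure ν₀] [IsFiniteMeasure ν₁] {w : ℝ → ℝ}
    {c₀ c₁ : ℝ} (h₀ : ∀ᵐ y ∂ν₀, w y = c₀) (h₁ : ∀ᵐ y ∂ν₁, w y = c₁) (F : ℝ × ℝ → ℝ) :
    ∫ z, w z.1 * w z.2 * F z ∂(ν₀.prod ν₁) = c₀ * c₁ * ∫ z, F z ∂(ν₀.prod ν₁) := by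
  rw [← integral_const_mul]
  refine integral_congr_ae ?_
  filter_upwards [Measure.quasiMeasurePreserving_fst.ae h₀,
    Measure.quasiMeasurePreserving_snd.ae h₁] with z hz₀ hz₁
  rw [hz₀, hz₁]

lemma gramInc_eq {μ₀ μ₁ ν₀ ν₁ : Measure ℝ} [IsFiniteMeasure μ₀] [IsFiniteMeasure μ₁]
    [IsFiniteMeasure ν₀] [IsFiniteMeasure ν₁] {w : ℝ → ℝ} (hw : BM w)
    (h₀ : ∀ᵐ y ∂ν₀, w y = 1) (h₁ : ∀ᵐ y ∂ν₁, w y = -1)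
    {u : ι → ℝ × ℝ → ℝ} (hu : ∀ i, BM (u i)) {v : κ → ℝ × ℝ → ℝ} (hv : ∀ i, BM (v i)) :
    gramInc μ₀ μ₁ ν₀ ν₁ u v = gramForm (μ₀ + μ₁) (ν₀ + ν₁) w u v +
      2 * (∫ z, (gram μ₀ u z - gram μ₁ u z) * (gram μ₀ v z - gram μ₁ v z) ∂(ν₀.prod ν₀) +
        ∫ z, (gram μ₀ u z - gram μ₁ u z) * (gram μ₀ v z - gram μ₁ v z) ∂(ν₁.prod ν₁)) := by
  have a₀ := gram_bm μ₀ hu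
  have a₁ := gram_bm μ₁ hu
  have b₀ := gram_bm μ₀ hv
  have b₁ := gram_bm μ₁ hv
  have hAB : BM fun z => gram (μ₀ + μ₁) u z * gram (μ₀ + μ₁) v z :=
    (gram_bm _ hu).mul (gram_bm _ hv)
  have hww : BM fun z : ℝ × ℝ => w z.1 * w z.2 :=
    (hw.comp measurable_fst).mul (hw.comp measurable_snd)
  have one : ∀ (μ ν : Measure ℝ), gramForm μ ν 1 u v = ∫ z, gram μ u z * gram μ v z ∂(ν.prod ν) :=
    fun μ ν => by simp [gramForm]
  have par : ∀ (ν : Measure ℝ) [IsFiniteMeasure ν],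
      2 * (∫ z, gram μ₀ u z * gram μ₀ v z ∂(ν.prod ν) + ∫ z, gram μ₁ u z * gram μ₁ v z ∂(ν.prod ν)) =
      ∫ z, gram (μ₀ + μ₁) u z * gram (μ₀ + μ₁) v z ∂(ν.prod ν) +
      ∫ z, (gram μ₀ u z - gram μ₁ u z) * (gram μ₀ v z - gram μ₁ v z) ∂(ν.prod ν) := by
    intro ν _
    rw [← integral_add ((a₀.mul b₀).integrable _) ((a₁.mul b₁).integrable _), ← integral_const_mul,
      ← integral_add (hAB.integrable _) (((a₀.sub a₁).mul (b₀.sub b₁)).integrable _)]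
    refine integral_congr_ae (Eventually.of_forall fun z => ?_)
    simp only [gram_add μ₀ μ₁ hu, gram_add μ₀ μ₁ hv]
    ring
  rw [gramInc, gramForm.eq_1 (μ₀ + μ₁) (ν₀ + ν₁) w, one, one, one, one, one,
    integral_prod_add_self hAB, integral_prod_add_self (hww.mul hAB),
    integral_congr_prod h₀ h₀, integral_congr_prod h₀ h₁, integral_congr_prod h₁ h₀,
    integral_congr_prod h₁ h₁]
  linarith [par ν₀, par ν₁]

lemma gramForm_le_gramInc {μ₀ μ₁ ν₀ ν₁ : Measure ℝ} [IsFiniteMeasure μ₀] [IsFiniteMeasure μ₁]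
    [IsFiniteMeasure ν₀] [IsFiniteMeasure ν₁] {w : ℝ → ℝ} (hw : BM w)
    (h₀ : ∀ᵐ y ∂ν₀, w y = 1) (h₁ : ∀ᵐ y ∂ν₁, w y = -1)
    {u : ι → ℝ × ℝ → ℝ} (hu : ∀ i, BM (u i)) {v : κ → ℝ × ℝ → ℝ} (hv : ∀ i, BM (v i))
    {t : ℝ} (ht : 0 < t) :
    2 * gramForm (μ₀ + μ₁) (ν₀ + ν₁) w u v ≤ t * gramInc μ₀ μ₁ ν₀ ν₁ u u +
      2 * gramInc μ₀ μ₁ ν₀ ν₁ u v + t⁻¹ * gramInc μ₀ μ₁ ν₀ ν₁ v v := by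
  have a₀ := gram_bm μ₀ hu
  have a₁ := gram_bm μ₁ hu
  have b₀ := gram_bm μ₀ hv
  have b₁ := gram_bm μ₁ hv
  have sqn : ∀ (ν : Measure ℝ) [IsFiniteMeasure ν], 0 ≤
      t * ∫ z, (gram μ₀ u z - gram μ₁ u z) * (gram μ₀ u z - gram μ₁ u z) ∂(ν.prod ν) +
      2 * ∫ z, (gram μ₀ u z - gram μ₁ u z) * (gram μ₀ v z - gram μ₁ v z) ∂(ν.prod ν) +
      t⁻¹ * ∫ z, (gram μ₀ v z - gram μ₁ v z) * (gram μ₀ v z - gram μ₁ v z) ∂(ν.prod ν) := by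
    intro ν _
    have i1 := ((a₀.sub a₁).mul (a₀.sub a₁)).integrable (ν.prod ν)
    have i2 := ((a₀.sub a₁).mul (b₀.sub b₁)).integrable (ν.prod ν)
    have i3 := ((b₀.sub b₁).mul (b₀.sub b₁)).integrable (ν.prod ν)
    rw [← integral_const_mul, ← integral_const_mul, ← integral_const_mul,
      ← integral_add (i1.const_mul _) (i2.const_mul _), ← integral_add
      ((((BM.const t).mul ((a₀.sub a₁).mul (a₀.sub a₁))).add
        ((BM.const 2).mul ((a₀.sub a₁).mul (b₀.sub b₁)))).integrable _) (i3.const_mul _)]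
    refine integral_nonneg fun z => ?_
    simp only [Pi.zero_apply]
    set a := gram μ₀ u z - gram μ₁ u z
    set b := gram μ₀ v z - gram μ₁ v z
    have : t * (a * a) + 2 * (a * b) + t⁻¹ * (b * b) = t⁻¹ * (t * a + b) ^ 2 := by
      field_simp
      ring
    rw [this]
    positivity
  have p1 := mul_nonneg ht.le (gramForm_nonneg (μ₀ + μ₁) (ν₀ + ν₁) hw hu hu)
  have p2 := mul_nonneg (inv_pos.2 ht).le (gramForm_nonneg (μ₀ + μ₁) (ν₀ + ν₁) hw hv hv)
  rw [gramInc_eq hw h₀ h₁ hu hu, gramInc_eq hw h₀ h₁ hu hv, gramInc_eq hw h₀ h₁ hv hv]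
  linarith [sqn ν₀, sqn ν₁]

end Increment

/-! ### The dyadic telescoping estimate -/

section Scalar

lemma inv_cube_sub_mul_le {H H' X m : ℝ} (hH : 0 < H) (h1 : H ≤ H') (h2 : H' ≤ 2 * H)
    (hm : 0 ≤ m) (hX' : X ≤ m * H' ^ 4) : (1 / H ^ 3 - 1 / H' ^ 3) * X ≤ 14 * m * (H' - H) := by
  have hH' : 0 < H' := hH.trans_le h1
  have h3 : 0 ≤ 1 / H ^ 3 - 1 / H' ^ 3 := by
    rw [sub_nonneg]
    exact one_div_le_one_div_of_le (by positivity) (pow_le_pow_left₀ hH.le h1 3)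
  refine (mul_le_mul_of_nonneg_left hX' h3).trans ?_
  have : (1 / H ^ 3 - 1 / H' ^ 3) * (m * H' ^ 4) = m * ((H' - H) * (H' * (H' ^ 2 + H' * H + H ^ 2)
      / H ^ 3)) := by
    field_simp
    ring
  rw [this]
  have h4 : H' * (H' ^ 2 + H' * H + H ^ 2) / H ^ 3 ≤ 14 := by
    rw [div_le_iff₀ (by positivity)]
    calc _ ≤ (2 * H) * ((2 * H) ^ 2 + (2 * H) * H + H ^ 2) := by gcongr
      _ = _ := by ring
  calc _ ≤ m * ((H' - H) * 14) := by
        gcongr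
    _ = _ := by ring

lemma inv_sub_mul_le {P P' X m : ℝ} (hP : 0 < P) (h1 : P ≤ P') (h2 : P' ≤ 4 * P)
    (hm : 0 ≤ m) (hX' : X ≤ m * P' ^ 2) : (1 / P - 1 / P') * X ≤ 4 * m * (P' - P) := by
  have hP' : 0 < P' := hP.trans_le h1
  have h3 : 0 ≤ 1 / P - 1 / P' := by
    rw [sub_nonneg]
    exact one_div_le_one_div_of_le hP h1
  refine (mul_le_mul_of_nonneg_left hX' h3).trans ?_
  have : (1 / P - 1 / P') * (m * P' ^ 2) = m * ((P' - P) * (P' / P)) := by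
    field_simp
  rw [this]
  have h4 : P' / P ≤ 4 := by rwa [div_le_iff₀ hP]
  calc _ ≤ m * ((P' - P) * 4) := by
        gcongr
    _ = _ := by ring

lemma telescope_child {F G H F' G' H' m S V R X Y Z : ℝ} (hF : 0 < F) (hG : 0 < G) (hH : 0 < H)
    (hF1 : F ≤ F') (hF2 : F' ≤ 2 * F) (hG1 : G ≤ G') (hG2 : G' ≤ 2 * G) (hH1 : H ≤ H')
    (hH2 : H' ≤ 2 * H) (hm : 0 ≤ m) (hX : 0 ≤ X) (hY : 0 ≤ Y) (hZ : 0 ≤ Z) (hR : 0 ≤ R)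
    (hX' : X ≤ m * H' ^ 4) (hY' : Y ≤ m * (F' * H') ^ 2) (hZ' : Z ≤ m * F' ^ 4)
    (hR' : R ≤ m * G' ^ 2)
    (h : S + 1 / 4 * (G' * F' * (1 / H' ^ 3) * X + 2 * G' * (1 / (F' * H')) * Y +
      G' * H' * (1 / F' ^ 3) * Z) ≤ 1 / 2 * (F' * H' / G') * R + 11 * V - 10 * (m * (F' * G' * H'))) :
    S + 1 / 4 * (G * F * (1 / H ^ 3) * X + 2 * G * (1 / (F * H)) * Y +
      G * H * (1 / F ^ 3) * Z) ≤ 1 / 2 * (F * H / G) * R + 11 * V - 10 * (m * (F * G * H)) := by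
  have hF' : 0 < F' := hF.trans_le hF1
  have hG' : 0 < G' := hG.trans_le hG1
  have hH' : 0 < H' := hH.trans_le hH1
  have hP1 : F * H ≤ F' * H' := by gcongr
  have hP2 : F' * H' ≤ 4 * (F * H) := by
    calc F' * H' ≤ (2 * F) * (2 * H) := by gcongr
      _ = _ := by ring
  have e1 := inv_cube_sub_mul_le hH hH1 hH2 hm hX'
  have e2 := inv_sub_mul_le (by positivity : 0 < F * H) hP1 hP2 hm hY'
  have e3 := inv_cube_sub_mul_le hF hF1 hF2 hm hZ'
  have d1 : G * F * (H' - H) ≤ F' * G' * H' - F * G * H := by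
    have : G * F * H' ≤ G' * F' * H' := by gcongr
    linarith
  have d2 : G * (F' * H' - F * H) ≤ F' * G' * H' - F * G * H := by
    have : G * (F' * H') ≤ G' * (F' * H') := by gcongr
    linarith
  have d3 : G * H * (F' - F) ≤ F' * G' * H' - F * G * H := by
    have : G * H * F' ≤ G' * H' * F' := by gcongr
    linarith
  have t1 : G * F * (1 / H ^ 3) * X ≤ G' * F' * (1 / H' ^ 3) * X +
      14 * m * (F' * G' * H' - F * G * H) := by
    have a1 : G * F * (1 / H' ^ 3) * X ≤ G' * F' * (1 / H' ^ 3) * X := by gcongr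
    have a2 := mul_le_mul_of_nonneg_left e1 (by positivity : 0 ≤ G * F)
    have a3 := mul_le_mul_of_nonneg_left d1 (by positivity : 0 ≤ 14 * m)
    linarith
  have t2 : 2 * G * (1 / (F * H)) * Y ≤ 2 * G' * (1 / (F' * H')) * Y +
      8 * m * (F' * G' * H' - F * G * H) := by
    have a1 : 2 * G * (1 / (F' * H')) * Y ≤ 2 * G' * (1 / (F' * H')) * Y := by gcongr
    have a2 := mul_le_mul_of_nonneg_left e2 (by positivity : 0 ≤ 2 * G)
    have a3 := mul_le_mul_of_nonneg_left d2 (by positivity : 0 ≤ 8 * m)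
    linarith
  have t3 : G * H * (1 / F ^ 3) * Z ≤ G' * H' * (1 / F' ^ 3) * Z +
      14 * m * (F' * G' * H' - F * G * H) := by
    have a1 : G * H * (1 / F' ^ 3) * Z ≤ G' * H' * (1 / F' ^ 3) * Z := by gcongr
    have a2 := mul_le_mul_of_nonneg_left e3 (by positivity : 0 ≤ G * H)
    have a3 := mul_le_mul_of_nonneg_left d3 (by positivity : 0 ≤ 14 * m)
    linarith
  have t4 : F' * H' / G' * R ≤ F * H / G * R + 2 * m * (F' * G' * H' - F * G * H) := by
    have a1 : F * H / G' * R ≤ F * H / G * R := by gcongr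
    have a2 : (F' * H' - F * H) / G' * R ≤ (F' * H' - F * H) / G' * (m * G' ^ 2) :=
      mul_le_mul_of_nonneg_left hR' (div_nonneg (by linarith) hG'.le)
    have a3 : (F' * H' - F * H) / G' * (m * G' ^ 2) = m * ((F' * H' - F * H) * G') := by
      field_simp
    have a4 : m * ((F' * H' - F * H) * G') ≤ m * ((F' * H' - F * H) * (2 * G)) := by
      gcongr
    have a5 := mul_le_mul_of_nonneg_left d2 (by positivity : 0 ≤ 2 * m)
    have a6 : F' * H' / G' * R = F * H / G' * R + (F' * H' - F * H) / G' * R := by ring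
    linarith
  linarith

end Scalar

/-- Lebesgue measure on `(a, a + ℓ]`. -/
def IM (a ℓ : ℝ) : Measure ℝ := volume.restrict (Set.Ioc a (a + ℓ))

instance (a ℓ : ℝ) : IsFiniteMeasure (IM a ℓ) := by
  unfold IM
  infer_instance

lemma IM_real_univ (a : ℝ) {ℓ : ℝ} (hℓ : 0 ≤ ℓ) : (IM a ℓ).real Set.univ = ℓ := by
  simp [IM, Measure.real, hℓ]

lemma IM_split (a : ℝ) {ℓ : ℝ} (hℓ : 0 ≤ ℓ) : IM a ℓ = IM a (ℓ / 2) + IM (a + ℓ / 2) (ℓ / 2) := by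
  have h : Set.Ioc a (a + ℓ) = Set.Ioc a (a + ℓ / 2) ∪ Set.Ioc (a + ℓ / 2) (a + ℓ / 2 + ℓ / 2) := by
    rw [Set.Ioc_union_Ioc_eq_Ioc (by linarith) (by linarith)]
    congr 1
    ring
  rw [IM, h, Measure.restrict_union _ measurableSet_Ioc]
  · rfl
  · exact Set.Ioc_disjoint_Ioc_of_le le_rfl

/-- Square with lower left corner `(a, b)` and side `ℓ`. -/
def Sq (a b ℓ : ℝ) : Set (ℝ × ℝ) := Set.Ioc a (a + ℓ) ×ˢ Set.Ioc b (b + ℓ)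

/-- Integral over a square. -/
def sqInt (a b ℓ : ℝ) (u : ℝ × ℝ → ℝ) : ℝ := ∫ z, u z ∂((IM a ℓ).prod (IM b ℓ))

lemma sqInt_eq_setIntegral (a b ℓ : ℝ) (u : ℝ × ℝ → ℝ) : sqInt a b ℓ u = ∫ z in Sq a b ℓ, u z := by
  rw [sqInt, IM, IM, Measure.prod_restrict, Sq, Measure.volume_eq_prod]

lemma sqInt_split (a b : ℝ) {ℓ : ℝ} (hℓ : 0 ≤ ℓ) {u : ℝ × ℝ → ℝ} (hu : BM u) :
    sqInt a b ℓ u = sqInt a b (ℓ / 2) u + sqInt (a + ℓ / 2) b (ℓ / 2) u +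
      sqInt a (b + ℓ / 2) (ℓ / 2) u + sqInt (a + ℓ / 2) (b + ℓ / 2) (ℓ / 2) u := by
  rw [sqInt, IM_split a hℓ, IM_split b hℓ, Measure.prod_add, Measure.add_prod, Measure.add_prod,
    integral_add_measure (hu.integrable _) (hu.integrable _), integral_add_measure
    (hu.integrable _) (hu.integrable _), integral_add_measure
    (hu.integrable _) (hu.integrable _)]
  simp only [sqInt]
  ring

lemma sqInt_nonneg (a b ℓ : ℝ) {u : ℝ × ℝ → ℝ} (hu : ∀ z, 0 ≤ u z) : 0 ≤ sqInt a b ℓ u :=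
  integral_nonneg hu

lemma sqInt_mono (a b ℓ : ℝ) {u v : ℝ × ℝ → ℝ} (hu : BM u) (hv : BM v) (h : ∀ z, u z ≤ v z) :
    sqInt a b ℓ u ≤ sqInt a b ℓ v := integral_mono (hu.integrable _) (hv.integrable _) h

lemma sqInt_const (a b : ℝ) {ℓ : ℝ} (hℓ : 0 ≤ ℓ) (c : ℝ) : sqInt a b ℓ (fun _ => c) = ℓ ^ 2 * c := by
  rw [sqInt, integral_const, ← Set.univ_prod_univ, measureReal_prod_prod, IM_real_univ a hℓ,
    IM_real_univ b hℓ, smul_eq_mul]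
  ring

/-- The sign function of an interval: `+1` on the left half and `-1` on the right half. -/
def sg (b ℓ y : ℝ) : ℝ := if y ≤ b + ℓ / 2 then 1 else -1

lemma sg_bm (b ℓ : ℝ) : BM (sg b ℓ) := by
  refine ⟨Measurable.ite measurableSet_Iic measurable_const measurable_const, 1, fun y => ?_⟩
  unfold sg
  split_ifs <;> simp

lemma sg_sq (b ℓ y : ℝ) : sg b ℓ y ^ 2 = 1 := by
  unfold sg
  split_ifs <;> simp

section Telescope

variable {ι : Type*} [Fintype ι]

/-- Localised trilinear form on a square, with absolute values inside. -/
def locForm (a b ℓ : ℝ) (f : ℝ × ℝ → ℝ) (h g : ι → ℝ × ℝ → ℝ) : ℝ :=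
  (ℓ ^ 2)⁻¹ * ∫ x, |∑ i, (∫ y, sg b ℓ y * g i (x.1, y) ∂(IM b ℓ)) *
    ∫ y, sg b ℓ y * (h i (x.1, y) * f (x.2, y)) ∂(IM b ℓ)| ∂((IM a ℓ).prod (IM a ℓ))

/-- Sum of `locForm` over `n` dyadic generations below a square, with the `j`-th function in
generation `j`. -/
def genSum (f : ℝ × ℝ → ℝ) (h : ι → ℝ × ℝ → ℝ) : ℕ → ℝ → ℝ → ℝ → (ℕ → ι → ℝ × ℝ → ℝ) → ℝ
  | 0, _, _, _, _ => 0
  | n + 1, a, b, ℓ, g => locForm a b ℓ f h (g 0) +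
      (genSum f h n a b (ℓ / 2) (fun j => g (j + 1)) +
        genSum f h n (a + ℓ / 2) b (ℓ / 2) (fun j => g (j + 1)) +
        genSum f h n a (b + ℓ / 2) (ℓ / 2) (fun j => g (j + 1)) +
        genSum f h n (a + ℓ / 2) (b + ℓ / 2) (ℓ / 2) (fun j => g (j + 1)))

/-- Normalised Gram form of a square. -/
def nGram {κ κ' : Type*} [Fintype κ] [Fintype κ'] (a b ℓ : ℝ) (u : κ → ℝ × ℝ → ℝ)
    (v : κ' → ℝ × ℝ → ℝ) : ℝ := (ℓ ^ 2)⁻¹ * gramForm (IM a ℓ) (IM b ℓ) 1 u v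

lemma nGram_nonneg {κ κ' : Type*} [Fintype κ] [Fintype κ'] (a b ℓ : ℝ) {u : κ → ℝ × ℝ → ℝ}
    {v : κ' → ℝ × ℝ → ℝ} (hu : ∀ i, BM (u i)) (hv : ∀ i, BM (v i)) : 0 ≤ nGram a b ℓ u v :=
  mul_nonneg (by positivity) (gramForm_nonneg _ _ (by exact BM.const 1) hu hv)

lemma nGram_le {κ κ' : Type*} [Fintype κ] [Fintype κ'] (a b : ℝ) {ℓ : ℝ} (hℓ : 0 < ℓ)
    {u : κ → ℝ × ℝ → ℝ} {v : κ' → ℝ × ℝ → ℝ} (hu : ∀ i, BM (u i)) (hv : ∀ i, BM (v i)) {A B : ℝ}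
    (hA : sqInt a b ℓ (fun z => ∑ i, u i z ^ 2) ≤ ℓ ^ 2 * A)
    (hB : sqInt a b ℓ (fun z => ∑ i, v i z ^ 2) ≤ ℓ ^ 2 * B) :
    nGram a b ℓ u v ≤ ℓ ^ 2 * (A * B) := by
  rw [nGram, inv_mul_le_iff₀ (by positivity)]
  refine (gramForm_one_le _ _ hu hv).trans ((mul_le_mul hA hB (sqInt_nonneg _ _ _ fun z =>
    Finset.sum_nonneg fun i _ => sq_nonneg _) ((sqInt_nonneg _ _ _ fun z =>
    Finset.sum_nonneg fun i _ => sq_nonneg _).trans hA)).trans (le_of_eq ?_))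
  ring

lemma locForm_le (a b : ℝ) {ℓ : ℝ} (hℓ : 0 < ℓ) {f : ℝ × ℝ → ℝ} {h g : ι → ℝ × ℝ → ℝ} (hf : BM f)
    (hh : ∀ i, BM (h i)) (hg : ∀ i, BM (g i)) {s : ℝ} (hs : 0 < s) :
    locForm a b ℓ f h g ≤ 1 / 2 * (s * sqInt a b ℓ (fun z => ∑ i, g i z ^ 2) +
      s⁻¹ * ((ℓ ^ 2)⁻¹ * gramForm (IM a ℓ) (IM b ℓ) (sg b ℓ) h (fun _ : Unit => f))) := by
  have hγ : ∀ i, BM fun x : ℝ × ℝ => ∫ y, sg b ℓ y * g i (x.1, y) ∂(IM b ℓ) := fun i =>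
    BM.integral_right (w := fun q : (ℝ × ℝ) × ℝ => sg b ℓ q.2 * g i (q.1.1, q.2))
      (((sg_bm b ℓ).comp (by fun_prop)).mul ((hg i).comp (by fun_prop))) _
  have hω : ∀ i, BM fun x : ℝ × ℝ => ∫ y, sg b ℓ y * (h i (x.1, y) * f (x.2, y)) ∂(IM b ℓ) :=
    fun i => BM.integral_right
      (w := fun q : (ℝ × ℝ) × ℝ => sg b ℓ q.2 * (h i (q.1.1, q.2) * f (q.1.2, q.2)))
      (((sg_bm b ℓ).comp (by fun_prop)).mul
        (((hh i).comp (by fun_prop)).mul (hf.comp (by fun_prop)))) _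
  have pt : ∀ x : ℝ × ℝ, |∑ i, (∫ y, sg b ℓ y * g i (x.1, y) ∂(IM b ℓ)) *
      ∫ y, sg b ℓ y * (h i (x.1, y) * f (x.2, y)) ∂(IM b ℓ)| ≤
      ∑ i, (s / 2 * (∫ y, sg b ℓ y * g i (x.1, y) ∂(IM b ℓ)) ^ 2 +
        s⁻¹ / 2 * (∫ y, sg b ℓ y * (h i (x.1, y) * f (x.2, y)) ∂(IM b ℓ)) ^ 2) := by
    intro x
    refine (Finset.abs_sum_le_sum_abs _ _).trans (Finset.sum_le_sum fun i _ => ?_)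
    set p := ∫ y, sg b ℓ y * g i (x.1, y) ∂(IM b ℓ)
    set q := ∫ y, sg b ℓ y * (h i (x.1, y) * f (x.2, y)) ∂(IM b ℓ)
    have : s / 2 * p ^ 2 + s⁻¹ / 2 * q ^ 2 - |p * q| = s⁻¹ / 2 * (s * |p| - |q|) ^ 2 := by
      rw [abs_mul, ← sq_abs p, ← sq_abs q]
      field_simp
      ring
    have h2 : 0 ≤ s⁻¹ / 2 * (s * |p| - |q|) ^ 2 := by positivity
    linarith
  have hsum : (∫ x, |∑ i, (∫ y, sg b ℓ y * g i (x.1, y) ∂(IM b ℓ)) *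
      ∫ y, sg b ℓ y * (h i (x.1, y) * f (x.2, y)) ∂(IM b ℓ)| ∂((IM a ℓ).prod (IM a ℓ))) ≤
      s / 2 * ∑ i, ∫ x : ℝ × ℝ, (∫ y, sg b ℓ y * g i (x.1, y) ∂(IM b ℓ)) ^ 2
        ∂((IM a ℓ).prod (IM a ℓ)) +
      s⁻¹ / 2 * gramForm (IM a ℓ) (IM b ℓ) (sg b ℓ) h (fun _ : Unit => f) := by
    rw [gramForm_eq _ _ (sg_bm b ℓ) hh (fun _ => hf), Finset.mul_sum, Finset.mul_sum,
      ← Finset.sum_add_distrib]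
    refine (integral_mono ((BM.sum Finset.univ fun i => (hγ i).mul (hω i)).abs.integrable _)
      ((BM.sum Finset.univ fun i => ((BM.const (s / 2)).mul ((hγ i).pow 2)).add
        ((BM.const (s⁻¹ / 2)).mul ((hω i).pow 2))).integrable _) pt).trans (le_of_eq ?_)
    rw [integral_finsetSum _ fun i _ => (((BM.const (s / 2)).mul ((hγ i).pow 2)).add
        ((BM.const (s⁻¹ / 2)).mul ((hω i).pow 2))).integrable _]
    refine Finset.sum_congr rfl fun i _ => ?_
    rw [integral_add (((hγ i).pow 2).integrable _ |>.const_mul _)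
      (((hω i).pow 2).integrable _ |>.const_mul _), integral_const_mul, integral_const_mul]
    simp
  have hgi : ∑ i, ∫ x : ℝ × ℝ, (∫ y, sg b ℓ y * g i (x.1, y) ∂(IM b ℓ)) ^ 2
        ∂((IM a ℓ).prod (IM a ℓ)) ≤ ℓ ^ 2 * sqInt a b ℓ (fun z => ∑ i, g i z ^ 2) := by
    rw [sqInt, integral_finsetSum _ fun i _ => ((hg i).pow 2).integrable _, Finset.mul_sum]
    refine Finset.sum_le_sum fun i _ => ?_
    rw [integral_prod _ (((hγ i).pow 2).integrable _), integral_prod _ (((hg i).pow 2).integrable _),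
      ← integral_const_mul]
    have h1 : BM fun x : ℝ => ∫ y, g i (x, y) ^ 2 ∂(IM b ℓ) := ((hg i).pow 2).integral_right _
    refine integral_mono_of_nonneg (Eventually.of_forall fun x => integral_nonneg fun _ =>
      sq_nonneg _) (((BM.const _).mul h1).integrable _) (Eventually.of_forall fun x => ?_)
    simp only [integral_const, IM_real_univ a hℓ.le, smul_eq_mul]
    have := integral_mul_sq_le (IM b ℓ) (sg_bm b ℓ) ((hg i).comp (by fun_prop : Measurable
      fun y : ℝ => (x, y)))
    simp only [sg_sq, integral_const, IM_real_univ b hℓ.le, smul_eq_mul, mul_one] at this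
    calc _ ≤ ℓ * (ℓ * ∫ y, g i (x, y) ^ 2 ∂(IM b ℓ)) := mul_le_mul_of_nonneg_left this hℓ.le
      _ = _ := by ring
  rw [locForm, inv_mul_le_iff₀ (by positivity)]
  refine hsum.trans ?_
  have := mul_le_mul_of_nonneg_left hgi (by positivity : 0 ≤ s / 2)
  refine (add_le_add_left this _).trans (le_of_eq ?_)
  field_simp

end Telescope

section TelescopeMain

variable {ι : Type*} [Fintype ι]

/-- `M` dominates all root mean squares of `u` (given through `u = |·|²`). -/
def DomSq (u M : ℝ × ℝ → ℝ) : Prop :=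
  ∀ a b ℓ, 0 < ℓ → ∀ z ∈ Sq a b ℓ, 0 ≤ M z ∧ sqInt a b ℓ u ≤ ℓ ^ 2 * M z ^ 2

lemma nGram_inc {κ κ' : Type*} [Fintype κ] [Fintype κ'] (a b : ℝ) {ℓ : ℝ} (hℓ : 0 < ℓ)
    (u : κ → ℝ × ℝ → ℝ) (v : κ' → ℝ × ℝ → ℝ) :
    (ℓ ^ 2)⁻¹ * gramInc (IM a (ℓ / 2)) (IM (a + ℓ / 2) (ℓ / 2)) (IM b (ℓ / 2))
      (IM (b + ℓ / 2) (ℓ / 2)) u v = nGram a b (ℓ / 2) u v + nGram (a + ℓ / 2) b (ℓ / 2) u v +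
      nGram a (b + ℓ / 2) (ℓ / 2) u v + nGram (a + ℓ / 2) (b + ℓ / 2) (ℓ / 2) u v -
        nGram a b ℓ u v := by
  rw [gramInc, ← IM_split a hℓ.le, ← IM_split b hℓ.le]
  simp only [nGram]
  field_simp
  ring

lemma locForm_le_inc (a b : ℝ) {ℓ : ℝ} (hℓ : 0 < ℓ) {f : ℝ × ℝ → ℝ} {h g : ι → ℝ × ℝ → ℝ}
    (hf : BM f) (hh : ∀ i, BM (h i)) (hg : ∀ i, BM (g i)) {F G H : ℝ} (hF : 0 < F) (hG : 0 < G)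
    (hH : 0 < H) :
    locForm a b ℓ f h g ≤ 1 / 2 * (F * H / G) * sqInt a b ℓ (fun z => ∑ i, g i z ^ 2) +
      1 / 4 * (G * F * (1 / H ^ 3) * (nGram a b (ℓ / 2) h h + nGram (a + ℓ / 2) b (ℓ / 2) h h +
        nGram a (b + ℓ / 2) (ℓ / 2) h h + nGram (a + ℓ / 2) (b + ℓ / 2) (ℓ / 2) h h -
        nGram a b ℓ h h) + 2 * G * (1 / (F * H)) * (nGram a b (ℓ / 2) h (fun _ : Unit => f) +
        nGram (a + ℓ / 2) b (ℓ / 2) h (fun _ : Unit => f) +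
        nGram a (b + ℓ / 2) (ℓ / 2) h (fun _ : Unit => f) +
        nGram (a + ℓ / 2) (b + ℓ / 2) (ℓ / 2) h (fun _ : Unit => f) -
        nGram a b ℓ h (fun _ : Unit => f)) + G * H * (1 / F ^ 3) *
        (nGram a b (ℓ / 2) (fun _ : Unit => f) (fun _ : Unit => f) +
        nGram (a + ℓ / 2) b (ℓ / 2) (fun _ : Unit => f) (fun _ : Unit => f) +
        nGram a (b + ℓ / 2) (ℓ / 2) (fun _ : Unit => f) (fun _ : Unit => f) +
        nGram (a + ℓ / 2) (b + ℓ / 2) (ℓ / 2) (fun _ : Unit => f) (fun _ : Unit => f) -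
        nGram a b ℓ (fun _ : Unit => f) (fun _ : Unit => f))) := by
  have h1 := locForm_le a b hℓ hf hh hg (s := F * H / G) (by positivity)
  have h0 : ∀ᵐ y ∂(IM b (ℓ / 2)), sg b ℓ y = 1 := by
    refine (ae_restrict_iff' measurableSet_Ioc).2 (Eventually.of_forall fun y hy => ?_)
    rw [sg, if_pos hy.2]
  have h0' : ∀ᵐ y ∂(IM (b + ℓ / 2) (ℓ / 2)), sg b ℓ y = -1 := by
    refine (ae_restrict_iff' measurableSet_Ioc).2 (Eventually.of_forall fun y hy => ?_)
    rw [sg, if_neg (not_le.2 hy.1)]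
  have h2 := gramForm_le_gramInc (μ₀ := IM a (ℓ / 2)) (μ₁ := IM (a + ℓ / 2) (ℓ / 2)) (sg_bm b ℓ) h0
    h0' hh (v := fun _ : Unit => f) (fun _ => hf) (t := F ^ 2 / H ^ 2) (by positivity)
  rw [← IM_split a hℓ.le, ← IM_split b hℓ.le] at h2
  have h3 := mul_le_mul_of_nonneg_left h2 (by positivity : 0 ≤ 1 / 4 * (F * H / G)⁻¹ * (ℓ ^ 2)⁻¹)
  rw [← nGram_inc a b hℓ h h, ← nGram_inc a b hℓ h (fun _ : Unit => f),
    ← nGram_inc a b hℓ (fun _ : Unit => f) (fun _ : Unit => f)]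
  set I1 := gramInc (IM a (ℓ / 2)) (IM (a + ℓ / 2) (ℓ / 2)) (IM b (ℓ / 2))
      (IM (b + ℓ / 2) (ℓ / 2)) h h
  set I2 := gramInc (IM a (ℓ / 2)) (IM (a + ℓ / 2) (ℓ / 2)) (IM b (ℓ / 2))
      (IM (b + ℓ / 2) (ℓ / 2)) h (fun _ : Unit => f)
  set I3 := gramInc (IM a (ℓ / 2)) (IM (a + ℓ / 2) (ℓ / 2)) (IM b (ℓ / 2))
      (IM (b + ℓ / 2) (ℓ / 2)) (fun _ : Unit => f) (fun _ : Unit => f)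
  refine h1.trans (le_trans (le_of_eq ?_) ((add_le_add_right h3
    (1 / 2 * (F * H / G) * sqInt a b ℓ (fun z => ∑ i, g i z ^ 2))).trans (le_of_eq ?_)))
  · ring
  · congr 1
    field_simp

lemma Sq_children {a b ℓ : ℝ} (hℓ : 0 < ℓ) {a' b' : ℝ} (ha : a' = a ∨ a' = a + ℓ / 2)
    (hb : b' = b ∨ b' = b + ℓ / 2) : Sq a' b' (ℓ / 2) ⊆ Sq a b ℓ := by
  rintro ⟨x, y⟩ ⟨⟨hx1, hx2⟩, hy1, hy2⟩
  simp only at hx1 hx2 hy1 hy2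
  refine ⟨⟨?_, ?_⟩, ?_, ?_⟩ <;> simp only <;> rcases ha with rfl | rfl <;>
    rcases hb with rfl | rfl <;> linarith

lemma sqInt_child_le {a b ℓ : ℝ} (hℓ : 0 < ℓ) {a' b' : ℝ} (ha : a' = a ∨ a' = a + ℓ / 2)
    (hb : b' = b ∨ b' = b + ℓ / 2) {u : ℝ × ℝ → ℝ} (hu : BM u) (h0 : ∀ z, 0 ≤ u z) :
    sqInt a' b' (ℓ / 2) u ≤ sqInt a b ℓ u := by
  rw [sqInt_split a b hℓ.le hu]
  have := sqInt_nonneg a b (ℓ / 2) h0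
  have := sqInt_nonneg (a + ℓ / 2) b (ℓ / 2) h0
  have := sqInt_nonneg a (b + ℓ / 2) (ℓ / 2) h0
  have := sqInt_nonneg (a + ℓ / 2) (b + ℓ / 2) (ℓ / 2) h0
  rcases ha with rfl | rfl <;> rcases hb with rfl | rfl <;> linarith

/-- Running maximum of root mean squares when passing from a square to a child. -/
lemma exists_child_size {a b ℓ : ℝ} (hℓ : 0 < ℓ) {a' b' : ℝ} (ha : a' = a ∨ a' = a + ℓ / 2)
    (hb : b' = b ∨ b' = b + ℓ / 2) {u M : ℝ × ℝ → ℝ} (hu : BM u) (h0 : ∀ z, 0 ≤ u z)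
    (hM : DomSq u M) {F : ℝ} (hF : 0 < F) (hFQ : sqInt a b ℓ u ≤ ℓ ^ 2 * F ^ 2)
    (hFM : ∀ z ∈ Sq a b ℓ, F ≤ M z) :
    ∃ F', F ≤ F' ∧ F' ≤ 2 * F ∧ sqInt a' b' (ℓ / 2) u ≤ (ℓ / 2) ^ 2 * F' ^ 2 ∧
      ∀ z ∈ Sq a' b' (ℓ / 2), F' ≤ M z := by
  have hs := sqInt_nonneg a' b' (ℓ / 2) h0
  have hc := (sqInt_child_le hℓ ha hb hu h0).trans hFQ
  have hv : 0 ≤ sqInt a' b' (ℓ / 2) u / (ℓ / 2) ^ 2 := by positivity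
  refine ⟨max F (Real.sqrt (sqInt a' b' (ℓ / 2) u / (ℓ / 2) ^ 2)), le_max_left _ _, ?_, ?_, ?_⟩
  · refine max_le (by linarith) (Real.sqrt_le_iff.2 ⟨by positivity, ?_⟩)
    rw [div_le_iff₀ (by positivity)]
    linarith
  · rw [mul_comm, ← div_le_iff₀ (by positivity)]
    calc _ = Real.sqrt (sqInt a' b' (ℓ / 2) u / (ℓ / 2) ^ 2) ^ 2 := (Real.sq_sqrt hv).symm
      _ ≤ _ := pow_le_pow_left₀ (Real.sqrt_nonneg _) (le_max_right _ _) 2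
  · intro z hz
    obtain ⟨h1, h2⟩ := hM a' b' (ℓ / 2) (by positivity) z hz
    refine max_le (hFM z (Sq_children hℓ ha hb hz)) (Real.sqrt_le_iff.2 ⟨h1, ?_⟩)
    rwa [div_le_iff₀ (by positivity), mul_comm]

lemma sum_sq_bm {κ : Type*} (s : Finset κ) {u : κ → ℝ × ℝ → ℝ} (hu : ∀ i, BM (u i)) :
    BM fun z => ∑ i ∈ s, u i z ^ 2 := BM.sum s fun i => (hu i).pow 2

lemma genSum_le_aux {f : ℝ × ℝ → ℝ} {h : ι → ℝ × ℝ → ℝ} (hf : BM f) (hh : ∀ i, BM (h i))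
    {Mf Mg Mh ug : ℝ × ℝ → ℝ} (hMf : BM Mf) (hMg : BM Mg) (hMh : BM Mh) (hug : BM ug)
    (hug0 : ∀ z, 0 ≤ ug z)
    (hdf : DomSq (fun z => f z ^ 2) Mf) (hdg : DomSq ug Mg) (hdh : DomSq (fun z => ∑ i, h i z ^ 2) Mh)
    (n : ℕ) : ∀ (a b ℓ : ℝ) (g : ℕ → ι → ℝ × ℝ → ℝ) (F G H : ℝ), 0 < ℓ → 0 < F → 0 < G → 0 < H →
    (∀ j i, BM (g j i)) → (∀ z, ∑ j ∈ Finset.range n, ∑ i, g j i z ^ 2 ≤ ug z) →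
    sqInt a b ℓ (fun z => f z ^ 2) ≤ ℓ ^ 2 * F ^ 2 → sqInt a b ℓ ug ≤ ℓ ^ 2 * G ^ 2 →
    sqInt a b ℓ (fun z => ∑ i, h i z ^ 2) ≤ ℓ ^ 2 * H ^ 2 →
    (∀ z ∈ Sq a b ℓ, F ≤ Mf z) → (∀ z ∈ Sq a b ℓ, G ≤ Mg z) → (∀ z ∈ Sq a b ℓ, H ≤ Mh z) →
    genSum f h n a b ℓ g + 1 / 4 * (G * F * (1 / H ^ 3) * nGram a b ℓ h h +
      2 * G * (1 / (F * H)) * nGram a b ℓ h (fun _ : Unit => f) +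
      G * H * (1 / F ^ 3) * nGram a b ℓ (fun _ : Unit => f) (fun _ : Unit => f)) ≤
    1 / 2 * (F * H / G) * sqInt a b ℓ (fun z => ∑ j ∈ Finset.range n, ∑ i, g j i z ^ 2) +
      11 * sqInt a b ℓ (fun z => Mf z * Mg z * Mh z) - 10 * (ℓ ^ 2 * (F * G * H)) := by
  have hf2 : BM fun z => f z ^ 2 := hf.pow 2
  have hh2 : BM fun z => ∑ i, h i z ^ 2 := sum_sq_bm _ hh
  have hV : BM fun z => Mf z * Mg z * Mh z := (hMf.mul hMg).mul hMh
  have hf' : ∀ _ : Unit, BM f := fun _ => hf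
  have bounds : ∀ {a b ℓ F H : ℝ}, 0 < ℓ → sqInt a b ℓ (fun z => f z ^ 2) ≤ ℓ ^ 2 * F ^ 2 →
      sqInt a b ℓ (fun z => ∑ i, h i z ^ 2) ≤ ℓ ^ 2 * H ^ 2 →
      nGram a b ℓ h h ≤ ℓ ^ 2 * H ^ 4 ∧ nGram a b ℓ h (fun _ : Unit => f) ≤ ℓ ^ 2 * (F * H) ^ 2 ∧
      nGram a b ℓ (fun _ : Unit => f) (fun _ : Unit => f) ≤ ℓ ^ 2 * F ^ 4 := by
    intro a b ℓ F H hℓ h1 h2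
    have h1' : sqInt a b ℓ (fun z => ∑ _i : Unit, f z ^ 2) ≤ ℓ ^ 2 * F ^ 2 := by simpa using h1
    refine ⟨(nGram_le a b hℓ hh hh h2 h2).trans (le_of_eq (by ring)),
      (nGram_le a b hℓ hh hf' h2 h1').trans (le_of_eq (by ring)),
      (nGram_le a b hℓ hf' hf' h1' h1').trans (le_of_eq (by ring))⟩
  induction n with
  | zero =>
    intro a b ℓ g F G H hℓ hF hG hH hg hgu hFQ hGQ hHQ hFM hGM hHM
    obtain ⟨b1, b2, b3⟩ := bounds hℓ hFQ hHQ
    have hVQ : ℓ ^ 2 * (F * G * H) ≤ sqInt a b ℓ (fun z => Mf z * Mg z * Mh z) := by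
      rw [← sqInt_const a b hℓ.le, sqInt_eq_setIntegral, sqInt_eq_setIntegral]
      have hfin : IsFiniteMeasure (volume.restrict (Sq a b ℓ)) := by
        rw [Sq, Measure.volume_eq_prod, ← Measure.prod_restrict]
        exact inferInstanceAs (IsFiniteMeasure ((IM a ℓ).prod (IM b ℓ)))
      refine setIntegral_mono_on (integrable_const _) (hV.integrable _)
        (measurableSet_Ioc.prod measurableSet_Ioc) fun z hz => ?_
      have := hFM z hz
      have := hGM z hz
      have := hHM z hz
      have : 0 ≤ Mf z := by linarith
      have : 0 ≤ Mf z * Mg z := mul_nonneg this (by linarith)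
      gcongr
    have c1 := mul_le_mul_of_nonneg_left b1 (by positivity : 0 ≤ G * F * (1 / H ^ 3))
    have c2 := mul_le_mul_of_nonneg_left b2 (by positivity : 0 ≤ 2 * G * (1 / (F * H)))
    have c3 := mul_le_mul_of_nonneg_left b3 (by positivity : 0 ≤ G * H * (1 / F ^ 3))
    have d1 : G * F * (1 / H ^ 3) * (ℓ ^ 2 * H ^ 4) = ℓ ^ 2 * (F * G * H) := by field_simp
    have d2 : 2 * G * (1 / (F * H)) * (ℓ ^ 2 * (F * H) ^ 2) = 2 * (ℓ ^ 2 * (F * G * H)) := by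
      field_simp
    have d3 : G * H * (1 / F ^ 3) * (ℓ ^ 2 * F ^ 4) = ℓ ^ 2 * (F * G * H) := by field_simp
    simp only [genSum, Finset.range_zero, Finset.sum_empty, sqInt_const a b hℓ.le]
    linarith
  | succ n ih =>
    intro a b ℓ g F G H hℓ hF hG hH hg hgu hFQ hGQ hHQ hFM hGM hHM
    have hl2 : 0 < ℓ / 2 := by positivity
    have child : ∀ {a' b' : ℝ}, (a' = a ∨ a' = a + ℓ / 2) → (b' = b ∨ b' = b + ℓ / 2) →
        genSum f h n a' b' (ℓ / 2) (fun j => g (j + 1)) +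
        1 / 4 * (G * F * (1 / H ^ 3) * nGram a' b' (ℓ / 2) h h +
          2 * G * (1 / (F * H)) * nGram a' b' (ℓ / 2) h (fun _ : Unit => f) +
          G * H * (1 / F ^ 3) * nGram a' b' (ℓ / 2) (fun _ : Unit => f) (fun _ : Unit => f)) ≤
        1 / 2 * (F * H / G) *
          sqInt a' b' (ℓ / 2) (fun z => ∑ j ∈ Finset.range n, ∑ i, g (j + 1) i z ^ 2) +
          11 * sqInt a' b' (ℓ / 2) (fun z => Mf z * Mg z * Mh z) -
          10 * ((ℓ / 2) ^ 2 * (F * G * H)) := by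
      intro a' b' ha hb
      obtain ⟨F', hF1, hF2, hF3, hF4⟩ := exists_child_size hℓ ha hb hf2 (fun _ => sq_nonneg _) hdf
        hF hFQ hFM
      obtain ⟨G', hG1, hG2, hG3, hG4⟩ := exists_child_size hℓ ha hb hug hug0 hdg hG hGQ hGM
      obtain ⟨H', hH1, hH2, hH3, hH4⟩ := exists_child_size hℓ ha hb hh2
        (fun _ => Finset.sum_nonneg fun _ _ => sq_nonneg _) hdh hH hHQ hHM
      have hgu' : ∀ z, ∑ j ∈ Finset.range n, ∑ i, g (j + 1) i z ^ 2 ≤ ug z := fun z => by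
        refine le_trans ?_ (hgu z)
        rw [Finset.sum_range_succ']
        exact le_add_of_nonneg_right (Finset.sum_nonneg fun _ _ => sq_nonneg _)
      have hgb : BM fun z => ∑ j ∈ Finset.range n, ∑ i, g (j + 1) i z ^ 2 :=
        BM.sum _ fun j => sum_sq_bm _ (hg (j + 1))
      obtain ⟨b1, b2, b3⟩ := bounds hl2 hF3 hH3
      exact telescope_child hF hG hH hF1 hF2 hG1 hG2 hH1 hH2 (by positivity)
        (nGram_nonneg _ _ _ hh hh) (nGram_nonneg _ _ _ hh hf') (nGram_nonneg _ _ _ hf' hf')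
        (sqInt_nonneg _ _ _ fun z => Finset.sum_nonneg fun _ _ => Finset.sum_nonneg fun _ _ =>
          sq_nonneg _) b1 b2 b3
        ((sqInt_mono _ _ _ hgb hug hgu').trans hG3)
        (ih a' b' (ℓ / 2) (fun j => g (j + 1)) F' G' H' hl2 (hF.trans_le hF1) (hG.trans_le hG1)
          (hH.trans_le hH1) (fun j => hg (j + 1)) hgu' hF3 hG3 hH3 hF4 hG4 hH4)
    have k1 := child (Or.inl rfl) (Or.inl rfl)
    have k2 := child (Or.inr rfl) (Or.inl rfl)
    have k3 := child (Or.inl rfl) (Or.inr rfl)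
    have k4 := child (Or.inr rfl) (Or.inr rfl)
    have l1 := locForm_le_inc a b hℓ hf hh (hg 0) hF hG hH
    have hgb : BM fun z => ∑ j ∈ Finset.range n, ∑ i, g (j + 1) i z ^ 2 :=
      BM.sum _ fun j => sum_sq_bm _ (hg (j + 1))
    have hR : sqInt a b ℓ (fun z => ∑ j ∈ Finset.range (n + 1), ∑ i, g j i z ^ 2) =
        sqInt a b ℓ (fun z => ∑ j ∈ Finset.range n, ∑ i, g (j + 1) i z ^ 2) +
        sqInt a b ℓ (fun z => ∑ i, g 0 i z ^ 2) := by
      simp only [Finset.sum_range_succ']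
      exact integral_add (hgb.integrable _) ((sum_sq_bm _ (hg 0)).integrable _)
    have e1 := sqInt_split a b hℓ.le hgb
    have e2 := sqInt_split a b hℓ.le hV
    rw [genSum, hR, e1, e2]
    linear_combination k1 + k2 + k3 + k4 + l1

lemma genSum_le {f : ℝ × ℝ → ℝ} {h : ι → ℝ × ℝ → ℝ} (hf : BM f) (hh : ∀ i, BM (h i))
    {Mf Mg Mh ug : ℝ × ℝ → ℝ} (hMf : BM Mf) (hMg : BM Mg) (hMh : BM Mh) (hug : BM ug)
    (hug0 : ∀ z, 0 ≤ ug z)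
    (hdf : DomSq (fun z => f z ^ 2) Mf) (hdg : DomSq ug Mg) (hdh : DomSq (fun z => ∑ i, h i z ^ 2) Mh)
    (n : ℕ) (a b ℓ : ℝ) (hℓ : 0 < ℓ) (g : ℕ → ι → ℝ × ℝ → ℝ) (hg : ∀ j i, BM (g j i))
    (hgu : ∀ z, ∑ j ∈ Finset.range n, ∑ i, g j i z ^ 2 ≤ ug z) :
    genSum f h n a b ℓ g ≤ 11 * sqInt a b ℓ (fun z => Mf z * Mg z * Mh z) := by
  have nn : ∀ {u M : ℝ × ℝ → ℝ}, DomSq u M → ∀ z, 0 ≤ M z := fun hd z =>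
    (hd (z.1 - 1) (z.2 - 1) 1 one_pos z ⟨by simp, by simp⟩).1
  have addε : ∀ {u M : ℝ × ℝ → ℝ} {ε : ℝ}, DomSq u M → 0 < ε → DomSq u fun z => M z + ε := by
    intro u M ε hd hε a b ℓ hℓ z hz
    obtain ⟨h1, h2⟩ := hd a b ℓ hℓ z hz
    refine ⟨by linarith, h2.trans ?_⟩
    gcongr
    linarith
  have start : ∀ {u M : ℝ × ℝ → ℝ} {ε : ℝ}, (∀ z, 0 ≤ u z) → DomSq u M → 0 < ε → ∃ F, 0 < F ∧
      sqInt a b ℓ u ≤ ℓ ^ 2 * F ^ 2 ∧ ∀ z ∈ Sq a b ℓ, F ≤ M z + ε := by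
    intro u M ε h0 hd hε
    have hs := sqInt_nonneg a b ℓ h0
    have hv : 0 ≤ sqInt a b ℓ u / ℓ ^ 2 := by positivity
    refine ⟨Real.sqrt (sqInt a b ℓ u / ℓ ^ 2) + ε, by positivity, ?_, fun z hz => ?_⟩
    · rw [mul_comm, ← div_le_iff₀ (by positivity)]
      calc _ = Real.sqrt (sqInt a b ℓ u / ℓ ^ 2) ^ 2 := (Real.sq_sqrt hv).symm
        _ ≤ _ := pow_le_pow_left₀ (Real.sqrt_nonneg _) (by linarith) 2
    · obtain ⟨h1, h2⟩ := hd a b ℓ hℓ z hz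
      refine add_le_add_left (Real.sqrt_le_iff.2 ⟨h1, ?_⟩) _
      rwa [div_le_iff₀ (by positivity), mul_comm]
  set W : ℝ × ℝ → ℝ := fun z => Mf z * Mg z + Mg z * Mh z + Mf z * Mh z + (Mf z + Mg z + Mh z + 1)
  have hW : BM W := (((hMf.mul hMg).add (hMg.mul hMh)).add (hMf.mul hMh)).add
    (((hMf.add hMg).add hMh).add (BM.const 1))
  have hV : BM fun z => Mf z * Mg z * Mh z := (hMf.mul hMg).mul hMh
  have hW0 : ∀ z, 0 ≤ W z := fun z => by
    have := nn hdf z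
    have := nn hdg z
    have := nn hdh z
    positivity
  have key : ∀ ε, 0 < ε → ε ≤ 1 → genSum f h n a b ℓ g ≤
      11 * sqInt a b ℓ (fun z => Mf z * Mg z * Mh z) + ε * (11 * sqInt a b ℓ W) := by
    intro ε hε hε1
    obtain ⟨F, hF, hFQ, hFM⟩ := start (fun _ => sq_nonneg _) hdf hε
    obtain ⟨G, hG, hGQ, hGM⟩ := start hug0 hdg hε
    obtain ⟨H, hH, hHQ, hHM⟩ := start
      (fun _ => Finset.sum_nonneg fun _ _ => sq_nonneg _) hdh hε
    have hMf' := hMf.add (BM.const ε)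
    have hMg' := hMg.add (BM.const ε)
    have hMh' := hMh.add (BM.const ε)
    have main := genSum_le_aux hf hh hMf' hMg' hMh' hug hug0 (addε hdf hε) (addε hdg hε)
      (addε hdh hε) n a b ℓ g F G H hℓ hF hG hH hg hgu hFQ hGQ hHQ hFM hGM hHM
    have hR := (sqInt_mono a b ℓ (BM.sum (Finset.range n) fun j => sum_sq_bm _ (hg j)) hug
      hgu).trans hGQ
    have hR' := mul_le_mul_of_nonneg_left hR (by positivity : 0 ≤ 1 / 2 * (F * H / G))
    have hR'' : 1 / 2 * (F * H / G) * (ℓ ^ 2 * G ^ 2) = 1 / 2 * (ℓ ^ 2 * (F * G * H)) := by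
      field_simp
    have p0 : 0 < ℓ ^ 2 * (F * G * H) := by positivity
    have p1 := mul_nonneg (by positivity : 0 ≤ G * F * (1 / H ^ 3)) (nGram_nonneg a b ℓ hh hh)
    have p2 := mul_nonneg (by positivity : 0 ≤ 2 * G * (1 / (F * H)))
      (nGram_nonneg a b ℓ hh (fun _ : Unit => hf))
    have p3 := mul_nonneg (by positivity : 0 ≤ G * H * (1 / F ^ 3))
      (nGram_nonneg a b ℓ (fun _ : Unit => hf) (fun _ : Unit => hf))
    have hVε : sqInt a b ℓ (fun z => (Mf z + ε) * (Mg z + ε) * (Mh z + ε)) ≤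
        sqInt a b ℓ (fun z => Mf z * Mg z * Mh z) + ε * sqInt a b ℓ W := by
      have e : sqInt a b ℓ (fun z => Mf z * Mg z * Mh z) + ε * sqInt a b ℓ W =
          sqInt a b ℓ (fun z => Mf z * Mg z * Mh z + ε * W z) := by
        rw [sqInt, sqInt, sqInt, ← integral_const_mul]
        exact (integral_add (hV.integrable _) (((BM.const ε).mul hW).integrable _)).symm
      rw [e]
      refine sqInt_mono a b ℓ ((hMf'.mul hMg').mul hMh') (hV.add ((BM.const ε).mul hW)) fun z => ?_
      have h1 := nn hdf z
      have h2 := nn hdg z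
      have h3 := nn hdh z
      have h4 : ε ^ 2 ≤ ε := by nlinarith
      have h5 : ε ^ 3 ≤ ε := by nlinarith
      have h6 := mul_le_mul_of_nonneg_right h4 (by positivity : 0 ≤ Mf z + Mg z + Mh z)
      simp only [W]
      linear_combination h5 + h6
    linarith
  refine le_of_forall_pos_le_add fun δ hδ => ?_
  have hK : 0 ≤ 11 * sqInt a b ℓ W := mul_nonneg (by norm_num) (sqInt_nonneg a b ℓ hW0)
  refine (key (min 1 (δ / (11 * sqInt a b ℓ W + 1))) (by positivity) (min_le_left _ _)).trans
    (add_le_add_right ?_ _)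
  calc _ ≤ δ / (11 * sqInt a b ℓ W + 1) * (11 * sqInt a b ℓ W + 1) := by
        gcongr
        · exact min_le_right _ _
        · linarith
    _ = δ := by field_simp

end TelescopeMain

/-! ### Averaging over translations -/

/-- Bounded measurable functions with bounded support. -/
def BC {α : Type*} [MeasurableSpace α] [NormedAddCommGroup α] (u : α → ℝ) : Prop :=
  BM u ∧ ∃ R, ∀ x, R < ‖x‖ → u x = 0

namespace BC

variable {α : Type*} [MeasurableSpace α] [NormedAddCommGroup α] {u v : α → ℝ}

lemma integrable [BorelSpace α] [ProperSpace α] (hu : BC u) (μ : Measure α)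
    [IsFiniteMeasureOnCompacts μ] : Integrable u μ := by
  obtain ⟨⟨hm, C, hC⟩, R, hR⟩ := hu
  have h1 : IntegrableOn u (Metric.closedBall 0 R) μ :=
    Measure.integrableOn_of_bounded (M := C) (isCompact_closedBall (0 : α) R).measure_ne_top
      hm.aestronglyMeasurable (Eventually.of_forall hC)
  refine (integrableOn_iff_integrable_of_support_subset fun x hx => ?_).1 h1
  rw [mem_closedBall_zero_iff]
  by_contra hcon
  exact hx (hR x (not_le.1 hcon))

lemma mul_bm (hu : BC u) (hv : BM v) : BC fun x => u x * v x :=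
  ⟨hu.1.mul hv, hu.2.imp fun _ hR x hx => by simp only [hR x hx, zero_mul]⟩

lemma add (hu : BC u) (hv : BC v) : BC fun x => u x + v x := by
  obtain ⟨hu, R, hR⟩ := hu
  obtain ⟨hv, S, hS⟩ := hv
  refine ⟨hu.add hv, max R S, fun x hx => ?_⟩
  simp only [hR x ((le_max_left _ _).trans_lt hx), hS x ((le_max_right _ _).trans_lt hx), add_zero]

lemma sum {ι : Type*} (s : Finset ι) {u : ι → α → ℝ} (hu : ∀ i, BC (u i)) :
    BC fun x => ∑ i ∈ s, u i x := by
  classical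
  induction s using Finset.induction_on with
  | empty => exact ⟨BM.sum ∅ fun i => (hu i).1, 0, fun _ _ => by simp⟩
  | insert i s hi ih =>
    simp only [Finset.sum_insert hi]
    exact (hu i).add ih

end BC

/-- The Haar profile on `(0, ℓ]`. -/
def haar (ℓ s : ℝ) : ℝ := if 0 < s ∧ s ≤ ℓ then (if s ≤ ℓ / 2 then 1 else -1) else 0

lemma haar_bm (ℓ : ℝ) : BM (haar ℓ) := by
  refine ⟨Measurable.ite measurableSet_Ioc (Measurable.ite measurableSet_Iic measurable_const
    measurable_const) measurable_const, 1, fun s => ?_⟩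
  unfold haar
  split_ifs <;> simp

lemma haar_eq_zero {ℓ s : ℝ} (h : ¬(0 < s ∧ s ≤ ℓ)) : haar ℓ s = 0 := by rw [haar, if_neg h]

lemma integral_sg_mul (b ℓ : ℝ) (q : ℝ → ℝ) :
    ∫ y, sg b ℓ y * q y ∂(IM b ℓ) = ∫ y, haar ℓ (y - b) * q y := by
  rw [IM, ← integral_indicator measurableSet_Ioc]
  refine integral_congr_ae (Eventually.of_forall fun y => ?_)
  simp only [Set.indicator_apply, Set.mem_Ioc, haar, sg, sub_pos, sub_le_iff_le_add, ite_mul,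
    zero_mul, add_comm]

/-- The correlation of the Haar profile with itself, normalised. -/
def eta (ℓ t : ℝ) : ℝ := (ℓ ^ 2)⁻¹ * ∫ s, haar ℓ (t + s) * haar ℓ s

lemma integral_haar_mul (ℓ y y' : ℝ) :
    ∫ b, haar ℓ (y - b) * haar ℓ (y' - b) = ∫ s, haar ℓ (y - y' + s) * haar ℓ s := by
  rw [← integral_sub_left_eq_self (fun s => haar ℓ (y - y' + s) * haar ℓ s) volume y']
  refine integral_congr_ae (Eventually.of_forall fun b => ?_)
  simp only [sub_add_sub_cancel]

lemma integral_haar_pair {ℓ : ℝ} (hℓ : 0 < ℓ) {p q : ℝ → ℝ} (hp : BC p) (hq : BM q) :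
    ∫ b, (∫ y, haar ℓ (y - b) * q y) * (∫ y, haar ℓ (y - b) * p y) =
      ℓ ^ 2 * ∫ y, p y * fconv (eta ℓ) q y := by
  obtain ⟨R, hR⟩ := hp.2
  have hF : BC fun w : ℝ × ℝ × ℝ => (haar ℓ (w.2.1 - w.1) * p w.2.1) *
      (haar ℓ (w.2.2 - w.1) * q w.2.2) := by
    refine ⟨(((haar_bm ℓ).comp (by fun_prop)).mul (hp.1.comp (by fun_prop))).mul
      (((haar_bm ℓ).comp (by fun_prop)).mul (hq.comp (by fun_prop))), |R| + ℓ, ?_⟩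
    rintro ⟨b, y, y'⟩ hw
    simp only
    by_contra hne
    have h1 : haar ℓ (y - b) ≠ 0 := fun h => hne (by rw [h]; ring)
    have h2 : p y ≠ 0 := fun h => hne (by rw [h]; ring)
    have h3 : haar ℓ (y' - b) ≠ 0 := fun h => hne (by rw [h]; ring)
    have h1' := not_imp_comm.1 haar_eq_zero h1
    have h3' := not_imp_comm.1 haar_eq_zero h3
    have h2' : ‖y‖ ≤ R := by
      by_contra hcon
      exact h2 (hR y (not_le.1 hcon))
    rw [Real.norm_eq_abs, abs_le] at h2'
    refine absurd hw (not_lt.2 ?_)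
    have := le_abs_self R
    have := neg_abs_le R
    simp only [Prod.norm_def, Real.norm_eq_abs]
    refine max_le ?_ (max_le ?_ ?_) <;> rw [abs_le] <;> constructor <;> linarith
  calc _ = ∫ b, ∫ z : ℝ × ℝ, (haar ℓ (z.1 - b) * p z.1) * (haar ℓ (z.2 - b) * q z.2) := by
        refine integral_congr_ae (Eventually.of_forall fun b => ?_)
        simp only
        rw [mul_comm, ← integral_prod_mul, Measure.volume_eq_prod]
    _ = ∫ z : ℝ × ℝ, ∫ b, (haar ℓ (z.1 - b) * p z.1) * (haar ℓ (z.2 - b) * q z.2) :=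
        integral_integral_swap (hF.integrable _)
    _ = ∫ z : ℝ × ℝ, ℓ ^ 2 * (p z.1 * (eta ℓ (z.1 - z.2) • q z.2)) := by
        refine integral_congr_ae (Eventually.of_forall fun z => ?_)
        have : ∀ b, (haar ℓ (z.1 - b) * p z.1) * (haar ℓ (z.2 - b) * q z.2) =
            (p z.1 * q z.2) * (haar ℓ (z.1 - b) * haar ℓ (z.2 - b)) := fun b => by ring
        simp only [this, integral_const_mul, integral_haar_mul, eta, smul_eq_mul]
        field_simp
    _ = ∫ y, ∫ y', ℓ ^ 2 * (p y * (eta ℓ (y - y') • q y')) := by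
        rw [Measure.volume_eq_prod, integral_prod]
        have h := (hF.integrable (volume.prod volume)).integral_prod_right
        refine h.congr (Eventually.of_forall fun z => ?_)
        have : ∀ b, (haar ℓ (z.1 - b) * p z.1) * (haar ℓ (z.2 - b) * q z.2) =
            (p z.1 * q z.2) * (haar ℓ (z.1 - b) * haar ℓ (z.2 - b)) := fun b => by ring
        simp only [this, integral_const_mul, integral_haar_mul, eta, smul_eq_mul]
        field_simp
    _ = _ := by
        simp only [integral_const_mul, fconv]

lemma lintegral_IM_prod {ℓ : ℝ} {Φ : ℝ × ℝ → ℝ≥0∞} (hΦ : Measurable Φ) :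
    ∫⁻ a, ∫⁻ x, Φ x ∂((IM a ℓ).prod (IM a ℓ)) =
      ∫⁻ x : ℝ × ℝ, ENNReal.ofReal (ℓ - |x.1 - x.2|) * Φ x := by
  have hS : MeasurableSet {w : ℝ × ℝ × ℝ | w.2 ∈ Sq w.1 w.1 ℓ} := by
    have : {w : ℝ × ℝ × ℝ | w.2 ∈ Sq w.1 w.1 ℓ} = {w | w.1 < w.2.1} ∩ {w | w.2.1 ≤ w.1 + ℓ} ∩
        ({w | w.1 < w.2.2} ∩ {w | w.2.2 ≤ w.1 + ℓ}) := by
      ext w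
      simp [Sq, Set.mem_prod]
    rw [this]
    exact ((measurableSet_lt (by fun_prop) (by fun_prop)).inter
      (measurableSet_le (by fun_prop) (by fun_prop))).inter
      ((measurableSet_lt (by fun_prop) (by fun_prop)).inter
      (measurableSet_le (by fun_prop) (by fun_prop)))
  calc _ = ∫⁻ a, ∫⁻ x : ℝ × ℝ, {w : ℝ × ℝ × ℝ | w.2 ∈ Sq w.1 w.1 ℓ}.indicator
          (fun w => Φ w.2) (a, x) := by
        refine lintegral_congr fun a => ?_
        rw [IM, Measure.prod_restrict, ← Measure.volume_eq_prod,
          ← lintegral_indicator (measurableSet_Ioc.prod measurableSet_Ioc)]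
        rfl
    _ = ∫⁻ x : ℝ × ℝ, ∫⁻ a, {w : ℝ × ℝ × ℝ | w.2 ∈ Sq w.1 w.1 ℓ}.indicator
          (fun w => Φ w.2) (a, x) :=
        lintegral_lintegral_swap ((hΦ.comp measurable_snd).indicator hS).aemeasurable
    _ = _ := by
        refine lintegral_congr fun x => ?_
        have : ∀ a, {w : ℝ × ℝ × ℝ | w.2 ∈ Sq w.1 w.1 ℓ}.indicator (fun w => Φ w.2) (a, x) =
            (Set.Ico (max x.1 x.2 - ℓ) (min x.1 x.2)).indicator (fun _ => Φ x) a := by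
          intro a
          have hiff : x ∈ Sq a a ℓ ↔ a ∈ Set.Ico (max x.1 x.2 - ℓ) (min x.1 x.2) := by
            simp only [Sq, Set.mem_prod, Set.mem_Ioc, Set.mem_Ico, lt_min_iff,
              sub_le_iff_le_add, max_le_iff]
            tauto
          by_cases h : x ∈ Sq a a ℓ
          · rw [Set.indicator_of_mem (hiff.1 h), Set.indicator_of_mem (by exact h)]
          · rw [Set.indicator_of_notMem (mt hiff.2 h), Set.indicator_of_notMem (by exact h)]
        simp only [this]
        rw [lintegral_indicator measurableSet_Ico, setLIntegral_const, Real.volume_Ico, mul_comm]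
        congr 2
        rw [← max_sub_min_eq_abs']
        ring

section Average

variable {ι : Type*} [Fintype ι]

/-- Tent-weighted kernel. -/
def tent (β : ℝ → ℝ) (ℓ t : ℝ) : ℝ := (ℓ ^ 2)⁻¹ * (max (ℓ - |t|) 0 * β t)

lemma tent_bm {β : ℝ → ℝ} (hβ : BM β) {ℓ : ℝ} (hℓ : 0 < ℓ) : BM (tent β ℓ) := by
  refine (BM.const _).mul (BM.mul ⟨by fun_prop, ℓ, fun t => ?_⟩ hβ)
  rw [abs_of_nonneg (le_max_right _ _)]
  exact max_le (by linarith [abs_nonneg t]) hℓ.le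

lemma tent_eq_zero {β : ℝ → ℝ} {ℓ t : ℝ} (h : ℓ ≤ |t|) : tent β ℓ t = 0 := by
  rw [tent, max_eq_right (by linarith)]
  ring

lemma eta_bm (ℓ : ℝ) : BM (eta ℓ) := by
  have h : ∀ t, eta ℓ t = (ℓ ^ 2)⁻¹ * ∫ s, haar ℓ (t + s) * haar ℓ s ∂(IM 0 ℓ) := by
    intro t
    rw [eta, IM, ← integral_indicator measurableSet_Ioc]
    congr 1
    refine integral_congr_ae (Eventually.of_forall fun s => ?_)
    simp only [Set.indicator_apply]
    split_ifs with hs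
    · rfl
    · rw [zero_add] at hs
      rw [haar_eq_zero hs, mul_zero]
  have h2 : BM fun t => (ℓ ^ 2)⁻¹ * ∫ s, haar ℓ (t + s) * haar ℓ s ∂(IM 0 ℓ) := by
    refine (BM.const _).mul (BM.integral_right
      (w := fun z : ℝ × ℝ => haar ℓ (z.1 + z.2) * haar ℓ z.2) ?_ _)
    exact ((haar_bm ℓ).comp (by fun_prop)).mul ((haar_bm ℓ).comp (by fun_prop))
  rwa [← funext h] at h2

lemma eta_eq_zero {ℓ t : ℝ} (h : ℓ ≤ |t|) : eta ℓ t = 0 := by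
  have : ∀ s, haar ℓ (t + s) * haar ℓ s = 0 := by
    intro s
    by_cases h1 : 0 < s ∧ s ≤ ℓ
    · rw [haar_eq_zero (s := t + s), zero_mul]
      rintro ⟨h2, h3⟩
      refine absurd h (not_le.2 (abs_lt.2 ⟨by linarith, by linarith⟩))
    · rw [haar_eq_zero h1, mul_zero]
  simp [eta, this]

end Average

lemma BM.fconv_param {α : Type*} [MeasurableSpace α] {K : ℝ → ℝ} (hKm : Measurable K)
    (hK : Integrable K) {w : α × ℝ → ℝ} (hw : BM w) :
    BM fun z : α × ℝ => fconv K (fun t => w (z.1, t)) z.2 := by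
  obtain ⟨hm, C, hC⟩ := hw
  refine ⟨?_, ∫ t, |K t| * C, fun z => ?_⟩
  · have h : Measurable fun v : (α × ℝ) × ℝ => K (v.1.2 - v.2) • w (v.1.1, v.2) := by fun_prop
    exact (h.stronglyMeasurable.integral_prod_right' (ν := volume)).measurable
  · unfold fconv
    rw [← integral_sub_left_eq_self (fun t => |K t| * C) volume z.2]
    refine norm_integral_le_of_norm_le (f := fun t => K (z.2 - t) • w (z.1, t)) ((hK.abs.mul_const C).comp_sub_left z.2)
      (Eventually.of_forall fun t => ?_)
    rw [norm_smul]
    exact mul_le_mul_of_nonneg_left (hC _) (norm_nonneg _)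

lemma BM.fconv_fst {K : ℝ → ℝ} (hKm : Measurable K) (hK : Integrable K) {w : ℝ × ℝ → ℝ}
    (hw : BM w) : BM fun z : ℝ × ℝ => fconv K (fun t => w (t, z.2)) z.1 :=
  ((hw.comp measurable_swap).fconv_param hKm hK).comp measurable_swap

lemma BM.fconv_snd {K : ℝ → ℝ} (hKm : Measurable K) (hK : Integrable K) {w : ℝ × ℝ → ℝ}
    (hw : BM w) : BM fun z : ℝ × ℝ => fconv K (fun t => w (z.1, t)) z.2 :=
  hw.fconv_param hKm hK

lemma tent_enorm_le {β : ℝ → ℝ} (hβ1 : ∀ t, |β t| ≤ 1) (ℓ t : ℝ) :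
    ‖tent β ℓ t‖ₑ ≤ ENNReal.ofReal ((ℓ ^ 2)⁻¹) * ENNReal.ofReal (ℓ - |t|) := by
  rw [Real.enorm_eq_ofReal_abs, tent, abs_mul,
    abs_of_nonneg (by positivity : 0 ≤ (ℓ ^ 2)⁻¹), abs_mul,
    abs_of_nonneg (le_max_right (ℓ - |t|) 0), ENNReal.ofReal_mul (by positivity)]
  have h : ENNReal.ofReal (max (ℓ - |t|) 0 * |β t|) ≤ ENNReal.ofReal (ℓ - |t|) := by
    refine (ENNReal.ofReal_le_ofReal (mul_le_of_le_one_right (le_max_right _ _) (hβ1 _))).trans ?_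
    rw [ENNReal.ofReal_max, ENNReal.ofReal_zero, max_eq_left zero_le]
  exact mul_le_mul_right h _

lemma tent_integrable {β : ℝ → ℝ} (hβ : BM β) {ℓ : ℝ} (hℓ : 0 < ℓ) : Integrable (tent β ℓ) :=
  BC.integrable ⟨tent_bm hβ hℓ, ℓ, fun _ hx => tent_eq_zero hx.le⟩ _

lemma eta_integrable (ℓ : ℝ) : Integrable (eta ℓ) :=
  BC.integrable ⟨eta_bm ℓ, ℓ, fun _ hx => eta_eq_zero hx.le⟩ _

lemma haar_integral_bm (ℓ : ℝ) {α : Type*} [MeasurableSpace α] {w : α × ℝ → ℝ} (hw : BM w) :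
    BM fun z : α × ℝ => ∫ y, haar ℓ (y - z.2) * w (z.1, y) := by
  have hb : BM fun t => haar ℓ (-t) := (haar_bm ℓ).comp measurable_neg
  have h0 : BC fun t => haar ℓ (-t) := ⟨hb, ℓ, fun t ht => haar_eq_zero fun h => by
    rw [Real.norm_eq_abs, abs_of_nonpos (by linarith)] at ht
    linarith⟩
  have h := hw.fconv_param hb.1 (h0.integrable volume)
  simpa only [fconv, neg_sub, smul_eq_mul] using h

section Average

variable {ι : Type*} [Fintype ι]

lemma integral_trilinear {ℓ : ℝ} (hℓ : 0 < ℓ) {β : ℝ → ℝ} (hβ : BM β)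
    {f : ℝ × ℝ → ℝ} (hf : BM f) {h B : ℝ × ℝ → ℝ} (hh : BC h) (hB : BM B) :
    Integrable (fun x : ℝ × ℝ => tent β ℓ (x.1 - x.2) * ∫ y, h (x.1, y) * f (x.2, y) * B (x.1, y)) ∧
    ∫ z, h z * (fconv (tent β ℓ) (fun t => f (t, z.2)) z.1 * B z) =
      ∫ x : ℝ × ℝ, tent β ℓ (x.1 - x.2) * ∫ y, h (x.1, y) * f (x.2, y) * B (x.1, y) := by
  obtain ⟨R, hR⟩ := hh.2
  have hW : BC fun w : (ℝ × ℝ) × ℝ => tent β ℓ (w.1.1 - w.1.2) *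
      (h (w.1.1, w.2) * f (w.1.2, w.2) * B (w.1.1, w.2)) := by
    refine ⟨((tent_bm hβ hℓ).comp (by fun_prop)).mul (((hh.1.comp (by fun_prop)).mul
      (hf.comp (by fun_prop))).mul (hB.comp (by fun_prop))), R + ℓ, ?_⟩
    rintro ⟨⟨x, x'⟩, y⟩ hw
    simp only
    by_contra hne
    have h1 : tent β ℓ (x - x') ≠ 0 := fun h => hne (by rw [h]; ring)
    have h2 : h (x, y) ≠ 0 := fun h => hne (by rw [h]; ring)
    have h1' : |x - x'| < ℓ := by
      by_contra hcon
      exact h1 (tent_eq_zero (not_lt.1 hcon))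
    have h2' : ‖(x, y)‖ ≤ R := by
      by_contra hcon
      exact h2 (hR _ (not_le.1 hcon))
    simp only [Prod.norm_def, Real.norm_eq_abs, max_le_iff, abs_le] at h2'
    rw [abs_lt] at h1'
    refine absurd hw (not_lt.2 ?_)
    simp only [Prod.norm_def, Real.norm_eq_abs]
    refine max_le (max_le ?_ ?_) ?_ <;> rw [abs_le] <;> constructor <;> linarith
  have hi := (hW.integrable (volume.prod volume)).integral_prod_left
  simp only [integral_const_mul] at hi
  refine ⟨hi, ?_⟩
  have hA := (hh.mul_bm ((hf.fconv_fst (tent_bm hβ hℓ).1 (tent_integrable hβ hℓ)).mul hB))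
  rw [Measure.volume_eq_prod, integral_prod _ (hA.integrable _), integral_prod _ hi]
  refine integral_congr_ae (Eventually.of_forall fun x => ?_)
  simp only
  have hx : Integrable (Function.uncurry fun y x' : ℝ => tent β ℓ (x - x') *
      (h (x, y) * f (x', y) * B (x, y))) (volume.prod volume) := by
    refine BC.integrable ⟨((tent_bm hβ hℓ).comp (by fun_prop)).mul (((hh.1.comp (by fun_prop)).mul
      (hf.comp (by fun_prop))).mul (hB.comp (by fun_prop))), (hW.2.imp fun S hS w hw => ?_)⟩ _
    refine hS ((x, w.2), w.1) (hw.trans_le ?_)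
    simp only [Prod.norm_def]
    exact max_le (le_max_right _ _) ((le_max_right _ _).trans (le_max_left _ _))
  calc _ = ∫ y, ∫ x', tent β ℓ (x - x') * (h (x, y) * f (x', y) * B (x, y)) := by
        refine integral_congr_ae (Eventually.of_forall fun y => ?_)
        simp only [fconv, smul_eq_mul]
        rw [← integral_mul_const, ← integral_const_mul]
        refine integral_congr_ae (Eventually.of_forall fun x' => ?_)
        simp only
        ring
    _ = ∫ x', ∫ y, tent β ℓ (x - x') * (h (x, y) * f (x', y) * B (x, y)) :=
        integral_integral_swap hx
    _ = _ := by simp only [integral_const_mul]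

lemma integral_sum_trilinear {ℓ : ℝ} (hℓ : 0 < ℓ) {β : ℝ → ℝ} (hβ : BM β)
    {f : ℝ × ℝ → ℝ} (hf : BM f) {h B : ι → ℝ × ℝ → ℝ} (hh : ∀ i, BC (h i)) (hB : ∀ i, BM (B i)) :
    ∫ z, ∑ i, h i z * (fconv (tent β ℓ) (fun t => f (t, z.2)) z.1 * B i z) =
      ∫ x : ℝ × ℝ, tent β ℓ (x.1 - x.2) *
        ∑ i, ∫ y, h i (x.1, y) * f (x.2, y) * B i (x.1, y) := by
  have hI := fun i => integral_trilinear hℓ hβ hf (hh i) (hB i)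
  have hA := hf.fconv_fst (tent_bm hβ hℓ).1 (tent_integrable hβ hℓ)
  rw [integral_finsetSum _ fun i _ => ((hh i).mul_bm (hA.mul (hB i))).integrable _]
  simp only [fun i => (hI i).2, Finset.mul_sum]
  rw [integral_finsetSum _ fun i _ => (hI i).1]

lemma locForm_enorm (a b ℓ : ℝ) {f : ℝ × ℝ → ℝ} (hf : BM f) {h g : ι → ℝ × ℝ → ℝ}
    (hh : ∀ i, BM (h i)) (hg : ∀ i, BM (g i)) :
    ENNReal.ofReal (locForm a b ℓ f h g) = ENNReal.ofReal ((ℓ ^ 2)⁻¹) *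
      ∫⁻ x, ‖∑ i, (∫ y, haar ℓ (y - b) * g i (x.1, y)) *
        ∫ y, haar ℓ (y - b) * (h i (x.1, y) * f (x.2, y))‖ₑ ∂((IM a ℓ).prod (IM a ℓ)) := by
  have h1 : ∀ i, BM fun x : ℝ × ℝ => (∫ y, haar ℓ (y - b) * g i (x.1, y)) *
      ∫ y, haar ℓ (y - b) * (h i (x.1, y) * f (x.2, y)) := fun i => by
    have h2 := (haar_integral_bm ℓ (hg i)).comp (m := fun x : ℝ × ℝ => (x.1, b)) (by fun_prop)
    have hw : BM fun w : (ℝ × ℝ) × ℝ => h i (w.1.1, w.2) * f (w.1.2, w.2) :=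
      ((hh i).comp (by fun_prop)).mul (hf.comp (by fun_prop))
    have h3 := (haar_integral_bm ℓ hw).comp (m := fun x : ℝ × ℝ => (x, b)) (by fun_prop)
    exact h2.mul h3
  rw [locForm, ENNReal.ofReal_mul (by positivity)]
  congr 1
  simp only [integral_sg_mul]
  exact ofReal_integral_norm_eq_lintegral_enorm ((BM.sum _ h1).integrable _)

lemma enorm_sum_pairing_le {ℓ : ℝ} (hℓ : 0 < ℓ) {f : ℝ × ℝ → ℝ} (hf : BM f)
    {h g : ι → ℝ × ℝ → ℝ} (hh : ∀ i, BC (h i)) (hg : ∀ i, BM (g i)) (x : ℝ × ℝ) :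
    ‖∑ i, ∫ y, h i (x.1, y) * f (x.2, y) * fconv (eta ℓ) (fun t => g i (x.1, t)) y‖ₑ ≤
      ENNReal.ofReal ((ℓ ^ 2)⁻¹) * ∫⁻ b, ‖∑ i, (∫ y, haar ℓ (y - b) * g i (x.1, y)) *
        ∫ y, haar ℓ (y - b) * (h i (x.1, y) * f (x.2, y))‖ₑ := by
  have hp : ∀ i, BC fun y => h i (x.1, y) * f (x.2, y) := fun i => by
    refine BC.mul_bm ⟨(hh i).1.comp (by fun_prop), (hh i).2.imp fun R hR y hy => ?_⟩
      (hf.comp (by fun_prop))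
    exact hR _ (hy.trans_le (le_max_right _ _))
  have hq : ∀ i, BM fun y => g i (x.1, y) := fun i => (hg i).comp (by fun_prop)
  have hintg : ∀ i, Integrable fun b => (∫ y, haar ℓ (y - b) * g i (x.1, y)) *
      ∫ y, haar ℓ (y - b) * (h i (x.1, y) * f (x.2, y)) := fun i => by
    obtain ⟨R, hR⟩ := (hp i).2
    have b1 := (haar_integral_bm ℓ (hg i)).comp (m := fun b : ℝ => (x.1, b)) (by fun_prop)
    have b2 := (haar_integral_bm ℓ (w := fun w : Unit × ℝ => h i (x.1, w.2) * f (x.2, w.2))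
      ((hp i).1.comp (by fun_prop))).comp (m := fun b : ℝ => ((), b)) (by fun_prop)
    refine BC.integrable ⟨b1.mul b2, |R| + ℓ, fun b hb => ?_⟩ _
    have : ∀ y, haar ℓ (y - b) * (h i (x.1, y) * f (x.2, y)) = 0 := by
      intro y
      by_contra hne
      have h1' := not_imp_comm.1 haar_eq_zero (left_ne_zero_of_mul hne)
      have h2' : ‖y‖ ≤ R := by
        by_contra hcon
        exact right_ne_zero_of_mul hne (hR y (not_le.1 hcon))
      rw [Real.norm_eq_abs, abs_le] at h2'
      refine absurd hb (not_lt.2 ?_)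
      have := le_abs_self R
      rw [Real.norm_eq_abs, abs_le]
      constructor <;> linarith
    simp only [this, integral_zero, mul_zero]
  have he : ∑ i, ∫ y, h i (x.1, y) * f (x.2, y) * fconv (eta ℓ) (fun t => g i (x.1, t)) y =
      (ℓ ^ 2)⁻¹ * ∫ b, ∑ i, (∫ y, haar ℓ (y - b) * g i (x.1, y)) *
        ∫ y, haar ℓ (y - b) * (h i (x.1, y) * f (x.2, y)) := by
    rw [integral_finsetSum _ fun i _ => hintg i, Finset.mul_sum]
    refine Finset.sum_congr rfl fun i _ => ?_
    rw [integral_haar_pair hℓ (hp i) (hq i)]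
    field_simp
  rw [he, enorm_mul, Real.enorm_of_nonneg (by positivity)]
  exact mul_le_mul_right (enorm_integral_le_lintegral_enorm _) _

lemma scale_le {ℓ : ℝ} (hℓ : 0 < ℓ) {β : ℝ → ℝ} (hβ : BM β) (hβ1 : ∀ t, |β t| ≤ 1)
    {f : ℝ × ℝ → ℝ} (hf : BM f) {h g : ι → ℝ × ℝ → ℝ} (hh : ∀ i, BC (h i)) (hg : ∀ i, BM (g i)) :
    ‖∫ z, ∑ i, h i z * (fconv (tent β ℓ) (fun t => f (t, z.2)) z.1 *
        fconv (eta ℓ) (fun t => g i (z.1, t)) z.2)‖ₑ ≤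
      ENNReal.ofReal ((ℓ ^ 2)⁻¹) * ∫⁻ b, ∫⁻ a, ENNReal.ofReal (locForm a b ℓ f h g) := by
  have hB : ∀ i, BM fun z : ℝ × ℝ => fconv (eta ℓ) (fun t => g i (z.1, t)) z.2 := fun i =>
    (hg i).fconv_snd (eta_bm ℓ).1 (eta_integrable ℓ)
  set Ψ : ℝ → ℝ × ℝ → ℝ := fun b x => ∑ i, (∫ y, haar ℓ (y - b) * g i (x.1, y)) *
        ∫ y, haar ℓ (y - b) * (h i (x.1, y) * f (x.2, y)) with hΨdef
  have hΨ : BM fun w : ℝ × ℝ × ℝ => Ψ w.1 w.2 := by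
    refine BM.sum _ fun i => ?_
    have h2 := (haar_integral_bm ℓ (hg i)).comp (m := fun x : ℝ × ℝ × ℝ => (x.2.1, x.1))
      (by fun_prop)
    have hw : BM fun w : (ℝ × ℝ) × ℝ => h i (w.1.1, w.2) * f (w.1.2, w.2) :=
      ((hh i).1.comp (by fun_prop)).mul (hf.comp (by fun_prop))
    have h3 := (haar_integral_bm ℓ hw).comp (m := fun x : ℝ × ℝ × ℝ => (x.2, x.1)) (by fun_prop)
    exact h2.mul h3
  have hΨb : ∀ b, Measurable fun x => ‖Ψ b x‖ₑ := fun b =>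
    (hΨ.1.comp (by fun_prop : Measurable fun x : ℝ × ℝ => (b, x))).enorm
  set Θ : ℝ × ℝ → ℝ := fun x => ∑ i, ∫ y, h i (x.1, y) * f (x.2, y) *
    fconv (eta ℓ) (fun t => g i (x.1, t)) y with hΘdef
  have hΘ : ∀ x, ‖Θ x‖ₑ ≤ ENNReal.ofReal ((ℓ ^ 2)⁻¹) * ∫⁻ b, ‖Ψ b x‖ₑ :=
    enorm_sum_pairing_le hℓ hf hh hg
  calc _ = ‖∫ x : ℝ × ℝ, tent β ℓ (x.1 - x.2) * Θ x‖ₑ :=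
        congrArg _ (integral_sum_trilinear hℓ hβ hf hh hB)
    _ ≤ ∫⁻ x : ℝ × ℝ, ‖tent β ℓ (x.1 - x.2) * Θ x‖ₑ := enorm_integral_le_lintegral_enorm _
    _ ≤ ∫⁻ x : ℝ × ℝ, ENNReal.ofReal ((ℓ ^ 2)⁻¹) * (ENNReal.ofReal ((ℓ ^ 2)⁻¹) *
          ∫⁻ b, ENNReal.ofReal (ℓ - |x.1 - x.2|) * ‖Ψ b x‖ₑ) := by
        refine lintegral_mono fun x => ?_
        rw [enorm_mul]
        refine (mul_le_mul' (tent_enorm_le hβ1 _ _) (hΘ x)).trans (le_of_eq ?_)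
        rw [lintegral_const_mul]
        · ring
        · exact (hΨ.1.comp (by fun_prop : Measurable fun b : ℝ => (b, x))).enorm
    _ = ENNReal.ofReal ((ℓ ^ 2)⁻¹) * (ENNReal.ofReal ((ℓ ^ 2)⁻¹) * ∫⁻ b, ∫⁻ x : ℝ × ℝ,
          ENNReal.ofReal (ℓ - |x.1 - x.2|) * ‖Ψ b x‖ₑ) := by
        have hm : Measurable fun w : (ℝ × ℝ) × ℝ => ENNReal.ofReal (ℓ - |w.1.1 - w.1.2|) *
            ‖Ψ w.2 w.1‖ₑ := by
          refine Measurable.mul (by fun_prop) (Measurable.enorm ?_)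
          exact hΨ.1.comp (by fun_prop : Measurable fun w : (ℝ × ℝ) × ℝ => (w.2, w.1))
        rw [lintegral_const_mul' _ _ ENNReal.ofReal_ne_top,
          lintegral_const_mul' _ _ ENNReal.ofReal_ne_top, lintegral_lintegral_swap hm.aemeasurable]
    _ = _ := by
        congr 1
        rw [← lintegral_const_mul' _ _ ENNReal.ofReal_ne_top]
        refine lintegral_congr fun b => ?_
        rw [← lintegral_IM_prod (hΨb b), ← lintegral_const_mul' _ _ ENNReal.ofReal_ne_top]
        exact lintegral_congr fun a => (locForm_enorm a b ℓ hf (fun i => (hh i).1) hg).symm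

end Average

lemma lintegral_IM {F : ℝ → ℝ≥0∞} (hF : Measurable F) {ℓ : ℝ} :
    ∫⁻ a, ∫⁻ x, F x ∂(IM a ℓ) = ENNReal.ofReal ℓ * ∫⁻ x, F x := by
  have hS : MeasurableSet {w : ℝ × ℝ | w.2 ∈ Set.Ioc w.1 (w.1 + ℓ)} :=
    (measurableSet_lt measurable_fst measurable_snd).inter
      (measurableSet_le measurable_snd (measurable_fst.add_const ℓ))
  calc _ = ∫⁻ a, ∫⁻ x : ℝ, {w : ℝ × ℝ | w.2 ∈ Set.Ioc w.1 (w.1 + ℓ)}.indicator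
          (fun w => F w.2) (a, x) := by
        refine lintegral_congr fun a => ?_
        rw [IM, ← lintegral_indicator measurableSet_Ioc]
        rfl
    _ = ∫⁻ x : ℝ, ∫⁻ a, {w : ℝ × ℝ | w.2 ∈ Set.Ioc w.1 (w.1 + ℓ)}.indicator
          (fun w => F w.2) (a, x) :=
        lintegral_lintegral_swap ((hF.comp measurable_snd).indicator hS).aemeasurable
    _ = ∫⁻ x : ℝ, ENNReal.ofReal ℓ * F x := by
        refine lintegral_congr fun x => ?_
        have : ∀ a, {w : ℝ × ℝ | w.2 ∈ Set.Ioc w.1 (w.1 + ℓ)}.indicator (fun w => F w.2) (a, x) =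
            (Set.Ico (x - ℓ) x).indicator (fun _ => F x) a := by
          intro a
          have hiff : x ∈ Set.Ioc a (a + ℓ) ↔ a ∈ Set.Ico (x - ℓ) x := by
            simp only [Set.mem_Ioc, Set.mem_Ico, sub_le_iff_le_add]
            tauto
          by_cases h : x ∈ Set.Ioc a (a + ℓ)
          · rw [Set.indicator_of_mem (hiff.1 h), Set.indicator_of_mem (by exact h)]
          · rw [Set.indicator_of_notMem (mt hiff.2 h), Set.indicator_of_notMem (by exact h)]
        simp only [this]
        rw [lintegral_indicator measurableSet_Ico, setLIntegral_const, Real.volume_Ico, mul_comm]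
        congr 2
        ring
    _ = _ := lintegral_const_mul _ hF

lemma lintegral_sqInt {V : ℝ × ℝ → ℝ} (hV : BM V) (hV0 : ∀ z, 0 ≤ V z) (ℓ : ℝ) :
    ∫⁻ b, ∫⁻ a, ENNReal.ofReal (sqInt a b ℓ V) =
      ENNReal.ofReal ℓ * (ENNReal.ofReal ℓ * ∫⁻ z, ENNReal.ofReal (V z)) := by
  have hm : Measurable fun z => ENNReal.ofReal (V z) := hV.1.ennreal_ofReal
  calc _ = ∫⁻ b, ∫⁻ a, ∫⁻ x, ∫⁻ y, ENNReal.ofReal (V (x, y)) ∂(IM b ℓ) ∂(IM a ℓ) := by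
        refine lintegral_congr fun b => lintegral_congr fun a => ?_
        rw [sqInt, ofReal_integral_eq_lintegral_ofReal (hV.integrable _)
          (Eventually.of_forall hV0), lintegral_prod _ hm.aemeasurable]
    _ = ∫⁻ b, ENNReal.ofReal ℓ * ∫⁻ y, (∫⁻ x, ENNReal.ofReal (V (x, y))) ∂(IM b ℓ) := by
        refine lintegral_congr fun b => ?_
        rw [lintegral_IM (F := fun x => ∫⁻ y, ENNReal.ofReal (V (x, y)) ∂(IM b ℓ))
          hm.lintegral_prod_right', lintegral_lintegral_swap (by exact hm.aemeasurable)]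
    _ = _ := by
        rw [lintegral_const_mul' _ _ ENNReal.ofReal_ne_top,
          lintegral_IM (F := fun y => ∫⁻ x, ENNReal.ofReal (V (x, y))) hm.lintegral_prod_left',
          Measure.volume_eq_prod, lintegral_prod_symm _ hm.aemeasurable]

section Average

variable {ι : Type*} [Fintype ι]

lemma locForm_nonneg (a b ℓ : ℝ) (f : ℝ × ℝ → ℝ) (h g : ι → ℝ × ℝ → ℝ) :
    0 ≤ locForm a b ℓ f h g :=
  mul_nonneg (by positivity) (integral_nonneg fun _ => abs_nonneg _)

lemma genSum_nonneg (f : ℝ × ℝ → ℝ) (h : ι → ℝ × ℝ → ℝ) (n : ℕ) :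
    ∀ (a b ℓ : ℝ) (g : ℕ → ι → ℝ × ℝ → ℝ), 0 ≤ genSum f h n a b ℓ g := by
  induction n with
  | zero => exact fun _ _ _ _ => le_rfl
  | succ n ih =>
    intro a b ℓ g
    rw [genSum]
    have := locForm_nonneg a b ℓ f h (g 0)
    have := ih a b (ℓ / 2) fun j => g (j + 1)
    have := ih (a + ℓ / 2) b (ℓ / 2) fun j => g (j + 1)
    have := ih a (b + ℓ / 2) (ℓ / 2) fun j => g (j + 1)
    have := ih (a + ℓ / 2) (b + ℓ / 2) (ℓ / 2) fun j => g (j + 1)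
    linarith

lemma sum_locForm_le (f : ℝ × ℝ → ℝ) (h : ι → ℝ × ℝ → ℝ) (n : ℕ) :
    ∀ (L : ℝ) (g : ℕ → ι → ℝ × ℝ → ℝ),
    ∑ j ∈ Finset.range n, ENNReal.ofReal (((L / 2 ^ j) ^ 2)⁻¹) *
      (∫⁻ b, ∫⁻ a, ENNReal.ofReal (locForm a b (L / 2 ^ j) f h (g j))) ≤
    ENNReal.ofReal ((L ^ 2)⁻¹) * ∫⁻ b, ∫⁻ a, ENNReal.ofReal (genSum f h n a b L g) := by
  induction n with
  | zero => simp
  | succ n ih =>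
    intro L g
    rw [Finset.sum_range_succ']
    have h1 := ih (L / 2) fun j => g (j + 1)
    have h2 : ∀ j : ℕ, L / 2 / 2 ^ j = L / 2 ^ (j + 1) := fun j => by
      rw [pow_succ']
      field_simp
    simp only [h2] at h1
    refine (add_le_add_left h1 _).trans ?_
    set G : ℝ → ℝ → ℝ≥0∞ := fun a b =>
      ENNReal.ofReal (genSum f h n a b (L / 2) fun j => g (j + 1)) with hG
    have h3 : ENNReal.ofReal (((L / 2) ^ 2)⁻¹) = ENNReal.ofReal ((L ^ 2)⁻¹) * 4 := by
      rw [← ENNReal.ofReal_ofNat, ← ENNReal.ofReal_mul (by positivity)]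
      congr 1
      rw [div_pow, inv_div, div_eq_mul_inv]
      ring
    have hsum : ∀ a b, ENNReal.ofReal (genSum f h (n + 1) a b L g) =
        (G a b + G (a + L / 2) b + G a (b + L / 2) + G (a + L / 2) (b + L / 2)) +
          ENNReal.ofReal (locForm a b L f h (g 0)) := by
      intro a b
      have n0 := locForm_nonneg a b L f h (g 0)
      have n1 := genSum_nonneg f h n a b (L / 2) fun j => g (j + 1)
      have n2 := genSum_nonneg f h n (a + L / 2) b (L / 2) fun j => g (j + 1)
      have n3 := genSum_nonneg f h n a (b + L / 2) (L / 2) fun j => g (j + 1)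
      have n4 := genSum_nonneg f h n (a + L / 2) (b + L / 2) (L / 2) fun j => g (j + 1)
      rw [genSum, ENNReal.ofReal_add n0 (by linarith), ENNReal.ofReal_add (by linarith) n4,
        ENNReal.ofReal_add (by linarith) n3, ENNReal.ofReal_add n1 n2, add_comm]
    have hadd : ∀ u v : ℝ → ℝ → ℝ≥0∞, (∫⁻ b, ∫⁻ a, u a b) + (∫⁻ b, ∫⁻ a, v a b) ≤
        ∫⁻ b, ∫⁻ a, (u a b + v a b) := fun u v =>
      (le_lintegral_add _ _).trans (lintegral_mono fun b => le_lintegral_add _ _)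
    have t1 : ∀ b, ∫⁻ a, G (a + L / 2) b = ∫⁻ a, G a b := fun b =>
      lintegral_add_right_eq_self (fun a => G a b) _
    have t2 : (∫⁻ b, ∫⁻ a, G a (b + L / 2)) = ∫⁻ b, ∫⁻ a, G a b :=
      lintegral_add_right_eq_self (fun b => ∫⁻ a, G a b) _
    have t3 : (∫⁻ b, ∫⁻ a, G (a + L / 2) (b + L / 2)) = ∫⁻ b, ∫⁻ a, G a b := by
      rw [← t2]
      exact lintegral_congr fun b => t1 _
    have t1' : (∫⁻ b, ∫⁻ a, G (a + L / 2) b) = ∫⁻ b, ∫⁻ a, G a b := lintegral_congr t1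
    rw [h3, mul_assoc, pow_zero, div_one, ← mul_add]
    refine mul_le_mul_right ?_ _
    simp only [hsum]
    refine le_trans (add_le_add_left ?_ _) (hadd _ _)
    refine le_trans ?_ ((add_le_add_left ((add_le_add_left (hadd _ _) _).trans (hadd _ _)) _).trans
      (hadd _ _))
    rw [t1', t2, t3]
    refine le_of_eq ?_
    ring

/-- The telescoped estimate after averaging over all translates of the dyadic grid. -/
theorem sum_scales_le {f : ℝ × ℝ → ℝ} {h : ι → ℝ × ℝ → ℝ} (hf : BM f) (hh : ∀ i, BC (h i))
    {Mf Mg Mh ug : ℝ × ℝ → ℝ} (hMf : BM Mf) (hMg : BM Mg) (hMh : BM Mh) (hug : BM ug)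
    (hug0 : ∀ z, 0 ≤ ug z) (hdf : DomSq (fun z => f z ^ 2) Mf) (hdg : DomSq ug Mg)
    (hdh : DomSq (fun z => ∑ i, h i z ^ 2) Mh) (n : ℕ) {L : ℝ} (hL : 0 < L)
    {β : ℕ → ℝ → ℝ} (hβ : ∀ j, BM (β j)) (hβ1 : ∀ j t, |β j t| ≤ 1)
    {g : ℕ → ι → ℝ × ℝ → ℝ} (hg : ∀ j i, BM (g j i))
    (hgu : ∀ z, ∑ j ∈ Finset.range n, ∑ i, g j i z ^ 2 ≤ ug z) :
    ∑ j ∈ Finset.range n, ‖∫ z, ∑ i, h i z *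
      (fconv (tent (β j) (L / 2 ^ j)) (fun t => f (t, z.2)) z.1 *
        fconv (eta (L / 2 ^ j)) (fun t => g j i (z.1, t)) z.2)‖ₑ ≤
      11 * ∫⁻ z, ENNReal.ofReal (Mf z * Mg z * Mh z) := by
  have nn : ∀ {u M : ℝ × ℝ → ℝ}, DomSq u M → ∀ z, 0 ≤ M z := fun hd z =>
    (hd (z.1 - 1) (z.2 - 1) 1 one_pos z ⟨by simp, by simp⟩).1
  have hV0 : ∀ z, 0 ≤ Mf z * Mg z * Mh z := fun z =>
    mul_nonneg (mul_nonneg (nn hdf z) (nn hdg z)) (nn hdh z)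
  calc _ ≤ _ := Finset.sum_le_sum fun j _ =>
        scale_le (by positivity) (hβ j) (hβ1 j) hf hh (hg j)
    _ ≤ _ := sum_locForm_le f h n L g
    _ ≤ ENNReal.ofReal ((L ^ 2)⁻¹) * ∫⁻ b, ∫⁻ a, 11 *
          ENNReal.ofReal (sqInt a b L fun z => Mf z * Mg z * Mh z) := by
        refine mul_le_mul_right (lintegral_mono fun b => lintegral_mono fun a => ?_) _
        rw [← ENNReal.ofReal_ofNat, ← ENNReal.ofReal_mul (by norm_num)]
        exact ENNReal.ofReal_le_ofReal (genSum_le hf (fun i => (hh i).1) hMf hMg hMh hug hug0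
          hdf hdg hdh n a b L hL g hg hgu)
    _ = _ := by
        simp_rw [lintegral_const_mul' (11 : ℝ≥0∞) _ (by norm_num)]
        rw [lintegral_sqInt ((hMf.mul hMg).mul hMh) hV0, mul_left_comm, ← mul_assoc
          (ENNReal.ofReal L), ← mul_assoc (ENNReal.ofReal _), ← ENNReal.ofReal_mul hL.le,
          ← ENNReal.ofReal_mul (by positivity)]
        have : (L ^ 2)⁻¹ * (L * L) = 1 := by field_simp
        rw [this, ENNReal.ofReal_one, one_mul]

end Average

/-! ### Maximal majorants and Hölder's inequality -/

/-- The square root of (a multiple of) the strong maximal function. -/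
def Msq (u : ℝ × ℝ → ℝ) (z : ℝ × ℝ) : ℝ :=
  Real.sqrt (4 * (Mx (My fun w => ENNReal.ofReal (u w)) z).toReal)

lemma Msq_nonneg (u : ℝ × ℝ → ℝ) (z : ℝ × ℝ) : 0 ≤ Msq u z := Real.sqrt_nonneg _

/-- The `L^P` norm of the square root of `u`. -/
def nq (P : ℝ) (u : ℝ × ℝ → ℝ) : ℝ≥0∞ := (∫⁻ z, ENNReal.ofReal (u z) ^ (P / 2)) ^ (1 / P)

lemma MxMy_le {u : ℝ × ℝ → ℝ} {C : ℝ} (hC : ∀ z, |u z| ≤ C) (z : ℝ × ℝ) :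
    Mx (My fun w => ENNReal.ofReal (u w)) z ≤ 2 * (2 * ENNReal.ofReal C) :=
  HL_le_of_le (fun _ => HL_le_of_le (fun _ =>
    ENNReal.ofReal_le_ofReal ((le_abs_self _).trans (hC _))) _) _

lemma MxMy_ne_top {u : ℝ × ℝ → ℝ} (hu : BM u) (z : ℝ × ℝ) :
    Mx (My fun w => ENNReal.ofReal (u w)) z ≠ ⊤ := by
  obtain ⟨C, hC⟩ := hu.2
  exact ((MxMy_le hC z).trans_lt (ENNReal.mul_lt_top (by norm_num)
    (ENNReal.mul_lt_top (by norm_num) ENNReal.ofReal_lt_top))).ne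

lemma Msq_bm {u : ℝ × ℝ → ℝ} (hu : BM u) : BM (Msq u) := by
  have hm : Measurable (Mx (My fun w => ENNReal.ofReal (u w))) :=
    measurable_Mx (measurable_My hu.1.ennreal_ofReal)
  obtain ⟨C, hC⟩ := hu.2
  refine ⟨(hm.ennreal_toReal.const_mul 4).sqrt,
    Real.sqrt (4 * (2 * (2 * ENNReal.ofReal C)).toReal), fun z => ?_⟩
  rw [Msq, abs_of_nonneg (Real.sqrt_nonneg _)]
  refine Real.sqrt_le_sqrt (mul_le_mul_of_nonneg_left (ENNReal.toReal_mono ?_ (MxMy_le hC z))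
    (by norm_num))
  exact ENNReal.mul_ne_top (by norm_num) (ENNReal.mul_ne_top (by norm_num) ENNReal.ofReal_ne_top)

lemma domSq_Msq {u : ℝ × ℝ → ℝ} (hu : BM u) (hu0 : ∀ z, 0 ≤ u z) : DomSq u (Msq u) := by
  intro a b ℓ hℓ z hz
  refine ⟨Real.sqrt_nonneg _, ?_⟩
  obtain ⟨k, hk1, hk2⟩ : ∃ k : ℤ, ℓ ≤ (2 : ℝ) ^ k ∧ (2 : ℝ) ^ k < 2 * ℓ := by
    obtain ⟨n, hn1, hn2⟩ := exists_mem_Ioc_zpow hℓ (one_lt_two (α := ℝ))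
    refine ⟨n + 1, hn2, ?_⟩
    rw [zpow_add_one₀ two_ne_zero]
    linarith
  have hm : Measurable fun z => ENNReal.ofReal (u z) := hu.1.ennreal_ofReal
  have hball : ∀ a x : ℝ, x ∈ Set.Ioc a (a + ℓ) →
      Set.Ioc a (a + ℓ) ⊆ Metric.closedBall x ((2 : ℝ) ^ k) := by
    rintro a x ⟨hx1, hx2⟩ y ⟨hy1, hy2⟩
    rw [Metric.mem_closedBall, Real.dist_eq, abs_le]
    constructor <;> linarith
  have key : ENNReal.ofReal (sqInt a b ℓ u) ≤ ENNReal.ofReal ((2 : ℝ) ^ k) *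
      (ENNReal.ofReal ((2 : ℝ) ^ k) * Mx (My fun w => ENNReal.ofReal (u w)) z) := by
    rw [sqInt, ofReal_integral_eq_lintegral_ofReal (hu.integrable _)
      (Eventually.of_forall hu0), lintegral_prod _ hm.aemeasurable]
    calc _ ≤ ∫⁻ x, ENNReal.ofReal ((2 : ℝ) ^ k) *
          My (fun w => ENNReal.ofReal (u w)) (x, z.2) ∂(IM a ℓ) := by
          refine lintegral_mono fun x => ?_
          exact (lintegral_mono_set (hball b z.2 hz.2)).trans
            (lintegral_closedBall_le_HL (fun t => ENNReal.ofReal (u (x, t))) z.2 k)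
      _ = ENNReal.ofReal ((2 : ℝ) ^ k) * ∫⁻ x,
          My (fun w => ENNReal.ofReal (u w)) (x, z.2) ∂(IM a ℓ) :=
          lintegral_const_mul' _ _ ENNReal.ofReal_ne_top
      _ ≤ _ := by
          refine mul_le_mul_right ?_ _
          exact (lintegral_mono_set (hball a z.1 hz.1)).trans
            (lintegral_closedBall_le_HL
              (fun t => My (fun w => ENNReal.ofReal (u w)) (t, z.2)) z.1 k)
  have h2 := ENNReal.toReal_mono (ENNReal.mul_ne_top ENNReal.ofReal_ne_top
    (ENNReal.mul_ne_top ENNReal.ofReal_ne_top (MxMy_ne_top hu z))) key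
  have h2k : (0 : ℝ) < 2 ^ k := by positivity
  rw [ENNReal.toReal_ofReal (sqInt_nonneg a b ℓ hu0), ENNReal.toReal_mul, ENNReal.toReal_mul,
    ENNReal.toReal_ofReal h2k.le] at h2
  have h0 : 0 ≤ (Mx (My fun w => ENNReal.ofReal (u w)) z).toReal := ENNReal.toReal_nonneg
  rw [Msq, Real.sq_sqrt (by positivity)]
  refine h2.trans ?_
  have : (2 : ℝ) ^ k * 2 ^ k ≤ (2 * ℓ) * (2 * ℓ) := by gcongr
  nlinarith

lemma lintegral_Msq_le {P : ℝ} (hP : 2 < P) : ∃ C : ℝ≥0, ∀ u : ℝ × ℝ → ℝ, BM u →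
    ∫⁻ z, ENNReal.ofReal (Msq u z) ^ P ≤ C * ∫⁻ z, ENNReal.ofReal (u z) ^ (P / 2) := by
  obtain ⟨C₁, hC₁⟩ := lintegral_Mx_rpow_le (p := P / 2) (by linarith)
  obtain ⟨C₂, hC₂⟩ := lintegral_My_rpow_le (p := P / 2) (by linarith)
  refine ⟨(4 : ℝ≥0) ^ (P / 2) * (C₁ * C₂), fun u hu => ?_⟩
  have hm : Measurable fun z => ENNReal.ofReal (u z) := hu.1.ennreal_ofReal
  have hpt : ∀ z, ENNReal.ofReal (Msq u z) ^ P = (4 : ℝ≥0∞) ^ (P / 2) *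
      Mx (My fun w => ENNReal.ofReal (u w)) z ^ (P / 2) := by
    intro z
    rw [Msq, Real.sqrt_eq_rpow, ← ENNReal.ofReal_rpow_of_nonneg (by positivity) (by norm_num),
      ← ENNReal.rpow_mul, ENNReal.ofReal_mul (by norm_num), ENNReal.ofReal_toReal (MxMy_ne_top hu z),
      ENNReal.mul_rpow_of_nonneg _ _ (by linarith)]
    norm_num
    ring_nf
  simp only [hpt]
  rw [lintegral_const_mul' _ _ (ENNReal.rpow_ne_top_of_nonneg (by linarith) (by norm_num))]
  push_cast
  rw [ENNReal.coe_rpow_of_nonneg _ (by linarith), mul_assoc, mul_assoc]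
  refine mul_le_mul_right ((hC₁ _ (measurable_My hm)).trans (mul_le_mul_right ?_ _)) _
  exact hC₂ _ hm

lemma lintegral_mul_three_le {P Q S : ℝ} (hP : 2 < P) (hQ : 2 < Q) (hS : 2 < S)
    (hPQS : 1 / P + 1 / Q + 1 / S = 1) {a b c : ℝ × ℝ → ℝ≥0∞} (ha : Measurable a)
    (hb : Measurable b) (hc : Measurable c) :
    ∫⁻ z, a z * b z * c z ≤ (∫⁻ z, a z ^ P) ^ (1 / P) * (∫⁻ z, b z ^ Q) ^ (1 / Q) *
      (∫⁻ z, c z ^ S) ^ (1 / S) := by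
  have h := ENNReal.lintegral_prod_norm_pow_le (μ := (volume : Measure (ℝ × ℝ))) Finset.univ
    (f := ![fun z => a z ^ P, fun z => b z ^ Q, fun z => c z ^ S]) (p := ![1 / P, 1 / Q, 1 / S])
    (by
      intro i _
      fin_cases i
      exacts [(ha.pow_const _).aemeasurable, (hb.pow_const _).aemeasurable,
        (hc.pow_const _).aemeasurable])
    (by simpa [Fin.sum_univ_three] using hPQS)
    (by
      intro i _
      fin_cases i
      exacts [one_div_nonneg.2 (by linarith), one_div_nonneg.2 (by linarith),
        one_div_nonneg.2 (by linarith)])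
  simp only [Fin.prod_univ_three, Matrix.cons_val_zero, Matrix.cons_val_one,
    Matrix.cons_val] at h
  have e : ∀ {R : ℝ}, 2 < R → ∀ x : ℝ≥0∞, (x ^ R) ^ (1 / R) = x := fun hR x => by
    rw [← ENNReal.rpow_mul, mul_one_div_cancel (by linarith), ENNReal.rpow_one]
  simpa only [e hP, e hQ, e hS] using h

theorem sum_scales_nq {P Q S : ℝ} (hP : 2 < P) (hQ : 2 < Q) (hS : 2 < S)
    (hPQS : 1 / P + 1 / Q + 1 / S = 1) : ∃ C : ℝ≥0, ∀ (m n : ℕ) (L : ℝ), 0 < L →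
    ∀ (β : ℕ → ℝ → ℝ) (f ug : ℝ × ℝ → ℝ) (h : Fin m → ℝ × ℝ → ℝ) (g : ℕ → Fin m → ℝ × ℝ → ℝ),
    (∀ j, BM (β j)) → (∀ j t, |β j t| ≤ 1) → BM f → BM ug → (∀ z, 0 ≤ ug z) → (∀ i, BC (h i)) →
    (∀ j i, BM (g j i)) → (∀ z, ∑ j ∈ Finset.range n, ∑ i, g j i z ^ 2 ≤ ug z) →
    ∑ j ∈ Finset.range n, ‖∫ z, ∑ i, h i z *
      (fconv (tent (β j) (L / 2 ^ j)) (fun t => f (t, z.2)) z.1 *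
        fconv (eta (L / 2 ^ j)) (fun t => g j i (z.1, t)) z.2)‖ₑ ≤
      C * (nq P (fun z => f z ^ 2) * nq Q ug * nq S fun z => ∑ i, h i z ^ 2) := by
  obtain ⟨A, hA⟩ := lintegral_Msq_le hP
  obtain ⟨B, hB⟩ := lintegral_Msq_le hQ
  obtain ⟨D, hD⟩ := lintegral_Msq_le hS
  refine ⟨11 * (A ^ (1 / P) * B ^ (1 / Q) * D ^ (1 / S)),
    fun m n L hL β f ug h g hβ hβ1 hf hug hug0 hh hg hgu => ?_⟩
  have hf2 : BM fun z => f z ^ 2 := hf.pow 2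
  have hh2 : BM fun z => ∑ i, h i z ^ 2 := BM.sum _ fun i => (hh i).1.pow 2
  have h0 := sum_scales_le hf hh (Msq_bm hf2) (Msq_bm hug) (Msq_bm hh2) hug hug0
    (domSq_Msq hf2 fun z => sq_nonneg _) (domSq_Msq hug hug0)
    (domSq_Msq hh2 fun z => Finset.sum_nonneg fun i _ => sq_nonneg _) n hL hβ hβ1 hg hgu
  refine h0.trans ?_
  have h1 : ∀ z, ENNReal.ofReal (Msq (fun z => f z ^ 2) z * Msq ug z *
      Msq (fun z => ∑ i, h i z ^ 2) z) = ENNReal.ofReal (Msq (fun z => f z ^ 2) z) *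
      ENNReal.ofReal (Msq ug z) * ENNReal.ofReal (Msq (fun z => ∑ i, h i z ^ 2) z) := fun z => by
    rw [ENNReal.ofReal_mul (mul_nonneg (Msq_nonneg _ _) (Msq_nonneg _ _)),
      ENNReal.ofReal_mul (Msq_nonneg _ _)]
  simp only [h1]
  have h2 := lintegral_mul_three_le hP hQ hS hPQS (Msq_bm hf2).1.ennreal_ofReal
    (Msq_bm hug).1.ennreal_ofReal (Msq_bm hh2).1.ennreal_ofReal
  have e : ∀ {R : ℝ} {E : ℝ≥0} {u : ℝ × ℝ → ℝ}, 2 < R →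
      (∫⁻ z, ENNReal.ofReal (Msq u z) ^ R ≤ E * ∫⁻ z, ENNReal.ofReal (u z) ^ (R / 2)) →
      (∫⁻ z, ENNReal.ofReal (Msq u z) ^ R) ^ (1 / R) ≤ (E : ℝ≥0∞) ^ (1 / R) * nq R u := by
    intro R E u hR hE
    have hR' : 0 ≤ 1 / R := one_div_nonneg.2 (by linarith)
    refine (ENNReal.rpow_le_rpow hE hR').trans ?_
    rw [ENNReal.mul_rpow_of_nonneg _ _ hR', nq]
  refine (mul_le_mul_right (h2.trans (mul_le_mul' (mul_le_mul' (e hP (hA _ hf2)) (e hQ (hB _ hug)))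
    (e hS (hD _ hh2)))) _).trans (le_of_eq ?_)
  push_cast
  rw [ENNReal.coe_rpow_of_nonneg _ (one_div_nonneg.2 (by linarith)),
    ENNReal.coe_rpow_of_nonneg _ (one_div_nonneg.2 (by linarith)),
    ENNReal.coe_rpow_of_nonneg _ (one_div_nonneg.2 (by linarith))]
  ring

/-! ### General kernels in the first variable -/

lemma map_dilate {D : ℝ} (hD : 0 < D) :
    Measure.map (fun z : ℝ × ℝ => (D * z.1, z.2)) volume = ENNReal.ofReal D⁻¹ • volume := by
  have h := Measure.map_prod_map (volume : Measure ℝ) (volume : Measure ℝ)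
    (f := fun x => D * x) (g := id) (by fun_prop) measurable_id
  rw [Real.map_volume_mul_left hD.ne', Measure.map_id, Measure.prod_smul_left,
    abs_of_pos (by positivity)] at h
  rw [Measure.volume_eq_prod, h]
  rfl

lemma integral_dilate {D : ℝ} (hD : 0 < D) {F : ℝ × ℝ → ℝ} (hF : Measurable F) :
    ∫ z : ℝ × ℝ, F (D * z.1, z.2) = D⁻¹ * ∫ z, F z := by
  rw [← integral_map (φ := fun z : ℝ × ℝ => (D * z.1, z.2)) (f := F)
    (by fun_prop) hF.aestronglyMeasurable, map_dilate hD, integral_smul_measure,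
    ENNReal.toReal_ofReal (by positivity), smul_eq_mul]

lemma nq_dilate {D P : ℝ} (hD : 0 < D) (hP : 0 < P) {u : ℝ × ℝ → ℝ} (hu : Measurable u) :
    nq P (fun z => u (D * z.1, z.2)) = ENNReal.ofReal D⁻¹ ^ (1 / P) * nq P u := by
  have hm : Measurable fun z => ENNReal.ofReal (u z) ^ (P / 2) := hu.ennreal_ofReal.pow_const _
  rw [nq, ← lintegral_map (f := fun z => ENNReal.ofReal (u z) ^ (P / 2))
    (g := fun z : ℝ × ℝ => (D * z.1, z.2)) hm (by fun_prop), map_dilate hD,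
    lintegral_smul_measure, smul_eq_mul, ENNReal.mul_rpow_of_nonneg _ _ (by positivity), nq]

lemma fconv_tent_dilate {D ℓ : ℝ} (hD : 0 < D) (β : ℝ → ℝ) (u : ℝ → ℝ) (x : ℝ) :
    fconv (tent (fun t => β (D * t)) ℓ) (fun t => u (D * t)) x =
      fconv (tent β (D * ℓ)) u (D * x) := by
  have h := Measure.integral_comp_mul_left (fun s => tent β (D * ℓ) (D * x - s) • u s) D
  rw [abs_of_pos (by positivity), smul_eq_mul, inv_mul_eq_div, eq_div_iff hD.ne'] at h
  rw [fconv, fconv, ← h, ← integral_mul_const]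
  refine integral_congr_ae (Eventually.of_forall fun t => ?_)
  simp only [tent, smul_eq_mul, ← mul_sub, abs_mul, abs_of_pos hD]
  have : max (D * (ℓ - |x - t|)) 0 = D * max (ℓ - |x - t|) 0 := by
    rw [mul_max_of_nonneg _ _ hD.le, mul_zero]
  rw [this]
  field_simp

theorem sum_scales_dilate {P Q S : ℝ} (hP : 2 < P) (hQ : 2 < Q) (hS : 2 < S)
    (hPQS : 1 / P + 1 / Q + 1 / S = 1) : ∃ C : ℝ≥0, ∀ (m n : ℕ) (L D : ℝ), 0 < L → 0 < D →
    ∀ (β : ℕ → ℝ → ℝ) (f ug : ℝ × ℝ → ℝ) (h : Fin m → ℝ × ℝ → ℝ) (g : ℕ → Fin m → ℝ × ℝ → ℝ),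
    (∀ j, BM (β j)) → (∀ j t, |β j t| ≤ 1) → BM f → BM ug → (∀ z, 0 ≤ ug z) → (∀ i, BC (h i)) →
    (∀ j i, BM (g j i)) → (∀ z, ∑ j ∈ Finset.range n, ∑ i, g j i z ^ 2 ≤ ug z) →
    ∑ j ∈ Finset.range n, ‖∫ z, ∑ i, h i z *
      (fconv (tent (β j) (D * (L / 2 ^ j))) (fun t => f (t, z.2)) z.1 *
        fconv (eta (L / 2 ^ j)) (fun t => g j i (z.1, t)) z.2)‖ₑ ≤
      C * (nq P (fun z => f z ^ 2) * nq Q ug * nq S fun z => ∑ i, h i z ^ 2) := by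
  obtain ⟨C, hC⟩ := sum_scales_nq hP hQ hS hPQS
  refine ⟨C, fun m n L D hL hD β f ug h g hβ hβ1 hf hug hug0 hh hg hgu => ?_⟩
  have hδ : Measurable fun z : ℝ × ℝ => (D * z.1, z.2) := by fun_prop
  have hBC : ∀ i, BC fun z : ℝ × ℝ => h i (D * z.1, z.2) := fun i => by
    refine ⟨(hh i).1.comp hδ, (hh i).2.elim fun R hR => ⟨max (R / D) R, fun z hz => hR _ ?_⟩⟩
    rw [Prod.norm_def, lt_max_iff, max_lt_iff, max_lt_iff] at hz
    rw [Prod.norm_def, lt_max_iff]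
    simp only [norm_mul, Real.norm_eq_abs, abs_of_pos hD] at hz ⊢
    rcases hz with h1 | h1
    · left
      have := (div_lt_iff₀ hD).1 h1.1
      linarith
    · exact Or.inr h1.2
  have h1 := hC m n L hL (fun j t => β j (D * t)) (fun z => f (D * z.1, z.2))
    (fun z => ug (D * z.1, z.2)) (fun i z => h i (D * z.1, z.2))
    (fun j i z => g j i (D * z.1, z.2)) (fun j => (hβ j).comp (by fun_prop))
    (fun j t => hβ1 j _) (hf.comp hδ) (hug.comp hδ) (fun z => hug0 _) hBC
    (fun j i => (hg j i).comp hδ) (fun z => hgu _)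
  have hF : ∀ j, Measurable fun z : ℝ × ℝ => ∑ i, h i z *
      (fconv (tent (β j) (D * (L / 2 ^ j))) (fun t => f (t, z.2)) z.1 *
        fconv (eta (L / 2 ^ j)) (fun t => g j i (z.1, t)) z.2) := fun j =>
    (BM.sum _ fun i => (hh i).1.mul ((hf.fconv_fst (tent_bm (hβ j) (by positivity)).1
      (tent_integrable (hβ j) (by positivity))).mul ((hg j i).fconv_snd (eta_bm _).1
        (eta_integrable _)))).1
  have h2 : ∀ j, (∫ z : ℝ × ℝ, ∑ i, h i (D * z.1, z.2) *
      (fconv (tent (fun t => β j (D * t)) (L / 2 ^ j)) (fun t => f (D * t, z.2)) z.1 *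
        fconv (eta (L / 2 ^ j)) (fun t => g j i (D * z.1, t)) z.2)) = D⁻¹ * ∫ z, ∑ i, h i z *
      (fconv (tent (β j) (D * (L / 2 ^ j))) (fun t => f (t, z.2)) z.1 *
        fconv (eta (L / 2 ^ j)) (fun t => g j i (z.1, t)) z.2) := fun j => by
    rw [← integral_dilate hD (hF j)]
    refine integral_congr_ae (Eventually.of_forall fun z => ?_)
    simp only
    rw [fconv_tent_dilate hD (β j) (fun t => f (t, z.2)) z.1]
  simp only [h2, enorm_mul, ← Finset.mul_sum] at h1
  have e2 : (fun z : ℝ × ℝ => f (D * z.1, z.2) ^ 2) = fun z => (fun w => f w ^ 2) (D * z.1, z.2) := rfl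
  have e3 : (fun z : ℝ × ℝ => ∑ i, h i (D * z.1, z.2) ^ 2) =
    fun z => (fun w => ∑ i, h i w ^ 2) (D * z.1, z.2) := rfl
  rw [e2, e3, nq_dilate hD (by linarith) (hf.pow 2).1, nq_dilate hD (by linarith) hug.1,
    nq_dilate hD (by linarith) (BM.sum _ fun i => (hh i).1.pow 2).1,
    Real.enorm_of_nonneg (by positivity)] at h1
  have hd0 : ENNReal.ofReal D⁻¹ ≠ 0 := by simpa using hD
  refine (ENNReal.mul_le_mul_iff_right hd0 ENNReal.ofReal_ne_top).1 (h1.trans (le_of_eq ?_))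
  have : ENNReal.ofReal D⁻¹ = ENNReal.ofReal D⁻¹ ^ (1 / P) * ENNReal.ofReal D⁻¹ ^ (1 / Q) *
      ENNReal.ofReal D⁻¹ ^ (1 / S) := by
    rw [← ENNReal.rpow_add _ _ hd0 ENNReal.ofReal_ne_top,
      ← ENNReal.rpow_add _ _ hd0 ENNReal.ofReal_ne_top, hPQS, ENNReal.rpow_one]
  conv_rhs => rw [this]
  ring

lemma fconv_rdil_eq {E : Type*} [NormedAddCommGroup E] [NormedSpace ℝ E] (K : ℝ → ℝ) (k : ℤ)
    (u : ℝ → E) (x : ℝ) :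
    fconv (rdil K k) u x = ∫ t, K t • u (x - ((2 : ℝ) ^ k)⁻¹ * t) := by
  have h2k : (0 : ℝ) < 2 ^ k := by positivity
  have h := Measure.integral_comp_mul_left (fun t => K t • u (x - ((2 : ℝ) ^ k)⁻¹ * t)) ((2 : ℝ) ^ k)
  rw [abs_of_pos (by positivity), eq_inv_smul_iff₀ h2k.ne', ← integral_smul] at h
  rw [← h, fconv, ← integral_sub_left_eq_self _ volume x]
  refine integral_congr_ae (Eventually.of_forall fun t => ?_)
  simp only [rdil, smul_smul, sub_sub_cancel, inv_mul_cancel_left₀ h2k.ne']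

lemma integral_mul_fconv_rdil {w : ℝ × ℝ → ℝ} (hw : BC w) {f : ℝ × ℝ → ℝ} (hf : BM f) {K : ℝ → ℝ}
    (hKm : Measurable K) (hK : Integrable K) (k : ℤ) :
    ∫ z, w z * fconv (rdil K k) (fun t => f (t, z.2)) z.1 =
      ∫ t, K t * ∫ z : ℝ × ℝ, w z * f (z.1 - ((2 : ℝ) ^ k)⁻¹ * t, z.2) := by
  obtain ⟨C, hC⟩ := hf.2
  have hintg : Integrable (Function.uncurry fun (z : ℝ × ℝ) (t : ℝ) =>
      K t * (w z * f (z.1 - ((2 : ℝ) ^ k)⁻¹ * t, z.2))) (volume.prod volume) := by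
    refine (((hw.integrable volume).mul_prod hK).norm.mul_const C).mono' ?_
      (Eventually.of_forall fun v => ?_)
    · refine Measurable.aestronglyMeasurable ?_
      have hw' := hw.1.1
      have hf' := hf.1
      unfold Function.uncurry
      fun_prop
    · simp only [Function.uncurry, norm_mul]
      rw [← mul_assoc, mul_comm ‖K v.2‖]
      exact mul_le_mul_of_nonneg_left (hC _) (by positivity)
  calc _ = ∫ z, ∫ t, K t * (w z * f (z.1 - ((2 : ℝ) ^ k)⁻¹ * t, z.2)) := by
        refine integral_congr_ae (Eventually.of_forall fun z => ?_)
        simp only [fconv_rdil_eq, ← integral_const_mul, smul_eq_mul]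
        refine integral_congr_ae (Eventually.of_forall fun t => ?_)
        simp only
        ring
    _ = ∫ t, ∫ z : ℝ × ℝ, K t * (w z * f (z.1 - ((2 : ℝ) ^ k)⁻¹ * t, z.2)) :=
        integral_integral_swap hintg
    _ = _ := by simp only [integral_const_mul]

lemma rdil_tent (β : ℝ → ℝ) {D : ℝ} (k : ℤ) :
    rdil (tent β D) k = tent (fun t => β ((2 : ℝ) ^ k * t)) (D * ((2 : ℝ) ^ k)⁻¹) := by
  have h2k : (0 : ℝ) < 2 ^ k := by positivity
  funext t
  simp only [rdil, tent, abs_mul, abs_of_pos h2k]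
  have : max (D - 2 ^ k * |t|) 0 = 2 ^ k * max (D * ((2 : ℝ) ^ k)⁻¹ - |t|) 0 := by
    rw [mul_max_of_nonneg _ _ h2k.le, mul_zero, mul_sub]
    congr 2
    field_simp
  rw [this, mul_pow, mul_inv, inv_pow, inv_inv]
  ring

lemma bm_shift_integral {w : ℝ × ℝ → ℝ} (hw : BC w) {f : ℝ × ℝ → ℝ} (hf : BM f) (c : ℝ) :
    BM fun t : ℝ => ∫ z : ℝ × ℝ, w z * f (z.1 - c * t, z.2) := by
  obtain ⟨C, hC⟩ := hf.2
  have hw' := hw.1.1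
  have hf' := hf.1
  refine ⟨?_, C * ∫ z, |w z|, fun t => ?_⟩
  · have : StronglyMeasurable (Function.uncurry fun (t : ℝ) (z : ℝ × ℝ) =>
        w z * f (z.1 - c * t, z.2)) := by
      refine Measurable.stronglyMeasurable ?_
      unfold Function.uncurry
      fun_prop
    exact this.integral_prod_right.measurable
  · rw [← integral_const_mul, ← Real.norm_eq_abs]
    refine norm_integral_le_of_norm_le (f := fun z : ℝ × ℝ => w z * f (z.1 - c * t, z.2))
      ((hw.integrable volume).abs.const_mul C) (Eventually.of_forall fun z => ?_)
    rw [norm_mul, Real.norm_eq_abs, Real.norm_eq_abs, mul_comm]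
    exact mul_le_mul_of_nonneg_right (hC _) (abs_nonneg _)

lemma lintegral_tent_mul_enorm {ρ : ℝ → ℝ} (hρ : BM ρ) {D : ℝ} (hD : 0 < D) :
    ∃ β : ℝ → ℝ, BM β ∧ (∀ t, |β t| ≤ 1) ∧
      ∫⁻ t, ENNReal.ofReal ((D ^ 2)⁻¹ * max (D - |t|) 0) * ‖ρ t‖ₑ = ‖∫ t, tent β D t * ρ t‖ₑ := by
  have hm : Measurable fun t => if 0 ≤ ρ t then (1 : ℝ) else -1 :=
    Measurable.ite (measurableSet_le measurable_const hρ.1) measurable_const measurable_const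
  have h1 : ∀ t, |if 0 ≤ ρ t then (1 : ℝ) else -1| ≤ 1 := fun t => by split_ifs <;> simp
  refine ⟨fun t => if 0 ≤ ρ t then 1 else -1, ⟨hm, 1, h1⟩, h1, ?_⟩
  have e : ∀ t, tent (fun t => if 0 ≤ ρ t then 1 else -1) D t * ρ t =
      (D ^ 2)⁻¹ * max (D - |t|) 0 * |ρ t| := fun t => by
    simp only [tent]
    split_ifs with h
    · rw [abs_of_nonneg h]
      ring
    · rw [abs_of_neg (not_le.1 h)]
      ring
  have h0 : ∀ t, 0 ≤ tent (fun t => if 0 ≤ ρ t then 1 else -1) D t * ρ t := fun t => by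
    rw [e]
    positivity
  obtain ⟨C, hC⟩ := hρ.2
  have hintg : Integrable fun t => tent (fun t => if 0 ≤ ρ t then 1 else -1) D t * ρ t :=
    (tent_integrable ⟨hm, 1, h1⟩ hD).mul_bdd (c := C) hρ.1.aestronglyMeasurable
      (Eventually.of_forall fun t => hC t)
  rw [Real.enorm_of_nonneg (integral_nonneg h0),
    ofReal_integral_eq_lintegral_ofReal hintg (Eventually.of_forall h0)]
  refine lintegral_congr fun t => ?_
  rw [e, ENNReal.ofReal_mul (p := (D ^ 2)⁻¹ * max (D - |t|) 0) (by positivity),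
    Real.enorm_eq_ofReal_abs]

theorem sum_scales_tent {P Q S : ℝ} (hP : 2 < P) (hQ : 2 < Q) (hS : 2 < S)
    (hPQS : 1 / P + 1 / Q + 1 / S = 1) : ∃ C : ℝ≥0, ∀ (m n N : ℕ) (D : ℝ), 0 < D →
    ∀ (f ug : ℝ × ℝ → ℝ) (h : Fin m → ℝ × ℝ → ℝ) (g : ℕ → Fin m → ℝ × ℝ → ℝ),
    BM f → BM ug → (∀ z, 0 ≤ ug z) → (∀ i, BC (h i)) →
    (∀ j i, BM (g j i)) → (∀ z, ∑ j ∈ Finset.range n, ∑ i, g j i z ^ 2 ≤ ug z) →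
    ∑ j ∈ Finset.range n, (∫⁻ t, ENNReal.ofReal ((D ^ 2)⁻¹ * max (D - |t|) 0) *
      ‖∫ z : ℝ × ℝ, (∑ i, h i z *
        fconv (eta ((2 : ℝ) ^ ((N : ℤ) - 1) / 2 ^ j)) (fun t => g j i (z.1, t)) z.2) *
        f (z.1 - ((2 : ℝ) ^ ((j : ℤ) - N))⁻¹ * t, z.2)‖ₑ) ≤
      C * (nq P (fun z => f z ^ 2) * nq Q ug * nq S fun z => ∑ i, h i z ^ 2) := by
  obtain ⟨C, hC⟩ := sum_scales_dilate hP hQ hS hPQS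
  refine ⟨C, fun m n N D hD f ug h g hf hug hug0 hh hg hgu => ?_⟩
  set L : ℝ := (2 : ℝ) ^ ((N : ℤ) - 1) with hL
  have hL0 : 0 < L := by positivity
  have hLj : ∀ j : ℕ, D * ((2 : ℝ) ^ ((j : ℤ) - N))⁻¹ = 2 * D * (L / 2 ^ j) := fun j => by
    rw [hL, zpow_sub₀ two_ne_zero, zpow_sub₀ two_ne_zero, zpow_natCast, zpow_natCast, zpow_one]
    field_simp
  have hw : ∀ j, BC fun z : ℝ × ℝ => ∑ i, h i z *
      fconv (eta (L / 2 ^ j)) (fun t => g j i (z.1, t)) z.2 := fun j =>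
    BC.sum _ fun i => (hh i).mul_bm ((hg j i).fconv_snd (eta_bm _).1 (eta_integrable _))
  choose β hβ hβ1 hβe using fun j : ℕ => lintegral_tent_mul_enorm
    (bm_shift_integral (hw j) hf ((2 : ℝ) ^ ((j : ℤ) - N))⁻¹) hD
  have key := hC m n L (2 * D) hL0 (by positivity)
    (fun j t => β j ((2 : ℝ) ^ ((j : ℤ) - N) * t)) f ug h g
    (fun j => (hβ j).comp (by fun_prop)) (fun j t => hβ1 j _) hf hug hug0 hh hg hgu
  refine (Finset.sum_congr rfl fun j _ => ?_).trans_le key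
  rw [hβe, ← hLj, ← rdil_tent, ← integral_mul_fconv_rdil (hw j) hf (tent_bm (hβ j) hD).1
    (tent_integrable (hβ j) hD)]
  congr 1
  refine integral_congr_ae (Eventually.of_forall fun z => ?_)
  simp only [Finset.sum_mul]
  exact Finset.sum_congr rfl fun i _ => by ring

lemma inv_cube_le_tsum (t : ℝ) : ENNReal.ofReal (1 / (1 + |t|) ^ 3) ≤
    ∑' n : ℕ, ENNReal.ofReal (32 * (1 / 4) ^ n) *
      ENNReal.ofReal (((2 ^ (n + 1)) ^ 2)⁻¹ * max (2 ^ (n + 1) - |t|) 0) := by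
  have hex : ∃ n : ℕ, |t| ≤ 2 ^ n := pow_unbounded_of_one_lt |t| one_lt_two |>.imp fun _ => le_of_lt
  classical
  obtain ⟨n, h1, h2⟩ : ∃ n : ℕ, |t| ≤ 2 ^ n ∧ (2 : ℝ) ^ n ≤ 2 * (1 + |t|) := by
    refine ⟨Nat.find hex, Nat.find_spec hex, ?_⟩
    rcases h : Nat.find hex with _ | n
    · rw [pow_zero]
      linarith [abs_nonneg t]
    · have := Nat.find_min hex (m := n) (by omega)
      rw [pow_succ]
      linarith
  refine le_trans ?_ (ENNReal.le_tsum n)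
  rw [← ENNReal.ofReal_mul (by positivity)]
  refine ENNReal.ofReal_le_ofReal ?_
  have h3 : (2 : ℝ) ^ n ≤ max (2 ^ (n + 1) - |t|) 0 := by
    refine le_max_of_le_left ?_
    rw [pow_succ]
    linarith
  have h4 : (1 : ℝ) / (1 + |t|) ^ 3 ≤ 8 / (2 ^ n) ^ 3 := by
    rw [div_le_div_iff₀ (by positivity) (by positivity)]
    calc (1 : ℝ) * (2 ^ n) ^ 3 ≤ (2 * (1 + |t|)) ^ 3 := by
          rw [one_mul]
          exact pow_le_pow_left₀ (by positivity) h2 3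
      _ = _ := by ring
  refine h4.trans (le_trans (le_of_eq ?_) (mul_le_mul_of_nonneg_left
    (mul_le_mul_of_nonneg_left h3 (by positivity)) (by positivity)))
  have : (4 : ℝ) ^ n = (2 ^ n) ^ 2 := by
    rw [← pow_mul, mul_comm, pow_mul]
    norm_num
  rw [one_div, inv_pow, this, pow_succ (2 : ℝ) n]
  field_simp
  ring

/-- Summed trilinear estimate with a general kernel acting on the first variable. -/
theorem sum_scales_ker {P Q S : ℝ} (hP : 2 < P) (hQ : 2 < Q) (hS : 2 < S)
    (hPQS : 1 / P + 1 / Q + 1 / S = 1) {K : ℝ → ℝ} {CK : ℝ} (hK : IsKer K CK) :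
    ∃ C : ℝ≥0, ∀ (m n N : ℕ)
    (f ug : ℝ × ℝ → ℝ) (h : Fin m → ℝ × ℝ → ℝ) (g : ℕ → Fin m → ℝ × ℝ → ℝ),
    BM f → BM ug → (∀ z, 0 ≤ ug z) → (∀ i, BC (h i)) →
    (∀ j i, BM (g j i)) → (∀ z, ∑ j ∈ Finset.range n, ∑ i, g j i z ^ 2 ≤ ug z) →
    ∑ j ∈ Finset.range n, ‖∫ z : ℝ × ℝ, (∑ i, h i z *
        fconv (eta ((2 : ℝ) ^ ((N : ℤ) - 1) / 2 ^ j)) (fun t => g j i (z.1, t)) z.2) *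
        fconv (rdil K ((j : ℤ) - N)) (fun t => f (t, z.2)) z.1‖ₑ ≤
      C * (nq P (fun z => f z ^ 2) * nq Q ug * nq S fun z => ∑ i, h i z ^ 2) := by
  obtain ⟨C, hC⟩ := sum_scales_tent hP hQ hS hPQS
  have hsum : (∑' n : ℕ, ENNReal.ofReal (32 * (1 / 4) ^ n)) ≠ ∞ := by
    rw [← ENNReal.ofReal_tsum_of_nonneg (fun n => by positivity)
      ((summable_geometric_of_lt_one (by norm_num) (by norm_num)).mul_left _)]
    exact ENNReal.ofReal_ne_top
  refine ⟨CK.toNNReal * ((∑' n : ℕ, ENNReal.ofReal (32 * (1 / 4) ^ n)).toNNReal * C),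
    fun m n N f ug h g hf hug hug0 hh hg hgu => ?_⟩
  have hw : ∀ j : ℕ, BC fun z : ℝ × ℝ => ∑ i, h i z *
      fconv (eta ((2 : ℝ) ^ ((N : ℤ) - 1) / 2 ^ j)) (fun t => g j i (z.1, t)) z.2 := fun j =>
    BC.sum _ fun i => (hh i).mul_bm ((hg j i).fconv_snd (eta_bm _).1 (eta_integrable _))
  set ρ : ℕ → ℝ → ℝ := fun j t => ∫ z : ℝ × ℝ, (∑ i, h i z *
    fconv (eta ((2 : ℝ) ^ ((N : ℤ) - 1) / 2 ^ j)) (fun t => g j i (z.1, t)) z.2) *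
      f (z.1 - ((2 : ℝ) ^ ((j : ℤ) - N))⁻¹ * t, z.2) with hρ
  have hρm : ∀ j, BM (ρ j) := fun j => bm_shift_integral (hw j) hf _
  have h1 : ∀ j, ‖∫ z : ℝ × ℝ, (∑ i, h i z *
        fconv (eta ((2 : ℝ) ^ ((N : ℤ) - 1) / 2 ^ j)) (fun t => g j i (z.1, t)) z.2) *
        fconv (rdil K ((j : ℤ) - N)) (fun t => f (t, z.2)) z.1‖ₑ ≤
      ENNReal.ofReal CK * ∫⁻ t, ENNReal.ofReal (1 / (1 + |t|) ^ 3) * ‖ρ j t‖ₑ := fun j => by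
    rw [integral_mul_fconv_rdil (hw j) hf hK.continuous.measurable hK.integrable,
      ← lintegral_const_mul _ (by have := (hρm j).1; fun_prop)]
    refine (enorm_integral_le_lintegral_enorm _).trans (lintegral_mono fun t => ?_)
    rw [enorm_mul, ← mul_assoc, ← ENNReal.ofReal_mul hK.nonneg, Real.enorm_eq_ofReal_abs]
    refine mul_le_mul_left (ENNReal.ofReal_le_ofReal ?_) _
    rw [mul_one_div]
    exact hK.bound t
  have h2 : ∀ j, ∫⁻ t, ENNReal.ofReal (1 / (1 + |t|) ^ 3) * ‖ρ j t‖ₑ ≤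
      ∑' n : ℕ, ENNReal.ofReal (32 * (1 / 4) ^ n) * ∫⁻ t,
        ENNReal.ofReal (((2 ^ (n + 1)) ^ 2)⁻¹ * max (2 ^ (n + 1) - |t|) 0) * ‖ρ j t‖ₑ := fun j => by
    have hj := (hρm j).1
    have : ∀ n : ℕ, Measurable fun t => ENNReal.ofReal (((2 ^ (n + 1)) ^ 2)⁻¹ *
        max (2 ^ (n + 1) - |t|) 0) * ‖ρ j t‖ₑ := fun n => by fun_prop
    simp_rw [← lintegral_const_mul _ (this _)]
    rw [← lintegral_tsum fun n => ((this n).const_mul _).aemeasurable]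
    refine lintegral_mono fun t => ?_
    simp only [← mul_assoc]
    rw [ENNReal.tsum_mul_right]
    exact mul_le_mul_left (inv_cube_le_tsum t) _
  refine (Finset.sum_le_sum fun j _ => (h1 j).trans (mul_le_mul_right (h2 j) _)).trans ?_
  rw [← Finset.mul_sum, ← Summable.tsum_finsetSum fun _ _ => ENNReal.summable]
  push_cast
  rw [ENNReal.coe_toNNReal hsum, mul_assoc, mul_assoc, ← ENNReal.tsum_mul_right]
  refine mul_le_mul_right (ENNReal.tsum_le_tsum fun k => ?_) _
  rw [← Finset.mul_sum]
  exact mul_le_mul_right (hC m n N _ (by positivity) f ug h g hf hug hug0 hh hg hgu) _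

/-! ### Dyadic cells and a Calderón–Zygmund decomposition -/

/-- The half-open dyadic interval of length `2 ^ (-k)` containing `x`. -/
def cell (k : ℤ) (x : ℝ) : Set ℝ := {y | ⌊(2 : ℝ) ^ k * y⌋ = ⌊(2 : ℝ) ^ k * x⌋}

lemma cell_eq_Ico (k : ℤ) (x : ℝ) : cell k x =
    Set.Ico (((2 : ℝ) ^ k)⁻¹ * ⌊(2 : ℝ) ^ k * x⌋) (((2 : ℝ) ^ k)⁻¹ * (⌊(2 : ℝ) ^ k * x⌋ + 1)) := by
  ext y
  have h2k : (0 : ℝ) < 2 ^ k := by positivity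
  rw [cell, Set.mem_ofPred_eq, Int.floor_eq_iff, Set.mem_Ico, inv_mul_le_iff₀ h2k,
    lt_inv_mul_iff₀ h2k]

lemma measurableSet_cell (k : ℤ) (x : ℝ) : MeasurableSet (cell k x) := by
  rw [cell_eq_Ico]
  exact measurableSet_Ico

lemma volume_cell (k : ℤ) (x : ℝ) : volume (cell k x) = ENNReal.ofReal ((2 : ℝ) ^ k)⁻¹ := by
  rw [cell_eq_Ico, Real.volume_Ico]
  congr 1
  ring

lemma mem_cell_self (k : ℤ) (x : ℝ) : x ∈ cell k x := rfl

lemma mem_cell_comm {k : ℤ} {x y : ℝ} : y ∈ cell k x ↔ x ∈ cell k y := eq_comm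

lemma cell_congr {k : ℤ} {x y : ℝ} (h : y ∈ cell k x) : cell k y = cell k x := by
  rw [cell, cell, show ⌊(2 : ℝ) ^ k * y⌋ = ⌊(2 : ℝ) ^ k * x⌋ from h]

lemma abs_sub_lt_of_mem_cell {k : ℤ} {x y : ℝ} (h : y ∈ cell k x) : |y - x| < ((2 : ℝ) ^ k)⁻¹ := by
  have h2k : (0 : ℝ) < 2 ^ k := by positivity
  have := Int.abs_sub_lt_one_of_floor_eq_floor (show ⌊(2 : ℝ) ^ k * y⌋ = ⌊(2 : ℝ) ^ k * x⌋ from h)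
  rw [← mul_sub, abs_mul, abs_of_pos h2k] at this
  rwa [← one_div, lt_div_iff₀' h2k]

lemma cell_anti {j k : ℤ} (h : j ≤ k) (x : ℝ) : cell k x ⊆ cell j x := by
  obtain ⟨n, rfl⟩ := Int.le.dest h
  have e : ∀ t : ℝ, ⌊(2 : ℝ) ^ j * t⌋ = ⌊(2 : ℝ) ^ (j + n) * t⌋ / ((2 ^ n : ℕ) : ℤ) := fun t => by
    rw [← Int.floor_div_natCast, zpow_add₀ two_ne_zero, zpow_natCast]
    congr 1
    push_cast
    field_simp
  intro y hy
  change ⌊(2 : ℝ) ^ j * y⌋ = ⌊(2 : ℝ) ^ j * x⌋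
  rw [e, e, show ⌊(2 : ℝ) ^ (j + n) * y⌋ = ⌊(2 : ℝ) ^ (j + n) * x⌋ from hy]

lemma measurableSet_cell_rel (k : ℤ) : MeasurableSet {z : ℝ × ℝ | z.2 ∈ cell k z.1} :=
  measurableSet_eq_fun (Int.measurable_floor.comp (measurable_snd.const_mul _))
    (Int.measurable_floor.comp (measurable_fst.const_mul _))

section CZ

variable {E : Type*} [NormedAddCommGroup E]

/-- Average of `‖u‖` over a dyadic cell. -/
def cellMass (k : ℤ) (u : ℝ → E) (x : ℝ) : ℝ≥0∞ :=
  ENNReal.ofReal (2 ^ k) * ∫⁻ y in cell k x, ‖u y‖ₑ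

lemma cellMass_congr {k : ℤ} (u : ℝ → E) {x y : ℝ} (h : y ∈ cell k x) :
    cellMass k u y = cellMass k u x := by
  rw [cellMass, cell_congr h, cellMass]

lemma cellMass_le_HL (k : ℤ) (u : ℝ → E) (x : ℝ) : cellMass k u x ≤ HL (fun t => ‖u t‖ₑ) x := by
  refine le_trans ?_ (le_iSup _ (-k))
  rw [cellMass, neg_neg]
  refine mul_le_mul_right (lintegral_mono_set fun y hy => ?_) _
  rw [Metric.mem_closedBall, Real.dist_eq, zpow_neg]
  exact (abs_sub_lt_of_mem_cell hy).le

lemma cellMass_le_two_mul (k : ℤ) (u : ℝ → E) (x : ℝ) :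
    cellMass k u x ≤ 2 * cellMass (k - 1) u x := by
  rw [cellMass, cellMass, ← mul_assoc]
  refine mul_le_mul' (le_of_eq ?_) (lintegral_mono_set (cell_anti (by omega) x))
  rw [show (2 : ℝ≥0∞) = ENNReal.ofReal 2 by simp, ← ENNReal.ofReal_mul (by norm_num),
    zpow_sub_one₀ two_ne_zero]
  congr 1
  ring

lemma exists_cellMass_le {u : ℝ → E} (hu : ∫⁻ t, ‖u t‖ₑ ≠ ∞) {α : ℝ} (hα : 0 < α) (x : ℝ) :
    ∃ k₀ : ℤ, ∀ k ≤ k₀, cellMass k u x ≤ ENNReal.ofReal α := by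
  set I := (∫⁻ t, ‖u t‖ₑ).toReal
  obtain ⟨n, hn⟩ := pow_unbounded_of_one_lt (I / α) one_lt_two
  refine ⟨-n, fun k hk => ?_⟩
  have h1 : ∫⁻ y in cell k x, ‖u y‖ₑ ≤ ENNReal.ofReal I := by
    rw [ENNReal.ofReal_toReal hu]
    exact setLIntegral_le_lintegral _ _
  refine (mul_le_mul_right h1 _).trans ?_
  rw [← ENNReal.ofReal_mul (by positivity)]
  refine ENNReal.ofReal_le_ofReal ?_
  have hI : 0 ≤ I := ENNReal.toReal_nonneg
  calc (2 : ℝ) ^ k * I ≤ 2 ^ (-n : ℤ) * I :=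
        mul_le_mul_of_nonneg_right (zpow_le_zpow_right₀ one_le_two hk) hI
    _ ≤ α := by
        rw [zpow_neg, zpow_natCast, inv_mul_le_iff₀ (by positivity)]
        exact ((div_lt_iff₀ hα).1 hn).le

/-- Points whose largest cell of mass exceeding `α` has scale `k`. -/
def stopSet (α : ℝ) (u : ℝ → E) (k : ℤ) : Set ℝ :=
  {x | ENNReal.ofReal α < cellMass k u x ∧ ∀ j < k, cellMass j u x ≤ ENNReal.ofReal α}

lemma stopSet_congr {α : ℝ} {u : ℝ → E} {k : ℤ} {x y : ℝ} (h : y ∈ cell k x) :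
    y ∈ stopSet α u k ↔ x ∈ stopSet α u k := by
  simp only [stopSet, Set.mem_ofPred_eq, cellMass_congr u h]
  refine and_congr_right fun _ => forall₂_congr fun j hj => ?_
  rw [cellMass_congr u (cell_anti hj.le x h)]

lemma stopSet_unique {α : ℝ} {u : ℝ → E} {j k : ℤ} {x : ℝ} (hj : x ∈ stopSet α u j)
    (hk : x ∈ stopSet α u k) : j = k := by
  rcases lt_trichotomy j k with h | h | h
  · exact absurd (hk.2 j h) (not_le.2 hj.1)
  · exact h
  · exact absurd (hj.2 k h) (not_le.2 hk.1)

lemma exists_mem_stopSet {u : ℝ → E} (hu : ∫⁻ t, ‖u t‖ₑ ≠ ∞) {α : ℝ} (hα : 0 < α) {x : ℝ} {k : ℤ}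
    (hk : ENNReal.ofReal α < cellMass k u x) : ∃ j, x ∈ stopSet α u j := by
  obtain ⟨k₀, hk₀⟩ := exists_cellMass_le hu hα x
  obtain ⟨j, hj, hmin⟩ := Int.exists_least_of_bdd (P := fun k => ENNReal.ofReal α < cellMass k u x)
    ⟨k₀, fun i hi => by
      by_contra h
      exact absurd (hk₀ i (by omega)) (not_le.2 hi)⟩ ⟨k, hk⟩
  refine ⟨j, hj, fun i hi => ?_⟩
  by_contra h
  exact absurd (hmin i (not_le.1 h)) (by omega)

lemma cellMass_le_of_mem_stopSet {α : ℝ} {u : ℝ → E} {k : ℤ} {x : ℝ} (h : x ∈ stopSet α u k) :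
    cellMass k u x ≤ 2 * ENNReal.ofReal α :=
  (cellMass_le_two_mul k u x).trans (mul_le_mul_right (h.2 _ (by omega)) _)

variable [NormedSpace ℝ E]

/-- Average of `u` over a dyadic cell. -/
def cellAvg (k : ℤ) (u : ℝ → E) (x : ℝ) : E := (2 : ℝ) ^ k • ∫ y in cell k x, u y

lemma enorm_cellAvg_le (k : ℤ) (u : ℝ → E) (x : ℝ) : ‖cellAvg k u x‖ₑ ≤ cellMass k u x := by
  rw [cellAvg, enorm_smul, cellMass, Real.enorm_of_nonneg (by positivity)]
  exact mul_le_mul_right (enorm_integral_le_lintegral_enorm _) _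

open Classical in
/-- The good part of the Calderón–Zygmund decomposition of `u` at height `α`. -/
def goodPart (α : ℝ) (u : ℝ → E) (x : ℝ) : E :=
  if h : ∃ k, x ∈ stopSet α u k then cellAvg h.choose u x else u x

lemma goodPart_of_mem {α : ℝ} {u : ℝ → E} {k : ℤ} {x : ℝ} (h : x ∈ stopSet α u k) :
    goodPart α u x = cellAvg k u x := by
  have h' : ∃ k, x ∈ stopSet α u k := ⟨k, h⟩
  rw [goodPart, dif_pos h', stopSet_unique h'.choose_spec h]

lemma goodPart_of_notMem {α : ℝ} {u : ℝ → E} {x : ℝ} (h : ¬ ∃ k, x ∈ stopSet α u k) :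
    goodPart α u x = u x := dif_neg h

end CZ

lemma ae_tendsto_cellAvg {E : Type*} [NormedAddCommGroup E] [NormedSpace ℝ E] [CompleteSpace E]
    {u : ℝ → E} (hu : Integrable u) :
    ∀ᵐ x, Tendsto (fun n : ℕ => cellAvg (n : ℤ) u x) atTop (𝓝 (u x)) := by
  filter_upwards [IsUnifLocDoublingMeasure.ae_tendsto_average (μ := (volume : Measure ℝ))
    hu.locallyIntegrable 1] with x hx
  set w : ℕ → ℝ := fun n => ((2 : ℝ) ^ (n : ℤ))⁻¹ * (⌊(2 : ℝ) ^ (n : ℤ) * x⌋ + 1 / 2) with hw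
  set δ : ℕ → ℝ := fun n => ((2 : ℝ) ^ (n : ℤ))⁻¹ * (1 / 2) with hδ
  have hb : ∀ n, Metric.closedBall (w n) (δ n) = Set.Icc
      (((2 : ℝ) ^ (n : ℤ))⁻¹ * ⌊(2 : ℝ) ^ (n : ℤ) * x⌋)
      (((2 : ℝ) ^ (n : ℤ))⁻¹ * (⌊(2 : ℝ) ^ (n : ℤ) * x⌋ + 1)) := fun n => by
    rw [Real.closedBall_eq_Icc, hw, hδ]
    congr 1 <;> ring
  have hc : ∀ n : ℕ, (Metric.closedBall (w n) (δ n) : Set ℝ) =ᵐ[volume] cell n x := fun n => by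
    rw [hb, cell_eq_Ico]
    exact Ico_ae_eq_Icc.symm
  have hδ0 : Tendsto δ atTop (𝓝[>] 0) := by
    refine tendsto_nhdsWithin_iff.2 ⟨?_, Eventually.of_forall fun n => ?_⟩
    · have := (tendsto_pow_atTop_nhds_zero_of_lt_one (r := (1 / 2 : ℝ)) (by norm_num)
        (by norm_num)).mul_const (1 / 2)
      rw [zero_mul] at this
      refine this.congr fun n => ?_
      simp [hδ]
    · simp only [hδ, Set.mem_Ioi]
      positivity
  refine (hx w δ hδ0 (Eventually.of_forall fun n => ?_)).congr fun n => ?_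
  · rw [one_mul, hb]
    have := mem_cell_self (n : ℤ) x
    rw [cell_eq_Ico] at this
    exact Set.Ico_subset_Icc_self this
  · rw [setAverage_eq, setIntegral_congr_set (hc n), measureReal_congr (hc n), cellAvg,
      measureReal_def, volume_cell, ENNReal.toReal_ofReal (by positivity), inv_inv]

section CZMeasurable

variable {E : Type*} [NormedAddCommGroup E] [MeasurableSpace E] [BorelSpace E]
  [SecondCountableTopology E] {γ : Type*} [MeasurableSpace γ] {u : γ → ℝ → E}

lemma measurableSet_cell_param (k : ℤ) :
    MeasurableSet {w : (γ × ℝ) × ℝ | w.2 ∈ cell k w.1.2} :=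
  (measurableSet_cell_rel k).preimage (f := fun w : (γ × ℝ) × ℝ => (w.1.2, w.2)) (by fun_prop)

lemma measurable_cellMass_param (hu : Measurable (Function.uncurry u)) (k : ℤ) :
    Measurable fun z : γ × ℝ => cellMass k (u z.1) z.2 := by
  have hm : Measurable fun w : (γ × ℝ) × ℝ =>
      {w : (γ × ℝ) × ℝ | w.2 ∈ cell k w.1.2}.indicator (fun w => ‖u w.1.1 w.2‖ₑ) w :=
    ((hu.comp (by fun_prop : Measurable fun w : (γ × ℝ) × ℝ => (w.1.1, w.2))).enorm).indicator
      (measurableSet_cell_param k)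
  refine Measurable.const_mul ?_ _
  convert hm.lintegral_prod_right' (ν := volume) using 2 with z
  rw [← lintegral_indicator (measurableSet_cell k z.2)]
  rfl

lemma measurableSet_stopSet_param (hu : Measurable (Function.uncurry u)) (α : ℝ) (k : ℤ) :
    MeasurableSet {z : γ × ℝ | z.2 ∈ stopSet α (u z.1) k} := by
  refine (measurableSet_lt measurable_const (measurable_cellMass_param hu k)).inter ?_
  have : {z : γ × ℝ | ∀ j < k, cellMass j (u z.1) z.2 ≤ ENNReal.ofReal α} =
      ⋂ j : ℤ, ⋂ _ : j < k, {z : γ × ℝ | cellMass j (u z.1) z.2 ≤ ENNReal.ofReal α} := by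
    ext z
    simp
  change MeasurableSet {z : γ × ℝ | ∀ j < k, cellMass j (u z.1) z.2 ≤ ENNReal.ofReal α}
  rw [this]
  exact MeasurableSet.iInter fun j => MeasurableSet.iInter fun _ =>
    measurableSet_le (measurable_cellMass_param hu j) measurable_const

variable [NormedSpace ℝ E]

lemma measurable_cellAvg_param (hu : Measurable (Function.uncurry u)) (k : ℤ) :
    Measurable fun z : γ × ℝ => cellAvg k (u z.1) z.2 := by
  have hm : Measurable fun w : (γ × ℝ) × ℝ =>
      {w : (γ × ℝ) × ℝ | w.2 ∈ cell k w.1.2}.indicator (fun w => u w.1.1 w.2) w :=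
    (hu.comp (by fun_prop : Measurable fun w : (γ × ℝ) × ℝ => (w.1.1, w.2))).indicator
      (measurableSet_cell_param k)
  refine Measurable.const_smul ?_ _
  convert (hm.stronglyMeasurable.integral_prod_right' (ν := volume)).measurable using 2 with z
  rw [← integral_indicator (measurableSet_cell k z.2)]
  rfl

lemma measurable_goodPart_param (hu : Measurable (Function.uncurry u)) (α : ℝ) :
    Measurable fun z : γ × ℝ => goodPart α (u z.1) z.2 := by
  have hA := measurableSet_stopSet_param hu α
  intro s hs
  have : (fun z : γ × ℝ => goodPart α (u z.1) z.2) ⁻¹' s =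
      (⋃ k : ℤ, {z : γ × ℝ | z.2 ∈ stopSet α (u z.1) k} ∩
        (fun z : γ × ℝ => cellAvg k (u z.1) z.2) ⁻¹' s) ∪
      ((⋃ k : ℤ, {z : γ × ℝ | z.2 ∈ stopSet α (u z.1) k})ᶜ ∩ (Function.uncurry u) ⁻¹' s) := by
    ext z
    simp only [Set.mem_preimage, Set.mem_union, Set.mem_iUnion, Set.mem_inter_iff,
      Set.mem_ofPred_eq, Set.mem_compl_iff]
    by_cases h : ∃ k, z.2 ∈ stopSet α (u z.1) k
    · obtain ⟨k, hk⟩ := h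
      rw [goodPart_of_mem hk]
      constructor
      · exact fun h => Or.inl ⟨k, hk, h⟩
      · rintro (⟨j, hj, h⟩ | ⟨h, _⟩)
        · rwa [stopSet_unique hk hj]
        · exact absurd ⟨k, hk⟩ h
    · rw [goodPart_of_notMem h]
      constructor
      · exact fun h' => Or.inr ⟨h, h'⟩
      · rintro (⟨j, hj, _⟩ | ⟨_, h'⟩)
        · exact absurd ⟨j, hj⟩ h
        · exact h'
  rw [this]
  exact (MeasurableSet.iUnion fun k => (hA k).inter (measurable_cellAvg_param hu k hs)).union
    ((MeasurableSet.iUnion hA).compl.inter (hu hs))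

end CZMeasurable

section CZOne

variable {E : Type*} [NormedAddCommGroup E] [MeasurableSpace E] [BorelSpace E]
  [SecondCountableTopology E] {u : ℝ → E}

lemma measurable_cellMass (hu : Measurable u) (k : ℤ) : Measurable (cellMass k u) := by
  have h := (measurable_cellMass_param (u := fun _ : Unit => u) (hu.comp measurable_snd) k).comp
    (measurable_prodMk_left (x := ()))
  exact h

lemma measurableSet_stopSet (hu : Measurable u) (α : ℝ) (k : ℤ) : MeasurableSet (stopSet α u k) := by
  have h := (measurableSet_stopSet_param (u := fun _ : Unit => u) (hu.comp measurable_snd) α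
    k).preimage (measurable_prodMk_left (x := ()))
  exact h

lemma lintegral_cellMass (hu : Measurable u) {k : ℤ} {A : Set ℝ} (hA : MeasurableSet A)
    (hAk : ∀ x y, y ∈ cell k x → (y ∈ A ↔ x ∈ A)) :
    ∫⁻ x in A, cellMass k u x = ∫⁻ x in A, ‖u x‖ₑ := by
  have hs : MeasurableSet {z : ℝ × ℝ | z.1 ∈ A ∧ z.2 ∈ cell k z.1} :=
    (hA.preimage measurable_fst).inter (measurableSet_cell_rel k)
  have hm : Measurable fun z : ℝ × ℝ => ENNReal.ofReal (2 ^ k) *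
      {z : ℝ × ℝ | z.1 ∈ A ∧ z.2 ∈ cell k z.1}.indicator (fun z => ‖u z.2‖ₑ) z :=
    ((hu.comp measurable_snd).enorm.indicator hs).const_mul _
  calc _ = ∫⁻ x, ∫⁻ y, ENNReal.ofReal (2 ^ k) *
        {z : ℝ × ℝ | z.1 ∈ A ∧ z.2 ∈ cell k z.1}.indicator (fun z => ‖u z.2‖ₑ) (x, y) := by
        rw [← lintegral_indicator hA]
        refine lintegral_congr fun x => ?_
        rw [lintegral_const_mul' _ _ ENNReal.ofReal_ne_top]
        by_cases hx : x ∈ A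
        · rw [Set.indicator_of_mem hx, cellMass, ← lintegral_indicator (measurableSet_cell k x)]
          congr 1
          refine lintegral_congr fun y => ?_
          by_cases hy : y ∈ cell k x
          · have : x ∈ A ∧ y ∈ cell k x := ⟨hx, hy⟩
            simp [Set.indicator, hy, this]
          · simp [Set.indicator, hy]
        · simp [Set.indicator, hx]
    _ = ∫⁻ y, ∫⁻ x, ENNReal.ofReal (2 ^ k) *
        {z : ℝ × ℝ | z.1 ∈ A ∧ z.2 ∈ cell k z.1}.indicator (fun z => ‖u z.2‖ₑ) (x, y) :=
        lintegral_lintegral_swap hm.aemeasurable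
    _ = _ := by
        rw [← lintegral_indicator hA]
        refine lintegral_congr fun y => ?_
        rw [lintegral_const_mul' _ _ ENNReal.ofReal_ne_top]
        by_cases hy : y ∈ A
        · have : ∀ x, {z : ℝ × ℝ | z.1 ∈ A ∧ z.2 ∈ cell k z.1}.indicator (fun z => ‖u z.2‖ₑ) (x, y) =
              (cell k y).indicator (fun _ => ‖u y‖ₑ) x := fun x => by
            by_cases hx : x ∈ cell k y
            · have : x ∈ A ∧ y ∈ cell k x := ⟨(hAk y x hx).2 hy, mem_cell_comm.1 hx⟩
              simp [Set.indicator, hx, this]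
            · have : ¬ (x ∈ A ∧ y ∈ cell k x) := fun h => hx (mem_cell_comm.1 h.2)
              simp [Set.indicator, hx, this]
          simp only [this]
          rw [lintegral_indicator (measurableSet_cell k y), setLIntegral_const, volume_cell,
            Set.indicator_of_mem hy, mul_comm, mul_assoc, ← ENNReal.ofReal_mul (by positivity),
            inv_mul_cancel₀ (by positivity), ENNReal.ofReal_one, mul_one]
        · have : ∀ x, {z : ℝ × ℝ | z.1 ∈ A ∧ z.2 ∈ cell k z.1}.indicator (fun z => ‖u z.2‖ₑ) (x, y) =
              0 := fun x => by
            have : ¬ (x ∈ A ∧ y ∈ cell k x) := fun h => hy ((hAk x y h.2).2 h.1)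
            simp [Set.indicator, this]
          simp [this, hy]

lemma lintegral_stopSet_le (hu : Measurable u) (α : ℝ) (k : ℤ) :
    ∫⁻ x in stopSet α u k, ‖u x‖ₑ ≤ 2 * ENNReal.ofReal α * volume (stopSet α u k) := by
  rw [← lintegral_cellMass hu (measurableSet_stopSet hu α k) fun x y h => stopSet_congr h,
    ← setLIntegral_const]
  exact setLIntegral_mono measurable_const fun x hx => cellMass_le_of_mem_stopSet hx

variable [NormedSpace ℝ E]

lemma measurable_goodPart (hu : Measurable u) (α : ℝ) : Measurable (goodPart α u) := by
  have h := (measurable_goodPart_param (u := fun _ : Unit => u) (hu.comp measurable_snd) α).comp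
    (measurable_prodMk_left (x := ()))
  exact h

lemma measurable_cellAvg (hu : Measurable u) (k : ℤ) : Measurable (cellAvg k u) := by
  have h := (measurable_cellAvg_param (u := fun _ : Unit => u) (hu.comp measurable_snd) k).comp
    (measurable_prodMk_left (x := ()))
  exact h

variable [CompleteSpace E]

/-- The good part is bounded by twice the height and by the maximal function. -/
lemma ae_enorm_goodPart_le (hu : Integrable u) {α : ℝ} (hα : 0 < α) :
    ∀ᵐ x, ‖goodPart α u x‖ₑ ≤ 2 * ENNReal.ofReal α ∧
      ‖goodPart α u x‖ₑ ≤ HL (fun t => ‖u t‖ₑ) x := by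
  filter_upwards [ae_tendsto_cellAvg hu] with x hx
  have hx' := hx.enorm
  by_cases h : ∃ k, x ∈ stopSet α u k
  · obtain ⟨k, hk⟩ := h
    rw [goodPart_of_mem hk]
    exact ⟨(enorm_cellAvg_le k u x).trans (cellMass_le_of_mem_stopSet hk),
      (enorm_cellAvg_le k u x).trans (cellMass_le_HL k u x)⟩
  · rw [goodPart_of_notMem h]
    have hle : ∀ k, cellMass k u x ≤ ENNReal.ofReal α := fun k => by
      by_contra h'
      exact h (exists_mem_stopSet hu.2.ne hα (not_le.1 h'))
    refine ⟨(le_of_tendsto' hx' fun n => (enorm_cellAvg_le n u x).trans (hle n)).trans ?_,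
      le_of_tendsto' hx' fun n => (enorm_cellAvg_le n u x).trans (cellMass_le_HL n u x)⟩
    exact le_mul_of_one_le_left (zero_le) one_le_two

end CZOne

section CZBad

variable {E : Type*} [NormedAddCommGroup E] [NormedSpace ℝ E] [CompleteSpace E]
  [MeasurableSpace E] [BorelSpace E] [SecondCountableTopology E] {u : ℝ → E}

lemma integral_smul_cellAvg (hu : Measurable u) (hi : Integrable u) {κ : ℝ → ℝ} (hκ : BM κ) {k : ℤ}
    {A : Set ℝ} (hA : MeasurableSet A) (hAk : ∀ x y, y ∈ cell k x → (y ∈ A ↔ x ∈ A)) :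
    ∫ x in A, κ x • cellAvg k u x = ∫ x in A, cellAvg k κ x • u x := by
  obtain ⟨hκm, C, hC⟩ := hκ
  set s : Set (ℝ × ℝ) := {z : ℝ × ℝ | z.1 ∈ A ∧ z.2 ∈ cell k z.1} with hsdef
  have hs : MeasurableSet s := (hA.preimage measurable_fst).inter (measurableSet_cell_rel k)
  have hsy : ∀ x y, (x, y) ∈ s ↔ y ∈ A ∧ x ∈ cell k y := fun x y =>
    ⟨fun h => ⟨(hAk x y h.2).2 h.1, mem_cell_comm.1 h.2⟩,
      fun h => ⟨(hAk y x h.2).2 h.1, mem_cell_comm.1 h.2⟩⟩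
  set F : ℝ × ℝ → E := s.indicator fun z => ((2 : ℝ) ^ k * κ z.1) • u z.2 with hF
  have hFm : Measurable F := by
    refine Measurable.indicator ?_ hs
    have h1 : Measurable fun z : ℝ × ℝ => (2 : ℝ) ^ k * κ z.1 := by fun_prop
    exact h1.smul (hu.comp measurable_snd)
  have hFy : ∀ x y, F (x, y) = A.indicator (fun y => (cell k y).indicator
      (fun x => ((2 : ℝ) ^ k * κ x) • u y) x) y := fun x y => by
    by_cases h : (x, y) ∈ s
    · have h' := (hsy x y).1 h
      rw [hF, Set.indicator_of_mem h, Set.indicator_of_mem h'.1, Set.indicator_of_mem h'.2]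
    · rw [hF, Set.indicator_of_notMem h]
      by_cases hy : y ∈ A
      · have : x ∉ cell k y := fun h' => h ((hsy x y).2 ⟨hy, h'⟩)
        rw [Set.indicator_of_mem hy, Set.indicator_of_notMem this]
      · rw [Set.indicator_of_notMem hy]
  have hintg : Integrable F (volume.prod volume) := by
    refine ⟨hFm.aestronglyMeasurable, ?_⟩
    rw [hasFiniteIntegral_iff_enorm, lintegral_prod_symm' _ hFm.enorm]
    calc ∫⁻ y, ∫⁻ x, ‖F (x, y)‖ₑ
        ≤ ∫⁻ y, ENNReal.ofReal C * ‖u y‖ₑ := by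
          refine lintegral_mono fun y => ?_
          calc ∫⁻ x, ‖F (x, y)‖ₑ ≤ ∫⁻ x, (cell k y).indicator
                (fun _ => ENNReal.ofReal (2 ^ k * C) * ‖u y‖ₑ) x := by
                refine lintegral_mono fun x => ?_
                rw [hFy]
                by_cases hy : y ∈ A
                · rw [Set.indicator_of_mem hy]
                  by_cases hx : x ∈ cell k y
                  · rw [Set.indicator_of_mem hx, Set.indicator_of_mem hx, enorm_smul,
                      Real.enorm_eq_ofReal_abs, abs_mul, abs_of_pos (by positivity)]
                    exact mul_le_mul_left (ENNReal.ofReal_le_ofReal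
                      (mul_le_mul_of_nonneg_left (hC x) (by positivity))) _
                  · rw [Set.indicator_of_notMem hx, enorm_zero]
                    exact zero_le
                · rw [Set.indicator_of_notMem hy, enorm_zero]
                  exact zero_le
            _ = _ := by
                rw [lintegral_indicator (measurableSet_cell k y), setLIntegral_const, volume_cell,
                  mul_right_comm, ← ENNReal.ofReal_mul (mul_nonneg (by positivity)
                    ((abs_nonneg _).trans (hC 0)))]
                congr 2
                field_simp
      _ < ∞ := by
          rw [lintegral_const_mul' _ _ ENNReal.ofReal_ne_top]
          exact ENNReal.mul_lt_top ENNReal.ofReal_lt_top hi.2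
  calc _ = ∫ x, ∫ y, F (x, y) := by
        rw [← integral_indicator hA]
        refine integral_congr_ae (Eventually.of_forall fun x => ?_)
        simp only
        by_cases hx : x ∈ A
        · have : ∀ y, F (x, y) = (cell k x).indicator (fun y => ((2 : ℝ) ^ k * κ x) • u y) y :=
            fun y => by
            by_cases hy : y ∈ cell k x
            · rw [hF, Set.indicator_of_mem (show (x, y) ∈ s from ⟨hx, hy⟩), Set.indicator_of_mem hy]
            · rw [hF, Set.indicator_of_notMem (fun h : (x, y) ∈ s => hy h.2),
                Set.indicator_of_notMem hy]
          simp only [this]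
          rw [Set.indicator_of_mem hx, integral_indicator (measurableSet_cell k x), integral_smul,
            cellAvg, smul_smul, mul_comm]
        · have : ∀ y, F (x, y) = 0 := fun y => by
            rw [hF, Set.indicator_of_notMem (fun h : (x, y) ∈ s => hx h.1)]
          simp [this, hx]
    _ = ∫ y, ∫ x, F (x, y) := integral_integral_swap hintg
    _ = _ := by
        rw [← integral_indicator hA]
        refine integral_congr_ae (Eventually.of_forall fun y => ?_)
        simp only [hFy]
        by_cases hy : y ∈ A
        · simp only [Set.indicator_of_mem hy]
          rw [integral_indicator (measurableSet_cell k y), integral_smul_const, integral_const_mul,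
            cellAvg, smul_eq_mul]
        · simp [hy]

lemma integrable_goodPart (hu : Measurable u) (hi : Integrable u) (α : ℝ) :
    Integrable (goodPart α u) := by
  refine ⟨(measurable_goodPart hu α).aestronglyMeasurable, ?_⟩
  have hA := measurableSet_stopSet hu α
  have hdisj : Pairwise (Function.onFun Disjoint (stopSet α u)) := fun i j hij =>
    Set.disjoint_left.2 fun x hi hj => hij (stopSet_unique hi hj)
  rw [hasFiniteIntegral_iff_enorm, ← lintegral_add_compl _ (MeasurableSet.iUnion hA),
    lintegral_iUnion hA hdisj]
  have h1 : ∀ k, ∫⁻ x in stopSet α u k, ‖goodPart α u x‖ₑ ≤ ∫⁻ x in stopSet α u k, ‖u x‖ₑ :=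
    fun k => by
    rw [← lintegral_cellMass hu (hA k) fun x y h => stopSet_congr h]
    refine setLIntegral_mono (measurable_cellMass hu k) fun x hx => ?_
    rw [goodPart_of_mem hx]
    exact enorm_cellAvg_le k u x
  have h2 : ∫⁻ x in (⋃ k, stopSet α u k)ᶜ, ‖goodPart α u x‖ₑ =
      ∫⁻ x in (⋃ k, stopSet α u k)ᶜ, ‖u x‖ₑ := by
    refine setLIntegral_congr_fun (MeasurableSet.iUnion hA).compl fun x hx => ?_
    rw [goodPart_of_notMem fun h => hx (Set.mem_iUnion.2 h)]
  refine lt_of_le_of_lt (add_le_add (ENNReal.tsum_le_tsum h1) h2.le) ?_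
  rw [← lintegral_iUnion hA hdisj, lintegral_add_compl _ (MeasurableSet.iUnion hA)]
  exact hi.2

/-- Cancellation of the bad part against a smooth function. -/
lemma enorm_integral_bad_le (hu : Measurable u) (hi : Integrable u) {κ : ℝ → ℝ} (hκ : BM κ) (α : ℝ) :
    ‖∫ t, κ t • (u t - goodPart α u t)‖ₑ ≤
      ∑' k : ℤ, ∫⁻ t in stopSet α u k, ‖κ t - cellAvg k κ t‖ₑ * ‖u t‖ₑ := by
  have hA := measurableSet_stopSet hu α
  have hdisj : Pairwise (Function.onFun Disjoint (stopSet α u)) := fun i j hij =>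
    Set.disjoint_left.2 fun x hi hj => hij (stopSet_unique hi hj)
  have hig := integrable_goodPart hu hi α
  obtain ⟨C, hC⟩ := hκ.2
  have hb : ∀ {v : ℝ → E}, Integrable v → Integrable fun t => κ t • v t := fun hv =>
    hv.bdd_smul C hκ.1.aestronglyMeasurable (Eventually.of_forall fun t => hC t)
  have h0 : ∫ t, κ t • (u t - goodPart α u t) =
      ∫ t in ⋃ k, stopSet α u k, κ t • (u t - goodPart α u t) := by
    refine (setIntegral_eq_integral_of_forall_compl_eq_zero fun t ht => ?_).symm
    rw [goodPart_of_notMem fun h => ht (Set.mem_iUnion.2 h), sub_self, smul_zero]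
  have hsub : Integrable fun t => κ t • (u t - goodPart α u t) := hb (hi.sub hig)
  rw [h0, integral_iUnion hA hdisj hsub.integrableOn]
  refine enorm_tsum_le_tsum_enorm.trans (ENNReal.tsum_le_tsum fun k => ?_)
  have hcm : Measurable fun t => cellAvg k κ t := measurable_cellAvg hκ.1 k
  have h2k : (0 : ℝ) < 2 ^ k := by positivity
  have hcC : ∀ t, ‖cellAvg k κ t‖ ≤ C := fun t => by
    have := norm_setIntegral_le_of_norm_le_const (s := cell k t) (f := κ) (C := C)
      (by rw [volume_cell]; exact ENNReal.ofReal_lt_top) fun x _ => hC x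
    rw [measureReal_def, volume_cell, ENNReal.toReal_ofReal (by positivity)] at this
    rw [cellAvg, norm_smul, Real.norm_of_nonneg h2k.le]
    calc _ ≤ (2 : ℝ) ^ k * (C * ((2 : ℝ) ^ k)⁻¹) := mul_le_mul_of_nonneg_left this h2k.le
      _ = C := by field_simp
  have hcu : Integrable fun t => cellAvg k κ t • u t :=
    hi.bdd_smul C hcm.aestronglyMeasurable (Eventually.of_forall hcC)
  have h1 : ∫ t in stopSet α u k, κ t • (u t - goodPart α u t) =
      ∫ t in stopSet α u k, (κ t - cellAvg k κ t) • u t := by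
    simp only [smul_sub, sub_smul]
    rw [integral_sub (hb hi).integrableOn (hb hig).integrableOn,
      integral_sub (hb hi).integrableOn hcu.integrableOn,
      ← integral_smul_cellAvg hu hi hκ (hA k) fun x y h => stopSet_congr h]
    congr 1
    refine setIntegral_congr_fun (hA k) fun t ht => ?_
    rw [goodPart_of_mem ht]
  rw [h1]
  refine (enorm_integral_le_lintegral_enorm _).trans (lintegral_mono fun t => ?_)
  rw [enorm_smul]

end CZBad

lemma sum_half_natAbs_le (S : Finset ℤ) (n : ℤ) :
    ∑ l ∈ S, (1 / 2 : ℝ) ^ (l + n).natAbs ≤ 4 := by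
  have key : ∀ T : Finset ℤ, Set.InjOn (fun l : ℤ => (l + n).natAbs) T →
      ∑ l ∈ T, (1 / 2 : ℝ) ^ (l + n).natAbs ≤ 2 := fun T hT => by
    rw [← Finset.sum_image (f := fun m => (1 / 2 : ℝ) ^ m) hT]
    exact (summable_geometric_two.sum_le_tsum _ fun _ _ => by positivity).trans_eq
      tsum_geometric_two
  rw [← Finset.sum_filter_add_sum_filter_not S fun l => 0 ≤ l + n]
  have h1 := key {l ∈ S | 0 ≤ l + n} fun i hi j hj h => by
    simp only [Finset.coe_filter, Set.mem_ofPred_eq] at hi hj h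
    omega
  have h2 := key {l ∈ S | ¬ 0 ≤ l + n} fun i hi j hj h => by
    simp only [Finset.coe_filter, Set.mem_ofPred_eq] at hi hj h
    omega
  linarith

lemma min_le_half_natAbs (m : ℤ) : min ((2 : ℝ) ^ m) (2 ^ m)⁻¹ ≤ (1 / 2) ^ m.natAbs := by
  rcases Int.natAbs_eq m with h | h
  · refine (min_le_right _ _).trans (le_of_eq ?_)
    conv_lhs => rw [h]
    rw [zpow_natCast, one_div, inv_pow]
  · refine (min_le_left _ _).trans (le_of_eq ?_)
    conv_lhs => rw [h]
    rw [zpow_neg, zpow_natCast, one_div, inv_pow]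

lemma sum_min_le (S : Finset ℤ) {a : ℝ} (ha : 0 < a) :
    ∑ l ∈ S, min ((2 : ℝ) ^ l * a) (2 ^ l * a)⁻¹ ≤ 8 := by
  obtain ⟨n, h1, h2⟩ := exists_mem_Ico_zpow ha one_lt_two
  have hl : ∀ l : ℤ, min ((2 : ℝ) ^ l * a) (2 ^ l * a)⁻¹ ≤ 2 * (1 / 2) ^ (l + n).natAbs := fun l => by
    have h2l : (0 : ℝ) < 2 ^ l := by positivity
    have hn : (0 : ℝ) < 2 ^ n := by positivity
    refine le_trans ?_ (mul_le_mul_of_nonneg_left (min_le_half_natAbs (l + n)) zero_le_two)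
    rw [mul_min_of_nonneg _ _ zero_le_two, zpow_add₀ two_ne_zero]
    refine min_le_min ?_ ?_
    · rw [zpow_add_one₀ two_ne_zero] at h2
      nlinarith
    · have : ((2 : ℝ) ^ l * a)⁻¹ ≤ (2 ^ l * 2 ^ n)⁻¹ :=
        inv_anti₀ (by positivity) (mul_le_mul_of_nonneg_left h1 h2l.le)
      have h3 : (0 : ℝ) < (2 ^ l * 2 ^ n)⁻¹ := by positivity
      linarith
  refine (Finset.sum_le_sum fun l _ => hl l).trans ?_
  rw [← Finset.mul_sum]
  linarith [sum_half_natAbs_le S n]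

lemma abs_sub_cellAvg_le {κ : ℝ → ℝ} (hκ : Continuous κ) {k : ℤ} {t ω : ℝ}
    (h : ∀ s ∈ cell k t, |κ t - κ s| ≤ ω) : |κ t - cellAvg k κ t| ≤ ω := by
  have h2k : (0 : ℝ) < 2 ^ k := by positivity
  have hv : volume (cell k t) < ∞ := by
    rw [volume_cell]
    exact ENNReal.ofReal_lt_top
  have hi : IntegrableOn κ (cell k t) := by
    rw [cell_eq_Ico]
    exact (hκ.integrableOn_Icc).mono_set Set.Ico_subset_Icc_self
  have hr : volume.real (cell k t) = ((2 : ℝ) ^ k)⁻¹ := by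
    rw [measureReal_def, volume_cell, ENNReal.toReal_ofReal (by positivity)]
  have h1 : κ t - cellAvg k κ t = 2 ^ k * ∫ s in cell k t, (κ t - κ s) := by
    have hc : IntegrableOn (fun _ => κ t) (cell k t) := integrableOn_const hv.ne (by simp)
    rw [integral_sub hc hi, setIntegral_const, hr, cellAvg]
    simp only [smul_eq_mul]
    field_simp
  have h2 := norm_setIntegral_le_of_norm_le_const (f := fun s => κ t - κ s) hv h
  rw [hr, Real.norm_eq_abs] at h2
  rw [h1, abs_mul, abs_of_pos h2k]
  calc _ ≤ (2 : ℝ) ^ k * (ω * ((2 : ℝ) ^ k)⁻¹) := mul_le_mul_of_nonneg_left h2 h2k.le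
    _ = ω := by field_simp

lemma IsKer.sum_osc_le {K : ℝ → ℝ} {C : ℝ} (hK : IsKer K C) (S : Finset ℤ) {k : ℤ} {x t : ℝ}
    (hxt : 3 * ((2 : ℝ) ^ k)⁻¹ < |x - t|) :
    ∑ l ∈ S, |rdil K l (x - t) - cellAvg k (fun s => rdil K l (x - s)) t| ≤
      40 * C * (((2 : ℝ) ^ k)⁻¹ / (x - t) ^ 2) := by
  set h : ℝ := ((2 : ℝ) ^ k)⁻¹ with hh
  have hh0 : 0 < h := by positivity
  set a := |x - t| with ha
  have ha0 : 0 < a := by linarith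
  have hC := hK.nonneg
  have hl : ∀ l : ℤ, |rdil K l (x - t) - cellAvg k (fun s => rdil K l (x - s)) t| ≤
      5 * C * (h / a ^ 2) * min ((2 : ℝ) ^ l * a) (2 ^ l * a)⁻¹ := fun l => by
    have h2l : (0 : ℝ) < 2 ^ l := by positivity
    refine (abs_sub_cellAvg_le (κ := fun s => rdil K l (x - s))
      ((hK.continuous_rdil l).comp (by fun_prop))
      (ω := 5 * C * h * (2 ^ l) ^ 2 / (1 + 2 ^ l * a) ^ 3) fun s hs => ?_).trans ?_
    · have hst := abs_sub_lt_of_mem_cell hs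
      have h1 : 2 / 3 * a ≤ |x - s| := by
        have : a ≤ |x - s| + |s - t| := by
          rw [ha]
          have := abs_add_le (x - s) (s - t)
          rwa [sub_add_sub_cancel] at this
        linarith
      have h2 := hK.lip (2 ^ l * (x - t)) (2 ^ l * (x - s))
      rw [← mul_sub, abs_mul, abs_mul, abs_mul, abs_of_pos h2l, sub_sub_sub_cancel_left, ← ha] at h2
      have h3 : (1 : ℝ) / (1 + 2 ^ l * |x - s|) ^ 3 ≤ 4 * (1 / (1 + 2 ^ l * a) ^ 3) := by
        rw [mul_one_div, div_le_div_iff₀ (by positivity) (by positivity)]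
        have : 1 + 2 ^ l * a ≤ 3 / 2 * (1 + 2 ^ l * |x - s|) := by nlinarith
        calc 1 * (1 + 2 ^ l * a) ^ 3 ≤ (3 / 2 * (1 + 2 ^ l * |x - s|)) ^ 3 := by
              rw [one_mul]
              exact pow_le_pow_left₀ (by positivity) this 3
          _ = 27 / 8 * (1 + 2 ^ l * |x - s|) ^ 3 := by ring
          _ ≤ _ := by gcongr; norm_num
      simp only [rdil]
      rw [← mul_sub, abs_mul, abs_of_pos h2l]
      calc (2 : ℝ) ^ l * |K (2 ^ l * (x - t)) - K (2 ^ l * (x - s))|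
          ≤ 2 ^ l * (C * (2 ^ l * h) * (5 * (1 / (1 + 2 ^ l * a) ^ 3))) := by
            refine mul_le_mul_of_nonneg_left (h2.trans ?_) h2l.le
            refine mul_le_mul (mul_le_mul_of_nonneg_left (mul_le_mul_of_nonneg_left hst.le h2l.le)
              hC) (by linarith) (by positivity) (by positivity)
        _ = _ := by ring
    · set b := (2 : ℝ) ^ l * a with hb
      have hb0 : 0 < b := by positivity
      have e : 5 * C * h * (2 ^ l) ^ 2 / (1 + b) ^ 3 = 5 * C * (h / a ^ 2) * (b ^ 2 / (1 + b) ^ 3) := by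
        rw [hb]
        field_simp
      rw [e]
      refine mul_le_mul_of_nonneg_left (le_min ?_ ?_) (by positivity)
      · rw [div_le_iff₀ (by positivity)]
        nlinarith [pow_pos hb0 2, pow_pos hb0 3, pow_pos hb0 4]
      · rw [inv_eq_one_div, div_le_div_iff₀ (by positivity) hb0]
        nlinarith [pow_pos hb0 2, pow_pos hb0 3]
  refine (Finset.sum_le_sum fun l _ => hl l).trans ?_
  rw [← Finset.mul_sum, ← sq_abs (x - t), ← ha]
  calc _ ≤ 5 * C * (h / a ^ 2) * 8 :=
        mul_le_mul_of_nonneg_left (sum_min_le S ha0) (by positivity)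
    _ = _ := by ring

lemma lintegral_tail_le (k : ℤ) (t : ℝ) :
    ∫⁻ x in {x : ℝ | 3 * ((2 : ℝ) ^ k)⁻¹ < |x - t|}, ENNReal.ofReal (((2 : ℝ) ^ k)⁻¹ / (x - t) ^ 2) ≤
      ENNReal.ofReal (2 * Real.pi) := by
  have h2k : (0 : ℝ) < 2 ^ k := by positivity
  have hi : Integrable fun x : ℝ => 2 * (2 ^ k * (1 + (2 ^ k * (x - t)) ^ 2)⁻¹) :=
    (((integrable_inv_one_add_sq.comp_mul_left' h2k.ne').comp_sub_right t).const_mul _).const_mul _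
  have hI : ∫ x : ℝ, 2 * (2 ^ k * (1 + (2 ^ k * (x - t)) ^ 2)⁻¹) = 2 * Real.pi := by
    rw [integral_const_mul, integral_const_mul,
      integral_sub_right_eq_self (fun x : ℝ => (1 + (2 ^ k * x) ^ 2)⁻¹) t,
      Measure.integral_comp_mul_left (fun x : ℝ => (1 + x ^ 2)⁻¹), integral_univ_inv_one_add_sq,
      abs_of_pos (by positivity), smul_eq_mul]
    field_simp
  rw [← hI, ofReal_integral_eq_lintegral_ofReal hi (Eventually.of_forall fun x => by positivity)]
  refine (setLIntegral_mono_ae (by fun_prop) (Eventually.of_forall fun x hx => ?_)).trans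
    (setLIntegral_le_lintegral _ _)
  refine ENNReal.ofReal_le_ofReal ?_
  have hx' : 3 * ((2 : ℝ) ^ k)⁻¹ < |x - t| := hx
  have h1 : 1 ≤ 2 ^ k * |x - t| := by
    have := mul_lt_mul_of_pos_left hx' h2k
    have e : (2 : ℝ) ^ k * (3 * ((2 : ℝ) ^ k)⁻¹) = 3 := by field_simp
    linarith
  have hx0 : 0 < |x - t| := lt_trans (by positivity) hx'
  rw [← sq_abs (x - t), mul_pow, ← sq_abs (x - t), inv_eq_one_div, div_div, ← mul_assoc,
    ← div_eq_mul_inv, div_le_div_iff₀ (by positivity) (by positivity)]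
  have : (1 : ℝ) ≤ (2 ^ k) ^ 2 * |x - t| ^ 2 := by
    rw [← mul_pow]
    exact one_le_pow₀ h1
  nlinarith

section CZMain

variable {E : Type*} [NormedAddCommGroup E]

lemma lt_abs_of_mem_stopSet {u : ℝ → E} {α : ℝ} {k : ℤ} {x t : ℝ} (ht : t ∈ stopSet α u k)
    (hx : HL (fun t => ‖u t‖ₑ) x ≤ ENNReal.ofReal (α / 4)) : 3 * ((2 : ℝ) ^ k)⁻¹ < |x - t| := by
  by_contra h
  have h0 : cellMass k u t ≤ 4 * HL (fun t => ‖u t‖ₑ) x := by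
    have h1 : ENNReal.ofReal (2 ^ (-(2 - k))) * ∫⁻ y in Metric.closedBall x (2 ^ (2 - k)), ‖u y‖ₑ ≤
        HL (fun t => ‖u t‖ₑ) x := le_iSup (fun k : ℤ => ENNReal.ofReal (2 ^ (-k)) *
          ∫⁻ y in Metric.closedBall x (2 ^ k), ‖u y‖ₑ) (2 - k)
    refine le_trans ?_ (mul_le_mul_right h1 4)
    rw [← mul_assoc, cellMass]
    refine mul_le_mul' (le_of_eq ?_) (lintegral_mono_set fun y hy => ?_)
    · rw [show (4 : ℝ≥0∞) = ENNReal.ofReal 4 by simp, ← ENNReal.ofReal_mul (by norm_num), neg_sub,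
        zpow_sub₀ two_ne_zero]
      congr 1
      norm_num
      ring
    · rw [Metric.mem_closedBall, Real.dist_eq, zpow_sub₀ two_ne_zero]
      have h1 := abs_sub_lt_of_mem_cell hy
      have h2 : |y - x| ≤ |y - t| + |x - t| := by
        rw [abs_sub_comm x t]
        exact abs_sub_le _ _ _
      have e : (2 : ℝ) ^ (2 : ℤ) / 2 ^ k = 4 * ((2 : ℝ) ^ k)⁻¹ := by
        norm_num
        ring
      rw [e]
      linarith
  refine absurd (ht.1.trans_le (h0.trans (mul_le_mul_right hx 4))) (not_lt.2 (le_of_eq ?_))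
  rw [show (4 : ℝ≥0∞) = ENNReal.ofReal 4 by simp, ← ENNReal.ofReal_mul (by norm_num)]
  congr 1
  ring

variable [NormedSpace ℝ E] [CompleteSpace E]
  [MeasurableSpace E] [BorelSpace E] [SecondCountableTopology E] {u : ℝ → E}

/-- The bad part contributes little away from the level set of the maximal function. -/
theorem IsKer.lintegral_sum_bad_le {K : ℝ → ℝ} {C : ℝ} (hK : IsKer K C) (hu : Measurable u)
    (hi : Integrable u) (S : Finset ℤ) {α : ℝ} (hα : 0 < α) :
    ∫⁻ x in {x | HL (fun t => ‖u t‖ₑ) x ≤ ENNReal.ofReal (α / 4)},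
      ∑ l ∈ S, ‖fconv (rdil K l) (fun t => u t - goodPart α u t) x‖ₑ ≤
    ENNReal.ofReal (160 * Real.pi * C * α) *
      volume {x | ENNReal.ofReal (α / 4) < HL (fun t => ‖u t‖ₑ) x} := by
  have hC := hK.nonneg
  have hA := measurableSet_stopSet hu α
  have hHL := measurable_HL hu.enorm
  set G := {x | HL (fun t => ‖u t‖ₑ) x ≤ ENNReal.ofReal (α / 4)} with hG
  have hGm : MeasurableSet G := measurableSet_le hHL measurable_const
  have hFm : ∀ k : ℤ, Measurable ({z : ℝ × ℝ | 3 * ((2 : ℝ) ^ k)⁻¹ < |z.1 - z.2|}.indicator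
      (fun z => ENNReal.ofReal (40 * C) * (ENNReal.ofReal (((2 : ℝ) ^ k)⁻¹ / (z.1 - z.2) ^ 2) *
        ‖u z.2‖ₑ))) := fun k =>
    (((by fun_prop : Measurable fun z : ℝ × ℝ => ENNReal.ofReal
      (((2 : ℝ) ^ k)⁻¹ / (z.1 - z.2) ^ 2)).mul (hu.comp measurable_snd).enorm).const_mul _).indicator
      (measurableSet_lt measurable_const (by fun_prop))
  have h1 : ∀ x ∈ G, ∑ l ∈ S, ‖fconv (rdil K l) (fun t => u t - goodPart α u t) x‖ₑ ≤
      ∑' k : ℤ, ∫⁻ t in stopSet α u k, {z : ℝ × ℝ | 3 * ((2 : ℝ) ^ k)⁻¹ < |z.1 - z.2|}.indicator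
        (fun z => ENNReal.ofReal (40 * C) * (ENNReal.ofReal (((2 : ℝ) ^ k)⁻¹ / (z.1 - z.2) ^ 2) *
          ‖u z.2‖ₑ)) (x, t) := fun x hx => by
    have h2 : ∀ l, ‖fconv (rdil K l) (fun t => u t - goodPart α u t) x‖ₑ ≤ _ := fun l =>
      enorm_integral_bad_le hu hi (κ := fun t => rdil K l (x - t))
        ⟨((hK.continuous_rdil l).comp (by fun_prop)).measurable, _, fun t => hK.rdil_le l _⟩ α
    refine (Finset.sum_le_sum fun l _ => h2 l).trans ?_
    rw [← Summable.tsum_finsetSum fun _ _ => ENNReal.summable]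
    refine ENNReal.tsum_le_tsum fun k => ?_
    have hm : ∀ l ∈ S, Measurable fun t => ‖rdil K l (x - t) -
        cellAvg k (fun t => rdil K l (x - t)) t‖ₑ * ‖u t‖ₑ := fun l _ => by
      have hc : Measurable fun t => rdil K l (x - t) :=
        ((hK.continuous_rdil l).comp (by fun_prop)).measurable
      exact (hc.sub (measurable_cellAvg hc k)).enorm.mul hu.enorm
    rw [← lintegral_finsetSum _ hm]
    refine setLIntegral_mono_ae ?_ (Eventually.of_forall fun t ht => ?_)
    · exact ((hFm k).comp (measurable_prodMk_left (x := x))).aemeasurable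
    · have hxt := lt_abs_of_mem_stopSet ht hx
      rw [Set.indicator_of_mem (show (x, t) ∈ {z : ℝ × ℝ | 3 * ((2 : ℝ) ^ k)⁻¹ < |z.1 - z.2|} from hxt),
        ← Finset.sum_mul, ← mul_assoc, ← ENNReal.ofReal_mul (by positivity)]
      refine mul_le_mul_left ?_ _
      simp only [Real.enorm_eq_ofReal_abs]
      rw [← ENNReal.ofReal_sum_of_nonneg fun _ _ => abs_nonneg _]
      exact ENNReal.ofReal_le_ofReal (hK.sum_osc_le S hxt)
  have h3 : ∀ (k : ℤ) (t : ℝ), ∫⁻ x in G, {z : ℝ × ℝ | 3 * ((2 : ℝ) ^ k)⁻¹ < |z.1 - z.2|}.indicator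
      (fun z => ENNReal.ofReal (40 * C) * (ENNReal.ofReal (((2 : ℝ) ^ k)⁻¹ / (z.1 - z.2) ^ 2) *
        ‖u z.2‖ₑ)) (x, t) ≤ ENNReal.ofReal (40 * C) * ENNReal.ofReal (2 * Real.pi) * ‖u t‖ₑ :=
    fun k t => by
      have e : ∀ x, {z : ℝ × ℝ | 3 * ((2 : ℝ) ^ k)⁻¹ < |z.1 - z.2|}.indicator
          (fun z => ENNReal.ofReal (40 * C) * (ENNReal.ofReal (((2 : ℝ) ^ k)⁻¹ / (z.1 - z.2) ^ 2) *
            ‖u z.2‖ₑ)) (x, t) = {x : ℝ | 3 * ((2 : ℝ) ^ k)⁻¹ < |x - t|}.indicator (fun x =>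
            ENNReal.ofReal (40 * C) * ‖u t‖ₑ * ENNReal.ofReal (((2 : ℝ) ^ k)⁻¹ / (x - t) ^ 2)) x :=
        fun x => by
          by_cases hx : 3 * ((2 : ℝ) ^ k)⁻¹ < |x - t|
          · simp only [Set.indicator, Set.mem_ofPred_eq, if_pos hx]
            ring
          · simp only [Set.indicator, Set.mem_ofPred_eq, if_neg hx]
      simp only [e]
      refine (setLIntegral_le_lintegral _ _).trans ?_
      rw [lintegral_indicator (measurableSet_lt measurable_const (by fun_prop)),
        lintegral_const_mul _ (by fun_prop)]
      refine (mul_le_mul_right (lintegral_tail_le k t) _).trans (le_of_eq ?_)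
      ring
  have h4 : ∑' k : ℤ, volume (stopSet α u k) ≤
      volume {x | ENNReal.ofReal (α / 4) < HL (fun t => ‖u t‖ₑ) x} := by
    rw [← measure_iUnion (fun i j hij => Set.disjoint_left.2 fun x hx hy =>
      hij (stopSet_unique hx hy)) hA]
    refine measure_mono (Set.iUnion_subset fun k x hx => ?_)
    exact (ENNReal.ofReal_le_ofReal (by linarith)).trans_lt (hx.1.trans_le (cellMass_le_HL _ _ _))
  calc _ ≤ ∫⁻ x in G, ∑' k : ℤ, ∫⁻ t in stopSet α u k,
        {z : ℝ × ℝ | 3 * ((2 : ℝ) ^ k)⁻¹ < |z.1 - z.2|}.indicator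
        (fun z => ENNReal.ofReal (40 * C) * (ENNReal.ofReal (((2 : ℝ) ^ k)⁻¹ / (z.1 - z.2) ^ 2) *
          ‖u z.2‖ₑ)) (x, t) := setLIntegral_mono' hGm h1
    _ = ∑' k : ℤ, ∫⁻ t in stopSet α u k, ∫⁻ x in G,
        {z : ℝ × ℝ | 3 * ((2 : ℝ) ^ k)⁻¹ < |z.1 - z.2|}.indicator
        (fun z => ENNReal.ofReal (40 * C) * (ENNReal.ofReal (((2 : ℝ) ^ k)⁻¹ / (z.1 - z.2) ^ 2) *
          ‖u z.2‖ₑ)) (x, t) := by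
        rw [lintegral_tsum fun k => ((hFm k).lintegral_prod_right'
          (ν := volume.restrict (stopSet α u k))).aemeasurable]
        refine tsum_congr fun k => ?_
        have := lintegral_lintegral_swap (μ := volume.restrict G)
          (ν := volume.restrict (stopSet α u k)) (f := fun x t =>
            {z : ℝ × ℝ | 3 * ((2 : ℝ) ^ k)⁻¹ < |z.1 - z.2|}.indicator
            (fun z => ENNReal.ofReal (40 * C) * (ENNReal.ofReal (((2 : ℝ) ^ k)⁻¹ /
              (z.1 - z.2) ^ 2) * ‖u z.2‖ₑ)) (x, t)) (hFm k).aemeasurable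
        exact this
    _ ≤ ∑' k : ℤ, ENNReal.ofReal (40 * C) * ENNReal.ofReal (2 * Real.pi) *
        (2 * ENNReal.ofReal α * volume (stopSet α u k)) := by
        refine ENNReal.tsum_le_tsum fun k => (lintegral_mono fun t => h3 k t).trans ?_
        rw [lintegral_const_mul _ hu.enorm]
        exact mul_le_mul_right (lintegral_stopSet_le hu α k) _
    _ = ENNReal.ofReal (160 * Real.pi * C * α) * ∑' k : ℤ, volume (stopSet α u k) := by
        rw [ENNReal.tsum_mul_left, ENNReal.tsum_mul_left, ← mul_assoc, ← mul_assoc,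
          show (2 : ℝ≥0∞) = ENNReal.ofReal 2 by simp, ← ENNReal.ofReal_mul (by positivity),
          ← ENNReal.ofReal_mul (by positivity), ← ENNReal.ofReal_mul (by positivity)]
        congr 2
        ring
    _ ≤ _ := mul_le_mul_right h4 _

end CZMain

/-! ### Almost orthogonality of mean-zero kernels at different scales -/

lemma lintegral_lintegral_sub_mul {M c : ℝ → ℝ≥0∞} (hM : Measurable M) (hc : Measurable c) :
    ∫⁻ x, ∫⁻ s, M (x - s) * c s = (∫⁻ x, M x) * ∫⁻ s, c s := by
  have := lintegral_lintegral_swap (μ := (volume : Measure ℝ)) (ν := (volume : Measure ℝ))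
    (f := fun x s => M (x - s) * c s)
    ((hM.comp (measurable_fst.sub measurable_snd)).mul (hc.comp measurable_snd)).aemeasurable
  rw [this, ← lintegral_const_mul _ hc]
  refine lintegral_congr fun s => ?_
  have hs : Measurable fun x => M (x - s) := hM.comp (measurable_id.sub_const s)
  rw [lintegral_mul_const _ hs,
    lintegral_sub_right_eq_self (fun x => M x) s]

lemma mul_le_sq_add_sq (a b : ℝ≥0∞) : a * b ≤ a ^ 2 + b ^ 2 := by
  rcases le_total a b with h | h
  · calc a * b ≤ b * b := mul_le_mul_left h b
      _ = b ^ 2 := (sq b).symm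
      _ ≤ _ := le_add_self
  · calc a * b ≤ a * a := mul_le_mul_right h a
      _ = a ^ 2 := (sq a).symm
      _ ≤ _ := le_self_add

lemma lintegral_triple_le {M P u v : ℝ → ℝ≥0∞} (hM : Measurable M) (hP : Measurable P)
    (hu : Measurable u) (hv : Measurable v) :
    ∫⁻ x, ∫⁻ s, M (x - s) * (u s * ∫⁻ t, (P (x - t) + P (s - t)) * v t) ≤
      2 * (∫⁻ x, M x) * (∫⁻ x, P x) * ((∫⁻ s, u s ^ 2) + ∫⁻ s, v s ^ 2) := by
  set p := ∫⁻ x, P x with hp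
  set w : ℝ → ℝ≥0∞ := fun x => ∫⁻ t, P (x - t) * v t ^ 2 with hw
  have hPs : Measurable fun z : ℝ × ℝ => P (z.1 - z.2) := hP.comp (measurable_fst.sub measurable_snd)
  have hwm : Measurable w :=
    (hPs.mul ((hv.comp measurable_snd).pow_const 2)).lintegral_prod_right'
  have hwi : ∫⁻ x, w x = p * ∫⁻ s, v s ^ 2 := lintegral_lintegral_sub_mul hP (hv.pow_const 2)
  have h1 : ∀ x s, u s * ∫⁻ t, (P (x - t) + P (s - t)) * v t ≤ 2 * p * u s ^ 2 + w s + w x := by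
    intro x s
    have m : ∀ y : ℝ, Measurable fun t => P (y - t) := fun y => hP.comp (measurable_const.sub measurable_id)
    have e : ∀ y, ∫⁻ t, P (y - t) * (u s ^ 2 + v t ^ 2) = p * u s ^ 2 + w y := fun y => by
      simp_rw [mul_add]
      rw [lintegral_add_left ((m y).mul_const _), lintegral_mul_const _ (m y),
        lintegral_sub_left_eq_self (fun t => P t) y]
    calc u s * ∫⁻ t, (P (x - t) + P (s - t)) * v t
        = ∫⁻ t, (P (x - t) + P (s - t)) * (u s * v t) := by
          have hm : Measurable fun t => (P (x - t) + P (s - t)) * v t := ((m x).add (m s)).mul hv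
          rw [← lintegral_const_mul _ hm]
          exact lintegral_congr fun t => by ring
      _ ≤ ∫⁻ t, (P (x - t) * (u s ^ 2 + v t ^ 2) + P (s - t) * (u s ^ 2 + v t ^ 2)) := by
          refine lintegral_mono fun t => ?_
          rw [← add_mul]
          exact mul_le_mul_right (mul_le_sq_add_sq _ _) _
      _ = p * u s ^ 2 + w x + (p * u s ^ 2 + w s) := by
          have hm : Measurable fun t => P (x - t) * (u s ^ 2 + v t ^ 2) :=
            (m x).mul ((hv.pow_const 2).const_add _)
          rw [lintegral_add_left hm, e, e]
      _ = _ := by ring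
  have mM : ∀ x : ℝ, Measurable fun s => M (x - s) := fun x => hM.comp (measurable_const.sub measurable_id)
  calc _ ≤ ∫⁻ x, ((∫⁻ s, M (x - s) * (2 * p * u s ^ 2 + w s)) + (∫⁻ s, M s) * w x) := by
        refine lintegral_mono fun x => ?_
        rw [← lintegral_sub_left_eq_self (fun t => M t) x, ← lintegral_mul_const _ (mM x),
          ← lintegral_add_right _ ((mM x).mul_const _)]
        refine lintegral_mono fun s => ?_
        rw [← mul_add]
        exact mul_le_mul_right (h1 x s) _
    _ = (∫⁻ x, M x) * (2 * p * (∫⁻ s, u s ^ 2) + p * ∫⁻ s, v s ^ 2) +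
        (∫⁻ s, M s) * (p * ∫⁻ s, v s ^ 2) := by
        have hm : Measurable fun s => 2 * p * u s ^ 2 + w s := ((hu.pow_const 2).const_mul _).add hwm
        rw [lintegral_add_right _ (hwm.const_mul _), lintegral_lintegral_sub_mul hM hm,
          lintegral_add_right _ hwm, lintegral_const_mul _ (hu.pow_const 2),
          lintegral_const_mul _ hwm, hwi]
    _ = _ := by ring

lemma lintegral_inv_one_add_sq (l : ℤ) {c : ℝ} (hc : 0 ≤ c) :
    ∫⁻ x : ℝ, ENNReal.ofReal (c * (1 + (2 ^ l * x) ^ 2)⁻¹) =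
      ENNReal.ofReal (c * (((2 : ℝ) ^ l)⁻¹ * Real.pi)) := by
  rw [← ofReal_integral_eq_lintegral_ofReal
    ((integrable_inv_one_add_sq.comp_mul_left' (by positivity : (2 : ℝ) ^ l ≠ 0)).const_mul _)
    (Eventually.of_forall fun x => by positivity), integral_const_mul,
    Measure.integral_comp_mul_left (fun x : ℝ => (1 + x ^ 2)⁻¹), integral_univ_inv_one_add_sq,
    abs_of_pos (by positivity), smul_eq_mul]

section

variable {K : ℝ → ℝ} {C : ℝ}

lemma fconv_eq_convolution (K u : ℝ → ℝ) :
    fconv K u = convolution u K (ContinuousLinearMap.mul ℝ ℝ) volume := by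
  funext x
  rw [fconv, convolution_def]
  exact integral_congr_ae (Eventually.of_forall fun t => by simp [mul_comm])

lemma integrable_fconv {K u : ℝ → ℝ} (hK : Integrable K) (hu : Integrable u) : Integrable (fconv K u) := by
  rw [fconv_eq_convolution]
  exact hu.integrable_convolution _ hK

lemma integral_fconv {K u : ℝ → ℝ} (hK : Integrable K) (hu : Integrable u) :
    ∫ x, fconv K u x = (∫ x, u x) * ∫ x, K x := by
  rw [fconv_eq_convolution, integral_convolution _ hu hK]
  simp

lemma IsKer.enorm_rdil_sub_le (hK : IsKer K C) (k : ℤ) (s t : ℝ) :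
    ‖rdil K k s - rdil K k t‖ₑ ≤ ENNReal.ofReal (C * 2 ^ k * |s - t|) *
      (ENNReal.ofReal (2 ^ k * (1 + (2 ^ k * s) ^ 2)⁻¹) + ENNReal.ofReal (2 ^ k * (1 + (2 ^ k * t) ^ 2)⁻¹)) := by
  have hC := hK.nonneg
  have h2k : (0 : ℝ) < 2 ^ k := by positivity
  rw [← ENNReal.ofReal_add (by positivity) (by positivity), ← ENNReal.ofReal_mul (by positivity),
    Real.enorm_eq_ofReal_abs]
  refine ENNReal.ofReal_le_ofReal ?_
  have one : ∀ τ : ℝ, 1 / (1 + |τ|) ^ 3 ≤ (1 + τ ^ 2)⁻¹ := fun τ => by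
    rw [one_div]
    refine inv_anti₀ (by positivity) ?_
    rw [← sq_abs τ]
    nlinarith [abs_nonneg τ, sq_nonneg |τ|, pow_nonneg (abs_nonneg τ) 3]
  have h := hK.lip (2 ^ k * s) (2 ^ k * t)
  rw [← mul_sub, abs_mul, abs_of_pos h2k] at h
  rw [rdil, rdil, ← mul_sub, abs_mul, abs_of_pos h2k]
  calc _ ≤ (2 : ℝ) ^ k * (C * (2 ^ k * |s - t|) * ((1 + (2 ^ k * s) ^ 2)⁻¹ + (1 + (2 ^ k * t) ^ 2)⁻¹)) :=
        mul_le_mul_of_nonneg_left (h.trans (mul_le_mul_of_nonneg_left (add_le_add (one _) (one _))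
          (by positivity))) h2k.le
    _ = _ := by ring

lemma IsKer.enorm_rdil_mul_abs_le (hK : IsKer K C) (l : ℤ) (y : ℝ) :
    ‖rdil K l y‖ₑ * ENNReal.ofReal |y| ≤ ENNReal.ofReal (C * (1 + (2 ^ l * y) ^ 2)⁻¹) := by
  have h2l : (0 : ℝ) < 2 ^ l := by positivity
  have h := hK.mul_bound_inv (2 ^ l * y)
  rw [Real.enorm_eq_ofReal_abs, ← ENNReal.ofReal_mul (abs_nonneg _)]
  refine ENNReal.ofReal_le_ofReal (le_trans (le_of_eq ?_) h)
  rw [rdil, abs_mul, abs_mul, abs_of_pos h2l]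
  ring

lemma IsKer.fconv_sub (hK : IsKer K C) (k : ℤ) {v : ℝ → ℝ} (hv : Integrable v) (x s : ℝ) :
    ‖fconv (rdil K k) v x - fconv (rdil K k) v s‖ₑ ≤ ENNReal.ofReal (C * 2 ^ k * |x - s|) *
      ∫⁻ t, (ENNReal.ofReal (2 ^ k * (1 + (2 ^ k * (x - t)) ^ 2)⁻¹) +
        ENNReal.ofReal (2 ^ k * (1 + (2 ^ k * (s - t)) ^ 2)⁻¹)) * ‖v t‖ₑ := by
  have hi : ∀ x : ℝ, Integrable fun t => rdil K k (x - t) • v t := fun x =>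
    hv.bdd_mul (c := C * 2 ^ k) ((hK.continuous_rdil k).comp (by fun_prop)).aestronglyMeasurable
      (Eventually.of_forall fun t => hK.rdil_le k _)
  rw [fconv, fconv, ← integral_sub (hi x) (hi s), ← lintegral_const_mul' _ _ ENNReal.ofReal_ne_top]
  refine (enorm_integral_le_lintegral_enorm _).trans (lintegral_mono fun t => ?_)
  rw [← sub_smul, enorm_smul, ← mul_assoc]
  refine mul_le_mul_left ?_ _
  have := hK.enorm_rdil_sub_le k (x - t) (s - t)
  rwa [sub_sub_sub_cancel_right] at this

/-- Decay of the pairing of two scales, `k ≤ l`. -/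
lemma IsKer.enorm_integral_fconv_mul_le (hK : IsKer K C) (h0 : ∫ t, K t = 0) (k l : ℤ) {u v : ℝ → ℝ}
    (hu : Measurable u) (hui : Integrable u) (hv : BM v) (hvi : Integrable v) :
    ‖∫ x, fconv (rdil K l) u x * fconv (rdil K k) v x‖ₑ ≤
      ENNReal.ofReal (2 * Real.pi ^ 2 * C ^ 2 * 2 ^ (k - l)) * ((∫⁻ s, ‖u s‖ₑ ^ 2) + ∫⁻ s, ‖v s‖ₑ ^ 2) := by
  have hC := hK.nonneg
  have h2k : (0 : ℝ) < 2 ^ k := by positivity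
  set w := fconv (rdil K k) v with hw
  have hwb : BM w := by
    have := BM.fconv_param (α := Unit) (hK.continuous_rdil k).measurable (hK.integrable_rdil k)
      (hv.comp (measurable_snd : Measurable (Prod.snd : Unit × ℝ → ℝ)))
    exact this.comp (measurable_prodMk_left (x := ()))
  obtain ⟨B, hB⟩ := hwb.2
  have hm0 : ∫ t, rdil K l t = 0 := by
    simp only [rdil]
    rw [integral_const_mul, Measure.integral_comp_mul_left, h0, smul_zero, mul_zero]
  have hKl := hK.integrable_rdil l
  have huw : Integrable fun s => u s * w s :=
    hui.mul_bdd (c := B) hwb.1.aestronglyMeasurable (Eventually.of_forall hB)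
  have hi : Integrable fun x => fconv (rdil K l) u x * w x :=
    (integrable_fconv hKl hui).mul_bdd (c := B) hwb.1.aestronglyMeasurable (Eventually.of_forall hB)
  have hs : ∀ {f : ℝ → ℝ}, Integrable f → ∀ x : ℝ, Integrable fun t => rdil K l (x - t) • f t :=
    fun hf x => hf.bdd_mul (c := C * 2 ^ l)
      ((hK.continuous_rdil l).comp (by fun_prop)).aestronglyMeasurable
      (Eventually.of_forall fun t => hK.rdil_le l _)
  have e : ∫ x, fconv (rdil K l) u x * w x =
      ∫ x, ∫ s, rdil K l (x - s) * (u s * (w x - w s)) := by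
    rw [← sub_zero (∫ x, fconv (rdil K l) u x * w x),
      show (0 : ℝ) = ∫ x, fconv (rdil K l) (fun s => u s * w s) x by
        rw [integral_fconv hKl huw, hm0, mul_zero],
      ← integral_sub hi (integrable_fconv hKl huw)]
    refine integral_congr_ae (Eventually.of_forall fun x => ?_)
    simp only [fconv]
    rw [← integral_mul_const, ← integral_sub ((hs hui x).mul_const _) (hs huw x)]
    refine integral_congr_ae (Eventually.of_forall fun s => ?_)
    simp only [smul_eq_mul]
    ring
  rw [e]
  calc ‖∫ x, ∫ s, rdil K l (x - s) * (u s * (w x - w s))‖ₑ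
      ≤ ∫⁻ x, ∫⁻ s, ‖rdil K l (x - s) * (u s * (w x - w s))‖ₑ :=
        (enorm_integral_le_lintegral_enorm _).trans
          (lintegral_mono fun x => enorm_integral_le_lintegral_enorm _)
    _ ≤ ∫⁻ x, ∫⁻ s, ENNReal.ofReal (C * 2 ^ k) * (ENNReal.ofReal (C * (1 + (2 ^ l * (x - s)) ^ 2)⁻¹) *
        (‖u s‖ₑ * ∫⁻ t, (ENNReal.ofReal (2 ^ k * (1 + (2 ^ k * (x - t)) ^ 2)⁻¹) +
        ENNReal.ofReal (2 ^ k * (1 + (2 ^ k * (s - t)) ^ 2)⁻¹)) * ‖v t‖ₑ)) := by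
        refine lintegral_mono fun x => lintegral_mono fun s => ?_
        rw [enorm_mul, enorm_mul]
        have h1 := hK.fconv_sub k hvi x s
        have h2 := hK.enorm_rdil_mul_abs_le l (x - s)
        rw [ENNReal.ofReal_mul (by positivity)] at h1
        refine (mul_le_mul_right (mul_le_mul_right h1 _) _).trans ?_
        refine le_trans (le_of_eq ?_) (mul_le_mul_right (mul_le_mul_left h2 _) _)
        ring
    _ ≤ ENNReal.ofReal (C * 2 ^ k) * (2 * (ENNReal.ofReal (C * ((2 ^ l)⁻¹ * Real.pi))) *
        ENNReal.ofReal (2 ^ k * ((2 ^ k)⁻¹ * Real.pi)) * ((∫⁻ s, ‖u s‖ₑ ^ 2) + ∫⁻ s, ‖v s‖ₑ ^ 2)) := by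
        simp_rw [lintegral_const_mul' _ _ ENNReal.ofReal_ne_top]
        refine mul_le_mul_right ?_ _
        rw [← lintegral_inv_one_add_sq l hC, ← lintegral_inv_one_add_sq k h2k.le]
        exact lintegral_triple_le
          (M := fun y => ENNReal.ofReal (C * (1 + (2 ^ l * y) ^ 2)⁻¹))
          (P := fun y => ENNReal.ofReal (2 ^ k * (1 + (2 ^ k * y) ^ 2)⁻¹))
          (by fun_prop) (by fun_prop) hu.enorm hv.1.enorm
    _ = _ := by
        rw [← mul_assoc, show (2 : ℝ≥0∞) = ENNReal.ofReal 2 by simp, ← ENNReal.ofReal_mul (by positivity),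
          ← ENNReal.ofReal_mul (by positivity), ← ENNReal.ofReal_mul (by positivity)]
        congr 2
        rw [zpow_sub₀ two_ne_zero]
        field_simp

/-- `L²` bound for a sum of mean-zero convolutions over dyadic scales. -/
lemma IsKer.lintegral_sum_fconv_sq_le (hK : IsKer K C) (h0 : ∫ t, K t = 0) (S : Finset ℤ)
    {h : ℤ → ℝ → ℝ} (hb : ∀ l, BM (h l)) (hi : ∀ l, Integrable (h l)) :
    ∫⁻ x, ‖∑ l ∈ S, fconv (rdil K l) (h l) x‖ₑ ^ 2 ≤
      ENNReal.ofReal (16 * Real.pi ^ 2 * C ^ 2) * ∑ l ∈ S, ∫⁻ s, ‖h l s‖ₑ ^ 2 := by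
  set A := 2 * Real.pi ^ 2 * C ^ 2 with hA
  have hA0 : 0 ≤ A := by positivity
  set N : ℤ → ℝ≥0∞ := fun l => ∫⁻ s, ‖h l s‖ₑ ^ 2 with hN
  have hF : ∀ l, BM (fconv (rdil K l) (h l)) := fun l => by
    have := BM.fconv_param (α := Unit) (hK.continuous_rdil l).measurable (hK.integrable_rdil l)
      ((hb l).comp (measurable_snd : Measurable (Prod.snd : Unit × ℝ → ℝ)))
    exact this.comp (measurable_prodMk_left (x := ()))
  have hFi : ∀ l, Integrable (fconv (rdil K l) (h l)) := fun l =>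
    integrable_fconv (hK.integrable_rdil l) (hi l)
  have hFF : ∀ k l, Integrable fun x => fconv (rdil K k) (h k) x * fconv (rdil K l) (h l) x :=
    fun k l => by
      obtain ⟨B, hB⟩ := (hF l).2
      exact (hFi k).mul_bdd (c := B) (hF l).1.aestronglyMeasurable (Eventually.of_forall hB)
  have key : ∀ k l, ‖∫ x, fconv (rdil K k) (h k) x * fconv (rdil K l) (h l) x‖ₑ ≤
      ENNReal.ofReal (A * (1 / 2) ^ (k - l).natAbs) * (N k + N l) := fun k l => by
    rcases le_total k l with hkl | hkl
    · have := hK.enorm_integral_fconv_mul_le h0 k l (hb l).1 (hi l) (hb k) (hi k)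
      simp_rw [mul_comm (fconv (rdil K k) (h k) _)]
      refine this.trans (le_of_eq ?_)
      rw [add_comm (N k)]
      congr 3
      rw [show k - l = -((k - l).natAbs : ℤ) by omega, zpow_neg, zpow_natCast, one_div, inv_pow,
        Int.natAbs_neg, Int.natAbs_natCast]
    · have := hK.enorm_integral_fconv_mul_le h0 l k (hb k).1 (hi k) (hb l) (hi l)
      refine this.trans (le_of_eq ?_)
      congr 3
      rw [show l - k = -((k - l).natAbs : ℤ) by omega, zpow_neg, zpow_natCast, one_div, inv_pow]
  have e : ∫⁻ x, ‖∑ l ∈ S, fconv (rdil K l) (h l) x‖ₑ ^ 2 =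
      ‖∑ k ∈ S, ∑ l ∈ S, ∫ x, fconv (rdil K k) (h k) x * fconv (rdil K l) (h l) x‖ₑ := by
    have e1 : ∀ x, ‖∑ l ∈ S, fconv (rdil K l) (h l) x‖ₑ ^ 2 =
        ENNReal.ofReal (∑ k ∈ S, ∑ l ∈ S, fconv (rdil K k) (h k) x * fconv (rdil K l) (h l) x) := fun x => by
      rw [← Finset.sum_mul_sum, ← sq, Real.enorm_eq_ofReal_abs, ← ENNReal.ofReal_pow (abs_nonneg _), sq_abs]
    simp_rw [e1]
    have hsum : Integrable fun x => ∑ k ∈ S, ∑ l ∈ S, fconv (rdil K k) (h k) x * fconv (rdil K l) (h l) x :=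
      integrable_finsetSum _ fun k _ => integrable_finsetSum _ fun l _ => hFF k l
    have hnn : ∀ x, 0 ≤ ∑ k ∈ S, ∑ l ∈ S, fconv (rdil K k) (h k) x * fconv (rdil K l) (h l) x := fun x => by
      rw [← Finset.sum_mul_sum]
      exact mul_self_nonneg _
    rw [← ofReal_integral_eq_lintegral_ofReal hsum (Eventually.of_forall hnn),
      ← Real.enorm_of_nonneg (integral_nonneg hnn),
      integral_finsetSum _ fun k _ => integrable_finsetSum _ fun l _ => hFF k l]
    congr 1
    exact Finset.sum_congr rfl fun k _ => integral_finsetSum _ fun l _ => hFF k l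
  have hsumS : ∀ n : ℤ, ∑ l ∈ S, ENNReal.ofReal (A * (1 / 2) ^ (l + n).natAbs) ≤ ENNReal.ofReal (4 * A) :=
    fun n => by
      rw [← ENNReal.ofReal_sum_of_nonneg fun _ _ => by positivity, ← Finset.mul_sum]
      refine ENNReal.ofReal_le_ofReal ?_
      nlinarith [sum_half_natAbs_le S n]
  rw [e]
  calc _ ≤ ∑ k ∈ S, ∑ l ∈ S, ENNReal.ofReal (A * (1 / 2) ^ (k - l).natAbs) * (N k + N l) :=
        (enorm_sum_le _ _).trans (Finset.sum_le_sum fun k _ =>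
          (enorm_sum_le _ _).trans (Finset.sum_le_sum fun l _ => key k l))
    _ = ∑ k ∈ S, (∑ l ∈ S, ENNReal.ofReal (A * (1 / 2) ^ (l + -k).natAbs)) * N k +
        ∑ l ∈ S, (∑ k ∈ S, ENNReal.ofReal (A * (1 / 2) ^ (k + -l).natAbs)) * N l := by
        simp_rw [mul_add, Finset.sum_add_distrib]
        congr 1
        · refine Finset.sum_congr rfl fun k _ => ?_
          rw [Finset.sum_mul]
          refine Finset.sum_congr rfl fun l _ => ?_
          rw [show (k - l).natAbs = (l + -k).natAbs by omega]
        · rw [Finset.sum_comm]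
          refine Finset.sum_congr rfl fun k _ => ?_
          rw [Finset.sum_mul]
          rfl
    _ ≤ ∑ k ∈ S, ENNReal.ofReal (4 * A) * N k + ∑ l ∈ S, ENNReal.ofReal (4 * A) * N l :=
        add_le_add (Finset.sum_le_sum fun k _ => mul_le_mul_left (hsumS _) _)
          (Finset.sum_le_sum fun k _ => mul_le_mul_left (hsumS _) _)
    _ = _ := by
        rw [← Finset.mul_sum, ← add_mul, ← ENNReal.ofReal_add (by positivity) (by positivity), hA]
        congr 2
        ring

end

/-! ### Calderón–Zygmund extrapolation from `L²` -/

lemma measurable_fconv_param {γ E : Type*} [MeasurableSpace γ] [NormedAddCommGroup E] [NormedSpace ℝ E]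
    [MeasurableSpace E] [BorelSpace E] [SecondCountableTopology E] {K : ℝ → ℝ}
    (hK : Measurable K) {u : γ × ℝ → E} (hu : Measurable u) :
    Measurable fun z : γ × ℝ => fconv K (fun t => u (z.1, t)) z.2 := by
  have h : Measurable fun v : (γ × ℝ) × ℝ => K (v.1.2 - v.2) • u (v.1.1, v.2) := by fun_prop
  exact (h.stronglyMeasurable.integral_prod_right' (ν := volume)).measurable

lemma measurable_fconv {E : Type*} [NormedAddCommGroup E] [NormedSpace ℝ E]
    [MeasurableSpace E] [BorelSpace E] [SecondCountableTopology E] {K : ℝ → ℝ}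
    (hK : Measurable K) {u : ℝ → E} (hu : Measurable u) : Measurable (fconv K u) := by
  have h : Measurable fun v : ℝ × ℝ => K (v.1 - v.2) • u v.2 := by fun_prop
  exact (h.stronglyMeasurable.integral_prod_right' (ν := volume)).measurable

lemma fconv_congr_ae {E : Type*} [NormedAddCommGroup E] [NormedSpace ℝ E] {K : ℝ → ℝ} {u v : ℝ → E}
    (h : u =ᵐ[volume] v) (x : ℝ) : fconv K u x = fconv K v x :=
  integral_congr_ae (h.mono fun t ht => by simp only [ht])

section

variable {E : Type*} [NormedAddCommGroup E] [NormedSpace ℝ E]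

open Classical in
/-- The good part, truncated on a null set so as to be bounded everywhere. -/
def goodClip (α : ℝ) (u : ℝ → E) (x : ℝ) : E :=
  if ‖goodPart α u x‖ ≤ 2 * α then goodPart α u x else 0

lemma norm_goodClip_le {α : ℝ} (hα : 0 ≤ α) (u : ℝ → E) (x : ℝ) : ‖goodClip α u x‖ ≤ 2 * α := by
  unfold goodClip
  split_ifs with h
  · exact h
  · simpa using hα

variable [MeasurableSpace E] [BorelSpace E] [SecondCountableTopology E]

lemma measurable_goodClip_param {γ : Type*} [MeasurableSpace γ] {u : γ → ℝ → E}
    (hu : Measurable (Function.uncurry u)) (α : ℝ) :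
    Measurable fun z : γ × ℝ => goodClip α (u z.1) z.2 := by
  have h := measurable_goodPart_param hu α
  exact Measurable.ite (measurableSet_le h.norm measurable_const) h measurable_const

lemma measurable_goodClip {u : ℝ → E} (hu : Measurable u) (α : ℝ) : Measurable (goodClip α u) := by
  have h := measurable_goodPart hu α
  exact Measurable.ite (measurableSet_le h.norm measurable_const) h measurable_const

variable [CompleteSpace E] {u : ℝ → E}

lemma goodClip_ae_eq (hi : Integrable u) {α : ℝ} (hα : 0 < α) :
    goodClip α u =ᵐ[volume] goodPart α u := by
  filter_upwards [ae_enorm_goodPart_le hi hα] with x hx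
  refine if_pos ?_
  have := hx.1
  rwa [show (2 : ℝ≥0∞) = ENNReal.ofReal 2 by simp, ← ENNReal.ofReal_mul zero_le_two,
    ← ofReal_norm, ENNReal.ofReal_le_ofReal_iff (by positivity)] at this

lemma ae_enorm_goodClip_le (hi : Integrable u) {α : ℝ} (hα : 0 < α) :
    ∀ᵐ x, ‖goodClip α u x‖ₑ ≤ HL (fun t => ‖u t‖ₑ) x := by
  filter_upwards [ae_enorm_goodPart_le hi hα, goodClip_ae_eq hi hα] with x hx h
  rw [h]
  exact hx.2

lemma integrable_goodClip (hu : Measurable u) (hi : Integrable u) {α : ℝ} (hα : 0 < α) :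
    Integrable (goodClip α u) :=
  (integrable_goodPart hu hi α).congr (goodClip_ae_eq hi hα).symm

lemma IsKer.lintegral_sum_sub_goodClip_le {K : ℝ → ℝ} {C : ℝ} (hK : IsKer K C) (hu : Measurable u)
    (hi : Integrable u) (S : Finset ℤ) {α : ℝ} (hα : 0 < α) :
    ∫⁻ x in {x | HL (fun t => ‖u t‖ₑ) x ≤ ENNReal.ofReal (α / 4)},
      ∑ l ∈ S, ‖fconv (rdil K l) (fun t => u t - goodClip α u t) x‖ₑ ≤
    ENNReal.ofReal (160 * Real.pi * C * α) *
      volume {x | ENNReal.ofReal (α / 4) < HL (fun t => ‖u t‖ₑ) x} := by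
  have e : ∀ l x, fconv (rdil K l) (fun t => u t - goodClip α u t) x =
      fconv (rdil K l) (fun t => u t - goodPart α u t) x := fun l x =>
    fconv_congr_ae ((goodClip_ae_eq hi hα).mono fun t ht => by simp only [ht]) x
  simp_rw [e]
  exact hK.lintegral_sum_bad_le hu hi S hα

/-- Chebyshev bound for the bad part. -/
lemma IsKer.volume_lt_sum_sub_goodClip_le {K : ℝ → ℝ} {C : ℝ} (hK : IsKer K C) (hu : Measurable u)
    (hi : Integrable u) (S : Finset ℤ) {α c : ℝ} (hα : 0 < α) (hc : 0 < c) :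
    volume {x | ENNReal.ofReal (c * α) < ∑ l ∈ S, ‖fconv (rdil K l) (fun t => u t - goodClip α u t) x‖ₑ} ≤
      ENNReal.ofReal (1 + 160 * Real.pi * C / c) *
        volume {x | ENNReal.ofReal (α / 4) < HL (fun t => ‖u t‖ₑ) x} := by
  have hC := hK.nonneg
  set b : ℝ → ℝ≥0∞ := fun x => ∑ l ∈ S, ‖fconv (rdil K l) (fun t => u t - goodClip α u t) x‖ₑ with hb
  have hbm : Measurable b := Finset.measurable_fun_sum _ fun l _ =>
    (measurable_fconv (hK.continuous_rdil l).measurable (hu.sub (measurable_goodClip hu α))).enorm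
  set H := {x | ENNReal.ofReal (α / 4) < HL (fun t => ‖u t‖ₑ) x} with hH
  set G := {x | HL (fun t => ‖u t‖ₑ) x ≤ ENNReal.ofReal (α / 4)} with hG
  have hca : ENNReal.ofReal (c * α) ≠ 0 := by
    rw [Ne, ENNReal.ofReal_eq_zero, not_le]
    positivity
  have h1 : (volume.restrict G) {x | ENNReal.ofReal (c * α) ≤ b x} ≤
      ENNReal.ofReal (160 * Real.pi * C / c) * volume H := by
    refine (meas_ge_le_lintegral_div hbm.aemeasurable hca ENNReal.ofReal_ne_top).trans ?_
    refine (ENNReal.div_le_div_right (hK.lintegral_sum_sub_goodClip_le hu hi S hα) _).trans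
      (le_of_eq ?_)
    rw [mul_comm, mul_div_assoc, ← ENNReal.ofReal_div_of_pos (by positivity), mul_comm]
    congr 2
    field_simp
  calc volume {x | ENNReal.ofReal (c * α) < b x} ≤ volume (H ∪ ({x | ENNReal.ofReal (c * α) ≤ b x} ∩ G)) := by
        refine measure_mono fun x hx => ?_
        rcases lt_or_ge (ENNReal.ofReal (α / 4)) (HL (fun t => ‖u t‖ₑ) x) with h | h
        · exact Or.inl h
        · exact Or.inr ⟨show ENNReal.ofReal (c * α) ≤ b x from le_of_lt hx, h⟩
    _ ≤ volume H + ENNReal.ofReal (160 * Real.pi * C / c) * volume H := by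
        refine (measure_union_le _ _).trans (add_le_add_right ?_ _)
        rwa [← Measure.restrict_apply (measurableSet_le measurable_const hbm)]
    _ = _ := by
        rw [ENNReal.ofReal_add zero_le_one (by positivity), ENNReal.ofReal_one, add_mul, one_mul]

end

lemma min_rpow {x y : ℝ≥0∞} {p : ℝ} (hp : 0 ≤ p) : min x y ^ p = min (x ^ p) (y ^ p) :=
  (ENNReal.monotone_rpow_of_nonneg hp).map_min

section

variable {E F : Type*} [NormedAddCommGroup E] [NormedSpace ℝ E]
  [CompleteSpace E] [MeasurableSpace E] [BorelSpace E] [SecondCountableTopology E]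
  [NormedAddCommGroup F] [NormedSpace ℝ F] [MeasurableSpace F] [BorelSpace F] [SecondCountableTopology F]

lemma IsKer.volume_lt_of_L2 {K : ℝ → ℝ} {C : ℝ} (hK : IsKer K C) {p : ℝ} (hp1 : 1 < p) {A : ℝ≥0}
    {S : Finset ℤ} {R : ℤ → E →L[ℝ] F} (hR : ∀ l v, ‖R l v‖ ≤ ‖v‖)
    (hL2 : ∀ u : ℝ → E, Measurable u → Integrable u → (∃ B, ∀ t, ‖u t‖ ≤ B) →
      ∫⁻ x, ‖∑ l ∈ S, R l (fconv (rdil K l) u x)‖ₑ ^ 2 ≤ A * ∫⁻ t, ‖u t‖ₑ ^ 2)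
    {u : ℝ → E} (hu : Measurable u) (hi : Integrable u) {s : ℝ} (hs : 0 < s) :
    volume {x | ENNReal.ofReal s < ‖∑ l ∈ S, R l (fconv (rdil K l) u x)‖ₑ ^ p} ≤
      ENNReal.ofReal (1 + 320 * Real.pi * C) *
        volume {x | ENNReal.ofReal s < (4 * HL (fun t => ‖u t‖ₑ) x) ^ p} +
      16 * A * (ENNReal.ofReal (s ^ (-(2 / p))) *
        ∫⁻ x, min ((4 * HL (fun t => ‖u t‖ₑ) x) ^ p) (ENNReal.ofReal s) ^ (2 / p)) := by
  have hp0 : 0 < p := by linarith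
  set α := s ^ (1 / p) with hα
  have hα0 : 0 < α := by positivity
  have hsα : ENNReal.ofReal s = ENNReal.ofReal α ^ p := by
    rw [ENNReal.ofReal_rpow_of_pos hα0, hα, ← Real.rpow_mul hs.le]
    congr 1
    field_simp
    simp
  set M := HL (fun t => ‖u t‖ₑ) with hM
  set g := goodClip α u with hg
  have hgm : Measurable g := measurable_goodClip hu α
  have hgi : Integrable g := integrable_goodClip hu hi hα0
  have ei : ∀ {f : ℝ → E}, Integrable f → ∀ l (x : ℝ), Integrable fun t => rdil K l (x - t) • f t :=
    fun hf l x => hf.bdd_smul (C * 2 ^ l)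
      ((hK.continuous_rdil l).comp (by fun_prop)).aestronglyMeasurable
      (Eventually.of_forall fun t => hK.rdil_le l _)
  have hsplit : ∀ x, ‖∑ l ∈ S, R l (fconv (rdil K l) u x)‖ₑ ≤ ‖∑ l ∈ S, R l (fconv (rdil K l) g x)‖ₑ +
      ∑ l ∈ S, ‖fconv (rdil K l) (fun t => u t - g t) x‖ₑ := fun x => by
    have e : ∑ l ∈ S, R l (fconv (rdil K l) u x) = ∑ l ∈ S, R l (fconv (rdil K l) g x) +
        ∑ l ∈ S, R l (fconv (rdil K l) (fun t => u t - g t) x) := by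
      rw [← Finset.sum_add_distrib]
      refine Finset.sum_congr rfl fun l _ => ?_
      have hug : Integrable fun t => rdil K l (x - t) • (u t - g t) := ei (hi.sub hgi) l x
      rw [← map_add, fconv, fconv, fconv, ← integral_add (ei hgi l x) hug]
      congr 2
      funext t
      rw [← smul_add, add_sub_cancel]
    rw [e]
    refine (enorm_add_le _ _).trans (add_le_add_right ((enorm_sum_le _ _).trans
      (Finset.sum_le_sum fun l _ => ?_)) _)
    rw [← ofReal_norm, ← ofReal_norm]
    exact ENNReal.ofReal_le_ofReal (hR l _)
  have hTg : Measurable fun x => ‖∑ l ∈ S, R l (fconv (rdil K l) g x)‖ₑ :=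
    (Finset.measurable_fun_sum _ fun l _ => (R l).continuous.measurable.comp
      (measurable_fconv (hK.continuous_rdil l).measurable hgm)).enorm
  have hgood : volume {x | ENNReal.ofReal (1 / 2 * α) < ‖∑ l ∈ S, R l (fconv (rdil K l) g x)‖ₑ} ≤
      16 * A * (ENNReal.ofReal (s ^ (-(2 / p))) *
        ∫⁻ x, min ((4 * M x) ^ p) (ENNReal.ofReal s) ^ (2 / p)) := by
    have h1 : ∫⁻ t, ‖g t‖ₑ ^ 2 ≤ 4 * ∫⁻ x, min ((4 * M x) ^ p) (ENNReal.ofReal s) ^ (2 / p) := by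
      rw [← lintegral_const_mul' _ _ (by simp)]
      refine lintegral_mono_ae ?_
      filter_upwards [ae_enorm_goodClip_le hi hα0] with x hx
      rw [hsα, ← min_rpow hp0.le, ← ENNReal.rpow_mul, mul_div_cancel₀ _ hp0.ne',
        show (2 : ℝ) = (2 : ℕ) by norm_num, ENNReal.rpow_natCast,
        show (4 : ℝ≥0∞) = 2 ^ 2 by norm_num, ← mul_pow]
      refine pow_le_pow_left₀ (zero_le) ?_ 2
      rw [mul_min]
      refine le_min (hx.trans ?_) ?_
      · rw [← mul_assoc]
        exact le_mul_of_one_le_left (zero_le) (by norm_num)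
      · rw [show (2 : ℝ≥0∞) = ENNReal.ofReal 2 by simp, ← ENNReal.ofReal_mul zero_le_two,
          ← ofReal_norm]
        exact ENNReal.ofReal_le_ofReal (norm_goodClip_le hα0.le u x)
    have h0 : ENNReal.ofReal (1 / 2 * α) ^ 2 ≠ 0 := pow_ne_zero _ (by
      rw [Ne, ENNReal.ofReal_eq_zero, not_le]
      positivity)
    calc _ ≤ volume {x | ENNReal.ofReal (1 / 2 * α) ^ 2 ≤ ‖∑ l ∈ S, R l (fconv (rdil K l) g x)‖ₑ ^ 2} :=
          measure_mono fun x hx => pow_le_pow_left₀ (zero_le) (le_of_lt hx) 2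
      _ ≤ (∫⁻ x, ‖∑ l ∈ S, R l (fconv (rdil K l) g x)‖ₑ ^ 2) / ENNReal.ofReal (1 / 2 * α) ^ 2 :=
          meas_ge_le_lintegral_div (hTg.pow_const 2).aemeasurable h0
            (ENNReal.pow_ne_top ENNReal.ofReal_ne_top)
      _ ≤ (A * (4 * ∫⁻ x, min ((4 * M x) ^ p) (ENNReal.ofReal s) ^ (2 / p))) /
          ENNReal.ofReal (1 / 2 * α) ^ 2 :=
          ENNReal.div_le_div_right ((hL2 g hgm hgi ⟨_, norm_goodClip_le hα0.le u⟩).trans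
            (mul_le_mul_right h1 _)) _
      _ = _ := by
          have e : (ENNReal.ofReal (1 / 2 * α) ^ 2)⁻¹ = 4 * ENNReal.ofReal (s ^ (-(2 / p))) := by
            rw [← ENNReal.ofReal_pow (by positivity), ← ENNReal.ofReal_inv_of_pos (by positivity),
              show (4 : ℝ≥0∞) = ENNReal.ofReal 4 by simp, ← ENNReal.ofReal_mul (by norm_num)]
            congr 1
            rw [Real.rpow_neg hs.le, show s ^ (2 / p) = α ^ 2 by
              rw [hα, ← Real.rpow_natCast, ← Real.rpow_mul hs.le]
              congr 1
              push_cast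
              ring]
            field_simp
            norm_num
          rw [div_eq_mul_inv, e]
          ring
  have hbad := hK.volume_lt_sum_sub_goodClip_le hu hi S hα0 (c := 1 / 2) (by norm_num)
  have hlev : {x | ENNReal.ofReal (α / 4) < M x} = {x | ENNReal.ofReal s < (4 * M x) ^ p} := by
    ext x
    simp only [Set.mem_ofPred_eq]
    rw [hsα, ENNReal.rpow_lt_rpow_iff hp0, show α = 4 * (α / 4) by ring,
      ENNReal.ofReal_mul (by norm_num), show ENNReal.ofReal 4 = 4 by simp,
      ENNReal.mul_lt_mul_iff_right (by norm_num) (by norm_num)]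
    ring_nf
  rw [hlev] at hbad
  calc _ ≤ volume ({x | ENNReal.ofReal (1 / 2 * α) < ∑ l ∈ S, ‖fconv (rdil K l) (fun t => u t - g t) x‖ₑ} ∪
        {x | ENNReal.ofReal (1 / 2 * α) < ‖∑ l ∈ S, R l (fconv (rdil K l) g x)‖ₑ}) := by
        refine measure_mono fun x hx => ?_
        by_contra h
        simp only [Set.mem_union, Set.mem_ofPred_eq, not_or, not_lt] at h hx
        rw [hsα, ENNReal.rpow_lt_rpow_iff hp0] at hx
        refine absurd (hx.trans_le ((hsplit x).trans (add_le_add h.2 h.1))) (not_lt.2 (le_of_eq ?_))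
        rw [← ENNReal.ofReal_add (by positivity) (by positivity)]
        congr 1
        ring
    _ ≤ _ := (measure_union_le _ _).trans (add_le_add (hbad.trans (le_of_eq (by
        congr 2
        ring))) hgood)

/-- An `L²` bound extrapolates to `Lᵖ`, `1 < p < 2`. -/
theorem strong_type_of_L2 {p : ℝ} (hp1 : 1 < p) (hp2 : p < 2) (C : ℝ) (A : ℝ≥0) :
    ∃ D : ℝ≥0, ∀ (K : ℝ → ℝ), IsKer K C →
    ∀ (E F : Type) [NormedAddCommGroup E] [NormedSpace ℝ E]
    [CompleteSpace E] [MeasurableSpace E] [BorelSpace E] [SecondCountableTopology E]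
    [NormedAddCommGroup F] [NormedSpace ℝ F] [MeasurableSpace F] [BorelSpace F]
    [SecondCountableTopology F] (S : Finset ℤ) (R : ℤ → E →L[ℝ] F), (∀ l v, ‖R l v‖ ≤ ‖v‖) →
    (∀ u : ℝ → E, Measurable u → Integrable u → (∃ B, ∀ t, ‖u t‖ ≤ B) →
      ∫⁻ x, ‖∑ l ∈ S, R l (fconv (rdil K l) u x)‖ₑ ^ 2 ≤ A * ∫⁻ t, ‖u t‖ₑ ^ 2) →
    ∀ u : ℝ → E, Measurable u → Integrable u →
      ∫⁻ x, ‖∑ l ∈ S, R l (fconv (rdil K l) u x)‖ₑ ^ p ≤ D * ∫⁻ t, ‖u t‖ₑ ^ p := by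
  have hp0 : 0 < p := by linarith
  obtain ⟨D, hD⟩ := HL_strong_type hp1
  set A' : ℝ≥0 := (1 + 320 * Real.pi * C).toNNReal + 16 * A with hA'
  refine ⟨A' * (2 * (4 ^ p * D * (1 + 2 / p / (2 / p - 1)).toNNReal)), ?_⟩
  intro K hK E F _ _ _ _ _ _ _ _ _ _ _ S R hR hL2 u hu hi
  have hHm := measurable_HL hu.enorm
  have hFm : Measurable fun x => (4 * HL (fun t => ‖u t‖ₑ) x) ^ p := (hHm.const_mul _).pow_const p
  have hUm : Measurable fun x => ‖∑ l ∈ S, R l (fconv (rdil K l) u x)‖ₑ ^ p :=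
    (Finset.measurable_fun_sum _ fun l _ => (R l).continuous.measurable.comp
      (measurable_fconv (hK.continuous_rdil l).measurable hu)).enorm.pow_const p
  have hP : 1 < 2 / p := by rwa [lt_div_iff₀ hp0, one_mul]
  refine (lintegral_le_of_level hUm hFm hFm hP hP (A := A') fun s hs => ?_).trans ?_
  · refine (hK.volume_lt_of_L2 hp1 hR hL2 hu hi hs).trans ?_
    rw [hA', ENNReal.coe_add, ENNReal.coe_mul, mul_add]
    refine add_le_add ?_ ?_
    · exact mul_le_mul' le_self_add le_self_add
    · exact mul_le_mul' le_add_self le_self_add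
  · rw [ENNReal.coe_mul, mul_assoc]
    refine mul_le_mul_right ?_ _
    have h1 : ∫⁻ x, (4 * HL (fun t => ‖u t‖ₑ) x) ^ p ≤ 4 ^ p * (D * ∫⁻ t, ‖u t‖ₑ ^ p) := by
      simp_rw [ENNReal.mul_rpow_of_nonneg _ _ hp0.le]
      rw [lintegral_const_mul' _ _ (ENNReal.rpow_ne_top_of_nonneg hp0.le (by simp))]
      exact mul_le_mul_right (hD _ hu.enorm) _
    rw [← two_mul]
    refine (mul_le_mul_right (mul_le_mul_left h1 _) _).trans (le_of_eq ?_)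
    push_cast
    rw [ENNReal.coe_rpow_of_nonneg _ hp0.le, ENNReal.ofReal, ENNReal.coe_ofNat]
    ring

end

/-! ### Duality and square functions -/

section Dual

variable {α : Type*} [NormedAddCommGroup α] [MeasurableSpace α] [BorelSpace α] [ProperSpace α]
  {ι : Type*} [Fintype ι]

lemma rpow_half_dual {r V : ℝ} (hr : 1 < r) (hV : 0 ≤ V) :
    V * V ^ ((r - 2) / 2) = V ^ (r / 2) := by
  rcases hV.eq_or_lt with rfl | h
  · rw [zero_mul, Real.zero_rpow (by linarith)]
  · rw [← Real.rpow_one_add' h.le (by linarith)]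
    congr 1
    ring

lemma abs_mul_rpow_le {r V a C : ℝ} (hr : 1 < r) (haV : a ^ 2 ≤ V) (hVC : V ≤ C) :
    |a * V ^ ((r - 2) / 2)| ≤ C ^ ((r - 1) / 2) := by
  have hV : 0 ≤ V := (sq_nonneg a).trans haV
  have h1 : |a| ≤ V ^ ((1 : ℝ) / 2) := by
    rw [← Real.sqrt_eq_rpow]
    exact Real.abs_le_sqrt haV
  rw [abs_mul, abs_of_nonneg (Real.rpow_nonneg hV _)]
  refine (mul_le_mul_of_nonneg_right h1 (Real.rpow_nonneg hV _)).trans ?_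
  rw [← Real.rpow_add' hV (by linarith)]
  refine (le_of_eq ?_).trans (Real.rpow_le_rpow hV hVC (by linarith : 0 ≤ (r - 1) / 2))
  congr 1
  ring

lemma sum_sq_dual {r S : ℝ} (hr : 1 < r) (hrS : 1 / r + 1 / S = 1) (a : ι → ℝ) :
    (∑ i, (a i * (∑ j, a j ^ 2) ^ ((r - 2) / 2)) ^ 2) ^ (S / 2) = (∑ j, a j ^ 2) ^ (r / 2) := by
  have hV : 0 ≤ ∑ j, a j ^ 2 := Finset.sum_nonneg fun j _ => sq_nonneg _
  set V := ∑ j, a j ^ 2 with hVdef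
  have hS : S ≠ 0 := by
    rintro rfl
    simp at hrS
    linarith
  have hSr : (r - 1) * S = r := by
    have : r ≠ 0 := by linarith
    field_simp at hrS
    linarith
  simp_rw [mul_pow]
  rw [← Finset.sum_mul, ← hVdef, sq (V ^ _), ← mul_assoc, rpow_half_dual hr hV]
  rcases hV.eq_or_lt with h | h
  · rw [← h, Real.zero_rpow (by linarith), zero_mul, Real.zero_rpow (by simpa using hS)]
  · rw [← Real.rpow_add h, ← Real.rpow_mul h.le]
    congr 1
    linarith

/-- Characterisation of mixed `Lʳ(ℓ²)` norms by duality. -/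
theorem lintegral_sum_sq_le_of_dual (μ : Measure α) [IsFiniteMeasureOnCompacts μ] {r S : ℝ}
    (hr : 1 < r) (hrS : 1 / r + 1 / S = 1) {v : ι → α → ℝ} (hv : ∀ i, BM (v i)) {A : ℝ≥0∞}
    (hA : ∀ h : ι → α → ℝ, (∀ i, BC (h i)) → ‖∫ x, ∑ i, h i x * v i x ∂μ‖ₑ ≤
      A * (∫⁻ x, ENNReal.ofReal (∑ i, h i x ^ 2) ^ (S / 2) ∂μ) ^ (1 / S)) :
    (∫⁻ x, ENNReal.ofReal (∑ i, v i x ^ 2) ^ (r / 2) ∂μ) ^ (1 / r) ≤ A := by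
  have hr0 : 0 < r := by linarith
  have h1r : 1 / r < 1 := (div_lt_one hr0).2 hr
  have hS1 : 0 < 1 / S := by linarith
  have hS0 : 0 < S := one_div_pos.1 hS1
  set V : α → ℝ := fun x => ∑ i, v i x ^ 2 with hVdef
  have hV0 : ∀ x, 0 ≤ V x := fun x => Finset.sum_nonneg fun j _ => sq_nonneg _
  have hVbm : BM V := BM.sum _ fun i => (hv i).pow 2
  obtain ⟨hVm, C, hC⟩ := hVbm
  have hC' : ∀ x, V x ≤ C := fun x => (le_abs_self _).trans (hC x)
  have hball : ∀ n : ℕ, (∫⁻ x in Metric.closedBall (0 : α) n, ENNReal.ofReal (V x) ^ (r / 2) ∂μ) ^ (1 / r) ≤ A := by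
    intro n
    set B := Metric.closedBall (0 : α) n with hB
    set h : ι → α → ℝ := fun i => B.indicator fun x => v i x * V x ^ ((r - 2) / 2) with hh
    have hhBC : ∀ i, BC (h i) := by
      intro i
      refine ⟨⟨((hv i).1.mul (hVm.pow_const _)).indicator measurableSet_closedBall,
        C ^ ((r - 1) / 2), fun x => ?_⟩, n, fun x hx => ?_⟩
      · by_cases hx : x ∈ B
        · simp only [hh, Set.indicator_of_mem hx]
          exact abs_mul_rpow_le hr (Finset.single_le_sum (f := fun j => v j x ^ 2)
            (fun j _ => sq_nonneg _) (Finset.mem_univ i)) (hC' x)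
        · simp only [hh, Set.indicator_of_notMem hx, abs_zero]
          exact Real.rpow_nonneg ((hV0 x).trans (hC' x)) _
      · simp only [hh]
        exact Set.indicator_of_notMem (by simpa [hB] using hx) _
    have h2 : ∀ x, ENNReal.ofReal (∑ i, h i x ^ 2) ^ (S / 2) =
        B.indicator (fun x => ENNReal.ofReal (V x) ^ (r / 2)) x := by
      intro x
      by_cases hx : x ∈ B
      · simp only [hh, Set.indicator_of_mem hx]
        rw [ENNReal.ofReal_rpow_of_nonneg (Finset.sum_nonneg fun j _ => sq_nonneg _) (by positivity),
          ENNReal.ofReal_rpow_of_nonneg (hV0 x) (by positivity), sum_sq_dual hr hrS]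
      · simp [hh, Set.indicator_of_notMem hx, hS0]
    have h3 : ∀ x, ∑ i, h i x * v i x = B.indicator (fun x => V x ^ (r / 2)) x := by
      intro x
      by_cases hx : x ∈ B
      · simp only [hh, Set.indicator_of_mem hx]
        rw [← rpow_half_dual hr (hV0 x), hVdef, Finset.sum_mul]
        exact Finset.sum_congr rfl fun i _ => by ring
      · simp [hh, Set.indicator_of_notMem hx]
    have hX : ‖∫ x, ∑ i, h i x * v i x ∂μ‖ₑ = ∫⁻ x in B, ENNReal.ofReal (V x) ^ (r / 2) ∂μ := by
      simp_rw [h3]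
      rw [integral_indicator measurableSet_closedBall, integral_eq_lintegral_of_nonneg_ae
        (Eventually.of_forall fun x => Real.rpow_nonneg (hV0 x) _) (hVm.pow_const _).aestronglyMeasurable]
      rw [Real.enorm_eq_ofReal ENNReal.toReal_nonneg, ENNReal.ofReal_toReal]
      · exact lintegral_congr fun x => (ENNReal.ofReal_rpow_of_nonneg (hV0 x) (by positivity)).symm
      · refine ((setLIntegral_mono measurable_const (g := fun _ => ENNReal.ofReal (C ^ (r / 2))) fun x _ =>
          ENNReal.ofReal_le_ofReal (Real.rpow_le_rpow (hV0 x) (hC' x) (by positivity))).trans_lt ?_).ne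
        rw [setLIntegral_const]
        exact ENNReal.mul_lt_top ENNReal.ofReal_lt_top (isCompact_closedBall _ _).measure_lt_top
    have h4 := hA h hhBC
    have hXfin : ∫⁻ x in B, ENNReal.ofReal (V x) ^ (r / 2) ∂μ ≠ ⊤ := by
      rw [← hX]; exact enorm_ne_top
    simp_rw [h2] at h4
    rw [hX, lintegral_indicator measurableSet_closedBall] at h4
    set X := ∫⁻ x in B, ENNReal.ofReal (V x) ^ (r / 2) ∂μ
    rcases eq_or_ne X 0 with h0 | h0
    · rw [h0, ENNReal.zero_rpow_of_pos (by positivity)]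
      exact zero_le
    · have h5 : X ^ (1 / r) * X ^ (1 / S) = X := by
        rw [← ENNReal.rpow_add _ _ h0 hXfin, hrS, ENNReal.rpow_one]
      have h6 : X ^ (1 / S) ≠ 0 := by simp [ENNReal.rpow_eq_zero_iff, h0, hXfin]
      have h7 : X ^ (1 / S) ≠ ⊤ := ENNReal.rpow_ne_top_of_nonneg hS1.le hXfin
      rw [← ENNReal.mul_le_mul_iff_left h6 h7, h5]
      exact h4
  have hU : (⋃ n : ℕ, Metric.closedBall (0 : α) n) = Set.univ := Metric.iUnion_closedBall_nat 0
  have hd : Directed (· ⊆ ·) fun n : ℕ => Metric.closedBall (0 : α) n :=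
    directed_of_isDirected_le fun m n hmn => Metric.closedBall_subset_closedBall (by exact_mod_cast hmn)
  rw [one_div, ENNReal.rpow_inv_le_iff hr0, ← setLIntegral_univ, ← hU,
    setLIntegral_iUnion_of_directed _ hd]
  refine iSup_le fun n => ?_
  rw [← ENNReal.rpow_inv_le_iff hr0, ← one_div]
  exact hball n

end Dual

lemma IsKer.comp_neg {K : ℝ → ℝ} {C : ℝ} (hK : IsKer K C) : IsKer (fun t => K (-t)) C where
  bound t := by simpa using hK.bound (-t)
  lip s t := by
    have := hK.lip (-s) (-t)
    rwa [abs_neg, abs_neg, neg_sub_neg, abs_sub_comm t s] at this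

lemma integral_mul_fconv_comm {κ : ℝ → ℝ} (hκ : Integrable κ) {h g : ℝ → ℝ}
    (hh : Integrable h) (hg : BM g) :
    Integrable (fun x => h x * fconv κ g x) ∧
    ∫ x, h x * fconv κ g x = ∫ t, fconv (fun s => κ (-s)) h t * g t := by
  obtain ⟨hgm, C, hC⟩ := hg
  have hint0 : Integrable (fun w : ℝ × ℝ => (h w.1 * κ (w.1 - w.2)) * g w.2) (volume.prod volume) := by
    refine Integrable.mul_bdd (c := C) ?_ (hgm.comp measurable_snd).aestronglyMeasurable
      (Eventually.of_forall fun w => hC _)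
    have h1 := (measurePreserving_prod_sub (volume : Measure ℝ) (volume : Measure ℝ)).integrable_comp_of_integrable
      (hh.mul_prod hκ.comp_neg)
    refine h1.congr (Eventually.of_forall fun w => ?_)
    simp only [Function.comp_apply, neg_sub]
  have hintg : Integrable (Function.uncurry fun x t => h x * (κ (x - t) * g t)) (volume.prod volume) :=
    hint0.congr (Eventually.of_forall fun w => mul_assoc _ _ _)
  have e1 : ∀ x, h x * fconv κ g x = ∫ t, h x * (κ (x - t) * g t) := fun x => by
    rw [integral_const_mul]; rfl
  refine ⟨by simpa only [e1, Function.uncurry_apply_pair] using hintg.integral_prod_left, ?_⟩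
  simp_rw [e1]
  rw [integral_integral_swap hintg]
  refine integral_congr_ae (Eventually.of_forall fun t => ?_)
  simp only [fconv, neg_sub, smul_eq_mul]
  rw [← integral_mul_const]
  refine integral_congr_ae (Eventually.of_forall fun x => ?_)
  simp only
  ring

section Square

variable {m : ℕ} (S : Finset ℤ)

/-- The projection onto the block of coordinates with scale `l`. -/
def blockProj (l : ℤ) : EuclideanSpace ℝ (S × Fin m) →L[ℝ] EuclideanSpace ℝ (Fin m) :=
  LinearMap.toContinuousLinearMap
    { toFun := fun e => WithLp.toLp 2 fun i => if h : l ∈ S then e (⟨l, h⟩, i) else 0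
      map_add' := fun a b => by
        ext i
        by_cases h : l ∈ S <;> simp [h]
      map_smul' := fun c a => by
        ext i
        by_cases h : l ∈ S <;> simp [h] }

lemma blockProj_apply (l : ℤ) (e : EuclideanSpace ℝ (S × Fin m)) (i : Fin m) :
    blockProj S l e i = if h : l ∈ S then e (⟨l, h⟩, i) else 0 := rfl

lemma sum_blockProj_sq (e : EuclideanSpace ℝ (S × Fin m)) {M : Type*} [AddCommMonoid M] (f : ℝ → M) :
    ∑ l ∈ S, ∑ i, f (blockProj S l e i) = ∑ v, f (e v) := by
  rw [Fintype.sum_prod_type, ← Finset.sum_coe_sort S]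
  exact Finset.sum_congr rfl fun l _ => Finset.sum_congr rfl fun i _ => by
    rw [blockProj_apply, dif_pos l.2]

lemma norm_blockProj_le (l : ℤ) (e : EuclideanSpace ℝ (S × Fin m)) : ‖blockProj S l e‖ ≤ ‖e‖ := by
  rw [EuclideanSpace.norm_eq, EuclideanSpace.norm_eq]
  refine Real.sqrt_le_sqrt ?_
  by_cases h : l ∈ S
  · simp only [blockProj_apply, dif_pos h, Fintype.sum_prod_type]
    exact Finset.single_le_sum (f := fun k : S => ∑ i, ‖e (k, i)‖ ^ 2)
      (fun k _ => Finset.sum_nonneg fun i _ => sq_nonneg _) (Finset.mem_univ (⟨l, h⟩ : S))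
  · simp only [blockProj_apply, dif_neg h, norm_zero]
    simp only [ne_eq, OfNat.ofNat_ne_zero, not_false_eq_true, zero_pow, Finset.sum_const_zero]
    exact Finset.sum_nonneg fun i _ => sq_nonneg _

lemma enorm_sq_euclidean {ι : Type*} [Fintype ι] (e : EuclideanSpace ℝ ι) :
    ‖e‖ₑ ^ 2 = ∑ i, ‖e i‖ₑ ^ 2 := by
  rw [← ofReal_norm, ← ENNReal.ofReal_pow (norm_nonneg _), EuclideanSpace.norm_sq_eq,
    ENNReal.ofReal_sum_of_nonneg fun i _ => sq_nonneg _]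
  refine Finset.sum_congr rfl fun i _ => ?_
  rw [ENNReal.ofReal_pow (norm_nonneg _), ofReal_norm]

lemma enorm_rpow_euclidean {ι : Type*} [Fintype ι] (e : EuclideanSpace ℝ ι) (s : ℝ) :
    ‖e‖ₑ ^ s = ENNReal.ofReal (∑ i, e i ^ 2) ^ (s / 2) := by
  have h : ENNReal.ofReal (∑ i, e i ^ 2) = ‖e‖ₑ ^ 2 := by
    rw [← ofReal_norm, ← ENNReal.ofReal_pow (norm_nonneg _), EuclideanSpace.norm_sq_eq]
    simp
  rw [h, ← ENNReal.rpow_natCast, ← ENNReal.rpow_mul]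
  congr 1
  push_cast
  ring

lemma IsKer.fconv_apply {K : ℝ → ℝ} {C : ℝ} (hK : IsKer K C) (l : ℤ) {E : Type*}
    [NormedAddCommGroup E] [NormedSpace ℝ E] [CompleteSpace E] {F : Type*} [NormedAddCommGroup F]
    [NormedSpace ℝ F] [CompleteSpace F] (L : E →L[ℝ] F)
    {u : ℝ → E} (hu : Integrable u) (x : ℝ) :
    L (fconv (rdil K l) u x) = fconv (rdil K l) (fun t => L (u t)) x := by
  have hi : Integrable fun t => rdil K l (x - t) • u t :=
    hu.bdd_smul (C * 2 ^ l) (((hK.continuous_rdil l).comp (by fun_prop)).aestronglyMeasurable)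
      (Eventually.of_forall fun t => hK.rdil_le l _)
  rw [fconv, ← L.integral_comp_comm hi, fconv]
  simp only [map_smul]

lemma IsKer.lintegral_sum_blockProj_le {K : ℝ → ℝ} {C : ℝ} (hK : IsKer K C) (h0 : ∫ t, K t = 0)
    {u : ℝ → EuclideanSpace ℝ (S × Fin m)} (hu : Measurable u) (hi : Integrable u)
    (hb : ∃ B, ∀ t, ‖u t‖ ≤ B) :
    ∫⁻ x, ‖∑ l ∈ S, blockProj S l (fconv (rdil K l) u x)‖ₑ ^ 2 ≤
      (16 * Real.pi ^ 2 * C ^ 2).toNNReal * ∫⁻ t, ‖u t‖ₑ ^ 2 := by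
  obtain ⟨B, hB⟩ := hb
  set P : ℤ → Fin m → EuclideanSpace ℝ (S × Fin m) →L[ℝ] ℝ := fun l i =>
    (EuclideanSpace.proj i).comp (blockProj S l) with hP
  have hPa : ∀ l i e, P l i e = blockProj S l e i := fun l i e => rfl
  have hbm : ∀ i l, BM fun t => P l i (u t) := fun i l =>
    ⟨(P l i).continuous.measurable.comp hu, ‖P l i‖ * B, fun t =>
      ((P l i).le_opNorm _).trans (mul_le_mul_of_nonneg_left (hB t) (norm_nonneg _))⟩
  have e1 : ∀ x, ‖∑ l ∈ S, blockProj S l (fconv (rdil K l) u x)‖ₑ ^ 2 =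
      ∑ i, ‖∑ l ∈ S, fconv (rdil K l) (fun t => P l i (u t)) x‖ₑ ^ 2 := by
    intro x
    rw [enorm_sq_euclidean]
    refine Finset.sum_congr rfl fun i _ => ?_
    congr 2
    rw [WithLp.ofLp_sum, Finset.sum_apply]
    exact Finset.sum_congr rfl fun l _ => hK.fconv_apply l (P l i) hi x
  have hfm : ∀ i, Measurable fun x => ‖∑ l ∈ S, fconv (rdil K l) (fun t => P l i (u t)) x‖ₑ ^ 2 := fun i =>
    (Finset.measurable_fun_sum _ fun l _ =>
      measurable_fconv (hK.continuous_rdil l).measurable (hbm i l).1).enorm.pow_const 2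
  simp_rw [e1]
  rw [lintegral_finsetSum _ fun i _ => hfm i]
  refine (Finset.sum_le_sum fun i _ => hK.lintegral_sum_fconv_sq_le h0 S (h := fun l t => P l i (u t)) (hbm i)
    fun l => (P l i).integrable_comp hi).trans (le_of_eq ?_)
  rw [← Finset.mul_sum, Finset.sum_comm]
  congr 1
  have hm2 : ∀ l i, Measurable fun t => ‖P l i (u t)‖ₑ ^ 2 := fun l i => (hbm i l).1.enorm.pow_const 2
  simp_rw [enorm_sq_euclidean (u _), ← sum_blockProj_sq S (u _) fun a => ‖a‖ₑ ^ 2, ← hPa]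
  rw [lintegral_finsetSum _ fun l _ => Finset.measurable_fun_sum _ fun i _ => hm2 l i]
  exact Finset.sum_congr rfl fun l _ => (lintegral_finsetSum _ fun i _ => hm2 l i).symm

end Square

lemma integrable_toLp {ι : Type*} [Fintype ι] {h : ι → ℝ → ℝ} (hh : ∀ v, Integrable (h v)) :
    Integrable fun t => (WithLp.toLp 2 fun v => h v t : EuclideanSpace ℝ ι) :=
  ((PiLp.continuousLinearEquiv 2 ℝ fun _ : ι => ℝ).symm.toContinuousLinearMap.integrable_comp
    (Integrable.of_eval (f := fun t v => h v t) hh))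

lemma measurable_toLp {α ι : Type*} [MeasurableSpace α] [Fintype ι] {h : ι → α → ℝ}
    (hh : ∀ v, Measurable (h v)) :
    Measurable fun t => (WithLp.toLp 2 fun v => h v t : EuclideanSpace ℝ ι) :=
  ((PiLp.continuousLinearEquiv 2 ℝ fun _ : ι => ℝ).symm.continuous.measurable.comp
    (measurable_pi_lambda _ hh))

lemma rdil_comp_neg (K : ℝ → ℝ) (k : ℤ) (t : ℝ) : rdil (fun s => K (-s)) k t = rdil K k (-t) := by
  simp only [rdil, mul_neg]

lemma IsKer.integral_sum_mul_fconv {K : ℝ → ℝ} {C : ℝ} (hK : IsKer K C) {m : ℕ} (S : Finset ℤ)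
    {h : S × Fin m → ℝ → ℝ} (hh : ∀ v, BC (h v)) {g : Fin m → ℝ → ℝ} (hg : ∀ i, BM (g i)) :
    ∫ x, ∑ v, h v x * fconv (rdil K v.1) (g v.2) x =
      ∫ t, ∑ i, (∑ l ∈ S, blockProj S l (fconv (rdil (fun s => K (-s)) l)
        (fun s => WithLp.toLp 2 fun v => h v s) t)) i * g i t := by
  have hi : ∀ v, Integrable (h v) := fun v => (hh v).integrable volume
  have hu : Integrable fun t => (WithLp.toLp 2 fun v => h v t : EuclideanSpace ℝ (S × Fin m)) :=
    integrable_toLp hi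
  have key := fun v : S × Fin m => integral_mul_fconv_comm (hK.integrable_rdil v.1) (hi v) (hg v.2)
  rw [integral_finsetSum _ fun v _ => (key v).1]
  simp_rw [fun v => (key v).2, ← rdil_comp_neg]
  have hbm : ∀ v : S × Fin m, Integrable fun t => fconv (rdil (fun s => K (-s)) v.1) (h v) t * g v.2 t := by
    intro v
    obtain ⟨hgm, B, hB⟩ := hg v.2
    exact (integrable_fconv (hK.comp_neg.integrable_rdil v.1) (hi v)).mul_bdd (c := B)
      hgm.aestronglyMeasurable (Eventually.of_forall hB)
  rw [← integral_finsetSum _ fun v _ => hbm v]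
  refine integral_congr_ae (Eventually.of_forall fun t => ?_)
  simp only
  have e : ∀ i, (∑ l ∈ S, blockProj S l (fconv (rdil (fun s => K (-s)) l)
        (fun s => WithLp.toLp 2 fun v => h v s) t)) i = ∑ l : S, fconv (rdil (fun s => K (-s)) l) (h (l, i)) t := by
    intro i
    rw [WithLp.ofLp_sum, Finset.sum_apply, ← Finset.sum_coe_sort S]
    refine Finset.sum_congr rfl fun l _ => ?_
    rw [blockProj_apply, dif_pos l.2]
    exact hK.comp_neg.fconv_apply l.1 (EuclideanSpace.proj (l, i)) hu t
  simp_rw [e, Finset.sum_mul]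
  rw [Fintype.sum_prod_type, Finset.sum_comm]

lemma enorm_sum_mul_le {ι : Type*} [Fintype ι] (a b : EuclideanSpace ℝ ι) :
    ‖∑ i, a i * b i‖ₑ ≤ ‖a‖ₑ * ‖b‖ₑ := by
  have h := norm_inner_le_norm (𝕜 := ℝ) b a
  rw [PiLp.inner_apply] at h
  simp only [RCLike.inner_apply, conj_trivial] at h
  rw [← ofReal_norm, ← ofReal_norm, ← ofReal_norm, ← ENNReal.ofReal_mul (norm_nonneg _)]
  exact ENNReal.ofReal_le_ofReal (by rwa [mul_comm ‖a‖])

/-- The square function of a mean-zero kernel is bounded on `L^Q(ℓ²)`, `2 < Q`. -/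
theorem IsKer.lintegral_square_le {Q : ℝ} (hQ : 2 < Q) {K : ℝ → ℝ} {C : ℝ} (hK : IsKer K C)
    (h0 : ∫ t, K t = 0) : ∃ D : ℝ≥0, ∀ (m : ℕ) (S : Finset ℤ) (g : Fin m → ℝ → ℝ),
      (∀ i, BM (g i)) →
      ∫⁻ x, ENNReal.ofReal (∑ v : S × Fin m, fconv (rdil K v.1) (g v.2) x ^ 2) ^ (Q / 2) ≤
        D * ∫⁻ x, ENNReal.ofReal (∑ i, g i x ^ 2) ^ (Q / 2) := by
  have hQ0 : 0 < Q := by linarith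
  set p := Q / (Q - 1) with hp
  have hpQ : p.HolderConjugate Q := (Real.HolderConjugate.conjExponent (by linarith : 1 < Q)).symm
  have hp1 : 1 < p := hpQ.lt
  have hp2 : p < 2 := by
    rw [hp, div_lt_iff₀ (by linarith)]
    linarith
  obtain ⟨D, hD⟩ := strong_type_of_L2 hp1 hp2 C (16 * Real.pi ^ 2 * C ^ 2).toNNReal
  refine ⟨(D ^ (1 / p)) ^ Q, fun m S g hg => ?_⟩
  set G : ℝ → EuclideanSpace ℝ (Fin m) := fun t => WithLp.toLp 2 fun i => g i t with hGdef
  have hGm : Measurable G := measurable_toLp fun i => (hg i).1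
  have hG : ∀ t, ENNReal.ofReal (∑ i, g i t ^ 2) ^ (Q / 2) = ‖G t‖ₑ ^ Q := fun t =>
    (enorm_rpow_euclidean (G t) Q).symm
  have hdual := lintegral_sum_sq_le_of_dual (volume : Measure ℝ) (by linarith : 1 < Q) (S := p)
    (by simpa [one_div] using hpQ.symm.inv_add_inv_eq_one)
    (v := fun v : S × Fin m => fconv (rdil K v.1) (g v.2)) (fun v => ?_)
    (A := D ^ (1 / p) * (∫⁻ x, ‖G x‖ₑ ^ Q) ^ (1 / Q)) (fun h hh => ?_)
  · simp_rw [hG]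
    have := ENNReal.rpow_le_rpow hdual hQ0.le
    rw [← ENNReal.rpow_mul, one_div_mul_cancel hQ0.ne', ENNReal.rpow_one,
      ENNReal.mul_rpow_of_nonneg _ _ hQ0.le, ← ENNReal.rpow_mul (∫⁻ _, _),
      one_div_mul_cancel hQ0.ne', ENNReal.rpow_one] at this
    refine this.trans (le_of_eq ?_)
    rw [← ENNReal.coe_rpow_of_nonneg _ (by positivity), ← ENNReal.coe_rpow_of_nonneg _ hQ0.le]
  · have := BM.fconv_param (α := Unit) (hK.continuous_rdil v.1).measurable (hK.integrable_rdil v.1)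
      ((hg v.2).comp (measurable_snd : Measurable (Prod.snd : Unit × ℝ → ℝ)))
    exact this.comp (measurable_prodMk_left (x := ()))
  · set u : ℝ → EuclideanSpace ℝ (S × Fin m) := fun t => WithLp.toLp 2 fun v => h v t with hu
    have hum : Measurable u := measurable_toLp fun v => (hh v).1.1
    have hui : Integrable u := integrable_toLp fun v => (hh v).integrable volume
    have hK0 : ∫ t, K (-t) = 0 := by rw [integral_neg_eq_self, h0]
    set W : ℝ → EuclideanSpace ℝ (Fin m) := fun x =>
      ∑ l ∈ S, blockProj S l (fconv (rdil (fun s => K (-s)) l) u x) with hW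
    have hWm : Measurable W := Finset.measurable_fun_sum _ fun l _ => (blockProj S l).continuous.measurable.comp
      (measurable_fconv (hK.comp_neg.continuous_rdil l).measurable hum)
    have hWp : ∫⁻ x, ‖W x‖ₑ ^ p ≤ D * ∫⁻ t, ‖u t‖ₑ ^ p :=
      hD _ hK.comp_neg _ _ S (blockProj S) (norm_blockProj_le S)
        (fun w hw hwi hwb => hK.comp_neg.lintegral_sum_blockProj_le S hK0 hw hwi hwb) u hum hui
    rw [hK.integral_sum_mul_fconv S hh hg]
    calc _ ≤ ∫⁻ t, ‖∑ i, W t i * G t i‖ₑ := enorm_integral_le_lintegral_enorm _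
      _ ≤ ∫⁻ t, ‖W t‖ₑ * ‖G t‖ₑ := lintegral_mono fun t => enorm_sum_mul_le _ _
      _ ≤ (∫⁻ t, ‖W t‖ₑ ^ p) ^ (1 / p) * (∫⁻ t, ‖G t‖ₑ ^ Q) ^ (1 / Q) :=
        ENNReal.lintegral_mul_le_Lp_mul_Lq _ hpQ hWm.enorm.aemeasurable hGm.enorm.aemeasurable
      _ ≤ (D * ∫⁻ t, ‖u t‖ₑ ^ p) ^ (1 / p) * (∫⁻ t, ‖G t‖ₑ ^ Q) ^ (1 / Q) :=
        mul_le_mul_left (ENNReal.rpow_le_rpow hWp (by positivity)) _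
      _ = _ := by
        rw [ENNReal.mul_rpow_of_nonneg _ _ (by positivity)]
        rw [show (fun t => ENNReal.ofReal (∑ v, h v t ^ 2) ^ (p / 2)) = fun t => ‖u t‖ₑ ^ p from
          funext fun t => (enorm_rpow_euclidean (u t) p).symm]
        ring

/-! ### The truncated paraproduct for large exponents -/

lemma fconv_fconv {κ m : ℝ → ℝ} (hκ : Integrable κ) (hm : Integrable m) {g : ℝ → ℝ} (hg : BM g)
    (y : ℝ) : fconv κ (fconv m g) y = fconv (fconv κ m) g y := by
  have h := (integral_mul_fconv_comm hm (hκ.comp_sub_left y) hg).2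
  simp only [fconv, smul_eq_mul] at h ⊢
  rw [h]
  refine integral_congr_ae (Eventually.of_forall fun t => ?_)
  simp only
  congr 1
  rw [← integral_add_right_eq_self _ t]
  refine integral_congr_ae (Eventually.of_forall fun s => ?_)
  simp only [neg_sub, add_sub_cancel_right]
  rw [mul_comm, sub_sub, add_comm t s]

lemma rdil_fconv (κ m : ℝ → ℝ) (k : ℤ) (t : ℝ) :
    rdil (fconv κ m) k t = fconv (rdil κ k) (rdil m k) t := by
  have h2k : (0 : ℝ) < 2 ^ k := by positivity
  rw [fconv_rdil_eq, rdil, fconv, ← integral_sub_left_eq_self _ volume ((2 : ℝ) ^ k * t),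
    ← integral_const_mul]
  refine integral_congr_ae (Eventually.of_forall fun s => ?_)
  simp only [rdil, sub_sub_cancel, smul_eq_mul, mul_sub, mul_inv_cancel_left₀ h2k.ne']
  ring

lemma haar_mul_left {c : ℝ} (hc : 0 < c) (ℓ s : ℝ) : haar (c * ℓ) (c * s) = haar ℓ s := by
  unfold haar
  simp only [mul_div_assoc, mul_le_mul_iff_right₀ hc, mul_pos_iff_of_pos_left hc]

lemma rdil_eta (ℓ : ℝ) (k : ℤ) (t : ℝ) : rdil (eta ℓ) k t = eta ((2 ^ k)⁻¹ * ℓ) t := by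
  have h2k : (0 : ℝ) < 2 ^ k := by positivity
  have h1 : ∫ s, haar ℓ (2 ^ k * t + s) * haar ℓ s =
      2 ^ k * ∫ s, haar ((2 ^ k)⁻¹ * ℓ) (t + s) * haar ((2 ^ k)⁻¹ * ℓ) s := by
    have h := Measure.integral_comp_mul_left (fun s => haar ℓ (2 ^ k * t + s) * haar ℓ s) ((2 : ℝ) ^ k)
    rw [abs_of_pos (by positivity), eq_inv_smul_iff₀ h2k.ne', smul_eq_mul] at h
    rw [← h]
    congr 1
    refine integral_congr_ae (Eventually.of_forall fun s => ?_)
    simp only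
    rw [← mul_add, ← haar_mul_left h2k ((2 ^ k)⁻¹ * ℓ) (t + s), ← haar_mul_left h2k ((2 ^ k)⁻¹ * ℓ) s,
      mul_inv_cancel_left₀ h2k.ne']
  rw [rdil, eta, eta, h1, mul_pow, mul_inv, inv_pow, inv_inv]
  ring

/-- The truncated twisted paraproduct with real kernels. -/
def tp (a b : ℝ → ℝ) (lam : ℤ → ℝ) (S : Finset ℤ) (f g : ℝ × ℝ → ℝ) (z : ℝ × ℝ) : ℝ :=
  ∑ l ∈ S, lam l * fconv (rdil a l) (fun t => f (t, z.2)) z.1 *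
    fconv (rdil b l) (fun t => g (z.1, t)) z.2

lemma sum_Icc_eq_sum_range {M : Type*} [AddCommMonoid M] (N : ℕ) (F : ℤ → M) :
    ∑ l ∈ Finset.Icc (-(N : ℤ)) N, F l = ∑ j ∈ Finset.range (2 * N + 1), F ((j : ℤ) - N) := by
  symm
  refine Finset.sum_bij (fun j _ => (j : ℤ) - N) (fun j hj => ?_) (fun i _ j _ h => ?_)
    (fun l hl => ?_) fun _ _ => rfl
  · rw [Finset.mem_range] at hj
    rw [Finset.mem_Icc]
    omega
  · omega
  · rw [Finset.mem_Icc] at hl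
    exact ⟨(l + N).toNat, by rw [Finset.mem_range]; omega, by omega⟩

/-- Fibrewise square function estimate in the plane. -/
lemma IsKer.nq_square_le {Q : ℝ} (hQ : 2 < Q) {K : ℝ → ℝ} {C : ℝ} (hK : IsKer K C)
    (h0 : ∫ t, K t = 0) : ∃ D : ℝ≥0, ∀ (m : ℕ) (S : Finset ℤ) (g : Fin m → ℝ × ℝ → ℝ),
      (∀ i, BM (g i)) →
      nq Q (fun z => ∑ v : S × Fin m, fconv (rdil K v.1) (fun t => g v.2 (z.1, t)) z.2 ^ 2) ≤
        D * nq Q (fun z => ∑ i, g i z ^ 2) := by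
  obtain ⟨D, hD⟩ := hK.lintegral_square_le hQ h0
  refine ⟨D ^ (1 / Q), fun m S g hg => ?_⟩
  have hQ0 : 0 < Q := by linarith
  unfold nq
  rw [ENNReal.coe_rpow_of_nonneg _ (by positivity), ← ENNReal.mul_rpow_of_nonneg _ _ (by positivity)]
  refine ENNReal.rpow_le_rpow ?_ (by positivity)
  have hm1 : Measurable fun z : ℝ × ℝ => ENNReal.ofReal
      (∑ v : S × Fin m, fconv (rdil K v.1) (fun t => g v.2 (z.1, t)) z.2 ^ 2) ^ (Q / 2) :=
    (Finset.measurable_fun_sum _ fun v _ => (((hg v.2).fconv_snd (hK.continuous_rdil v.1).measurable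
      (hK.integrable_rdil v.1)).1.pow_const 2)).ennreal_ofReal.pow_const _
  have hm2 : Measurable fun z : ℝ × ℝ => ENNReal.ofReal (∑ i, g i z ^ 2) ^ (Q / 2) :=
    (Finset.measurable_fun_sum _ fun i _ => (hg i).1.pow_const 2).ennreal_ofReal.pow_const _
  rw [Measure.volume_eq_prod, lintegral_prod _ hm1.aemeasurable, lintegral_prod _ hm2.aemeasurable,
    ← lintegral_const_mul' _ _ (by simp)]
  exact lintegral_mono fun x => hD m S (fun i t => g i (x, t)) fun i => (hg i).comp measurable_prodMk_left

lemma BM.tp {a b : ℝ → ℝ} {lam : ℤ → ℝ} {Ca Cb : ℝ} (ha : IsKer a Ca) (hb : IsKer b Cb) {S : Finset ℤ}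
    {f g : ℝ × ℝ → ℝ} (hf : BM f) (hg : BM g) : BM (tp a b lam S f g) :=
  BM.sum _ fun l => ((BM.const (lam l)).mul (hf.fconv_fst (ha.continuous_rdil l).measurable
    (ha.integrable_rdil l))).mul (hg.fconv_snd (hb.continuous_rdil l).measurable (hb.integrable_rdil l))

lemma fconv_rdil_eta {b m : ℝ → ℝ} {Cm : ℝ} (hm : IsKer m Cm) (hb : ∀ t, b t = fconv (eta (1 / 2)) m t)
    (N j : ℕ) {g : ℝ → ℝ} (hg : BM g) (y : ℝ) :
    fconv (rdil b ((j : ℤ) - N)) g y =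
      fconv (eta ((2 : ℝ) ^ ((N : ℤ) - 1) / 2 ^ j)) (fconv (rdil m ((j : ℤ) - N)) g) y := by
  have h1 : eta ((2 : ℝ) ^ ((N : ℤ) - 1) / 2 ^ j) = rdil (eta (1 / 2)) ((j : ℤ) - N) := by
    funext t
    rw [rdil_eta]
    congr 1
    rw [zpow_sub₀ two_ne_zero, zpow_sub₀ two_ne_zero, zpow_one, zpow_natCast, zpow_natCast]
    field_simp
  have h2 : Integrable (rdil (eta (1 / 2)) ((j : ℤ) - N)) := by
    rw [← h1]; exact eta_integrable _
  rw [h1, fconv_fconv h2 (hm.integrable_rdil _) hg, ← funext (rdil_fconv _ _ _), ← funext hb]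

lemma fconv_const_mul (κ : ℝ → ℝ) (c : ℝ) (u : ℝ → ℝ) (y : ℝ) :
    fconv κ (fun t => c * u t) y = c * fconv κ u y := by
  simp only [fconv, smul_eq_mul]
  rw [← integral_const_mul]
  exact integral_congr_ae (Eventually.of_forall fun t => mul_left_comm _ _ _)

/-- The paraproduct estimate in the local `L²` range. -/
theorem base_estimate {p q r : ℝ} (hp : 2 < p) (hq : 2 < q) (hpqr : 1 / p + 1 / q = 1 / r)
    (hr1 : 1 < r) (hr2 : r < 2) {a b m : ℝ → ℝ} {Ca Cb Cm : ℝ} (ha : IsKer a Ca) (hbk : IsKer b Cb)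
    (hm : IsKer m Cm) (hm0 : ∫ t, m t = 0) (hb : ∀ t, b t = fconv (eta (1 / 2)) m t) :
    ∃ C : ℝ≥0, ∀ (M : ℕ) (lam : ℤ → ℝ), (∀ k, |lam k| ≤ 1) → ∀ (N : ℕ) (f : ℝ × ℝ → ℝ)
      (g : Fin M → ℝ × ℝ → ℝ), BM f → (∀ i, BM (g i)) →
      nq r (fun z => ∑ i, tp a b lam (Finset.Icc (-(N : ℤ)) N) f (g i) z ^ 2) ≤
        C * (nq p (fun z => f z ^ 2) * nq q (fun z => ∑ i, g i z ^ 2)) := by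
  have hr0 : 0 < r := by linarith
  set S : ℝ := r / (r - 1) with hSdef
  have hS : 2 < S := by
    rw [hSdef, lt_div_iff₀ (by linarith)]
    linarith
  have hrS : 1 / r + 1 / S = 1 := by
    rw [hSdef]
    field_simp
    ring
  obtain ⟨C, hC⟩ := sum_scales_ker hp hq hS (by linarith) ha
  obtain ⟨D, hD⟩ := hm.nq_square_le hq hm0
  refine ⟨C * D, fun M lam hlam N f g hf hg => ?_⟩
  set T : Finset ℤ := Finset.Icc (-(N : ℤ)) N with hT
  set n := 2 * N + 1 with hn
  have hmg : ∀ (l : ℤ) i, BM fun z : ℝ × ℝ => fconv (rdil m l) (fun t => g i (z.1, t)) z.2 := fun l i =>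
    (hg i).fconv_snd (hm.continuous_rdil l).measurable (hm.integrable_rdil l)
  set gj : ℕ → Fin M → ℝ × ℝ → ℝ := fun j i z =>
    lam ((j : ℤ) - N) * fconv (rdil m ((j : ℤ) - N)) (fun t => g i (z.1, t)) z.2 with hgj
  set ug : ℝ × ℝ → ℝ := fun z => ∑ v : T × Fin M, fconv (rdil m v.1) (fun t => g v.2 (z.1, t)) z.2 ^ 2
    with hug
  have hgjb : ∀ j i, BM (gj j i) := fun j i => (BM.const _).mul (hmg _ i)
  have hugb : BM ug := BM.sum _ fun v => (hmg v.1 v.2).pow 2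
  have hug0 : ∀ z, 0 ≤ ug z := fun z => Finset.sum_nonneg fun v _ => sq_nonneg _
  have hgu : ∀ z, ∑ j ∈ Finset.range n, ∑ i, gj j i z ^ 2 ≤ ug z := by
    intro z
    have e : ug z = ∑ j ∈ Finset.range n, ∑ i,
        fconv (rdil m ((j : ℤ) - N)) (fun t => g i (z.1, t)) z.2 ^ 2 := by
      rw [← sum_Icc_eq_sum_range N fun l => ∑ i, fconv (rdil m l) (fun t => g i (z.1, t)) z.2 ^ 2,
        hug, ← Finset.sum_coe_sort]
      exact Fintype.sum_prod_type _
    rw [e]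
    refine Finset.sum_le_sum fun j _ => Finset.sum_le_sum fun i _ => ?_
    rw [hgj, mul_pow]
    exact mul_le_of_le_one_left (sq_nonneg _) ((sq_le_one_iff_abs_le_one _).2 (hlam _))
  refine lintegral_sum_sq_le_of_dual (volume : Measure (ℝ × ℝ)) hr1 hrS
    (fun i => BM.tp ha hbk hf (hg i)) (fun h hh => ?_)
  have hw : ∀ j : ℕ, Integrable fun z : ℝ × ℝ => (∑ i, h i z *
      fconv (eta ((2 : ℝ) ^ ((N : ℤ) - 1) / 2 ^ j)) (fun t => gj j i (z.1, t)) z.2) *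
        fconv (rdil a ((j : ℤ) - N)) (fun t => f (t, z.2)) z.1 := fun j =>
    ((BC.sum _ fun i => (hh i).mul_bm ((hgjb j i).fconv_snd (eta_bm _).1 (eta_integrable _))).mul_bm
      (hf.fconv_fst (ha.continuous_rdil _).measurable (ha.integrable_rdil _))).integrable volume
  have e : ∀ z, ∑ i, h i z * tp a b lam T f (g i) z = ∑ j ∈ Finset.range n, (∑ i, h i z *
      fconv (eta ((2 : ℝ) ^ ((N : ℤ) - 1) / 2 ^ j)) (fun t => gj j i (z.1, t)) z.2) *
        fconv (rdil a ((j : ℤ) - N)) (fun t => f (t, z.2)) z.1 := by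
    intro z
    simp only [tp, hT, sum_Icc_eq_sum_range, Finset.mul_sum, Finset.sum_mul]
    rw [Finset.sum_comm]
    refine Finset.sum_congr rfl fun j _ => Finset.sum_congr rfl fun i _ => ?_
    rw [fconv_rdil_eta hm hb N j ((hg i).comp measurable_prodMk_left)]
    simp only [hgj, fconv_const_mul]
    ring
  simp_rw [e]
  rw [integral_finsetSum _ fun j _ => hw j]
  refine (enorm_sum_le _ _).trans ((hC M n N f ug h gj hf hugb hug0 hh hgjb hgu).trans ?_)
  rw [ENNReal.coe_mul]
  calc _ ≤ C * (nq p (fun z => f z ^ 2) * (D * nq q fun z => ∑ i, g i z ^ 2) *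
        nq S fun z => ∑ i, h i z ^ 2) :=
        mul_le_mul_right (mul_le_mul_left (mul_le_mul_right (hD M T g hg) _) _) _
    _ = _ := by
        rw [nq, nq, nq]
        ring

/-! ### Extension of the range of exponents -/

section GoodFibre

variable {E : Type*} [NormedAddCommGroup E] [NormedSpace ℝ E]

/-- Fibrewise truncated good part in the second variable. -/
def clipY (β : ℝ) (w : ℝ × ℝ → E) (z : ℝ × ℝ) : E := goodClip β (fun t => w (z.1, t)) z.2

/-- Fibrewise truncated good part in the first variable. -/
def clipX (α : ℝ) (w : ℝ × ℝ → E) (z : ℝ × ℝ) : E := goodClip α (fun t => w (t, z.2)) z.1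

variable [MeasurableSpace E] [BorelSpace E] [SecondCountableTopology E] {w : ℝ × ℝ → E}

lemma measurable_clipY (hw : Measurable w) (β : ℝ) : Measurable (clipY β w) :=
  measurable_goodClip_param (u := fun x t => w (x, t)) hw β

lemma measurable_clipX (hw : Measurable w) (α : ℝ) : Measurable (clipX α w) := by
  have hu : Measurable (Function.uncurry fun y t => w (t, y)) := hw.comp measurable_swap
  have h := measurable_goodClip_param hu α
  have e : clipX α w = (fun z : ℝ × ℝ => goodClip α ((fun y t => w (t, y)) z.1) z.2) ∘ Prod.swap := rfl
  rw [e]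
  exact h.comp measurable_swap

variable [CompleteSpace E]

lemma lintegral_clipY_le (hw : Measurable w) (hi : ∀ x, Integrable fun t => w (x, t)) {β : ℝ}
    (hβ : 0 < β) {P : ℝ} (hP : 0 < P) :
    ∫⁻ z, ‖clipY β w z‖ₑ ^ P ≤ ∫⁻ z, min (My (fun v => ‖w v‖ₑ) z) (ENNReal.ofReal (2 * β)) ^ P := by
  have h1 : Measurable fun z => ‖clipY β w z‖ₑ ^ P := (measurable_clipY hw β).enorm.pow_const _
  have h2 : Measurable fun z => min (My (fun v => ‖w v‖ₑ) z) (ENNReal.ofReal (2 * β)) ^ P :=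
    ((measurable_My hw.enorm).min measurable_const).pow_const _
  rw [Measure.volume_eq_prod, lintegral_prod _ h1.aemeasurable, lintegral_prod _ h2.aemeasurable]
  refine lintegral_mono fun x => lintegral_mono_ae ?_
  filter_upwards [ae_enorm_goodClip_le (hi x) hβ] with y hy
  refine ENNReal.rpow_le_rpow (le_min hy ?_) hP.le
  rw [← ofReal_norm]
  exact ENNReal.ofReal_le_ofReal (norm_goodClip_le hβ.le _ _)

lemma lintegral_clipX_le (hw : Measurable w) (hi : ∀ y, Integrable fun t => w (t, y)) {α : ℝ}
    (hα : 0 < α) {P : ℝ} (hP : 0 < P) :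
    ∫⁻ z, ‖clipX α w z‖ₑ ^ P ≤ ∫⁻ z, min (Mx (fun v => ‖w v‖ₑ) z) (ENNReal.ofReal (2 * α)) ^ P := by
  have h := lintegral_clipY_le (hw.comp measurable_swap) hi hα hP
  rw [← lintegral_swap_plane, ← lintegral_swap_plane (u := fun z => min (Mx _ z) _ ^ P)]
  exact h

lemma IsKer.volume_lt_sum_sub_clipY_le {K : ℝ → ℝ} {C : ℝ} (hK : IsKer K C) (hw : Measurable w)
    (hi : ∀ x, Integrable fun t => w (x, t)) (S : Finset ℤ) {β c : ℝ} (hβ : 0 < β) (hc : 0 < c) :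
    volume {z : ℝ × ℝ | ENNReal.ofReal (c * β) <
        ∑ l ∈ S, ‖fconv (rdil K l) (fun t => w (z.1, t) - clipY β w (z.1, t)) z.2‖ₑ} ≤
      ENNReal.ofReal (1 + 160 * Real.pi * C / c) *
        volume {z | ENNReal.ofReal (β / 4) < My (fun v => ‖w v‖ₑ) z} := by
  have h1 : Measurable fun z : ℝ × ℝ =>
      ∑ l ∈ S, ‖fconv (rdil K l) (fun t => w (z.1, t) - clipY β w (z.1, t)) z.2‖ₑ :=
    Finset.measurable_fun_sum _ fun l _ => (measurable_fconv_param (hK.continuous_rdil l).measurable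
      (hw.sub (measurable_clipY hw β))).enorm
  have h2 : Measurable (My fun v => ‖w v‖ₑ) := measurable_My hw.enorm
  rw [Measure.volume_eq_prod, Measure.prod_apply (measurableSet_lt measurable_const h1),
    Measure.prod_apply (measurableSet_lt measurable_const h2), ← lintegral_const_mul' _ _ (by simp)]
  exact lintegral_mono fun x => hK.volume_lt_sum_sub_goodClip_le (hw.comp measurable_prodMk_left) (hi x)
    S hβ hc

lemma volume_swap_plane {s : Set (ℝ × ℝ)} : volume (Prod.swap ⁻¹' s) = volume s :=
  (Measure.measurePreserving_swap (μ := (volume : Measure ℝ)) (ν := (volume : Measure ℝ))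
    ).measure_preimage_emb MeasurableEquiv.prodComm.measurableEmbedding s

lemma IsKer.volume_lt_sum_sub_clipX_le {K : ℝ → ℝ} {C : ℝ} (hK : IsKer K C) (hw : Measurable w)
    (hi : ∀ y, Integrable fun t => w (t, y)) (S : Finset ℤ) {α c : ℝ} (hα : 0 < α) (hc : 0 < c) :
    volume {z : ℝ × ℝ | ENNReal.ofReal (c * α) <
        ∑ l ∈ S, ‖fconv (rdil K l) (fun t => w (t, z.2) - clipX α w (t, z.2)) z.1‖ₑ} ≤
      ENNReal.ofReal (1 + 160 * Real.pi * C / c) *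
        volume {z | ENNReal.ofReal (α / 4) < Mx (fun v => ‖w v‖ₑ) z} := by
  have h := hK.volume_lt_sum_sub_clipY_le (hw.comp measurable_swap) hi S hα hc
  rw [← volume_swap_plane, ← volume_swap_plane (s := {z | _ < Mx _ z})]
  exact h

end GoodFibre

lemma min_rpow_le_level {B s q Q : ℝ} (hB : 0 < B) (hs : 0 < s) (hq : 0 < q) (hQ : 0 < Q) (M : ℝ≥0∞) :
    min M (ENNReal.ofReal (2 * (B * s ^ (1 / q)))) ^ Q ≤ ENNReal.ofReal ((2 * (B * s ^ (1 / q))) ^ Q) *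
      (ENNReal.ofReal (s ^ (-(Q / q))) *
        min ((4 * M / ENNReal.ofReal B) ^ q) (ENNReal.ofReal s) ^ (Q / q)) := by
  set σ := s ^ (1 / q) with hσ
  have hσ0 : 0 < σ := by positivity
  have hsσ : s = σ ^ q := by rw [hσ, ← Real.rpow_mul hs.le, one_div_mul_cancel hq.ne', Real.rpow_one]
  have h1 : s ^ (-(Q / q)) = σ⁻¹ ^ Q := by
    rw [Real.inv_rpow hσ0.le, hsσ, ← Real.rpow_mul hσ0.le, ← Real.rpow_neg hσ0.le]
    congr 1
    field_simp
  have h2 : min ((4 * M / ENNReal.ofReal B) ^ q) (ENNReal.ofReal s) ^ (Q / q) =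
      min (4 * M / ENNReal.ofReal B) (ENNReal.ofReal σ) ^ Q := by
    rw [hsσ, ← ENNReal.ofReal_rpow_of_nonneg hσ0.le hq.le, ← min_rpow hq.le, ← ENNReal.rpow_mul,
      mul_div_cancel₀ _ hq.ne']
  rw [h1, h2, ← ENNReal.ofReal_rpow_of_nonneg (by positivity) hQ.le,
    ← ENNReal.ofReal_rpow_of_nonneg (by positivity) hQ.le, ← ENNReal.mul_rpow_of_nonneg _ _ hQ.le,
    ← ENNReal.mul_rpow_of_nonneg _ _ hQ.le]
  refine ENNReal.rpow_le_rpow ?_ hQ.le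
  have hB0 : ENNReal.ofReal B ≠ 0 := by simpa using hB
  rw [← mul_assoc (ENNReal.ofReal _) (ENNReal.ofReal _) _, ← ENNReal.ofReal_mul (by positivity),
    mul_min]
  refine le_min ((min_le_left _ _).trans ?_) ((min_le_right _ _).trans (le_of_eq ?_))
  · rw [show 2 * (B * σ) * σ⁻¹ = B * 2 by field_simp, ENNReal.ofReal_mul hB.le, div_eq_mul_inv,
      show ENNReal.ofReal B * ENNReal.ofReal 2 * (4 * M * (ENNReal.ofReal B)⁻¹) =
        (ENNReal.ofReal B * (ENNReal.ofReal B)⁻¹) * (ENNReal.ofReal 2 * 4 * M) by ring,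
      ENNReal.mul_inv_cancel hB0 ENNReal.ofReal_ne_top, one_mul]
    refine le_mul_of_one_le_left zero_le ?_
    rw [show ENNReal.ofReal 2 = 2 by simp]
    norm_num
  · rw [← ENNReal.ofReal_mul (by positivity)]
    congr 1
    field_simp

lemma lt_level_iff {B s q : ℝ} (hB : 0 < B) (hs : 0 < s) (hq : 0 < q) (M : ℝ≥0∞) :
    ENNReal.ofReal (B * s ^ (1 / q) / 4) < M ↔ ENNReal.ofReal s < (4 * M / ENNReal.ofReal B) ^ q := by
  set σ := s ^ (1 / q) with hσ
  have hσ0 : 0 < σ := by positivity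
  have hsσ : s = σ ^ q := by rw [hσ, ← Real.rpow_mul hs.le, one_div_mul_cancel hq.ne', Real.rpow_one]
  have hB0 : ENNReal.ofReal B ≠ 0 := by simpa using hB
  rw [hsσ, ← ENNReal.ofReal_rpow_of_nonneg hσ0.le hq.le, ENNReal.rpow_lt_rpow_iff hq,
    ENNReal.lt_div_iff_mul_lt (Or.inl hB0) (Or.inl ENNReal.ofReal_ne_top), ← ENNReal.ofReal_mul hσ0.le,
    show σ * B = 4 * (B * σ / 4) by ring, ENNReal.ofReal_mul (by norm_num),
    show ENNReal.ofReal 4 = 4 by simp, ENNReal.mul_lt_mul_iff_right (by norm_num) (by norm_num)]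

lemma volume_lt_of_norm_le {T : ℝ × ℝ → ℝ≥0∞} (hT : Measurable T) {p q r α β : ℝ} (hp : 0 < p)
    (hq : 0 < q) (hr : 0 < r) (hpqr : 1 / p + 1 / q = 1 / r) (hα : 0 < α) (hβ : 0 < β) {C : ℝ≥0}
    {X Y : ℝ≥0∞} (h : (∫⁻ z, T z ^ r) ^ (1 / r) ≤
      C * ((ENNReal.ofReal ((2 * α) ^ p) * X) ^ (1 / p) * (ENNReal.ofReal ((2 * β) ^ q) * Y) ^ (1 / q))) :
    volume {z | ENNReal.ofReal (α * β / 3) < T z} ≤ (12 * C : ℝ≥0) ^ r * (X + Y) := by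
  have e : ∀ {p α : ℝ} (X : ℝ≥0∞), 0 < p → 0 < α → (ENNReal.ofReal ((2 * α) ^ p) * X) ^ (1 / p) =
      ENNReal.ofReal (2 * α) * X ^ (1 / p) := by
    intro p α X hp hα
    rw [ENNReal.mul_rpow_of_nonneg _ _ (by positivity), ENNReal.ofReal_rpow_of_nonneg (by positivity)
      (by positivity), ← Real.rpow_mul (by positivity), mul_one_div_cancel hp.ne', Real.rpow_one]
  rw [e X hp hα, e Y hq hβ] at h
  have h1 : X ^ (1 / p) * Y ^ (1 / q) ≤ (X + Y) ^ (1 / r) := by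
    rw [← hpqr, ENNReal.rpow_add_of_nonneg _ _ (by positivity) (by positivity)]
    exact mul_le_mul' (ENNReal.rpow_le_rpow le_self_add (by positivity))
      (ENNReal.rpow_le_rpow le_add_self (by positivity))
  have h2 : (∫⁻ z, T z ^ r) ^ (1 / r) ≤ (ENNReal.ofReal (α * β / 3) * (12 * C : ℝ≥0)) * (X + Y) ^ (1 / r) := by
    refine h.trans ?_
    calc _ = C * (ENNReal.ofReal (2 * α) * ENNReal.ofReal (2 * β)) * (X ^ (1 / p) * Y ^ (1 / q)) := by ring
      _ ≤ C * (ENNReal.ofReal (2 * α) * ENNReal.ofReal (2 * β)) * (X + Y) ^ (1 / r) := mul_le_mul_right h1 _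
      _ = _ := by
        rw [← ENNReal.ofReal_mul (by positivity), show 2 * α * (2 * β) = α * β / 3 * 12 by ring,
          ENNReal.ofReal_mul (by positivity), show ENNReal.ofReal 12 = 12 by simp]
        push_cast
        ring
  have h3 : ∫⁻ z, T z ^ r ≤ (ENNReal.ofReal (α * β / 3) ^ r * (12 * C : ℝ≥0) ^ r) * (X + Y) := by
    rw [one_div, ENNReal.rpow_inv_le_iff hr, ENNReal.mul_rpow_of_nonneg _ _ hr.le,
      ENNReal.mul_rpow_of_nonneg _ _ hr.le, ← ENNReal.rpow_mul, inv_mul_cancel₀ hr.ne',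
      ENNReal.rpow_one] at h2
    exact h2
  have hc0 : ENNReal.ofReal (α * β / 3) ^ r ≠ 0 := by
    have : 0 < α * β / 3 := by positivity
    simp only [ne_eq, ENNReal.rpow_eq_zero_iff, ENNReal.ofReal_eq_zero, not_or, not_and, not_lt,
      ENNReal.ofReal_ne_top, false_and, not_false_eq_true, and_true]
    intro h
    linarith
  have hct : ENNReal.ofReal (α * β / 3) ^ r ≠ ⊤ := ENNReal.rpow_ne_top_of_nonneg hr.le (by simp)
  rw [← ENNReal.mul_le_mul_iff_right hc0 hct, ← mul_assoc]
  refine le_trans ?_ h3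
  refine (mul_le_mul_right (measure_mono fun z hz => ?_) _).trans
    (mul_meas_ge_le_lintegral (hT.pow_const r) _)
  exact ENNReal.rpow_le_rpow (le_of_lt hz) hr.le

section VectorValued

variable {E : Type*} [NormedAddCommGroup E] [NormedSpace ℝ E]

/-- The vector-valued truncated twisted paraproduct. -/
def tpv (a b : ℝ → ℝ) (lam : ℤ → ℝ) (S : Finset ℤ) (f : ℝ × ℝ → ℝ) (g : ℝ × ℝ → E) (z : ℝ × ℝ) : E :=
  ∑ l ∈ S, (lam l * fconv (rdil a l) (fun t => f (t, z.2)) z.1) •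
    fconv (rdil b l) (fun t => g (z.1, t)) z.2

lemma tpv_apply {M : ℕ} {a b : ℝ → ℝ} {Cb : ℝ} (hb : IsKer b Cb) (lam : ℤ → ℝ) (S : Finset ℤ)
    (f : ℝ × ℝ → ℝ) {g : ℝ × ℝ → EuclideanSpace ℝ (Fin M)} (hg : ∀ x, Integrable fun t => g (x, t))
    (z : ℝ × ℝ) (i : Fin M) : tpv a b lam S f g z i = tp a b lam S f (fun w => g w i) z := by
  rw [tpv, WithLp.ofLp_sum, Finset.sum_apply]
  refine Finset.sum_congr rfl fun l _ => ?_
  rw [PiLp.smul_apply, smul_eq_mul]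
  congr 1
  exact hb.fconv_apply l (EuclideanSpace.proj i) (hg z.1) z.2

lemma IsKer.integrable_rdil_smul {K : ℝ → ℝ} {C : ℝ} (hK : IsKer K C) (l : ℤ) {u : ℝ → E}
    (hu : Integrable u) (x : ℝ) : Integrable fun t => rdil K l (x - t) • u t :=
  hu.bdd_smul (C * 2 ^ l) (((hK.continuous_rdil l).comp (by fun_prop)).aestronglyMeasurable)
    (Eventually.of_forall fun t => hK.rdil_le l _)

lemma IsKer.fconv_eq_add_sub {K : ℝ → ℝ} {C : ℝ} (hK : IsKer K C) (l : ℤ) {u v : ℝ → E}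
    (hu : Integrable u) (hv : Integrable v) (x : ℝ) :
    fconv (rdil K l) u x = fconv (rdil K l) v x + fconv (rdil K l) (fun t => u t - v t) x := by
  rw [fconv, fconv, fconv, ← integral_add (hK.integrable_rdil_smul l hv x)
    (hK.integrable_rdil_smul l (u := fun t => u t - v t) (hu.sub hv) x)]
  refine integral_congr_ae (Eventually.of_forall fun t => ?_)
  simp only [smul_sub]
  abel

lemma measurable_tpv [MeasurableSpace E] [BorelSpace E] [SecondCountableTopology E] {a b : ℝ → ℝ}
    {Ca Cb : ℝ} (ha : IsKer a Ca) (hb : IsKer b Cb) {f : ℝ × ℝ → ℝ} {g : ℝ × ℝ → E}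
    (lam : ℤ → ℝ) (S : Finset ℤ) (hf : Measurable f) (hg : Measurable g) :
    Measurable (tpv a b lam S f g) := by
  refine Finset.measurable_fun_sum _ fun l _ => ?_
  have hg' : Measurable fun z : ℝ × ℝ => fconv (rdil b l) (fun t => g (z.1, t)) z.2 :=
    measurable_fconv_param (hb.continuous_rdil l).measurable hg
  have hu : Measurable fun v : ℝ × ℝ => f (v.2, v.1) := hf.comp measurable_swap
  have hf' : Measurable fun z : ℝ × ℝ => fconv (rdil a l) (fun t => f (t, z.1)) z.2 :=
    measurable_fconv_param (hK := (ha.continuous_rdil l).measurable) hu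
  have hf'' : Measurable fun z : ℝ × ℝ => fconv (rdil a l) (fun t => f (t, z.2)) z.1 :=
    hf'.comp measurable_swap
  exact (hf''.const_mul _).smul hg'

lemma enorm_tpv_le {a b : ℝ → ℝ} {Ca Cb : ℝ} (ha : IsKer a Ca) (hb : IsKer b Cb) {lam : ℤ → ℝ}
    (hlam : ∀ k, |lam k| ≤ 1) (S : Finset ℤ) {f f' : ℝ × ℝ → ℝ} {g g' : ℝ × ℝ → E} (z : ℝ × ℝ)
    (hf : Integrable fun t => f (t, z.2)) (hf' : Integrable fun t => f' (t, z.2))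
    (hg : Integrable fun t => g (z.1, t)) (hg' : Integrable fun t => g' (z.1, t)) :
    ‖tpv a b lam S f g z‖ₑ ≤ ‖tpv a b lam S f' g' z‖ₑ +
      ((∑ l ∈ S, ‖fconv (rdil a l) (fun t => f' (t, z.2)) z.1‖ₑ *
        ‖fconv (rdil b l) (fun t => g (z.1, t) - g' (z.1, t)) z.2‖ₑ) +
      ∑ l ∈ S, ‖fconv (rdil a l) (fun t => f (t, z.2) - f' (t, z.2)) z.1‖ₑ *
        ‖fconv (rdil b l) (fun t => g (z.1, t)) z.2‖ₑ) := by
  have e : tpv a b lam S f g z = tpv a b lam S f' g' z +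
      ((∑ l ∈ S, (lam l * fconv (rdil a l) (fun t => f' (t, z.2)) z.1) •
        fconv (rdil b l) (fun t => g (z.1, t) - g' (z.1, t)) z.2) +
      ∑ l ∈ S, (lam l * fconv (rdil a l) (fun t => f (t, z.2) - f' (t, z.2)) z.1) •
        fconv (rdil b l) (fun t => g (z.1, t)) z.2) := by
    rw [tpv, tpv, ← Finset.sum_add_distrib, ← Finset.sum_add_distrib]
    refine Finset.sum_congr rfl fun l _ => ?_
    rw [ha.fconv_eq_add_sub l hf hf' z.1, hb.fconv_eq_add_sub l hg hg' z.2]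
    simp only [mul_add, add_smul, smul_add]
    abel
  have hl : ∀ l (x : ℝ) (e : E), ‖(lam l * x) • e‖ₑ ≤ ‖x‖ₑ * ‖e‖ₑ := by
    intro l x e
    rw [enorm_smul, enorm_mul]
    refine mul_le_mul_left (mul_le_of_le_one_left zero_le ?_) _
    rw [← ofReal_norm]
    exact ENNReal.ofReal_le_one.2 (hlam l)
  rw [e]
  refine (enorm_add_le _ _).trans (add_le_add_right ((enorm_add_le _ _).trans (add_le_add ?_ ?_)) _)
  · exact (enorm_sum_le _ _).trans (Finset.sum_le_sum fun l _ => hl _ _ _)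
  · exact (enorm_sum_le _ _).trans (Finset.sum_le_sum fun l _ => hl _ _ _)

end VectorValued

section Level

variable {E : Type*} [NormedAddCommGroup E] [NormedSpace ℝ E] [MeasurableSpace E] [BorelSpace E]

lemma enorm_fconv_le_of_My_le {b : ℝ → ℝ} {Cb : ℝ} (hb : IsKer b Cb) {g : ℝ × ℝ → E} (hg : Measurable g)
    {β : ℝ} {z : ℝ × ℝ} (hz : My (fun v => ‖g v‖ₑ) z ≤ ENNReal.ofReal β) (l : ℤ) :
    ‖fconv (rdil b l) (fun t => g (z.1, t)) z.2‖ₑ ≤ ENNReal.ofReal (8 * Cb * β) := by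
  have h := hb.enorm_fconv_le l (u := fun t => g (z.1, t)) ((hg.comp measurable_prodMk_left).enorm) z.2
  rw [ENNReal.ofReal_mul (by have := hb.nonneg; positivity)]
  exact h.trans (mul_le_mul_right hz _)

variable [SecondCountableTopology E]

lemma enorm_fconv_clipX_le {a : ℝ → ℝ} {Ca : ℝ} (ha : IsKer a Ca) {f : ℝ × ℝ → E} (hf : Measurable f)
    {α : ℝ} (hα : 0 < α) (z : ℝ × ℝ) (l : ℤ) :
    ‖fconv (rdil a l) (fun t => clipX α f (t, z.2)) z.1‖ₑ ≤ ENNReal.ofReal (32 * Ca * α) := by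
  have h0 := ha.nonneg
  have hm : Measurable fun t => ‖clipX α f (t, z.2)‖ₑ :=
    ((measurable_clipX hf α).comp measurable_prodMk_right).enorm
  refine (ha.enorm_fconv_le l hm z.1).trans ?_
  have h := HL_le_of_le (u := fun t => ‖clipX α f (t, z.2)‖ₑ) (s := ENNReal.ofReal (2 * α)) (fun t => by
    rw [← ofReal_norm]
    exact ENNReal.ofReal_le_ofReal (norm_goodClip_le hα.le _ _)) z.1
  refine (mul_le_mul_right h _).trans (le_of_eq ?_)
  rw [show (2 : ℝ≥0∞) = ENNReal.ofReal 2 by simp, ← ENNReal.ofReal_mul (by norm_num),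
    ← ENNReal.ofReal_mul (by positivity)]
  congr 1
  ring

variable [CompleteSpace E]

lemma subset_of_enorm_tpv_le {a b : ℝ → ℝ} {Ca Cb : ℝ} (ha : IsKer a Ca) (hb : IsKer b Cb) {lam : ℤ → ℝ}
    (hlam : ∀ k, |lam k| ≤ 1) (S : Finset ℤ) {f : ℝ × ℝ → ℝ} {g : ℝ × ℝ → E}
    (hf : Measurable f) (hg : Measurable g) (hfi : ∀ y, Integrable fun t => f (t, y))
    (hgi : ∀ x, Integrable fun t => g (x, t)) {α β : ℝ} (hα : 0 < α) (hβ : 0 < β) :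
    {z | ENNReal.ofReal (α * β) < ‖tpv a b lam S f g z‖ₑ} ⊆
      ({z | ENNReal.ofReal (α * β / 3) < ‖tpv a b lam S (clipX α f) (clipY β g) z‖ₑ} ∪
        {z | ENNReal.ofReal (1 / (96 * (Ca + 1)) * β) <
          ∑ l ∈ S, ‖fconv (rdil b l) (fun t => g (z.1, t) - clipY β g (z.1, t)) z.2‖ₑ}) ∪
      ({z | ENNReal.ofReal (1 / (6 * (Cb + 1)) * α) <
          ∑ l ∈ S, ‖fconv (rdil a l) (fun t => f (t, z.2) - clipX α f (t, z.2)) z.1‖ₑ} ∪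
        {z | ENNReal.ofReal (β / 4) < My (fun v => ‖g v‖ₑ) z}) := by
  have hCa := ha.nonneg
  have hCb := hb.nonneg
  intro z hz
  by_contra hn
  simp only [Set.mem_union, Set.mem_ofPred_eq, not_or, not_lt] at hn hz
  obtain ⟨⟨h1, h2⟩, h3, h4⟩ := hn
  have hfc : Integrable fun t => clipX α f (t, z.2) :=
    integrable_goodClip (hf.comp measurable_prodMk_right) (hfi z.2) hα
  have hgc : Integrable fun t => clipY β g (z.1, t) :=
    integrable_goodClip (hg.comp measurable_prodMk_left) (hgi z.1) hβ
  have h := enorm_tpv_le ha hb hlam S z (hfi z.2) hfc (hgi z.1) hgc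
  refine absurd hz (not_lt.2 (h.trans ?_))
  have h5 : ∑ l ∈ S, ‖fconv (rdil a l) (fun t => clipX α f (t, z.2)) z.1‖ₑ *
      ‖fconv (rdil b l) (fun t => g (z.1, t) - clipY β g (z.1, t)) z.2‖ₑ ≤ ENNReal.ofReal (α * β / 3) := by
    calc _ ≤ ∑ l ∈ S, ENNReal.ofReal (32 * Ca * α) *
          ‖fconv (rdil b l) (fun t => g (z.1, t) - clipY β g (z.1, t)) z.2‖ₑ :=
          Finset.sum_le_sum fun l _ => mul_le_mul_left (enorm_fconv_clipX_le ha hf hα z l) _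
      _ ≤ ENNReal.ofReal (32 * Ca * α) * ENNReal.ofReal (1 / (96 * (Ca + 1)) * β) := by
          rw [← Finset.mul_sum]
          exact mul_le_mul_right h2 _
      _ ≤ _ := by
          rw [← ENNReal.ofReal_mul (by positivity)]
          refine ENNReal.ofReal_le_ofReal ?_
          rw [show 32 * Ca * α * (1 / (96 * (Ca + 1)) * β) = α * β / 3 * (Ca / (Ca + 1)) by
            field_simp; ring]
          exact mul_le_of_le_one_right (by positivity) ((div_le_one (by positivity)).2 (by linarith))
  have h6 : ∑ l ∈ S, ‖fconv (rdil a l) (fun t => f (t, z.2) - clipX α f (t, z.2)) z.1‖ₑ *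
      ‖fconv (rdil b l) (fun t => g (z.1, t)) z.2‖ₑ ≤ ENNReal.ofReal (α * β / 3) := by
    calc _ ≤ ∑ l ∈ S, ‖fconv (rdil a l) (fun t => f (t, z.2) - clipX α f (t, z.2)) z.1‖ₑ *
          ENNReal.ofReal (8 * Cb * (β / 4)) := Finset.sum_le_sum fun l _ =>
          mul_le_mul_right (enorm_fconv_le_of_My_le hb hg h4 l) _
      _ ≤ ENNReal.ofReal (1 / (6 * (Cb + 1)) * α) * ENNReal.ofReal (8 * Cb * (β / 4)) := by
          rw [← Finset.sum_mul]
          exact mul_le_mul_left h3 _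
      _ ≤ _ := by
          rw [← ENNReal.ofReal_mul (by positivity)]
          refine ENNReal.ofReal_le_ofReal ?_
          rw [show 1 / (6 * (Cb + 1)) * α * (8 * Cb * (β / 4)) = α * β / 3 * (Cb / (Cb + 1)) by
            field_simp; ring]
          exact mul_le_of_le_one_right (by positivity) ((div_le_one (by positivity)).2 (by linarith))
  refine (add_le_add h1 (add_le_add h5 h6)).trans (le_of_eq ?_)
  rw [← ENNReal.ofReal_add (by positivity) (by positivity), ← ENNReal.ofReal_add (by positivity) (by positivity)]
  congr 1
  ring

end Level

lemma enorm_rpow_real (x s : ℝ) : ‖x‖ₑ ^ s = ENNReal.ofReal (x ^ 2) ^ (s / 2) := by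
  rw [← sq_abs, ENNReal.ofReal_pow (abs_nonneg _), ← Real.norm_eq_abs, ofReal_norm, ← ENNReal.rpow_natCast,
    ← ENNReal.rpow_mul]
  congr 1
  push_cast
  ring

theorem vector_base_estimate {p q r : ℝ} (hp : 2 < p) (hq : 2 < q) (hpqr : 1 / p + 1 / q = 1 / r)
    (hr1 : 1 < r) (hr2 : r < 2) {a b m : ℝ → ℝ} {Ca Cb Cm : ℝ} (ha : IsKer a Ca) (hbk : IsKer b Cb)
    (hm : IsKer m Cm) (hm0 : ∫ t, m t = 0) (hb : ∀ t, b t = fconv (eta (1 / 2)) m t) :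
    ∃ C : ℝ≥0, ∀ (M : ℕ) (lam : ℤ → ℝ), (∀ k, |lam k| ≤ 1) → ∀ (N : ℕ) (f : ℝ × ℝ → ℝ)
      (g : ℝ × ℝ → EuclideanSpace ℝ (Fin M)), BM f → Measurable g → (∃ B, ∀ z, ‖g z‖ ≤ B) →
      (∀ x, Integrable fun t => g (x, t)) →
      (∫⁻ z, ‖tpv a b lam (Finset.Icc (-(N : ℤ)) N) f g z‖ₑ ^ r) ^ (1 / r) ≤
        C * ((∫⁻ z, ‖f z‖ₑ ^ p) ^ (1 / p) * (∫⁻ z, ‖g z‖ₑ ^ q) ^ (1 / q)) := by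
  obtain ⟨C, hC⟩ := base_estimate hp hq hpqr hr1 hr2 ha hbk hm hm0 hb
  refine ⟨C, fun M lam hlam N f g hf hg ⟨B, hB⟩ hgi => ?_⟩
  have hgb : ∀ i, BM fun z => g z i := fun i =>
    ⟨(EuclideanSpace.proj (𝕜 := ℝ) i).continuous.measurable.comp hg, B, fun z =>
      (PiLp.norm_apply_le (g z) i).trans (hB z)⟩
  have h := hC M lam hlam N f (fun i z => g z i) hf hgb
  simp only [nq, ← tpv_apply hbk lam _ f hgi, ← enorm_rpow_euclidean, ← enorm_rpow_real] at h
  exact h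

/-- Level set bound obtained by splitting both functions at heights depending on the level. -/
lemma volume_level_le {M : ℕ} {a b : ℝ → ℝ} {Ca Cb : ℝ} (ha : IsKer a Ca) (hb : IsKer b Cb)
    {p₀ q₀ r₀ : ℝ} (hp₀ : 0 < p₀) (hq₀ : 0 < q₀) (hr₀ : 0 < r₀) (hpqr₀ : 1 / p₀ + 1 / q₀ = 1 / r₀)
    {lam : ℤ → ℝ} (hlam : ∀ k, |lam k| ≤ 1) (S : Finset ℤ) {C : ℝ≥0}
    (hbase : ∀ (f : ℝ × ℝ → ℝ) (g : ℝ × ℝ → EuclideanSpace ℝ (Fin M)), BM f → Measurable g →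
      (∃ B, ∀ z, ‖g z‖ ≤ B) → (∀ x, Integrable fun t => g (x, t)) →
      (∫⁻ z, ‖tpv a b lam S f g z‖ₑ ^ r₀) ^ (1 / r₀) ≤
        C * ((∫⁻ z, ‖f z‖ₑ ^ p₀) ^ (1 / p₀) * (∫⁻ z, ‖g z‖ₑ ^ q₀) ^ (1 / q₀)))
    {f : ℝ × ℝ → ℝ} {g : ℝ × ℝ → EuclideanSpace ℝ (Fin M)} (hf : Measurable f) (hg : Measurable g)
    (hfi : ∀ y, Integrable fun t => f (t, y)) (hgi : ∀ x, Integrable fun t => g (x, t))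
    {p q : ℝ} (hp : 0 < p) (hq : 0 < q) {A B s : ℝ} (hA : 0 < A) (hB : 0 < B) (hs : 0 < s) :
    volume {z | ENNReal.ofReal (A * s ^ (1 / p) * (B * s ^ (1 / q))) < ‖tpv a b lam S f g z‖ₑ} ≤
      ((12 * C : ℝ≥0) ^ r₀ + (ENNReal.ofReal (1 + 160 * Real.pi * Cb / (1 / (96 * (Ca + 1)))) +
        ENNReal.ofReal (1 + 160 * Real.pi * Ca / (1 / (6 * (Cb + 1)))) + 1)) *
      (volume {z | ENNReal.ofReal s < (4 * Mx (fun v => ‖f v‖ₑ) z / ENNReal.ofReal A) ^ p} +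
        volume {z | ENNReal.ofReal s < (4 * My (fun v => ‖g v‖ₑ) z / ENNReal.ofReal B) ^ q} +
        ((ENNReal.ofReal (s ^ (-(p₀ / p))) * ∫⁻ z, min ((4 * Mx (fun v => ‖f v‖ₑ) z / ENNReal.ofReal A) ^ p)
            (ENNReal.ofReal s) ^ (p₀ / p)) +
          ENNReal.ofReal (s ^ (-(q₀ / q))) * ∫⁻ z, min ((4 * My (fun v => ‖g v‖ₑ) z / ENNReal.ofReal B) ^ q)
            (ENNReal.ofReal s) ^ (q₀ / q))) := by
  have hCa := ha.nonneg
  have hCb := hb.nonneg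
  set α := A * s ^ (1 / p) with hα'
  set β := B * s ^ (1 / q) with hβ'
  have hα : 0 < α := by positivity
  have hβ : 0 < β := by positivity
  set F := fun z => (4 * Mx (fun v => ‖f v‖ₑ) z / ENNReal.ofReal A) ^ p
  set G := fun z => (4 * My (fun v => ‖g v‖ₑ) z / ENNReal.ofReal B) ^ q
  set X := ENNReal.ofReal (s ^ (-(p₀ / p))) * ∫⁻ z, min (F z) (ENNReal.ofReal s) ^ (p₀ / p)
  set Y := ENNReal.ofReal (s ^ (-(q₀ / q))) * ∫⁻ z, min (G z) (ENNReal.ofReal s) ^ (q₀ / q)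
  have hFs : volume {z | ENNReal.ofReal (α / 4) < Mx (fun v => ‖f v‖ₑ) z} =
      volume {z | ENNReal.ofReal s < F z} := by
    congr 1
    ext z
    exact lt_level_iff hA hs hp _
  have hGs : volume {z | ENNReal.ofReal (β / 4) < My (fun v => ‖g v‖ₑ) z} =
      volume {z | ENNReal.ofReal s < G z} := by
    congr 1
    ext z
    exact lt_level_iff hB hs hq _
  have hfX : ∫⁻ z, ‖clipX α f z‖ₑ ^ p₀ ≤ ENNReal.ofReal ((2 * α) ^ p₀) * X := by
    refine (lintegral_clipX_le hf hfi hα hp₀).trans ?_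
    simp only [X]
    rw [← lintegral_const_mul' _ _ ENNReal.ofReal_ne_top, ← lintegral_const_mul' _ _ ENNReal.ofReal_ne_top]
    exact lintegral_mono fun z => min_rpow_le_level hA hs hp hp₀ _
  have hgY : ∫⁻ z, ‖clipY β g z‖ₑ ^ q₀ ≤ ENNReal.ofReal ((2 * β) ^ q₀) * Y := by
    refine (lintegral_clipY_le hg hgi hβ hq₀).trans ?_
    simp only [Y]
    rw [← lintegral_const_mul' _ _ ENNReal.ofReal_ne_top, ← lintegral_const_mul' _ _ ENNReal.ofReal_ne_top]
    exact lintegral_mono fun z => min_rpow_le_level hB hs hq hq₀ _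
  have hmain : volume {z | ENNReal.ofReal (α * β / 3) < ‖tpv a b lam S (clipX α f) (clipY β g) z‖ₑ} ≤
      (12 * C : ℝ≥0) ^ r₀ * (X + Y) := by
    refine volume_lt_of_norm_le (measurable_tpv ha hb lam S (measurable_clipX hf α)
      (measurable_clipY hg β)).enorm hp₀ hq₀ hr₀ hpqr₀ hα hβ ?_
    refine (hbase _ _ ⟨measurable_clipX hf α, 2 * α, fun z => norm_goodClip_le hα.le (fun t => f (t, z.2)) z.1⟩
      (measurable_clipY hg β) ⟨2 * β, fun z => norm_goodClip_le hβ.le _ _⟩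
      fun x => integrable_goodClip (hg.comp measurable_prodMk_left) (hgi x) hβ).trans ?_
    exact mul_le_mul_right (mul_le_mul' (ENNReal.rpow_le_rpow hfX (by positivity))
      (ENNReal.rpow_le_rpow hgY (by positivity))) _
  have hbg := hb.volume_lt_sum_sub_clipY_le hg hgi S hβ (c := 1 / (96 * (Ca + 1))) (by positivity)
  have hbf := ha.volume_lt_sum_sub_clipX_le hf hfi S hα (c := 1 / (6 * (Cb + 1))) (by positivity)
  rw [hGs] at hbg
  rw [hFs] at hbf
  refine (measure_mono (subset_of_enorm_tpv_le ha hb hlam S hf hg hfi hgi hα hβ)).trans ?_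
  refine ((measure_union_le _ _).trans (add_le_add ((measure_union_le _ _).trans (add_le_add hmain hbg))
    ((measure_union_le _ _).trans (add_le_add hbf hGs.le)))).trans ?_
  set c1 := ENNReal.ofReal (1 + 160 * Real.pi * Cb / (1 / (96 * (Ca + 1))))
  set c2 := ENNReal.ofReal (1 + 160 * Real.pi * Ca / (1 / (6 * (Cb + 1))))
  set c0 : ℝ≥0∞ := (12 * C : ℝ≥0) ^ r₀
  set vF := volume {z | ENNReal.ofReal s < F z}
  set vG := volume {z | ENNReal.ofReal s < G z}
  clear_value X Y vF vG c0 c1 c2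
  calc c0 * (X + Y) + c1 * vG + (c2 * vF + vG)
      ≤ c0 * (X + Y) + c1 * vG + (c2 * vF + vG) + (c0 * (vF + vG) + c1 * (vF + (X + Y)) +
        (c2 * (vG + (X + Y)) + (vF + (X + Y)))) := le_self_add
    _ = _ := by ring

lemma lintegral_maximal_rpow_le {p A : ℝ} (hp : 0 < p) (hA : 0 < A) {u M : ℝ × ℝ → ℝ≥0∞} {C : ℝ≥0}
    (h : ∫⁻ z, M z ^ p ≤ C * ∫⁻ z, u z ^ p) (hu : ∫⁻ z, u z ^ p ≤ ENNReal.ofReal A ^ p) :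
    ∫⁻ z, (4 * M z / ENNReal.ofReal A) ^ p ≤ 4 ^ p * C := by
  have hA0 : ENNReal.ofReal A ≠ 0 := by simpa using hA
  have hc : ∀ z, (4 * M z / ENNReal.ofReal A) ^ p = (4 / ENNReal.ofReal A) ^ p * M z ^ p := by
    intro z
    rw [← ENNReal.mul_rpow_of_nonneg _ _ hp.le]
    congr 1
    simp only [div_eq_mul_inv]
    ring
  simp_rw [hc]
  rw [lintegral_const_mul' _ _ (ENNReal.rpow_ne_top_of_nonneg hp.le (ENNReal.div_ne_top (by norm_num) hA0)),
    ENNReal.div_rpow_of_nonneg _ _ hp.le]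
  calc _ ≤ 4 ^ p / ENNReal.ofReal A ^ p * (C * ENNReal.ofReal A ^ p) :=
        mul_le_mul_right (h.trans (mul_le_mul_right hu _)) _
    _ = 4 ^ p * C * ((ENNReal.ofReal A ^ p)⁻¹ * ENNReal.ofReal A ^ p) := by
        rw [div_eq_mul_inv]
        ring
    _ = _ := by
        rw [ENNReal.inv_mul_cancel (by simp [hA0, ENNReal.rpow_eq_zero_iff])
          (ENNReal.rpow_ne_top_of_nonneg hp.le (by simp)), mul_one]

/-- Exponents in the local `L²` range on the ray through the target exponents. -/
lemma exists_base_exponents {p q r : ℝ} (hp : 1 < p) (hq : 1 < q) (hpqr : 1 / p + 1 / q = 1 / r)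
    (hr2 : 1 / 2 < 1 / r) : ∃ p₀ q₀ r₀ : ℝ, 2 < p₀ ∧ 2 < q₀ ∧ 1 / p₀ + 1 / q₀ = 1 / r₀ ∧ 1 < r₀ ∧ r₀ < 2 ∧
      p < p₀ ∧ q < q₀ := by
  have hp0 : 0 < 1 / p := by positivity
  have hq0 : 0 < 1 / q := by positivity
  have hp1 : 1 / p < 1 := (div_lt_one (by linarith)).2 hp
  have hq1 : 1 / q < 1 := (div_lt_one (by linarith)).2 hq
  obtain ⟨x, y, hx0, hy0, hx, hy, hxp, hyq, hxy⟩ : ∃ x y : ℝ, 0 < x ∧ 0 < y ∧ x < 1 / 2 ∧ y < 1 / 2 ∧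
      x < 1 / p ∧ y < 1 / q ∧ 1 / 2 < x + y := by
    set s := min (1 / p) (1 / 2) with hs
    set t := min (1 / q) (1 / 2) with ht
    have hs0 : 0 < s := lt_min hp0 (by norm_num)
    have ht0 : 0 < t := lt_min hq0 (by norm_num)
    have hst : 1 / 2 < s + t := by
      rcases min_choice (1 / p) (1 / 2) with h1 | h1 <;> rcases min_choice (1 / q) (1 / 2) with h2 | h2 <;>
        rw [hs, ht, h1, h2] <;> linarith
    have hd : 0 < s + t - 1 / 2 := by linarith
    have hd1 : (s + t - 1 / 2) / 3 * s < s := by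
      have := min_le_right (1 / p) (1 / 2)
      have := min_le_right (1 / q) (1 / 2)
      nlinarith
    have hs2 : s ≤ 1 / 2 := min_le_right _ _
    have ht2 : t ≤ 1 / 2 := min_le_right _ _
    have e1 : 0 < (s + t - 1 / 2) / 3 * s := by positivity
    have e2 : 0 < (s + t - 1 / 2) / 3 * t := by positivity
    refine ⟨s - (s + t - 1 / 2) / 3 * s, t - (s + t - 1 / 2) / 3 * t, by linarith, by nlinarith, ?_, ?_, ?_,
      ?_, ?_⟩
    · linarith
    · linarith
    · linarith [min_le_left (1 / p) (1 / 2)]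
    · linarith [min_le_left (1 / q) (1 / 2)]
    · nlinarith
  refine ⟨1 / x, 1 / y, 1 / (x + y), ?_, ?_, ?_, ?_, ?_, ?_, ?_⟩
  · rw [lt_div_iff₀ hx0]; linarith
  · rw [lt_div_iff₀ hy0]; linarith
  · simp
  · rw [lt_div_iff₀ (by linarith)]; linarith
  · rw [div_lt_iff₀ (by linarith)]; linarith
  · rw [lt_div_iff₀ hx0]; rw [lt_div_iff₀ (by linarith)] at hxp; linarith
  · rw [lt_div_iff₀ hy0]; rw [lt_div_iff₀ (by linarith)] at hyq; linarith

/-- The paraproduct estimate in the full range of exponents. -/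
theorem extended_estimate {p q r : ℝ} (hp : 1 < p) (hq : 1 < q) (hpqr : 1 / p + 1 / q = 1 / r)
    (hr2 : 1 / 2 < 1 / r) {a b m : ℝ → ℝ} {Ca Cb Cm : ℝ} (ha : IsKer a Ca) (hbk : IsKer b Cb)
    (hm : IsKer m Cm) (hm0 : ∫ t, m t = 0) (hb : ∀ t, b t = fconv (eta (1 / 2)) m t) :
    ∃ C : ℝ≥0, ∀ (M : ℕ) (lam : ℤ → ℝ), (∀ k, |lam k| ≤ 1) → ∀ (N : ℕ) (f : ℝ × ℝ → ℝ)
      (g : ℝ × ℝ → EuclideanSpace ℝ (Fin M)), Measurable f → Measurable g →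
      (∀ y, Integrable fun t => f (t, y)) → (∀ x, Integrable fun t => g (x, t)) →
      ∀ A B : ℝ, 0 < A → 0 < B → ∫⁻ z, ‖f z‖ₑ ^ p ≤ ENNReal.ofReal A ^ p →
      ∫⁻ z, ‖g z‖ₑ ^ q ≤ ENNReal.ofReal B ^ q →
      ∫⁻ z, ‖tpv a b lam (Finset.Icc (-(N : ℤ)) N) f g z‖ₑ ^ r ≤ C * ENNReal.ofReal (A * B) ^ r := by
  have hp0 : 0 < p := by linarith
  have hq0 : 0 < q := by linarith
  have hr0 : 0 < r := one_div_pos.1 (by linarith)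
  obtain ⟨p₀, q₀, r₀, hp₀, hq₀, hpqr₀, hr₀, hr₀2, hpp, hqq⟩ := exists_base_exponents hp hq hpqr hr2
  obtain ⟨C, hC⟩ := vector_base_estimate hp₀ hq₀ hpqr₀ hr₀ hr₀2 ha hbk hm hm0 hb
  obtain ⟨C1, hC1⟩ := lintegral_Mx_rpow_le hp
  obtain ⟨C2, hC2⟩ := lintegral_My_rpow_le hq
  set K : ℝ≥0∞ := ((12 * C : ℝ≥0) ^ r₀ + (ENNReal.ofReal (1 + 160 * Real.pi * Cb / (1 / (96 * (Ca + 1)))) +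
        ENNReal.ofReal (1 + 160 * Real.pi * Ca / (1 / (6 * (Cb + 1)))) + 1)) with hK
  set P := p₀ / p with hP
  set Q := q₀ / q with hQ
  have hP1 : 1 < P := (one_lt_div hp0).2 hpp
  have hQ1 : 1 < Q := (one_lt_div hq0).2 hqq
  set L : ℝ≥0∞ := K * (4 ^ p * C1 * ENNReal.ofReal (1 + P / (P - 1)) +
    4 ^ q * C2 * ENNReal.ofReal (1 + Q / (Q - 1))) with hL
  have hLt : L ≠ ⊤ := by
    have h1 : (4 : ℝ≥0∞) ^ p ≠ ⊤ := ENNReal.rpow_ne_top_of_nonneg hp0.le (by norm_num)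
    have h2 : (4 : ℝ≥0∞) ^ q ≠ ⊤ := ENNReal.rpow_ne_top_of_nonneg hq0.le (by norm_num)
    have h3 : ((12 * C : ℝ≥0) : ℝ≥0∞) ^ r₀ ≠ ⊤ := ENNReal.rpow_ne_top_of_nonneg (by linarith) ENNReal.coe_ne_top
    finiteness
  refine ⟨L.toNNReal, fun M lam hlam N f g hf hg hfi hgi A B hA hB hfA hgB => ?_⟩
  rw [ENNReal.coe_toNNReal hLt]
  set S := Finset.Icc (-(N : ℤ)) N
  set D := ENNReal.ofReal (A * B) with hD
  have hAB : 0 < A * B := by positivity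
  have hD0 : D ≠ 0 := by simpa [hD] using hAB
  have hDt : D ≠ ⊤ := ENNReal.ofReal_ne_top
  have hTm : Measurable fun z => ‖tpv a b lam S f g z‖ₑ := (measurable_tpv ha hbk lam S hf hg).enorm
  have hlev : ∀ s : ℝ, 0 < s → {z | ENNReal.ofReal s < (‖tpv a b lam S f g z‖ₑ / D) ^ r} =
      {z | ENNReal.ofReal (A * s ^ (1 / p) * (B * s ^ (1 / q))) < ‖tpv a b lam S f g z‖ₑ} := by
    intro s hs
    ext z
    have hσ : 0 < s ^ (1 / r) := by positivity
    have e : A * s ^ (1 / p) * (B * s ^ (1 / q)) = s ^ (1 / r) * (A * B) := by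
      rw [← hpqr, Real.rpow_add hs]
      ring
    have e2 : ENNReal.ofReal s = ENNReal.ofReal (s ^ (1 / r)) ^ r := by
      rw [ENNReal.ofReal_rpow_of_nonneg hσ.le hr0.le, ← Real.rpow_mul hs.le, one_div_mul_cancel hr0.ne',
        Real.rpow_one]
    simp only [Set.mem_ofPred_eq]
    rw [e, e2, ENNReal.rpow_lt_rpow_iff hr0, ENNReal.lt_div_iff_mul_lt (Or.inl hD0) (Or.inl hDt),
      ENNReal.ofReal_mul hσ.le]
  have hmain := lintegral_le_of_level (μ := (volume : Measure (ℝ × ℝ)))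
    (U := fun z => (‖tpv a b lam S f g z‖ₑ / D) ^ r)
    (F := fun z => (4 * Mx (fun v => ‖f v‖ₑ) z / ENNReal.ofReal A) ^ p)
    (G := fun z => (4 * My (fun v => ‖g v‖ₑ) z / ENNReal.ofReal B) ^ q)
    ((hTm.div_const D).pow_const r) ((((measurable_Mx hf.enorm).const_mul 4).div_const _).pow_const p)
    ((((measurable_My hg.enorm).const_mul 4).div_const _).pow_const q) hP1 hQ1 (A := K) (fun s hs => by
      rw [hlev s hs]
      exact volume_level_le ha hbk (by linarith) (by linarith) (by linarith) hpqr₀ hlam S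
        (fun f g hf hg hgb hgi => hC M lam hlam N f g hf hg hgb hgi) hf hg hfi hgi hp0 hq0 hA hB hs)
  have hF := lintegral_maximal_rpow_le hp0 hA (hC1 _ hf.enorm) hfA
  have hG := lintegral_maximal_rpow_le hq0 hB (hC2 _ hg.enorm) hgB
  have h1 : ∫⁻ z, (‖tpv a b lam S f g z‖ₑ / D) ^ r ≤ L :=
    hmain.trans (mul_le_mul_right (add_le_add (mul_le_mul_left hF _) (mul_le_mul_left hG _)) _)
  have h2 : ∫⁻ z, ‖tpv a b lam S f g z‖ₑ ^ r = (∫⁻ z, (‖tpv a b lam S f g z‖ₑ / D) ^ r) * D ^ r := by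
    rw [← lintegral_mul_const' _ _ (ENNReal.rpow_ne_top_of_nonneg hr0.le hDt)]
    refine lintegral_congr fun z => ?_
    rw [← ENNReal.mul_rpow_of_nonneg _ _ hr0.le, ENNReal.div_mul_cancel hD0 hDt]
  rw [h2]
  exact mul_le_mul_left h1 _

/-! ### Division by the Fourier transform of the averaging kernel -/

section

open scoped FourierTransform Convolution ContDiff

lemma FT1_eq_fourier (φ : ℝ → ℂ) : FT1 φ = 𝓕 φ := by
  funext ξ
  rw [Real.fourier_real_eq_integral_exp_smul, FT1]
  refine integral_congr_ae (Eventually.of_forall fun t => ?_)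
  simp only [e2π, smul_eq_mul]
  rw [mul_comm]
  congr 2
  push_cast
  ring

lemma haar_eq_indicator (s : ℝ) : haar (1 / 2) s =
    (Set.Ioc (0 : ℝ) (1 / 4)).indicator (fun _ => 1) s -
      (Set.Ioc (1 / 4 : ℝ) (1 / 2)).indicator (fun _ => 1) s := by
  simp only [haar, Set.indicator, Set.mem_Ioc]
  split_ifs <;> norm_num <;> grind

lemma haar_integrable : Integrable fun s => (haar (1 / 2) s : ℂ) := by
  have h : Integrable (haar (1 / 2)) := by
    rw [funext haar_eq_indicator]
    exact ((integrable_indicator_iff measurableSet_Ioc).2 (by simp)).sub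
      ((integrable_indicator_iff measurableSet_Ioc).2 (by simp))
  exact h.ofReal

lemma fourier_haar {ξ : ℝ} (hξ : ξ ≠ 0) : 𝓕 (fun s => (haar (1 / 2) s : ℂ)) ξ =
    -(1 - Complex.exp (-2 * Real.pi * ξ * Complex.I * (1 / 4))) ^ 2 / (-2 * Real.pi * ξ * Complex.I) := by
  set c : ℂ := -2 * Real.pi * ξ * Complex.I with hc
  have hc0 : c ≠ 0 := by simp [hc, hξ, Real.pi_ne_zero]
  have e : ∀ v : ℝ, Complex.exp (↑(-2 * Real.pi * v * ξ) * Complex.I) • (haar (1 / 2) v : ℂ) =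
      (Set.Ioc (0 : ℝ) (1 / 4)).indicator (fun v : ℝ => Complex.exp (c * v)) v -
        (Set.Ioc (1 / 4 : ℝ) (1 / 2)).indicator (fun v : ℝ => Complex.exp (c * v)) v := by
    intro v
    have h1 : ↑(-2 * Real.pi * v * ξ) * Complex.I = c * v := by
      rw [hc]; push_cast; ring
    rw [h1, haar_eq_indicator]
    simp only [Set.indicator]
    split_ifs <;> simp
  have hi : ∀ x y : ℝ, Integrable ((Set.Ioc x y).indicator fun v : ℝ => Complex.exp (c * v)) := fun x y =>
    (integrable_indicator_iff measurableSet_Ioc).2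
      ((by fun_prop : Continuous fun v : ℝ => Complex.exp (c * v)).integrableOn_Ioc)
  rw [Real.fourier_real_eq_integral_exp_smul]
  simp_rw [e]
  rw [integral_sub (hi _ _) (hi _ _), integral_indicator measurableSet_Ioc,
    integral_indicator measurableSet_Ioc, ← intervalIntegral.integral_of_le (by norm_num),
    ← intervalIntegral.integral_of_le (by norm_num), integral_exp_mul_complex hc0,
    integral_exp_mul_complex hc0]
  have h2 : Complex.exp (c * ((1 / 2 : ℝ) : ℂ)) = Complex.exp (c * (1 / 4)) ^ 2 := by
    rw [← Complex.exp_nat_mul]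
    congr 1
    push_cast
    ring
  rw [h2]
  push_cast
  rw [mul_zero, Complex.exp_zero]
  ring

lemma fourier_haar_ne_zero {ξ : ℝ} (hξ : ξ ≠ 0) (hξ4 : |ξ| < 4) :
    𝓕 (fun s => (haar (1 / 2) s : ℂ)) ξ ≠ 0 := by
  rw [fourier_haar hξ]
  refine div_ne_zero (neg_ne_zero.2 (pow_ne_zero _ (sub_ne_zero.2 fun h => ?_)))
    (by simp [hξ, Real.pi_ne_zero])
  obtain ⟨n, hn⟩ := Complex.exp_eq_one_iff.1 h.symm
  have h1 : (2 * Real.pi * Complex.I : ℂ) ≠ 0 := by simp [Real.pi_ne_zero]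
  have h2 : (-(ξ / 4) : ℂ) = n := by
    apply mul_right_cancel₀ h1
    rw [← hn]
    ring
  have h3 : -(ξ / 4) = (n : ℝ) := by exact_mod_cast h2
  have h4 : |(n : ℝ)| < 1 := by
    rw [← h3, abs_neg, abs_div]
    rw [div_lt_one (by norm_num)]
    simpa using hξ4
  have h5 : n = 0 := by
    have : |n| < 1 := by exact_mod_cast h4
    exact Int.abs_lt_one_iff.1 this
  rw [h5] at h3
  simp at h3
  exact hξ h3

lemma eta_eq_convolution : (fun t => (eta (1 / 2) t : ℂ)) =
    (4 : ℂ) • ((fun s => (haar (1 / 2) (-s) : ℂ)) ⋆[ContinuousLinearMap.mul ℂ ℂ] fun s => (haar (1 / 2) s : ℂ)) := by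
  funext t
  rw [Pi.smul_apply, convolution_def, eta, smul_eq_mul, ← integral_neg_eq_self, Complex.ofReal_mul,
    ← integral_complex_ofReal]
  congr 1
  · norm_num
  · refine integral_congr_ae (Eventually.of_forall fun s => ?_)
    simp [← sub_eq_add_neg, mul_comm]

lemma fourier_eta_ne_zero {ξ : ℝ} (hξ : ξ ≠ 0) (hξ4 : |ξ| < 4) :
    𝓕 (fun t => (eta (1 / 2) t : ℂ)) ξ ≠ 0 := by
  have h1 : 𝓕 (fun s => (haar (1 / 2) (-s) : ℂ)) ξ = 𝓕 (fun s => (haar (1 / 2) s : ℂ)) (-ξ) := by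
    rw [Real.fourier_real_eq_integral_exp_smul, Real.fourier_real_eq_integral_exp_smul,
      ← integral_neg_eq_self]
    simp
  have h2 : 𝓕 (fun t => (eta (1 / 2) t : ℂ)) ξ = 4 * (𝓕 (fun s => (haar (1 / 2) s : ℂ)) (-ξ) *
      𝓕 (fun s => (haar (1 / 2) s : ℂ)) ξ) := by
    rw [eta_eq_convolution, ← h1, ← Real.fourier_mul_convolution_eq haar_integrable.comp_neg haar_integrable,
      Real.fourier_real_eq_integral_exp_smul, Real.fourier_real_eq_integral_exp_smul,
      ← integral_const_mul]
    refine integral_congr_ae (Eventually.of_forall fun s => ?_)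
    simp only [Pi.smul_apply, smul_eq_mul]
    ring
  rw [h2]
  exact mul_ne_zero (by norm_num) (mul_ne_zero (fourier_haar_ne_zero (neg_ne_zero.2 hξ) (by rwa [abs_neg]))
    (fourier_haar_ne_zero hξ hξ4))

lemma contDiff_fourier_eta : ContDiff ℝ ∞ (𝓕 fun t => (eta (1 / 2) t : ℂ)) := by
  refine Real.contDiff_fourier fun n _ => ?_
  have h := (eta_integrable (1 / 2)).ofReal (𝕜 := ℂ)
  refine h.norm.mono' ?_ (Eventually.of_forall fun t => ?_)
  · exact ((continuous_norm.pow n).aestronglyMeasurable).mul h.norm.aestronglyMeasurable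
  · rw [norm_mul, norm_pow, norm_norm, norm_norm]
    by_cases ht : 1 / 2 ≤ |t|
    · rw [eta_eq_zero ht]
      simp
    · refine mul_le_of_le_one_left (norm_nonneg _) (pow_le_one₀ (norm_nonneg _) ?_)
      rw [Real.norm_eq_abs]
      linarith

/-- A Schwartz function with spectrum in an annulus factors through the averaging kernel. -/
theorem exists_fconv_eta_eq (ψ : SchwartzMap ℝ ℂ)
    (hψ : tsupport (FT1 ⇑ψ) ⊆ {ξ : ℝ | 1 / 2 ≤ |ξ| ∧ |ξ| ≤ 2}) :
    ∃ m : SchwartzMap ℝ ℂ, ∫ t, m t = 0 ∧ ∀ t, ψ t = fconv (eta (1 / 2)) m t := by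
  rw [FT1_eq_fourier] at hψ
  set e : ℝ → ℂ := 𝓕 fun t => (eta (1 / 2) t : ℂ) with he
  have hψ0 : ∀ ξ, ¬(1 / 2 ≤ |ξ| ∧ |ξ| ≤ 2) → 𝓕 (⇑ψ) ξ = 0 := fun ξ h =>
    image_eq_zero_of_notMem_tsupport fun h' => h (hψ h')
  have hne : ∀ ξ, 1 / 2 ≤ |ξ| ∧ |ξ| ≤ 2 → e ξ ≠ 0 := fun ξ h =>
    fourier_eta_ne_zero (fun h0 => by rw [h0] at h; norm_num at h) (by linarith [h.2])
  set w : ℝ → ℂ := fun ξ => 𝓕 (⇑ψ) ξ / e ξ with hw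
  have hwc : HasCompactSupport w := by
    refine HasCompactSupport.intro (isCompact_Icc (a := (-2 : ℝ)) (b := 2)) fun ξ hξ => ?_
    rw [hw]
    simp only
    rw [hψ0 ξ fun h => hξ (abs_le.1 h.2), zero_div]
  have hws : ContDiff ℝ ∞ w := by
    refine contDiff_iff_contDiffAt.2 fun ξ => ?_
    by_cases hξ : ξ ∈ tsupport (𝓕 (⇑ψ))
    · have h1 : ContDiffAt ℝ ∞ (𝓕 (⇑ψ)) ξ := by
        rw [← SchwartzMap.fourier_coe]
        exact ((𝓕 ψ : SchwartzMap ℝ ℂ).smooth (⊤ : ℕ∞)).contDiffAt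
      simp only [hw, div_eq_mul_inv]
      exact h1.mul (contDiff_fourier_eta.contDiffAt.inv (hne ξ (hψ hξ)))
    · refine contDiffAt_const (c := (0 : ℂ)).congr_of_eventuallyEq ?_
      filter_upwards [(isClosed_tsupport _).isOpen_compl.mem_nhds hξ] with x hx
      simp [hw, image_eq_zero_of_notMem_tsupport hx]
  set W : SchwartzMap ℝ ℂ := hwc.toSchwartzMap hws with hW
  have hWw : (⇑W : ℝ → ℂ) = w := rfl
  set m : SchwartzMap ℝ ℂ := 𝓕⁻ W with hmW
  have hm : 𝓕 (⇑m) = w := by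
    rw [← SchwartzMap.fourier_coe, hmW, FourierTransform.fourier_fourierInv_eq, hWw]
  refine ⟨m, ?_, ?_⟩
  · have h1 : ∫ t, m t = 𝓕 (⇑m) 0 := by
      rw [Real.fourier_real_eq_integral_exp_smul]
      simp
    rw [h1, hm, hw]
    simp only
    rw [hψ0 0 (by norm_num), zero_div]
  · set g : ℝ → ℂ := (fun t => (eta (1 / 2) t : ℂ)) ⋆[ContinuousLinearMap.mul ℂ ℂ] ⇑m with hg
    have hei : Integrable fun t => (eta (1 / 2) t : ℂ) := (eta_integrable (1 / 2)).ofReal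
    have hgF : 𝓕 g = 𝓕 (⇑ψ) := by
      funext ξ
      rw [hg, Real.fourier_mul_convolution_eq hei m.integrable, hm, hw]
      by_cases hξ : 1 / 2 ≤ |ξ| ∧ |ξ| ≤ 2
      · exact mul_div_cancel₀ _ (hne ξ hξ)
      · simp [hψ0 ξ hξ]
    have hgi : Integrable g := hei.integrable_convolution _ m.integrable
    have hgc : Continuous g := by
      refine BddAbove.continuous_convolution_right_of_integrable _ ?_ hei m.continuous
      obtain ⟨C, hC⟩ := m.decay 0 0
      exact ⟨C, by rintro _ ⟨x, rfl⟩; simpa using hC.2 x⟩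
    have hψi : Integrable (𝓕 (⇑ψ)) := by
      rw [← SchwartzMap.fourier_coe]
      exact (𝓕 ψ).integrable
    have h1 := hgc.fourierInv_fourier_eq hgi (by rwa [hgF])
    have h2 := ψ.continuous.fourierInv_fourier_eq ψ.integrable hψi
    rw [hgF, h2] at h1
    intro t
    rw [h1, hg, convolution_def, ← integral_sub_left_eq_self _ _ t, fconv]
    refine integral_congr_ae (Eventually.of_forall fun s => ?_)
    simp

end

/-! ### Real and imaginary parts -/

/-- The real and imaginary parts of a complex number. -/
def part : Fin 2 → ℂ →L[ℝ] ℝ := ![Complex.reCLM, Complex.imCLM]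

lemma sum_part (c : ℂ) : ∑ i : Fin 2, Complex.I ^ (i : ℕ) * (part i c : ℂ) = c := by
  simp only [Fin.sum_univ_two, part]
  simp [mul_comm Complex.I]

lemma abs_part_le (i : Fin 2) (c : ℂ) : |part i c| ≤ ‖c‖ := by
  fin_cases i
  · exact Complex.abs_re_le_norm c
  · exact Complex.abs_im_le_norm c

lemma isKer_of_deriv {E : Type*} [NormedAddCommGroup E] [NormedSpace ℝ E] {F : ℝ → E} {C : ℝ}
    (hF : Differentiable ℝ F)
    (h0 : ∀ t, (1 + |t|) ^ 3 * ‖F t‖ ≤ C) (h1 : ∀ t, (1 + |t|) ^ 3 * ‖deriv F t‖ ≤ C)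
    (L : E → ℝ) (hL : ∀ x y, |L x - L y| ≤ ‖x - y‖) (hL0 : ∀ x, |L x| ≤ ‖x‖) :
    IsKer (fun t => L (F t)) (8 * C) where
  bound t := by
    have hC : 0 ≤ C := le_trans (by positivity) (h0 t)
    have : ‖F t‖ ≤ C / (1 + |t|) ^ 3 := by
      rw [le_div_iff₀ (by positivity), mul_comm]
      exact h0 t
    refine (hL0 _).trans (this.trans ?_)
    gcongr
    linarith
  lip s t := by
    have hC : 0 ≤ C := le_trans (by positivity) (h0 t)
    refine (hL _ _).trans ?_
    have hb : ∀ x, ‖F x‖ ≤ C * (1 / (1 + |x|) ^ 3) := fun x => by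
      rw [mul_one_div, le_div_iff₀ (by positivity), mul_comm]
      exact h0 x
    by_cases hst : 1 ≤ |s - t|
    · calc ‖F s - F t‖ ≤ ‖F s‖ + ‖F t‖ := norm_sub_le _ _
        _ ≤ C * (1 / (1 + |s|) ^ 3 + 1 / (1 + |t|) ^ 3) := by linarith [hb s, hb t]
        _ ≤ 8 * C * |s - t| * (1 / (1 + |s|) ^ 3 + 1 / (1 + |t|) ^ 3) := by
          gcongr
          nlinarith
    · have hd : ∀ x ∈ segment ℝ t s, ‖deriv F x‖ ≤ 8 * C * (1 / (1 + |s|) ^ 3) := by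
        intro x hx
        have hxs : |s| ≤ |x| + 1 := by
          have h2 : |s - x| ≤ |s - t| := by
            obtain ⟨a, b, ha, hb, hab, rfl⟩ := hx
            have h6 : s - (a • t + b • s) = a * (s - t) := by
              simp only [smul_eq_mul]
              linear_combination s * hab.symm
            rw [h6, abs_mul, abs_of_nonneg ha]
            exact mul_le_of_le_one_left (abs_nonneg _) (by linarith)
          have h3 := abs_sub_abs_le_abs_sub s x
          linarith
        have h4 : (1 + |s|) ^ 3 ≤ 8 * (1 + |x|) ^ 3 := by
          calc (1 + |s|) ^ 3 ≤ (2 * (1 + |x|)) ^ 3 := by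
                gcongr
                linarith [abs_nonneg x]
            _ = 8 * (1 + |x|) ^ 3 := by ring
        rw [mul_one_div, le_div_iff₀ (by positivity)]
        calc ‖deriv F x‖ * (1 + |s|) ^ 3 ≤ ‖deriv F x‖ * (8 * (1 + |x|) ^ 3) := by gcongr
          _ = 8 * ((1 + |x|) ^ 3 * ‖deriv F x‖) := by ring
          _ ≤ 8 * C := by gcongr; exact h1 x
      have h5 := (convex_segment t s).norm_image_sub_le_of_norm_deriv_le (fun x _ => hF x) hd
        (left_mem_segment ℝ t s) (right_mem_segment ℝ t s)
      refine h5.trans ?_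
      rw [Real.norm_eq_abs]
      calc 8 * C * (1 / (1 + |s|) ^ 3) * |s - t| = 8 * C * |s - t| * (1 / (1 + |s|) ^ 3 + 0) := by ring
        _ ≤ _ := by
          gcongr
          positivity

lemma exists_isKer_part (F : SchwartzMap ℝ ℂ) : ∃ C, ∀ i, IsKer (fun t => part i (F t)) C := by
  have h : ∀ n : ℕ, n ≤ 1 → ∀ t, (1 + |t|) ^ 3 * ‖iteratedFDeriv ℝ n F t‖ ≤
      2 ^ 3 * (Finset.Iic (3, 1)).sup (fun m => SchwartzMap.seminorm ℝ m.1 m.2) F := fun n hn t =>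
    SchwartzMap.one_add_le_sup_seminorm_apply (𝕜 := ℝ) (m := (3, 1)) le_rfl hn F t
  refine ⟨8 * (2 ^ 3 * (Finset.Iic (3, 1)).sup (fun m => SchwartzMap.seminorm ℝ m.1 m.2) F),
    fun i => isKer_of_deriv F.differentiable (fun t => ?_) (fun t => ?_) (part i)
    (fun x y => ?_) (abs_part_le i)⟩
  · simpa using h 0 (by norm_num) t
  · have := h 1 le_rfl t
    rwa [norm_iteratedFDeriv_eq_norm_iteratedDeriv, iteratedDeriv_one] at this
  · rw [← map_sub]
    exact abs_part_le i _

lemma exists_part_fconv_eta_eq (ψ : SchwartzMap ℝ ℂ)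
    (hψ : tsupport (FT1 ⇑ψ) ⊆ {ξ : ℝ | 1 / 2 ≤ |ξ| ∧ |ξ| ≤ 2}) :
    ∃ m : Fin 2 → ℝ → ℝ, ∃ C, (∀ i, IsKer (m i) C) ∧ (∀ i, ∫ t, m i t = 0) ∧
      ∀ i t, part i (ψ t) = fconv (eta (1 / 2)) (m i) t := by
  obtain ⟨m, hm0, hm⟩ := exists_fconv_eta_eq ψ hψ
  obtain ⟨C, hC⟩ := exists_isKer_part m
  refine ⟨fun i t => part i (m t), C, hC, fun i => ?_, fun i t => ?_⟩
  · rw [(part i).integral_comp_comm m.integrable, hm0, map_zero]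
  · obtain ⟨he, D, hD⟩ := eta_bm (1 / 2)
    have hi : Integrable fun s => eta (1 / 2) (t - s) • m s :=
      m.integrable.bdd_smul D ((he.comp (by fun_prop : Measurable fun s : ℝ => t - s)).aestronglyMeasurable)
        (Eventually.of_forall fun s => hD _)
    rw [hm, fconv, ← (part i).integral_comp_comm hi, fconv]
    simp only [map_smul]

/-! ### Complexification and passage to the limit -/

lemma integrable_fiber (f : SchwartzMap (ℝ × ℝ) ℂ) {ι : ℝ → ℝ × ℝ} (hι : Continuous ι)
    (h : ∀ t, |t| ≤ ‖ι t‖) : Integrable fun t => f (ι t) := by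
  set C := 2 ^ 2 * (Finset.Iic (2, 0)).sup (fun m => SchwartzMap.seminorm ℝ m.1 m.2) f
  refine (integrable_inv_one_add_sq.const_mul C).mono' ((f.continuous.comp hι).aestronglyMeasurable)
    (Eventually.of_forall fun t => ?_)
  have h1 : (1 + ‖ι t‖) ^ 2 * ‖f (ι t)‖ ≤ C := by
    simpa using SchwartzMap.one_add_le_sup_seminorm_apply (𝕜 := ℝ) (m := (2, 0)) (k := 2) (n := 0)
      le_rfl le_rfl f (ι t)
  have h2 : 1 + t ^ 2 ≤ (1 + ‖ι t‖) ^ 2 := by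
    nlinarith [h t, sq_abs t, abs_nonneg t, norm_nonneg (ι t)]
  rw [← div_eq_mul_inv, le_div_iff₀ (by positivity), mul_comm]
  exact le_trans (by gcongr) h1

lemma integrable_fst_fiber (f : SchwartzMap (ℝ × ℝ) ℂ) (y : ℝ) : Integrable fun t => f (t, y) :=
  integrable_fiber f (by fun_prop) fun t => by simp [Prod.norm_def]

lemma integrable_snd_fiber (f : SchwartzMap (ℝ × ℝ) ℂ) (x : ℝ) : Integrable fun t => f (x, t) :=
  integrable_fiber f (by fun_prop) fun t => by simp [Prod.norm_def]

lemma integral_dil_eq {φ : ℝ → ℂ} {C : ℝ} (hφ : ∀ i, IsKer (fun t => part i (φ t)) C) (k : ℤ)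
    {u : ℝ → ℂ} (hu : Integrable u) (x : ℝ) :
    ∫ t, u (x - t) * dil φ k t = ∑ i : Fin 2 × Fin 2, Complex.I ^ (i.1 : ℕ) * Complex.I ^ (i.2 : ℕ) *
      ((fconv (rdil (fun t => part i.1 (φ t)) k) (fun t => part i.2 (u t)) x : ℝ) : ℂ) := by
  have e : ∀ t, u t * dil φ k (x - t) = ∑ i : Fin 2 × Fin 2,
      Complex.I ^ (i.1 : ℕ) * Complex.I ^ (i.2 : ℕ) *
        ((rdil (fun t => part i.1 (φ t)) k (x - t) • part i.2 (u t) : ℝ) : ℂ) := by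
    intro t
    conv_lhs => rw [dil, ← sum_part (u t), ← sum_part (φ _)]
    simp only [Fintype.sum_prod_type, Fin.sum_univ_two, rdil, smul_eq_mul]
    push_cast
    ring
  have hi : ∀ i : Fin 2 × Fin 2, Integrable fun t =>
      rdil (fun t => part i.1 (φ t)) k (x - t) • part i.2 (u t) := fun i =>
    (hφ i.1).integrable_rdil_smul k ((part i.2).integrable_comp hu) x
  rw [← integral_sub_left_eq_self (fun t => u (x - t) * dil φ k t) volume x]
  simp only [sub_sub_cancel]
  simp_rw [e]
  rw [integral_finsetSum _ fun i _ => (hi i).ofReal.const_mul _]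
  refine Finset.sum_congr rfl fun i _ => ?_
  rw [integral_const_mul, integral_complex_ofReal, fconv]

/-- The truncation of the twisted paraproduct to the scales `|k| ≤ N`. -/
def truncTwPara (φ ψ : ℝ → ℂ) (lam : ℤ → ℂ) (N : ℕ) (f g : ℝ × ℝ → ℂ) (z : ℝ × ℝ) : ℂ :=
  ∑ k ∈ Finset.Icc (-(N : ℤ)) N, lam k * Px (dil φ k) f z * Py (dil ψ k) g z

/-- Indices for the real and imaginary parts of the coefficients, kernels and functions. -/
abbrev PartIdx := Fin 2 × (Fin 2 × Fin 2) × Fin 2 × Fin 2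

lemma truncTwPara_eq {φ ψ : ℝ → ℂ} {C D : ℝ} (hφ : ∀ i, IsKer (fun t => part i (φ t)) C)
    (hψ : ∀ i, IsKer (fun t => part i (ψ t)) D) (lam : ℤ → ℂ) (N : ℕ)
    (f g : SchwartzMap (ℝ × ℝ) ℂ) (z : ℝ × ℝ) :
    truncTwPara φ ψ lam N f g z = ∑ i : PartIdx,
      Complex.I ^ (i.1 : ℕ) * (Complex.I ^ (i.2.1.1 : ℕ) * Complex.I ^ (i.2.1.2 : ℕ)) *
        (Complex.I ^ (i.2.2.1 : ℕ) * Complex.I ^ (i.2.2.2 : ℕ)) *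
      (tp (fun t => part i.2.1.1 (φ t)) (fun t => part i.2.2.1 (ψ t)) (fun k => part i.1 (lam k))
        (Finset.Icc (-(N : ℤ)) N) (fun w => part i.2.1.2 (f w)) (fun w => part i.2.2.2 (g w)) z : ℂ) := by
  simp only [tp, Complex.ofReal_sum, Finset.mul_sum]
  rw [Finset.sum_comm]
  refine Finset.sum_congr rfl fun k _ => ?_
  have h1 := integral_dil_eq hφ k (integrable_fst_fiber f z.2) z.1
  have h2 := integral_dil_eq hψ k (integrable_snd_fiber g z.1) z.2
  rw [Px, Py, h1, h2]
  conv_lhs => rw [← sum_part (lam k)]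
  conv_rhs => rw [Fintype.sum_prod_type]
  rw [Finset.sum_mul_sum, Finset.sum_mul]
  refine Finset.sum_congr rfl fun i _ => ?_
  conv_rhs => rw [Fintype.sum_prod_type]
  rw [Finset.sum_mul_sum]
  refine Finset.sum_congr rfl fun j _ => Finset.sum_congr rfl fun l _ => ?_
  push_cast
  ring

lemma enorm_truncTwPara_le {φ ψ : ℝ → ℂ} {C D : ℝ} (hφ : ∀ i, IsKer (fun t => part i (φ t)) C)
    (hψ : ∀ i, IsKer (fun t => part i (ψ t)) D) (lam : ℤ → ℂ) (N : ℕ)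
    (f g : SchwartzMap (ℝ × ℝ) ℂ) (z : ℝ × ℝ) :
    ‖truncTwPara φ ψ lam N f g z‖ₑ ≤ ∑ i : PartIdx,
      ‖tp (fun t => part i.2.1.1 (φ t)) (fun t => part i.2.2.1 (ψ t)) (fun k => part i.1 (lam k))
        (Finset.Icc (-(N : ℤ)) N) (fun w => part i.2.1.2 (f w)) (fun w => part i.2.2.2 (g w)) z‖ₑ := by
  rw [truncTwPara_eq hφ hψ]
  refine (enorm_sum_le _ _).trans (Finset.sum_le_sum fun i _ => ?_)
  rw [enorm_mul]
  have hI : ‖Complex.I‖ₑ = 1 := by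
    rw [← ofReal_norm, Complex.norm_I, ENNReal.ofReal_one]
  simp only [enorm_mul, enorm_pow, hI, one_pow, one_mul]
  rw [← ofReal_norm, ← ofReal_norm, Complex.norm_real]

lemma sum_rpow_le_card {ι : Type*} [Fintype ι] [Nonempty ι] (y : ι → ℝ≥0∞) {s : ℝ} (hs : 0 ≤ s) :
    (∑ i, y i) ^ s ≤ (Fintype.card ι : ℝ≥0∞) ^ s * ∑ i, y i ^ s := by
  obtain ⟨j, hj⟩ := Finite.exists_max y
  calc (∑ i, y i) ^ s ≤ (Fintype.card ι * y j) ^ s := by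
        gcongr
        simpa using Finset.sum_le_card_nsmul Finset.univ y (y j) fun i _ => hj i
    _ = (Fintype.card ι : ℝ≥0∞) ^ s * y j ^ s := ENNReal.mul_rpow_of_nonneg _ _ hs
    _ ≤ _ := by
        gcongr
        exact Finset.single_le_sum (f := fun i => y i ^ s) (fun _ _ => by positivity) (Finset.mem_univ j)

/-- The vector of the real or imaginary parts of the first `M` functions of a sequence. -/
def partVec (M : ℕ) (i : Fin 2) (g : ℕ → SchwartzMap (ℝ × ℝ) ℂ) (z : ℝ × ℝ) : EuclideanSpace ℝ (Fin M) :=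
  WithLp.toLp 2 fun l : Fin M => part i (g l z)

lemma measurable_partVec (M : ℕ) (i : Fin 2) (g : ℕ → SchwartzMap (ℝ × ℝ) ℂ) :
    Measurable (partVec M i g) :=
  measurable_toLp fun l => ((part i).continuous.comp (g l).continuous).measurable

lemma integrable_partVec (M : ℕ) (i : Fin 2) (g : ℕ → SchwartzMap (ℝ × ℝ) ℂ) (x : ℝ) :
    Integrable fun t => partVec M i g (x, t) :=
  integrable_toLp fun l => (part i).integrable_comp (integrable_snd_fiber (g l) x)

lemma enorm_partVec_sq_le (M : ℕ) (i : Fin 2) (g : ℕ → SchwartzMap (ℝ × ℝ) ℂ) (z : ℝ × ℝ) :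
    ‖partVec M i g z‖ₑ ^ 2 ≤ ∑' l, ‖g l z‖ₑ ^ 2 := by
  rw [enorm_sq_euclidean]
  calc ∑ l : Fin M, ‖partVec M i g z l‖ₑ ^ 2 ≤ ∑ l : Fin M, ‖g l z‖ₑ ^ 2 := by
        gcongr with l
        rw [← ofReal_norm, ← ofReal_norm]
        exact ENNReal.ofReal_le_ofReal (abs_part_le i _)
    _ = ∑ l ∈ Finset.range M, ‖g l z‖ₑ ^ 2 := Fin.sum_univ_eq_sum_range (fun l => ‖g l z‖ₑ ^ 2) M
    _ ≤ _ := ENNReal.sum_le_tsum _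

/-- The real vector-valued building blocks of the truncated twisted paraproduct. -/
def block (φ ψ : ℝ → ℂ) (lam : ℤ → ℂ) (N M : ℕ) (f : SchwartzMap (ℝ × ℝ) ℂ)
    (g : ℕ → SchwartzMap (ℝ × ℝ) ℂ) (i : PartIdx) : ℝ × ℝ → EuclideanSpace ℝ (Fin M) :=
  tpv (fun t => part i.2.1.1 (φ t)) (fun t => part i.2.2.1 (ψ t)) (fun k => part i.1 (lam k))
    (Finset.Icc (-(N : ℤ)) N) (fun w => part i.2.1.2 (f w)) (partVec M i.2.2.2 g)

lemma sum_truncTwPara_le {φ ψ : ℝ → ℂ} {C D : ℝ} (hφ : ∀ i, IsKer (fun t => part i (φ t)) C)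
    (hψ : ∀ i, IsKer (fun t => part i (ψ t)) D) (lam : ℤ → ℂ) (N M : ℕ) {r : ℝ} (hr : 0 ≤ r)
    (f : SchwartzMap (ℝ × ℝ) ℂ) (g : ℕ → SchwartzMap (ℝ × ℝ) ℂ) (z : ℝ × ℝ) :
    (∑ l ∈ Finset.range M, ‖truncTwPara φ ψ lam N f (g l) z‖ₑ ^ 2) ^ (r / 2) ≤
      (32 ^ 2) ^ (r / 2) * (32 ^ (r / 2) * ∑ i, ‖block φ ψ lam N M f g i z‖ₑ ^ r) := by
  have hcard : (Fintype.card PartIdx : ℝ≥0∞) = 32 := by simp [PartIdx]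
  have h1 : ∑ l ∈ Finset.range M, ‖truncTwPara φ ψ lam N f (g l) z‖ₑ ^ 2 ≤
      32 ^ 2 * ∑ i, ‖block φ ψ lam N M f g i z‖ₑ ^ 2 := by
    calc ∑ l ∈ Finset.range M, ‖truncTwPara φ ψ lam N f (g l) z‖ₑ ^ 2
        = ∑ l : Fin M, ‖truncTwPara φ ψ lam N f (g l) z‖ₑ ^ 2 :=
          (Fin.sum_univ_eq_sum_range (fun l => ‖truncTwPara φ ψ lam N f (g l) z‖ₑ ^ 2) M).symm
      _ ≤ ∑ l : Fin M, 32 ^ 2 * ∑ i, ‖block φ ψ lam N M f g i z l‖ₑ ^ 2 := by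
          refine Finset.sum_le_sum fun l _ => ?_
          have h2 : ‖truncTwPara φ ψ lam N f (g l) z‖ₑ ≤ ∑ i, ‖block φ ψ lam N M f g i z l‖ₑ := by
            refine (enorm_truncTwPara_le hφ hψ lam N f (g l) z).trans (Finset.sum_le_sum fun i _ => ?_)
            rw [block, tpv_apply (hψ _) _ _ _ (integrable_partVec M i.2.2.2 g)]
            rfl
          calc _ ≤ (∑ i, ‖block φ ψ lam N M f g i z l‖ₑ) ^ 2 := by gcongr
            _ ≤ _ := by
              have := sum_rpow_le_card (fun i => ‖block φ ψ lam N M f g i z l‖ₑ) (zero_le_two (α := ℝ))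
              rw [hcard] at this
              simpa only [ENNReal.rpow_two] using this
      _ = 32 ^ 2 * ∑ i, ‖block φ ψ lam N M f g i z‖ₑ ^ 2 := by
          rw [← Finset.mul_sum, Finset.sum_comm]
          simp only [enorm_sq_euclidean]
  have h3 := sum_rpow_le_card (fun i => ‖block φ ψ lam N M f g i z‖ₑ ^ 2) (s := r / 2) (by positivity)
  rw [hcard] at h3
  calc _ ≤ (32 ^ 2 * ∑ i, ‖block φ ψ lam N M f g i z‖ₑ ^ 2) ^ (r / 2) := by gcongr
    _ = (32 ^ 2) ^ (r / 2) * (∑ i, ‖block φ ψ lam N M f g i z‖ₑ ^ 2) ^ (r / 2) :=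
      ENNReal.mul_rpow_of_nonneg _ _ (by positivity)
    _ ≤ _ := by
      gcongr
      refine h3.trans_eq ?_
      congr 1
      refine Finset.sum_congr rfl fun i _ => ?_
      rw [← ENNReal.rpow_two, ← ENNReal.rpow_mul]
      congr 1
      ring

lemma rpow_tsum_le_liminf {u : ℕ → ℝ≥0∞} {v : ℕ → ℕ → ℝ≥0∞} {s : ℝ} (hs : 0 ≤ s)
    (h : ∀ l, Tendsto (fun n => v n l) atTop (𝓝 (u l)) ∨ u l = 0) :
    (∑' l, u l) ^ s ≤ liminf (fun n => (∑ l ∈ Finset.range n, v n l) ^ s) atTop := by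
  have hc : Tendsto (fun F : Finset ℕ => (∑ l ∈ F, u l) ^ s) atTop (𝓝 ((∑' l, u l) ^ s)) :=
    (ENNReal.continuous_rpow_const.tendsto _).comp ENNReal.summable.hasSum
  refine le_of_tendsto' hc fun F => ?_
  classical
  set G := F.filter fun l => u l ≠ 0
  have hG : Tendsto (fun n => (∑ l ∈ G, v n l) ^ s) atTop (𝓝 ((∑ l ∈ F, u l) ^ s)) := by
    rw [← Finset.sum_filter_ne_zero F]
    refine (ENNReal.continuous_rpow_const.tendsto _).comp (tendsto_finsetSum _ fun l hl => ?_)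
    exact (h l).resolve_right (Finset.mem_filter.1 hl).2
  rw [← hG.liminf_eq]
  refine liminf_le_liminf ?_
  filter_upwards [eventually_ge_atTop (G.sup id + 1)] with n hn
  gcongr
  intro l hl
  have : l ≤ G.sup id := Finset.le_sup (f := id) hl
  exact Finset.mem_range.2 (by omega)

lemma tendsto_truncTwPara (φ ψ : ℝ → ℂ) (lam : ℤ → ℂ) (f g : ℝ × ℝ → ℂ) (z : ℝ × ℝ) :
    Tendsto (fun N => ‖truncTwPara φ ψ lam N f g z‖ₑ ^ 2) atTop (𝓝 (‖TwPara φ ψ lam f g z‖ₑ ^ 2)) ∨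
      ‖TwPara φ ψ lam f g z‖ₑ ^ 2 = 0 := by
  by_cases h : Summable fun k : ℤ => lam k * Px (dil φ k) f z * Py (dil ψ k) g z
  · left
    have h1 : Tendsto (fun N : ℕ => truncTwPara φ ψ lam N f g z) atTop (𝓝 (TwPara φ ψ lam f g z)) :=
      h.hasSum.comp Finset.tendsto_Icc_neg
    exact (ENNReal.continuous_pow 2).tendsto _ |>.comp h1.enorm
  · right
    rw [TwPara, tsum_eq_zero_of_not_summable h]
    simp

theorem exists_twPara_estimate (φ ψ : SchwartzMap ℝ ℂ)
    (hψ : tsupport (FT1 ⇑ψ) ⊆ {ξ : ℝ | 1 / 2 ≤ |ξ| ∧ |ξ| ≤ 2})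
    (lam : ℤ → ℂ) (hlam : ∀ k : ℤ, ‖lam k‖ ≤ 1)
    {p q r : ℝ} (hp : 1 < p) (hq : 1 < q)
    (hpqr : 1 / p + 1 / q = 1 / r) (hr2 : 1 / 2 < 1 / r) :
    ∃ K : ℝ≥0∞, K ≠ ⊤ ∧ ∀ (f : SchwartzMap (ℝ × ℝ) ℂ) (g : ℕ → SchwartzMap (ℝ × ℝ) ℂ) (x y : ℝ),
      0 < x → 0 < y → ∫⁻ z, ‖f z‖ₑ ^ p ≤ ENNReal.ofReal x ^ p →
      ∫⁻ z, (∑' l, ‖g l z‖ₑ ^ 2) ^ (q / 2) ≤ ENNReal.ofReal y ^ q →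
      ∫⁻ z, (∑' l, ‖TwPara φ ψ lam f (g l) z‖ₑ ^ 2) ^ (r / 2) ≤ K * ENNReal.ofReal (x * y) ^ r := by
  obtain ⟨Ca, ha⟩ := exists_isKer_part φ
  obtain ⟨Cb, hb⟩ := exists_isKer_part ψ
  obtain ⟨m, Cm, hm, hm0, hmb⟩ := exists_part_fconv_eta_eq ψ hψ
  have hr : 0 < r := by
    have : 0 < 1 / r := by linarith
    simpa using this
  have hex := fun (i j : Fin 2) => extended_estimate hp hq hpqr hr2 (ha i) (hb j) (hm j) (hm0 j) (hmb j)
  choose C hC using hex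
  refine ⟨(32 ^ 2) ^ (r / 2) * (32 ^ (r / 2) * ∑ i : PartIdx, (C i.2.1.1 i.2.2.1 : ℝ≥0∞)), ?_, ?_⟩
  · have h1 : ((32 : ℝ≥0∞) ^ 2) ^ (r / 2) ≠ ⊤ := ENNReal.rpow_ne_top_of_nonneg (by positivity) (by finiteness)
    have h2 : (32 : ℝ≥0∞) ^ (r / 2) ≠ ⊤ := ENNReal.rpow_ne_top_of_nonneg (by positivity) (by finiteness)
    refine ENNReal.mul_ne_top h1 (ENNReal.mul_ne_top h2 (ENNReal.sum_ne_top.2 fun i _ => ENNReal.coe_ne_top))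
  intro f g x y hx hy hfx hgy
  have hfm : ∀ i, Measurable fun w => part i (f w) := fun i =>
    ((part i).continuous.comp f.continuous).measurable
  have hblock : ∀ N (i : PartIdx), ∫⁻ z, ‖block φ ψ lam N N f g i z‖ₑ ^ r ≤
      C i.2.1.1 i.2.2.1 * ENNReal.ofReal (x * y) ^ r := by
    intro N i
    refine hC i.2.1.1 i.2.2.1 N _ (fun k => (abs_part_le i.1 _).trans (hlam k)) N _ _ (hfm _)
      (measurable_partVec N i.2.2.2 g) (fun v => (part i.2.1.2).integrable_comp (integrable_fst_fiber f v))
      (integrable_partVec N i.2.2.2 g) x y hx hy ((lintegral_mono fun z => ?_).trans hfx)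
      ((lintegral_mono fun z => ?_).trans hgy)
    · refine ENNReal.rpow_le_rpow ?_ (by linarith)
      rw [← ofReal_norm, ← ofReal_norm]
      exact ENNReal.ofReal_le_ofReal (abs_part_le _ _)
    · have h1 := ENNReal.rpow_le_rpow (enorm_partVec_sq_le N i.2.2.2 g z) (by linarith : 0 ≤ q / 2)
      rw [← ENNReal.rpow_two, ← ENNReal.rpow_mul] at h1
      rwa [show 2 * (q / 2) = q by ring] at h1
  have hmeas : ∀ N (i : PartIdx), Measurable fun z => ‖block φ ψ lam N N f g i z‖ₑ ^ r := fun N i =>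
    ((measurable_tpv (ha _) (hb _) _ _ (hfm _) (measurable_partVec N i.2.2.2 g)).enorm).pow_const r
  calc ∫⁻ z, (∑' l, ‖TwPara φ ψ lam f (g l) z‖ₑ ^ 2) ^ (r / 2)
      ≤ ∫⁻ z, liminf (fun N => (32 ^ 2) ^ (r / 2) * (32 ^ (r / 2) *
          ∑ i, ‖block φ ψ lam N N f g i z‖ₑ ^ r)) atTop := by
        refine lintegral_mono fun z => ?_
        refine (rpow_tsum_le_liminf (by positivity)
          fun l => tendsto_truncTwPara φ ψ lam f (g l) z).trans (liminf_le_liminf ?_)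
        exact Eventually.of_forall fun N => sum_truncTwPara_le ha hb lam N N hr.le f g z
    _ ≤ liminf (fun N => ∫⁻ z, (32 ^ 2) ^ (r / 2) * (32 ^ (r / 2) *
          ∑ i, ‖block φ ψ lam N N f g i z‖ₑ ^ r)) atTop :=
        lintegral_liminf_le fun N => ((Finset.measurable_fun_sum _ fun i _ => hmeas N i).const_mul _).const_mul _
    _ ≤ _ := by
        refine liminf_le_of_frequently_le' (Eventually.of_forall fun N => ?_).frequently
        rw [lintegral_const_mul _ ((Finset.measurable_fun_sum _ fun i _ => hmeas N i).const_mul _),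
          lintegral_const_mul _ (Finset.measurable_fun_sum _ fun i _ => hmeas N i),
          lintegral_finsetSum _ fun i _ => hmeas N i, mul_assoc, mul_assoc, Finset.sum_mul]
        gcongr with i
        exact hblock N i

lemma LpNorm_eq (f : SchwartzMap (ℝ × ℝ) ℂ) {p : ℝ} (hp : 0 < p) :
    LpNorm p f = (∫⁻ z, ‖f z‖ₑ ^ p) ^ (1 / p) := by
  rw [LpNorm, eLpNorm_eq_lintegral_rpow_enorm_toReal (by simpa using hp) ENNReal.ofReal_ne_top,
    ENNReal.toReal_ofReal hp.le]

lemma LpNorm_ne_top (f : SchwartzMap (ℝ × ℝ) ℂ) (p : ℝ) : LpNorm p f ≠ ⊤ :=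
  (SchwartzMap.memLp f (ENNReal.ofReal p) volume).2.ne

lemma eq_zero_of_LpNorm_eq_zero (f : SchwartzMap (ℝ × ℝ) ℂ) {p : ℝ} (hp : 0 < p) (h : LpNorm p f = 0) :
    ⇑f = 0 :=
  f.continuous.ae_eq_iff_eq volume continuous_zero |>.1
    ((eLpNorm_eq_zero_iff f.continuous.aestronglyMeasurable (by simpa using hp)).1 h)

lemma TwPara_zero (φ ψ : ℝ → ℂ) (lam : ℤ → ℂ) (g : ℝ × ℝ → ℂ) (z : ℝ × ℝ) :
    TwPara φ ψ lam 0 g z = 0 := by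
  simp [TwPara, Px]

/-- Homogeneous bounds may be tested on strictly larger positive numbers. -/
lemma le_mul_of_forall_gt {L K X Y : ℝ≥0∞} (hK : K ≠ ⊤) (hX : X ≠ ⊤) (hY : Y ≠ ⊤)
    (h : ∀ x y : ℝ, 0 < x → 0 < y → X ≤ ENNReal.ofReal x → Y ≤ ENNReal.ofReal y →
      L ≤ K * ENNReal.ofReal (x * y)) : L ≤ K * X * Y := by
  have h1 : Tendsto (fun n : ℕ => K * ENNReal.ofReal ((X.toReal + 1 / ((n : ℝ) + 1)) *
      (Y.toReal + 1 / ((n : ℝ) + 1)))) atTop (𝓝 (K * ENNReal.ofReal ((X.toReal + 0) * (Y.toReal + 0)))) :=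
    ENNReal.Tendsto.const_mul (ENNReal.tendsto_ofReal
      ((tendsto_const_nhds.add tendsto_one_div_add_atTop_nhds_zero_nat).mul
        (tendsto_const_nhds.add tendsto_one_div_add_atTop_nhds_zero_nat))) (Or.inr hK)
  rw [add_zero, add_zero, ENNReal.ofReal_mul ENNReal.toReal_nonneg, ENNReal.ofReal_toReal hX,
    ENNReal.ofReal_toReal hY, ← mul_assoc] at h1
  refine ge_of_tendsto' h1 fun n => h _ _ (by positivity) (by positivity) ?_ ?_
  · rw [ENNReal.le_ofReal_iff_toReal_le hX (by positivity)]
    simp only [le_add_iff_nonneg_right]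
    positivity
  · rw [ENNReal.le_ofReal_iff_toReal_le hY (by positivity)]
    simp only [le_add_iff_nonneg_right]
    positivity

end TwistedParaproduct

/-- `ℓ²`-valued estimates for the twisted paraproduct in the second argument:
`‖(∑_ℓ |Π(f, g_ℓ)|²)^{1/2}‖_{L^r} ≲ ‖f‖_{L^p} ‖(∑_ℓ |g_ℓ|²)^{1/2}‖_{L^q}`. -/
theorem statement16 (φ ψ : SchwartzMap ℝ ℂ)
    (hφ : tsupport (FT1 ⇑φ) ⊆ {ξ : ℝ | |ξ| ≤ 1})
    (hψ : tsupport (FT1 ⇑ψ) ⊆ {ξ : ℝ | 1 / 2 ≤ |ξ| ∧ |ξ| ≤ 2})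
    (lam : ℤ → ℂ) (hlam : ∀ k : ℤ, ‖lam k‖ ≤ 1)
    (p q r : ℝ) (hp : 1 < p) (hq : 1 < q)
    (hpqr : 1 / p + 1 / q = 1 / r) (hr2 : 1 / 2 < 1 / r) :
    ∃ C : ℝ, 0 ≤ C ∧ ∀ (f : SchwartzMap (ℝ × ℝ) ℂ) (g : ℕ → SchwartzMap (ℝ × ℝ) ℂ),
      (∫⁻ z : ℝ × ℝ,
          (∑' ℓ : ℕ, (‖TwPara ⇑φ ⇑ψ lam ⇑f ⇑(g ℓ) z‖₊ : ℝ≥0∞) ^ 2) ^ (r / 2)) ^ (1 / r) ≤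
        ENNReal.ofReal C * LpNorm p ⇑f *
          (∫⁻ z : ℝ × ℝ, (∑' ℓ : ℕ, (‖g ℓ z‖₊ : ℝ≥0∞) ^ 2) ^ (q / 2)) ^ (1 / q) := by
  have hp0 : 0 < p := by linarith
  have hq0 : 0 < q := by linarith
  have hr : 0 < r := by
    have : 0 < 1 / r := by linarith
    simpa using this
  obtain ⟨K, hK, hest⟩ := TwistedParaproduct.exists_twPara_estimate φ ψ hψ lam hlam hp hq hpqr hr2
  have hKr : K ^ (1 / r) ≠ ⊤ := ENNReal.rpow_ne_top_of_nonneg (by positivity) hK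
  refine ⟨(K ^ (1 / r)).toReal + 1, by positivity, fun f g => ?_⟩
  rcases eq_or_ne (LpNorm p f) 0 with hf | hf
  · rw [TwistedParaproduct.eq_zero_of_LpNorm_eq_zero f hp0 hf]
    simp [TwistedParaproduct.TwPara_zero, hr]
  set Y := (∫⁻ z : ℝ × ℝ, (∑' ℓ : ℕ, (‖g ℓ z‖₊ : ℝ≥0∞) ^ 2) ^ (q / 2)) ^ (1 / q) with hY
  rcases eq_or_ne Y ⊤ with hYt | hYt
  · rw [hYt, ENNReal.mul_top (mul_ne_zero (by simp; positivity) hf)]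
    exact le_top
  refine TwistedParaproduct.le_mul_of_forall_gt ENNReal.ofReal_ne_top (TwistedParaproduct.LpNorm_ne_top f p)
    hYt fun x y hx hy hfx hgy => ?_
  have hfx' : ∫⁻ z, ‖f z‖ₑ ^ p ≤ ENNReal.ofReal x ^ p := by
    rw [TwistedParaproduct.LpNorm_eq f hp0, one_div, ENNReal.rpow_inv_le_iff hp0] at hfx
    exact hfx
  have hgy' : ∫⁻ z, (∑' l, ‖g l z‖ₑ ^ 2) ^ (q / 2) ≤ ENNReal.ofReal y ^ q := by
    rw [hY, one_div, ENNReal.rpow_inv_le_iff hq0] at hgy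
    exact hgy
  calc _ ≤ (K * ENNReal.ofReal (x * y) ^ r) ^ (1 / r) :=
        ENNReal.rpow_le_rpow (hest f g x y hx hy hfx' hgy') (by positivity)
    _ = K ^ (1 / r) * ENNReal.ofReal (x * y) := by
        rw [ENNReal.mul_rpow_of_nonneg _ _ (by positivity), one_div, ENNReal.rpow_rpow_inv hr.ne']
    _ ≤ _ := by
        gcongr
        rw [ENNReal.le_ofReal_iff_toReal_le hKr (by positivity)]
        linarith
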